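/- Let φ:ℝⁿ→ℝⁿ be a K-quasiconformal homeomorphism. Then the transport operator T_φ, defined on measures with H¹(ℝⁿ) density by T_φ h = (h ∘ φ⁻¹)·J(·, φ⁻¹), maps H¹(ℝⁿ) boundedly into itself: there exists C(n,K) such that ‖T_φ h‖_{H¹} ≤ C(n,K)·‖h‖_{H¹} for all h ∈ H¹(ℝⁿ). -/

import Mathlib

open MeasureTheory Set Filter

noncomputable section

/-- A `K`-quasiconformal map `φ` with (distributional) differential `Dφ`:
a homeomorphism of `ℝⁿ`, in `W^{1,n}_loc`, whose differential satisfies the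
distortion inequality `‖Dφ(x)‖ⁿ ≤ K · J(x,φ)` a.e. -/
def IsQC (n : ℕ) (K : ℝ) (φ : EuclideanSpace ℝ (Fin n) → EuclideanSpace ℝ (Fin n))
    (Dφ : EuclideanSpace ℝ (Fin n) →
      EuclideanSpace ℝ (Fin n) →L[ℝ] EuclideanSpace ℝ (Fin n)) : Prop :=
  Function.Bijective φ ∧ Continuous φ ∧ Continuous (Function.invFun φ) ∧
  AEStronglyMeasurable Dφ volume ∧
  (∀ R : ℝ, IntegrableOn (fun x => ‖Dφ x‖ ^ n) (Metric.ball 0 R) volume) ∧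
  -- `Dφ` is the distributional differential of `φ`
  (∀ ψ : EuclideanSpace ℝ (Fin n) → ℝ, ContDiff ℝ (⊤ : ℕ∞) ψ → HasCompactSupport ψ →
    ∀ i j : Fin n,
      ∫ x, φ x i * fderiv ℝ ψ x (EuclideanSpace.single j 1) =
        - ∫ x, (Dφ x (EuclideanSpace.single j 1)) i * ψ x) ∧
  -- distortion inequality (which also encodes that φ is sense-preserving)
  (∀ᵐ x ∂(volume : Measure (EuclideanSpace ℝ (Fin n))),
    ‖Dφ x‖ ^ n ≤ K * LinearMap.det ((Dφ x) : EuclideanSpace ℝ (Fin n) →ₗ[ℝ] EuclideanSpace ℝ (Fin n)))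

/-- The `j`-th Riesz transform of `h`, as a principal value. -/
def rieszTransform (n : ℕ) (h : EuclideanSpace ℝ (Fin n) → ℝ) (j : Fin n)
    (x : EuclideanSpace ℝ (Fin n)) : ℝ :=
  limUnder (nhdsWithin (0:ℝ) (Ioi 0)) (fun ε : ℝ =>
    ∫ y in {y : EuclideanSpace ℝ (Fin n) | ε < ‖y‖}, (y j / ‖y‖ ^ (n + 1)) * h (x - y))

/-- Membership in the real Hardy space `H¹(ℝⁿ)`. -/
def MemH1 (n : ℕ) (h : EuclideanSpace ℝ (Fin n) → ℝ) : Prop :=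
  Integrable h volume ∧ ∀ j : Fin n, Integrable (rieszTransform n h j) volume

/-- The `H¹(ℝⁿ)` norm. -/
def H1Norm (n : ℕ) (h : EuclideanSpace ℝ (Fin n) → ℝ) : ℝ :=
  (∫ x, |h x|) + ∑ j : Fin n, ∫ x, |rieszTransform n h j x|

end

open MeasureTheory Set

section
set_option linter.all false
open ENNReal (add_ne_top div_le_iff div_ne_top inv_ne_top mul_eq_top mul_ne_top mul_rpow_of_nonneg ofReal ofReal_add ofReal_coe_nnreal ofReal_inv_of_pos ofReal_le_iff_le_toReal ofReal_le_ofReal ofReal_le_ofReal_iff ofReal_lt_top ofReal_mul ofReal_natCast ofReal_ne_top ofReal_ofNat ofReal_pow ofReal_rpow_of_nonneg ofReal_toReal ofReal_zero pow_ne_top rpow_le_rpow rpow_mul rpow_natCast rpow_one tendsto_ofReal toReal_nonneg toReal_pos tsum_le_tsum)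
open Finset (mul_sum sum_add_distrib sum_congr sum_eq_zero sum_le_sum sum_nonneg)
open Real (dist_eq enorm_eq_ofReal enorm_eq_ofReal_abs enorm_of_nonneg norm_eq_abs norm_of_nonneg smoothTransition volume_Icc)
open EuclideanSpace (proj single)
open WithLp (ofLp_injective toLp)
open ContinuousLinearMap (coe_coe le_opNorm lsmul)
open Nat (find_min find_spec one_le_iff_ne_zero)
open LinearMap (trace_eq_sum_inner)
open Function (comp_def)
local notation "pv" => by positivity
local notation "sm" => by simp
section
open MeasureTheory Set Filter Metric
open scoped ENNReal NNReal Topology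
variable {n : ℕ} {t r : ℝ}
abbrev En (n : ℕ) := EuclideanSpace ℝ (Fin n)
noncomputable def om (n : ℕ) : ENNReal := volume (ball (0 : En n) 1)
theorem om_pos (n : ℕ) : om n ≠ 0 := (measure_ball_pos volume _ one_pos).ne'
theorem om_top (n : ℕ) : om n ≠ ∞ := measure_ball_lt_top.ne
theorem vol_ball (x : En n) (hr : 0 < r) :
    volume (ball x r) = ofReal (r ^ n) * om n := by
  have := Measure.addHaar_ball_of_pos (volume : Measure (En n)) x hr
  simpa [om] using this
theorem vol_cball (x : En n) (hr : 0 ≤ r) :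
    volume (closedBall x r) = ofReal (r ^ n) * om n := by
  have := Measure.addHaar_closedBall (volume : Measure (En n)) x hr
  simpa [om] using this
theorem vitali5 (s : Set (En n)) (r : En n → ℝ) (R : ℝ) (hr : ∀ x ∈ s, 0 < r x)
    (hR : ∀ x ∈ s, r x ≤ R) : ∃ u ⊆ s, u.Countable ∧
      u.PairwiseDisjoint (fun x => closedBall x (r x)) ∧
      ∀ a ∈ s, ∃ b ∈ u, closedBall a (r a) ⊆ closedBall b (5 * r b) := by
  obtain ⟨u, hu, hd, hc⟩ := Vitali.exists_disjoint_subfamily_covering_enlargement_closedBall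
    s (fun x => x) r R hR 5 (by norm_num)
  refine ⟨u, hu, ?_, hd, hc⟩
  refine hd.countable_of_nonempty_interior fun x hx => ?_
  exact ⟨x, ball_subset_interior_closedBall (mem_ball_self (hr x (hu hx)))⟩
theorem layer {p : ℝ} (hp : 0 < p) (a : ENNReal) :
    a ^ p = ∫⁻ l in Ioi (0 : ℝ), ofReal (p * l ^ (p - 1)) *
      (if ofReal l < a then 1 else 0) := by
  have key : ∀ b : ℝ, 0 ≤ b → ∫⁻ l in Ioc (0 : ℝ) b, ofReal (p * l ^ (p - 1)) =
      ofReal (b ^ p) := by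
    intro b hb
    rw [← ofReal_integral_eq_lintegral_ofReal]
    · rw [← intervalIntegral.integral_of_le hb, intervalIntegral.integral_const_mul,
        integral_rpow (Or.inl (by linarith))]
      simp only [sub_add_cancel, Real.zero_rpow hp.ne', sub_zero]
      rw [mul_div_cancel₀ _ hp.ne']
    · have := (intervalIntegral.intervalIntegrable_rpow' (a := 0) (b := b) (r := p - 1)
        (by linarith)).const_mul p
      exact (intervalIntegrable_iff_integrableOn_Ioc_of_le hb).1 this
    · refine (ae_restrict_iff' measurableSet_Ioc).2 (ae_of_all _ fun l hl => ?_)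
      have := hl.1.le
      positivity
  have key2 : ∀ b : ℝ, 0 ≤ b → ofReal b < a → ofReal (b ^ p) ≤
      ∫⁻ l in Ioi (0 : ℝ), ofReal (p * l ^ (p - 1)) *
      (if ofReal l < a then 1 else 0) := by
    intro b hb hba
    rw [← key b hb]
    calc _ = ∫⁻ l in Ioc (0 : ℝ) b, ofReal (p * l ^ (p - 1)) *
          (if ofReal l < a then 1 else 0) := by
          refine setLIntegral_congr_fun measurableSet_Ioc fun l hl => ?_
          simp [lt_of_le_of_lt (ofReal_le_ofReal hl.2) hba]
      _ ≤ _ := lintegral_mono_set Ioc_subset_Ioi_self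
  refine le_antisymm ?_ ?_
  · refine le_of_forall_lt fun c hc => ?_
    have hc' : c ^ (1 / p) < a := by
      have := ENNReal.rpow_lt_rpow hc (z := 1 / p) pv
      rwa [← rpow_mul, mul_one_div_cancel hp.ne', rpow_one] at this
    obtain ⟨d, hd1, hd2⟩ := exists_between hc'
    lift d to NNReal using (hd2.trans_le le_top).ne
    have h2 := key2 d d.2 (by simpa using hd2)
    refine lt_of_lt_of_le ?_ h2
    rw [← ofReal_rpow_of_nonneg d.coe_nonneg hp.le]
    have := ENNReal.rpow_lt_rpow hd1 hp
    rwa [← rpow_mul, one_div_mul_cancel hp.ne', rpow_one,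
      ← ofReal_coe_nnreal] at this
  · by_cases ha : a = ∞
    · subst ha; simp [hp]
    · lift a to NNReal using ha
      rw [← ofReal_coe_nnreal, ofReal_rpow_of_nonneg a.coe_nonneg hp.le, ← key a a.2]
      have h1 : ∀ l : ℝ, 0 < l → ofReal (p * l ^ (p - 1)) *
          (if ofReal l < ofReal (a : ℝ) then 1 else 0) ≤
          (Ioc (0 : ℝ) a).indicator (fun l => ofReal (p * l ^ (p - 1))) l := by
        intro l hl
        split_ifs with h
        · rw [indicator_of_mem]
          · simp
          · exact ⟨hl, (ENNReal.ofReal_lt_ofReal_iff_of_nonneg hl.le).1 h |>.le⟩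
        · simp
      calc _ ≤ ∫⁻ l in Ioi (0 : ℝ),
            (Ioc (0 : ℝ) a).indicator (fun l => ofReal (p * l ^ (p - 1))) l :=
            setLIntegral_mono' measurableSet_Ioi fun l hl => h1 l hl
        _ ≤ _ := by
            rw [← lintegral_indicator measurableSet_Ioc]
            exact setLIntegral_le_lintegral _ _
noncomputable def Mx (f : En n → ENNReal) (x : En n) : ENNReal :=
  ⨆ r : ℝ, ⨆ _ : 0 < r, (ofReal (r ^ n))⁻¹ * ∫⁻ y in ball x r, f y
theorem le_Mx (f : En n → ENNReal) (x : En n) (hr : 0 < r) :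
    ∫⁻ y in ball x r, f y ≤ ofReal (r ^ n) * Mx f x := by
  have h0 : ofReal (r ^ n) ≠ 0 := by simp; positivity
  rw [mul_comm, ← div_le_iff h0 ofReal_ne_top, ENNReal.div_eq_inv_mul]
  exact le_iSup₂ (f := fun (r : ℝ) (_ : 0 < r) =>
    (ofReal (r ^ n))⁻¹ * ∫⁻ y in ball x r, f y) r hr
theorem lt_Mx {f : En n → ENNReal} {x : En n} {l : ENNReal} (h : l < Mx f x) :
    ∃ r : ℝ, 0 < r ∧ l * ofReal (r ^ n) < ∫⁻ y in ball x r, f y := by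
  simp only [Mx, lt_iSup_iff] at h
  obtain ⟨r, hr, h⟩ := h
  refine ⟨r, hr, ?_⟩
  have h0 : ofReal (r ^ n) ≠ 0 := by simp; positivity
  rwa [← ENNReal.div_eq_inv_mul, ENNReal.lt_div_iff_mul_lt (Or.inl h0)
    (Or.inl ofReal_ne_top)] at h
theorem Mx_open (f : En n → ENNReal) (l : ENNReal) : IsOpen {x | l < Mx f x} := by
  rw [Metric.isOpen_iff]
  intro x hx
  obtain ⟨r, hr, h⟩ := lt_Mx hx
  have hU : ball x r = ⋃ k : ℕ, ball x (r - 1 / (k + 1 : ℝ)) := by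
    ext y
    simp only [mem_ball, mem_iUnion]
    constructor
    · intro hy
      obtain ⟨k, hk⟩ := exists_nat_one_div_lt (sub_pos.2 hy)
      exact ⟨k, by linarith⟩
    · rintro ⟨k, hk⟩
      have : 0 < 1 / (k + 1 : ℝ) := by positivity
      linarith
  have hm : Monotone fun k : ℕ => ball x (r - 1 / (k + 1 : ℝ)) := by
    intro a b hab
    refine ball_subset_ball (by gcongr)
  rw [hU, setLIntegral_iUnion_of_directed _ (hm.directed_le), lt_iSup_iff] at h
  obtain ⟨k, hk⟩ := h
  refine ⟨1 / (k + 1 : ℝ), by positivity, fun y hy => ?_⟩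
  have h2 : ball x (r - 1 / (k + 1 : ℝ)) ⊆ ball y r := by
    refine ball_subset_ball' ?_
    rw [mem_ball, dist_comm] at hy
    linarith
  have h3 := (hk.trans_le (lintegral_mono_set h2)).trans_le (le_Mx f y hr)
  rw [mul_comm] at h3
  exact lt_of_mul_lt_mul_left' h3
theorem Mx_meas (f : En n → ENNReal) : Measurable (Mx f) :=
  measurable_of_Ioi fun l => (Mx_open f l).measurableSet
theorem Mx_weak (hn : n ≠ 0) (f : En n → ENNReal) {l : ENNReal} (hl : l ≠ 0) (hl' : l ≠ ∞) :
    volume {x | l < Mx f x} ≤ 5 ^ n * om n * l⁻¹ * ∫⁻ y, f y := by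
  by_cases hf : ∫⁻ y, f y = ∞
  · rw [hf, ENNReal.mul_top]
    · exact le_top
    · simp [om_pos, hl']
  have hch : ∀ x : En n, ∃ r : ℝ, l < Mx f x → 0 < r ∧
      l * ofReal (r ^ n) < ∫⁻ y in ball x r, f y := fun x => by
    by_cases h : l < Mx f x
    · obtain ⟨r, hr⟩ := lt_Mx h
      exact ⟨r, fun _ => hr⟩
    · exact ⟨0, fun h' => absurd h' h⟩
  choose r hr using hch
  set A := (l⁻¹ * ∫⁻ y, f y).toReal
  have hA : l⁻¹ * ∫⁻ y, f y ≠ ∞ := mul_ne_top (by simp [hl]) hf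
  have hb : ∀ x, l < Mx f x → r x ≤ A + 1 := by
    intro x hx
    have h1 := (hr x hx).2.le.trans (setLIntegral_le_lintegral _ _)
    have h2 : ofReal (r x ^ n) ≤ l⁻¹ * ∫⁻ y, f y := by
      rw [mul_comm, ← div_eq_mul_inv, ENNReal.le_div_iff_mul_le (Or.inl hl) (Or.inl hl'), mul_comm]
      exact h1
    have h3 : r x ^ n ≤ A := by
      rwa [ofReal_le_iff_le_toReal hA] at h2
    by_contra h4
    push Not at h4
    have hA0 : 0 ≤ A := toReal_nonneg
    have : r x ≤ r x ^ n := le_self_pow₀ (by linarith) hn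
    linarith
  obtain ⟨u, hus, huc, hud, hcov⟩ := vitali5 {x | l < Mx f x} r _ (fun x hx => (hr x hx).1) hb
  have hsub : {x | l < Mx f x} ⊆ ⋃ x ∈ u, closedBall x (5 * r x) := fun a ha => by
    obtain ⟨b, hb, hab⟩ := hcov a ha
    exact mem_biUnion hb (hab (mem_closedBall_self (hr a ha).1.le))
  calc _ ≤ volume (⋃ x ∈ u, closedBall x (5 * r x)) := measure_mono hsub
    _ ≤ ∑' x : u, volume (closedBall (x : En n) (5 * r x)) := measure_biUnion_le _ huc _
    _ ≤ ∑' x : u, 5 ^ n * om n * l⁻¹ * ∫⁻ y in closedBall (x : En n) (r x), f y := by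
        refine tsum_le_tsum fun x => ?_
        have hx := hr x (hus x.2)
        rw [vol_cball _ (by linarith [hx.1]), mul_pow, ofReal_mul pv]
        have h2 : ofReal (r x ^ n) ≤ l⁻¹ * ∫⁻ y in closedBall (x : En n) (r x), f y := by
          rw [mul_comm, ← div_eq_mul_inv, ENNReal.le_div_iff_mul_le (Or.inl hl) (Or.inl hl'),
            mul_comm]
          exact hx.2.le.trans (lintegral_mono_set ball_subset_closedBall)
        calc _ = 5 ^ n * om n * ofReal (r x ^ n) := by
              rw [ofReal_pow (by norm_num)]; norm_num; ring
          _ ≤ 5 ^ n * om n * (l⁻¹ * ∫⁻ y in closedBall (x : En n) (r x), f y) := by gcongr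
          _ = _ := by ring
    _ = 5 ^ n * om n * l⁻¹ * ∫⁻ y in ⋃ x ∈ u, closedBall x (r x), f y := by
        rw [ENNReal.tsum_mul_left, lintegral_biUnion huc (fun x _ => measurableSet_closedBall) hud]
    _ ≤ _ := mul_le_mul_right (setLIntegral_le_lintegral _ _) _
theorem Mx_strong (n : ℕ) (hn : n ≠ 0) {p : ℝ} (hp : 1 < p) : ∃ C : ENNReal, C ≠ ∞ ∧
    ∀ f : En n → ENNReal, Measurable f → ∫⁻ x, Mx f x ^ p ≤ C * ∫⁻ x, f x ^ p := by
  set a : ENNReal := 2 * om n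
  have ha0 : a ≠ 0 := by simp [a, om_pos]
  have ha1 : a ≠ ∞ := by simp [a, om_top, mul_eq_top]
  have hp0 : 0 < p := by linarith
  refine ⟨5 ^ n * om n * 2 * ofReal (p / (p - 1)) * a ^ (p - 1), ?_, ?_⟩
  · have : a ^ (p - 1) ≠ ∞ := ENNReal.rpow_ne_top_of_nonneg (by linarith) ha1
    simp [mul_eq_top, om_top, this]
  intro f hf
  have hw : ∀ l : ℝ, 0 < l → volume {x | ofReal l < Mx f x} ≤
      5 ^ n * om n * (2 * ofReal l⁻¹) *
        ∫⁻ y, f y * (if ofReal l < a * f y then 1 else 0) := by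
    intro l hl
    set g : En n → ENNReal := fun y => f y * (if ofReal l < a * f y then 1 else 0)
    have hl2 : ofReal l / 2 ≠ 0 := by simp [hl]
    have hsub : {x | ofReal l < Mx f x} ⊆ {x | ofReal l / 2 < Mx g x} := by
      intro x hx
      obtain ⟨r, hr, h⟩ := lt_Mx hx
      have h1 : ∀ y, f y ≤ g y + ofReal l / a := by
        intro y
        simp only [g]
        split_ifs with h
        · simp
        · simp only [mul_zero, zero_add]
          rw [ENNReal.le_div_iff_mul_le (Or.inl ha0) (Or.inl ha1), mul_comm]
          exact not_lt.1 h
      have h2 : ∫⁻ y in ball x r, f y ≤ ofReal (r ^ n) * Mx g x +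
          ofReal (r ^ n) * (ofReal l / 2) := by
        calc _ ≤ ∫⁻ y in ball x r, (g y + ofReal l / a) := lintegral_mono h1
          _ = (∫⁻ y in ball x r, g y) + ofReal l / a * volume (ball x r) := by
              rw [lintegral_add_right _ measurable_const, setLIntegral_const]
          _ ≤ _ := by
              rw [vol_ball _ hr]
              refine add_le_add (le_Mx _ _ hr) (le_of_eq ?_)
              simp only [a, div_eq_mul_inv]
              rw [ENNReal.mul_inv sm sm]
              calc _ = ofReal (r ^ n) * (ofReal l * 2⁻¹) * ((om n)⁻¹ * om n) := by
                    ring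
                _ = _ := by rw [ENNReal.inv_mul_cancel (om_pos n) (om_top n), mul_one]
      by_contra hx2
      simp only [mem_ofPred_eq, not_lt] at hx2
      have h3 : ∫⁻ y in ball x r, f y ≤ ofReal l * ofReal (r ^ n) := by
        refine h2.trans ?_
        rw [← mul_add, mul_comm]
        gcongr
        calc _ ≤ ofReal l / 2 + ofReal l / 2 := by gcongr
          _ = _ := ENNReal.add_halves _
      exact absurd h (not_lt.2 h3)
    refine (measure_mono hsub).trans ((Mx_weak hn g hl2
      (div_ne_top ofReal_ne_top sm)).trans (le_of_eq ?_))
    rw [ENNReal.inv_div sm sm, ofReal_inv_of_pos hl, div_eq_mul_inv]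
  have hmj : Measurable (Function.uncurry fun (x : En n) (l : ℝ) =>
      ofReal (p * l ^ (p - 1)) * (if ofReal l < Mx f x then (1 : ENNReal) else 0)) := by
    refine Measurable.mul (by fun_prop) (Measurable.ite ?_ measurable_const measurable_const)
    exact measurableSet_lt (by fun_prop) ((Mx_meas f).comp measurable_fst)
  have hmj2 : Measurable (Function.uncurry fun (l : ℝ) (y : En n) =>
      f y * (ofReal ((p - 1) * l ^ (p - 1 - 1)) *
        (if ofReal l < a * f y then (1 : ENNReal) else 0))) := by
    refine Measurable.mul (hf.comp measurable_snd)
      (Measurable.mul (by fun_prop) (Measurable.ite ?_ measurable_const measurable_const))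
    exact measurableSet_lt (by fun_prop) ((hf.comp measurable_snd).const_mul a)
  calc ∫⁻ x, Mx f x ^ p = ∫⁻ x, ∫⁻ l in Ioi (0 : ℝ), ofReal (p * l ^ (p - 1)) *
        (if ofReal l < Mx f x then 1 else 0) := by simp_rw [← layer hp0]
    _ = ∫⁻ l in Ioi (0 : ℝ), ∫⁻ x, ofReal (p * l ^ (p - 1)) *
        (if ofReal l < Mx f x then 1 else 0) := lintegral_lintegral_swap hmj.aemeasurable
    _ ≤ ∫⁻ l in Ioi (0 : ℝ), 5 ^ n * om n * 2 * ofReal (p / (p - 1)) *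
        ∫⁻ y, f y * (ofReal ((p - 1) * l ^ (p - 1 - 1)) *
          (if ofReal l < a * f y then 1 else 0)) := by
        refine setLIntegral_mono' measurableSet_Ioi fun l (hl : 0 < l) => ?_
        have hs : MeasurableSet {x | ofReal l < Mx f x} := (Mx_open f _).measurableSet
        have e1 : ∫⁻ x, (if ofReal l < Mx f x then (1 : ENNReal) else 0) =
            volume {x | ofReal l < Mx f x} := by
          rw [← lintegral_indicator_one hs]
          exact lintegral_congr fun x => by simp [indicator]
        rw [lintegral_const_mul' _ _ ofReal_ne_top, e1]
        have e2 : ∀ y, f y * (ofReal ((p - 1) * l ^ (p - 1 - 1)) *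
          (if ofReal l < a * f y then 1 else 0)) =
          ofReal ((p - 1) * l ^ (p - 1 - 1)) *
            (f y * (if ofReal l < a * f y then 1 else 0)) := fun y => by ring
        simp_rw [e2]
        rw [lintegral_const_mul' _ _ ofReal_ne_top]
        have e3 : ofReal (p * l ^ (p - 1)) * ofReal l⁻¹ =
            ofReal (p / (p - 1)) * ofReal ((p - 1) * l ^ (p - 1 - 1)) := by
          rw [← ofReal_mul pv,
            ← ofReal_mul (div_nonneg hp0.le (by linarith))]
          congr 1
          rw [Real.rpow_sub_one hl.ne' (p - 1)]
          have : p - 1 ≠ 0 := by linarith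
          field_simp
        calc _ ≤ ofReal (p * l ^ (p - 1)) * (5 ^ n * om n * (2 * ofReal l⁻¹) *
              ∫⁻ y, f y * (if ofReal l < a * f y then 1 else 0)) := by
              gcongr; exact hw l hl
          _ = 5 ^ n * om n * 2 * (ofReal (p * l ^ (p - 1)) * ofReal l⁻¹) *
              ∫⁻ y, f y * (if ofReal l < a * f y then 1 else 0) := by ring
          _ = _ := by rw [e3]; ring
    _ = 5 ^ n * om n * 2 * ofReal (p / (p - 1)) * ∫⁻ y, ∫⁻ l in Ioi (0 : ℝ),
        f y * (ofReal ((p - 1) * l ^ (p - 1 - 1)) *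
          (if ofReal l < a * f y then 1 else 0)) := by
        rw [lintegral_const_mul' _ _ (by simp [mul_eq_top, om_top]),
          lintegral_lintegral_swap hmj2.aemeasurable]
    _ = 5 ^ n * om n * 2 * ofReal (p / (p - 1)) * ∫⁻ y, a ^ (p - 1) * f y ^ p := by
        congr 1
        refine lintegral_congr fun y => ?_
        rw [lintegral_const_mul, ← layer (by linarith : 0 < p - 1),
          mul_rpow_of_nonneg _ _ (by linarith : 0 ≤ p - 1)]
        · rw [mul_left_comm]
          congr 1
          conv_lhs => rw [← rpow_one (f y), ← rpow_mul, one_mul,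
            ← ENNReal.rpow_add_of_nonneg _ _ (by norm_num) (by linarith)]
          ring_nf
        · refine Measurable.mul (by fun_prop) (Measurable.ite ?_ measurable_const measurable_const)
          exact measurableSet_lt (by fun_prop) measurable_const
    _ = _ := by rw [lintegral_const_mul _ (hf.pow_const p)]; ring
noncomputable def pk (n : ℕ) (t : ℝ) (v : En n) : ℝ := t / (t + ‖v‖) ^ (n + 1)
theorem pk_Mx {f : En n → ENNReal} (hf : Measurable f) (ht : 0 < t) {x y : En n} (hxy : dist x y ≤ t) :
    ∫⁻ w, ofReal (pk n t (y - w)) * f w ≤ 2 ^ (2 * n + 2) * Mx f x := by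
  have hpt : ∀ w, ofReal (pk n t (y - w)) * f w ≤ ∑' j : ℕ,
      (ball x (2 ^ (j + 1) * t)).indicator
        (fun w => ofReal (2 ^ (n + 1) * (1 / 2) ^ j * ((2 ^ j * t) ^ n)⁻¹) * f w) w := by
    intro w
    have hex : ∃ j : ℕ, ‖y - w‖ < 2 ^ j * t ∧
        pk n t (y - w) ≤ 2 ^ (n + 1) * (1 / 2) ^ j * ((2 ^ j * t) ^ n)⁻¹ := by
      have hex0 : ∃ j : ℕ, ‖y - w‖ < 2 ^ j * t := by
        obtain ⟨j, hj⟩ := pow_unbounded_of_one_lt (‖y - w‖ / t) (by norm_num : (1 : ℝ) < 2)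
        exact ⟨j, by rwa [div_lt_iff₀ ht] at hj⟩
      classical
      refine ⟨Nat.find hex0, find_spec hex0, ?_⟩
      have hle : 2 ^ (Nat.find hex0) * t ≤ 2 * (t + ‖y - w‖) := by
        rcases hj : Nat.find hex0 with _ | j
        · simp; linarith [norm_nonneg (y - w)]
        · have := find_min hex0 (m := j) (by omega)
          rw [pow_succ]
          linarith [not_lt.1 this]
      generalize Nat.find hex0 = j at hle
      unfold pk
      have e : (2 : ℝ) ^ (n + 1) * (1 / 2) ^ j * ((2 ^ j * t) ^ n)⁻¹ =
          t / ((2 ^ j * t) / 2) ^ (n + 1) := by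
        field_simp
        simp only [one_div, inv_pow, div_pow]
        field_simp
        ring
      rw [e]
      gcongr
      linarith
    obtain ⟨j, hj1, hj2⟩ := hex
    refine le_trans ?_ (ENNReal.le_tsum j)
    rw [indicator_of_mem]
    · gcongr
    · rw [mem_ball, dist_comm]
      have h1 : dist y w < 2 ^ j * t := by rwa [dist_eq_norm]
      have h2 : t ≤ 2 ^ j * t := le_mul_of_one_le_left ht.le (one_le_pow₀ (by norm_num))
      calc dist x w ≤ dist x y + dist y w := dist_triangle _ _ _
        _ < 2 ^ (j + 1) * t := by rw [pow_succ]; linarith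
  calc _ ≤ ∫⁻ w, ∑' j : ℕ, (ball x (2 ^ (j + 1) * t)).indicator
        (fun w => ofReal (2 ^ (n + 1) * (1 / 2) ^ j * ((2 ^ j * t) ^ n)⁻¹) * f w) w :=
        lintegral_mono hpt
    _ ≤ ∑' j : ℕ, ∫⁻ w, (ball x (2 ^ (j + 1) * t)).indicator
        (fun w => ofReal (2 ^ (n + 1) * (1 / 2) ^ j * ((2 ^ j * t) ^ n)⁻¹) * f w) w := by
        rw [lintegral_tsum fun j => ((hf.const_mul _).indicator measurableSet_ball).aemeasurable]
    _ ≤ ∑' j : ℕ, ofReal (2 ^ (2 * n + 1) * (1 / 2) ^ j) * Mx f x := by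
        refine tsum_le_tsum fun j => ?_
        rw [lintegral_indicator measurableSet_ball, lintegral_const_mul' _ _ ofReal_ne_top]
        have h := le_Mx f x (r := 2 ^ (j + 1) * t) pv
        calc _ ≤ ofReal (2 ^ (n + 1) * (1 / 2) ^ j * ((2 ^ j * t) ^ n)⁻¹) *
              (ofReal ((2 ^ (j + 1) * t) ^ n) * Mx f x) := by gcongr
          _ = _ := by
              rw [← mul_assoc, ← ofReal_mul pv]
              congr 2
              rw [pow_succ (2 : ℝ) j, mul_pow, mul_pow, mul_pow]
              field_simp
              ring
    _ = _ := by
        rw [ENNReal.tsum_mul_right, ← ENNReal.ofReal_tsum_of_nonneg (fun j => by positivity)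
          ((summable_geometric_of_lt_one (by norm_num) (by norm_num)).mul_left _), tsum_mul_left,
          tsum_geometric_two]
        congr 1
        rw [← pow_succ, ofReal_pow (by norm_num)]
        norm_num
end
section
open MeasureTheory Set Filter Metric
open scoped ENNReal NNReal Topology ContDiff InnerProductSpace
variable {n : ℕ} {t r : ℝ}
def Vn (n : ℕ) : Type := WithLp 2 (En n × ℝ)
noncomputable instance (n : ℕ) : NormedAddCommGroup (Vn n) :=
  inferInstanceAs (NormedAddCommGroup (WithLp 2 (En n × ℝ)))
noncomputable instance (n : ℕ) : InnerProductSpace ℝ (Vn n) :=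
  inferInstanceAs (InnerProductSpace ℝ (WithLp 2 (En n × ℝ)))
instance (n : ℕ) : FiniteDimensional ℝ (Vn n) :=
  inferInstanceAs (FiniteDimensional ℝ (WithLp 2 (En n × ℝ)))
instance (n : ℕ) : MeasurableSpace (Vn n) := inferInstanceAs (MeasurableSpace (WithLp 2 (En n × ℝ)))
instance (n : ℕ) : BorelSpace (Vn n) := inferInstanceAs (BorelSpace (WithLp 2 (En n × ℝ)))
def Vn.fst (z : Vn n) : En n := WithLp.fst z
def Vn.snd (z : Vn n) : ℝ := WithLp.snd z
def pt (x : En n) (t : ℝ) : Vn n := toLp 2 (x, t)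
variable {z : Vn n} {h : En n → ℝ}
theorem Vn_finrank (n : ℕ) : Module.finrank ℝ (Vn n) = n + 1 := by
  have := (WithLp.linearEquiv 2 ℝ (En n × ℝ)).finrank_eq
  exact this.trans sm
theorem vol_pt (n : ℕ) : MeasurePreserving (fun p : En n × ℝ => pt p.1 p.2) :=
  WithLp.volume_preserving_toLp (En n) ℝ
theorem pt_fst (x : En n) (t : ℝ) : (pt x t).fst = x := rfl
theorem inner_V (z w : Vn n) : ⟪z, w⟫_ℝ = ⟪z.fst, w.fst⟫_ℝ + z.snd * w.snd := by
  rw [mul_comm]; exact WithLp.prod_inner_apply (𝕜 := ℝ) z w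
theorem sub_snd (z w : Vn n) : (z - w).snd = z.snd - w.snd := rfl
theorem add_snd (z w : Vn n) : (z + w).snd = z.snd + w.snd := rfl
theorem smul_snd (c : ℝ) (z : Vn n) : (c • z).snd = c * z.snd := rfl
theorem zero_snd : (0 : Vn n).snd = 0 := rfl
theorem sub_fst (z w : Vn n) : (z - w).fst = z.fst - w.fst := rfl
theorem pt_snd (x : En n) (t : ℝ) : (pt x t).snd = t := rfl
theorem pt_eta (z : Vn n) : pt z.fst z.snd = z := rfl
theorem pt_sub (x y : En n) (t s : ℝ) : pt x t - pt y s = pt (x - y) (t - s) := rfl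
theorem pt_add (x y : En n) (t s : ℝ) : pt x t + pt y s = pt (x + y) (t + s) := rfl
theorem norm_pt (x : En n) (t : ℝ) : ‖pt x t‖ ^ 2 = ‖x‖ ^ 2 + t ^ 2 := by
  rw [← real_inner_self_eq_norm_sq, inner_V, pt_fst, pt_snd, real_inner_self_eq_norm_sq]; ring
theorem snd_le_norm (z : Vn n) : |z.snd| ≤ ‖z‖ := by
  refine abs_le_of_sq_le_sq ?_ (norm_nonneg _)
  rw [← pt_eta z, norm_pt]; simp [pt_snd]
theorem fst_le_norm (z : Vn n) : ‖z.fst‖ ≤ ‖z‖ := by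
  refine le_of_sq_le_sq ?_ (norm_nonneg _)
  rw [← pt_eta z, norm_pt]; simp [pt_fst]; positivity
theorem norm_pt_le (x : En n) (t : ℝ) : ‖pt x t‖ ≤ ‖x‖ + |t| := by
  refine le_of_sq_le_sq ?_ pv
  rw [norm_pt, ← sq_abs t]; nlinarith [norm_nonneg x, abs_nonneg t]
theorem cont_pt : Continuous fun p : En n × ℝ => pt p.1 p.2 :=
  WithLp.prod_continuous_toLp 2 _ _
theorem cont_snd : Continuous fun z : Vn n => z.snd :=
  continuous_snd.comp (WithLp.prod_continuous_ofLp 2 _ _)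
theorem cont_fst : Continuous fun z : Vn n => z.fst :=
  continuous_fst.comp (WithLp.prod_continuous_ofLp 2 _ _)
def hs (n : ℕ) : Set (Vn n) := {z | 0 < z.snd}
theorem hs_open (n : ℕ) : IsOpen (hs n) := isOpen_lt continuous_const cont_snd
theorem hs_nhds (hz : 0 < z.snd) : ∀ᶠ w in 𝓝 z, 0 < w.snd :=
  (hs_open n).mem_nhds hz
def HK {Y : Type*} [NormedAddCommGroup Y] [NormedSpace ℝ Y] (m : ℕ) (κ : Vn n → Y) : Prop :=
  ContDiffOn ℝ ∞ κ {0}ᶜ ∧ ∀ c : ℝ, 0 < c → ∀ z, z ≠ 0 → κ (c • z) = (c ^ m)⁻¹ • κ z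
variable {Y : Type} [NormedAddCommGroup Y] [NormedSpace ℝ Y] {m : ℕ} {κ : Vn n → Y}
theorem HK.contAt (hk : HK m κ) (hz : z ≠ 0) : ContDiffAt ℝ ∞ κ z :=
  hk.1.contDiffAt (isOpen_compl_singleton.mem_nhds hz)
theorem HK.fderiv (hk : HK m κ) : HK (m + 1) (fderiv ℝ κ) := by
  refine ⟨hk.1.fderiv_of_isOpen isOpen_compl_singleton sm, fun c hc z hz => ?_⟩
  have hcz : c • z ≠ 0 := smul_ne_zero hc.ne' hz
  have h1 : (fun w => κ (c • w)) =ᶠ[𝓝 z] fun w => (c ^ m)⁻¹ • κ w := by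
    filter_upwards [isOpen_compl_singleton.mem_nhds hz] with w hw
    exact hk.2 c hc w hw
  have d1 : HasFDerivAt κ (_root_.fderiv ℝ κ (c • z)) (c • z) :=
    ((hk.contAt hcz).differentiableAt sm).hasFDerivAt
  have d2 : HasFDerivAt (fun w : Vn n => c • w) (c • ContinuousLinearMap.id ℝ (Vn n)) z :=
    (hasFDerivAt_id z).const_smul c
  have d3 := d1.comp z d2
  have d4 : HasFDerivAt κ (_root_.fderiv ℝ κ z) z :=
    ((hk.contAt hz).differentiableAt sm).hasFDerivAt
  have e := (d3.congr_of_eventuallyEq h1.symm).unique (d4.const_smul ((c ^ m)⁻¹))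
  have e2 : c • _root_.fderiv ℝ κ (c • z) = (c ^ m)⁻¹ • _root_.fderiv ℝ κ z := by
    rw [← e]; ext v; simp
  rw [pow_succ, mul_inv, mul_comm, mul_smul, ← e2, smul_smul, inv_mul_cancel₀ hc.ne', one_smul]
theorem HK.bound (hk : HK m κ) : ∃ C : ℝ, 0 < C ∧ ∀ z, z ≠ 0 → ‖κ z‖ ≤ C * (‖z‖ ^ m)⁻¹ := by
  obtain ⟨C, hC⟩ := (isCompact_sphere (0 : Vn n) 1).exists_bound_of_continuousOn
    (hk.1.continuousOn.mono fun z hz => by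
      rintro rfl; simp at hz)
  refine ⟨max C 1, by positivity, fun z hz => ?_⟩
  have hz' : 0 < ‖z‖ := norm_pos_iff.2 hz
  have h := hk.2 ‖z‖ hz' (‖z‖⁻¹ • z) (smul_ne_zero (inv_ne_zero hz'.ne') hz)
  rw [smul_smul, mul_inv_cancel₀ hz'.ne', one_smul] at h
  rw [h, norm_smul, norm_inv, norm_pow, norm_norm, mul_comm]
  gcongr
  exact (hC _ (by simp [norm_smul, hz'.ne'])).trans (le_max_left _ _)
noncomputable def Po (κ : Vn n → Y) (h : En n → ℝ) (z : Vn n) : Y := ∫ w, h w • κ (z - pt w 0)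
theorem sub_ne (hz : 0 < z.snd) (w : En n) : z - pt w 0 ≠ 0 := by
  intro h
  have : (z - pt w 0).snd = z.snd := by simp [sub_snd, pt_snd]
  rw [h, zero_snd] at this
  linarith
theorem snd_le_sub (z : Vn n) (w : En n) : z.snd ≤ ‖z - pt w 0‖ := by
  have := snd_le_norm (z - pt w 0)
  have h2 : (z - pt w 0).snd = z.snd := by simp [sub_snd, pt_snd]
  rw [h2] at this
  exact (le_abs_self _).trans this
theorem HK.bound' (hk : HK m κ) : ∃ C : ℝ, 0 < C ∧ ∀ z : Vn n, 0 < z.snd → ∀ w,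
    ‖κ (z - pt w 0)‖ ≤ C * (z.snd ^ m)⁻¹ := by
  obtain ⟨C, hC, h⟩ := hk.bound
  refine ⟨C, hC, fun z hz w => (h _ (sub_ne hz w)).trans ?_⟩
  gcongr
  exact snd_le_sub z w
theorem HK.contw (hk : HK m κ) (hz : 0 < z.snd) : Continuous fun w => κ (z - pt w 0) :=
  hk.1.continuousOn.comp_continuous
    (continuous_const.sub (cont_pt.comp (continuous_id.prodMk continuous_const))) (sub_ne hz)
theorem Po_int (hk : HK m κ) (hh : Integrable h) (hz : 0 < z.snd) :
    Integrable fun w => h w • κ (z - pt w 0) := by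
  obtain ⟨C, hC, hb⟩ := hk.bound'
  exact (hh.bdd_mul (hk.contw hz).aestronglyMeasurable.norm (ae_of_all _ fun w => by
      rw [norm_norm]; exact hb z hz w)).mono
    (hh.aestronglyMeasurable.smul (hk.contw hz).aestronglyMeasurable)
    (ae_of_all _ fun w => by rw [norm_smul, norm_mul, norm_norm, mul_comm])
theorem Po_hasFDerivAt (hk : HK m κ) (hh : Integrable h)
    (hz : 0 < z.snd) : HasFDerivAt (Po κ h) (Po (fderiv ℝ κ) h z) z := by
  obtain ⟨C, hC, hb⟩ := hk.fderiv.bound'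
  have hU : {y : Vn n | z.snd / 2 < y.snd} ∈ 𝓝 z :=
    (isOpen_lt continuous_const cont_snd).mem_nhds (by simp; linarith)
  refine hasFDerivAt_integral_of_dominated_of_fderiv_le (F := fun z w => h w • κ (z - pt w 0))
    (F' := fun z w => h w • fderiv ℝ κ (z - pt w 0)) (bound := fun w => |h w| * (C * ((z.snd / 2) ^ (m+1))⁻¹))
    hU ?_ (Po_int hk hh hz) (Po_int hk.fderiv hh hz).aestronglyMeasurable ?_
    (hh.abs.mul_const _) ?_
  · filter_upwards [hs_nhds hz] with y hy using (Po_int hk hh hy).aestronglyMeasurable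
  · refine ae_of_all _ fun w y hy => ?_
    replace hy : z.snd / 2 < y.snd := hy
    rw [norm_smul, norm_eq_abs]
    gcongr
    refine (hb y (by linarith) w).trans ?_
    gcongr
  · refine ae_of_all _ fun w y hy => ?_
    replace hy : z.snd / 2 < y.snd := hy
    have d : HasFDerivAt κ (fderiv ℝ κ (y - pt w 0)) (y - pt w 0) :=
      ((hk.contAt (sub_ne (by linarith) w)).differentiableAt sm).hasFDerivAt
    exact ((d.comp y ((hasFDerivAt_id y).sub_const _)).const_smul (h w)).congr_fderiv
      sm
theorem Po_contDiff (hh : Integrable h) (k : ℕ) :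
    ∀ {Y : Type} [NormedAddCommGroup Y] [NormedSpace ℝ Y] {m : ℕ} {κ : Vn n → Y}, HK m κ →
      ContDiffOn ℝ k (Po κ h) (hs n) := by
  induction k with
  | zero =>
    intro Y _ _ m κ hk
    exact contDiffOn_zero.2 fun z hz => (Po_hasFDerivAt hk hh hz).continuousAt.continuousWithinAt
  | succ k ih =>
    intro Y _ _ m κ hk
    rw [Nat.cast_succ, contDiffOn_succ_iff_fderiv_of_isOpen (hs_open n)]
    refine ⟨fun z hz => (Po_hasFDerivAt hk hh hz).differentiableAt.differentiableWithinAt,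
      by simp, (ih hk.fderiv).congr fun z hz => (Po_hasFDerivAt hk hh hz).fderiv⟩
theorem Po_bound (hk : HK m κ) : ∃ C : ℝ, 0 < C ∧ ∀ h : En n → ℝ, Integrable h → ∀ z : Vn n,
    0 < z.snd → ‖Po κ h z‖ ≤ C * (z.snd ^ m)⁻¹ * ∫ w, |h w| := by
  obtain ⟨C, hC, hb⟩ := hk.bound'
  refine ⟨C, hC, fun h hh z hz => ?_⟩
  rw [← integral_const_mul]
  refine norm_integral_le_of_norm_le (hh.abs.const_mul _) (ae_of_all _ fun w => ?_)
  rw [norm_smul, norm_eq_abs, mul_comm]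
  gcongr
  exact hb z hz w
noncomputable def kk (z : Vn n) : Vn n := (‖z‖ ^ (n + 1))⁻¹ • z
theorem kk_HK (n : ℕ) : HK n (kk (n := n)) := by
  constructor
  · intro z hz
    have : ContDiffAt ℝ ∞ (fun z : Vn n => ‖z‖) z := contDiffAt_norm ℝ hz
    exact (((this.pow (n + 1)).inv (pow_ne_zero _ (norm_ne_zero_iff.2 hz))).smul
      contDiffAt_id).contDiffWithinAt
  · intro c hc z hz
    simp only [kk, norm_smul, norm_eq_abs, abs_of_pos hc, smul_smul]
    congr 1
    have := norm_ne_zero_iff.2 hz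
    rw [mul_pow, pow_succ c]
    field_simp
theorem kk_norm (hz : z ≠ 0) : ‖kk z‖ = (‖z‖ ^ n)⁻¹ := by
  have := norm_ne_zero_iff.2 hz
  rw [kk, norm_smul, norm_inv, norm_pow, norm_norm, pow_succ]
  field_simp
theorem kk_fderiv (hz : z ≠ 0) (v : Vn n) : fderiv ℝ kk z v =
    (‖z‖ ^ (n + 1))⁻¹ • v - ((n + 1 : ℝ) * (‖z‖ ^ (n + 3))⁻¹ * ⟪z, v⟫_ℝ) • z := by
  have hz0 := norm_ne_zero_iff.2 hz
  have d0 : HasFDerivAt (fun z : Vn n => ‖z‖) (‖z‖⁻¹ • innerSL ℝ z) z := by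
    have h1 := (hasStrictFDerivAt_norm_sq z).hasFDerivAt.sqrt pv
    simp only [Real.sqrt_sq (norm_nonneg _)] at h1
    refine h1.congr_fderiv ?_
    ext v; simp; field_simp
  have d1 := ((hasDerivAt_inv (pow_ne_zero (n + 1) hz0)).comp_hasFDerivAt z (d0.pow (n + 1))).smul
    (hasFDerivAt_id z)
  change fderiv ℝ (fun z : Vn n => (‖z‖ ^ (n + 1))⁻¹ • z) z v = _
  refine (congrArg (fun L => L v) d1.fderiv).trans ?_
  simp [smul_smul, sub_eq_add_neg, ← neg_smul]
  congr 1
  field_simp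
  ring
noncomputable def bs (n : ℕ) : OrthonormalBasis (Fin (n + 1)) ℝ (Vn n) :=
  (stdOrthonormalBasis ℝ (Vn n)).reindex (finCongr (Vn_finrank n))
theorem kk_sym (hz : z ≠ 0) (v w : Vn n) :
    ⟪fderiv ℝ kk z v, w⟫_ℝ = ⟪v, fderiv ℝ kk z w⟫_ℝ := by
  simp only [kk_fderiv hz, inner_sub_left, inner_sub_right, inner_smul_left, inner_smul_right,
    real_inner_comm z v]
  simp; ring
theorem kk_trace (hz : z ≠ 0) :
    ∑ i, ⟪fderiv ℝ kk z (bs n i), bs n i⟫_ℝ = 0 := by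
  have hz0 := norm_ne_zero_iff.2 hz
  have h1 : ∑ i, ⟪z, bs n i⟫_ℝ * ⟪z, bs n i⟫_ℝ = ‖z‖ ^ 2 := by
    rw [← real_inner_self_eq_norm_sq, ← (bs n).sum_inner_mul_inner z z]
    exact sum_congr rfl fun i _ => by rw [real_inner_comm z]
  simp only [kk_fderiv hz, inner_sub_left, inner_smul_left, Finset.sum_sub_distrib]
  simp [mul_assoc, ← mul_sum, h1]
  field_simp
  ring
noncomputable def Fp (h : En n → ℝ) : Vn n → Vn n := Po kk h
theorem inner_Po {n m : ℕ} {κ : Vn n → Vn n →L[ℝ] Vn n} (hk : HK m κ) {h : En n → ℝ}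
    (hh : Integrable h) {z : Vn n} (hz : 0 < z.snd) (v w : Vn n) :
    ⟪Po κ h z v, w⟫_ℝ = ∫ y, h y * ⟪κ (z - pt y 0) v, w⟫_ℝ := by
  have hi := Po_int hk hh hz
  rw [Po, ContinuousLinearMap.integral_apply hi, real_inner_comm, ← integral_inner
    (hi.apply_continuousLinearMap v)]
  refine integral_congr_ae (ae_of_all _ fun y => ?_)
  simp [inner_smul_right, real_inner_comm]
theorem Fp_fderiv (hh : Integrable h) (hz : 0 < z.snd) :
    fderiv ℝ (Fp h) z = Po (fderiv ℝ kk) h z := (Po_hasFDerivAt (kk_HK n) hh hz).fderiv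
theorem Fp_sym (hh : Integrable h) (hz : 0 < z.snd)
    (v w : Vn n) : ⟪fderiv ℝ (Fp h) z v, w⟫_ℝ = ⟪v, fderiv ℝ (Fp h) z w⟫_ℝ := by
  rw [Fp_fderiv hh hz, inner_Po (kk_HK n).fderiv hh hz, real_inner_comm,
    inner_Po (kk_HK n).fderiv hh hz]
  refine integral_congr_ae (ae_of_all _ fun y => ?_)
  simp only []
  rw [kk_sym (sub_ne hz y), real_inner_comm]
theorem Fp_trace (hh : Integrable h) (hz : 0 < z.snd) :
    ∑ i, ⟪fderiv ℝ (Fp h) z (bs n i), bs n i⟫_ℝ = 0 := by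
  rw [Fp_fderiv hh hz]
  simp only [inner_Po (kk_HK n).fderiv hh hz]
  rw [← integral_finsetSum]
  · simp [← mul_sum, kk_trace (sub_ne hz _)]
  · intro i _
    have := ((Po_int (kk_HK n).fderiv hh hz).apply_continuousLinearMap (bs n i)).const_inner (𝕜 := ℝ) (bs n i)
    refine this.congr (ae_of_all _ fun y => ?_)
    simp [inner_smul_right, real_inner_comm]
theorem Fp_smooth (hh : Integrable h) : ContDiffOn ℝ 2 (Fp h) (hs n) :=
  Po_contDiff hh 2 (kk_HK n)
theorem Fp_smoothAt (hh : Integrable h) (hz : 0 < z.snd) :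
    ContDiffAt ℝ 2 (Fp h) z := (Fp_smooth hh).contDiffAt ((hs_open n).mem_nhds hz)
noncomputable def lap {Y : Type*} [NormedAddCommGroup Y] [NormedSpace ℝ Y]
    (W : Vn n → Y) (z : Vn n) : Y := ∑ i, fderiv ℝ (fderiv ℝ W) z (bs n i) (bs n i)
theorem Fp_lap (hh : Integrable h) (hz : 0 < z.snd) :
    lap (Fp h) z = 0 := by
  set D := fderiv ℝ (Fp h)
  have hD : DifferentiableAt ℝ D z :=
    ((Fp_smoothAt hh hz).fderiv_right (m := 1) (by norm_num)).differentiableAt sm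
  have hev := hs_nhds hz
  have key : ∀ u v w : Vn n, ∀ x : Vn n, HasFDerivAt (fun y => ⟪D y v, w⟫_ℝ)
      ((innerSL ℝ w).comp ((ContinuousLinearMap.apply ℝ (Vn n) v).comp (fderiv ℝ D z))) z := by
    intro u v w x
    have h1 := hD.hasFDerivAt.clm_apply (hasFDerivAt_const v z)
    have h2 := (innerSL ℝ w).hasFDerivAt.comp z h1
    refine (h2.congr_of_eventuallyEq (Eventually.of_forall fun y => ?_)).congr_fderiv ?_
    · simp [real_inner_comm]
    · ext; simp
  have hs2 : ∀ u v : Vn n, fderiv ℝ D z u v = fderiv ℝ D z v u := fun u v =>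
    (Fp_smoothAt hh hz).isSymmSndFDerivAt sm u v
  refine ext_inner_left ℝ fun v => ?_
  rw [inner_zero_right, lap, inner_sum]
  have h1 : ∀ i, ⟪v, fderiv ℝ D z (bs n i) (bs n i)⟫_ℝ = ⟪bs n i, fderiv ℝ D z v (bs n i)⟫_ℝ := by
    intro i
    have e : (fun y => ⟪D y (bs n i), v⟫_ℝ) =ᶠ[𝓝 z] fun y => ⟪D y v, bs n i⟫_ℝ := by
      filter_upwards [hev] with y hy
      rw [Fp_sym hh hy, real_inner_comm]
    have := congrArg (fun L => L (bs n i)) (((key 0 (bs n i) v 0).congr_of_eventuallyEq e.symm).unique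
      (key 0 v (bs n i) 0))
    simp at this
    rw [this, hs2]
  have h2 : HasFDerivAt (fun y => ∑ i, ⟪D y (bs n i), bs n i⟫_ℝ)
      (∑ i, ((innerSL ℝ (bs n i)).comp ((ContinuousLinearMap.apply ℝ (Vn n) (bs n i)).comp
        (fderiv ℝ D z)))) z := HasFDerivAt.fun_sum fun i _ => key 0 _ _ 0
  have e : (fun y => ∑ i, ⟪D y (bs n i), bs n i⟫_ℝ) =ᶠ[𝓝 z] fun _ => (0 : ℝ) := by
    filter_upwards [hev] with y hy using Fp_trace hh hy
  have := congrArg (fun L => L v) ((h2.congr_of_eventuallyEq e.symm).unique (hasFDerivAt_const 0 z))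
  simp at this
  exact (sum_congr rfl fun i _ => h1 i).trans this
theorem tr_bound (T : Vn n →L[ℝ] Vn n) (hs : ∀ v w, ⟪T v, w⟫_ℝ = ⟪v, T w⟫_ℝ)
    (ht : ∑ i, ⟪T (bs n i), bs n i⟫_ℝ = 0) (v : Vn n) :
    ((n : ℝ) + 1) * ‖T v‖ ^ 2 ≤ n * ‖v‖ ^ 2 * ∑ i, ‖T (bs n i)‖ ^ 2 := by
  have hT : (T : Vn n →ₗ[ℝ] Vn n).IsSymmetric := hs
  set b := hT.eigenvectorBasis (Vn_finrank n)
  set l := hT.eigenvalues (Vn_finrank n)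
  have hb : ∀ i, T (b i) = l i • b i := fun i => hT.apply_eigenvectorBasis (Vn_finrank n) i
  have h1 : ∑ i, l i = 0 := by
    have e1 := trace_eq_sum_inner (T : Vn n →ₗ[ℝ] Vn n) b
    have e2 := trace_eq_sum_inner (T : Vn n →ₗ[ℝ] Vn n) (bs n)
    rw [e2] at e1
    simp only [coe_coe, hb, inner_smul_right] at e1
    simp only [real_inner_self_eq_norm_sq, b.norm_eq_one] at e1
    simp only [one_pow, mul_one] at e1
    rw [← e1, ← ht]
    exact sum_congr rfl fun i _ => real_inner_comm _ _
  have h2 : ∑ i, ‖T (bs n i)‖ ^ 2 = ∑ i, l i ^ 2 := by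
    have e1 := trace_eq_sum_inner ((T : Vn n →ₗ[ℝ] Vn n) ∘ₗ T) b
    have e2 := trace_eq_sum_inner ((T : Vn n →ₗ[ℝ] Vn n) ∘ₗ T) (bs n)
    rw [e2] at e1
    simp only [LinearMap.comp_apply, coe_coe] at e1
    calc _ = ∑ i, ⟪bs n i, T (T (bs n i))⟫_ℝ := sum_congr rfl fun i _ => by
            rw [← hs, real_inner_self_eq_norm_sq]
      _ = _ := e1
      _ = _ := sum_congr rfl fun i _ => by
        rw [← hs, real_inner_self_eq_norm_sq, hb, norm_smul, b.norm_eq_one]; simp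
  have h3 : ∀ i, ((n : ℝ) + 1) * l i ^ 2 ≤ n * ∑ j, l j ^ 2 := by
    intro i
    have e3 := sq_sum_le_card_mul_sum_sq (s := Finset.univ.erase i) (f := l)
    rw [Finset.card_erase_of_mem (Finset.mem_univ i)] at e3
    simp [h1] at e3
    nlinarith
  have h4 : ‖T v‖ ^ 2 = ∑ i, l i ^ 2 * ⟪b i, v⟫_ℝ ^ 2 := by
    rw [← b.sum_sq_norm_inner_right]
    refine sum_congr rfl fun i _ => ?_
    rw [← hs, hb, inner_smul_left]; simp [mul_pow]
  rw [h4, h2, ← b.sum_sq_norm_inner_right v, mul_sum, mul_right_comm, mul_sum]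
  refine sum_le_sum fun i _ => ?_
  have := mul_le_mul_of_nonneg_right (h3 i) (sq_nonneg ⟪b i, v⟫_ℝ)
  simp only [norm_eq_abs, sq_abs]
  linarith
theorem d2_of {Y : Type} [NormedAddCommGroup Y] [NormedSpace ℝ Y] {W : Vn n → Y} {z v : Vn n} (hW : ContDiffAt ℝ 2 W z) {w1 : Vn n → Y}
    (h1 : ∀ᶠ y in 𝓝 z, fderiv ℝ W y v = w1 y) {L : Vn n →L[ℝ] Y} (hL : HasFDerivAt w1 L z)
    (u : Vn n) : fderiv ℝ (fderiv ℝ W) z u v = L u := by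
  have hD : DifferentiableAt ℝ (fderiv ℝ W) z :=
    (hW.fderiv_right (m := 1) (by norm_num)).differentiableAt sm
  have h2 := hD.hasFDerivAt.clm_apply (hasFDerivAt_const v z)
  have := congrArg (fun L => L u) ((h2.congr_of_eventuallyEq
    (EventuallyEq.symm h1)).unique hL)
  simpa using this
theorem ev2 {Y : Type} [NormedAddCommGroup Y] [NormedSpace ℝ Y] {W : Vn n → Y}
    (hW : ContDiffAt ℝ 2 W z) : ∀ᶠ y in 𝓝 z, DifferentiableAt ℝ W y := by
  filter_upwards [hW.eventually sm] with y hy using hy.differentiableAt sm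
theorem diff2 {Y : Type} [NormedAddCommGroup Y] [NormedSpace ℝ Y] {W : Vn n → Y}
    (hW : ContDiffAt ℝ 2 W z) (v : Vn n) : HasFDerivAt (fun y => fderiv ℝ W y v)
      ((ContinuousLinearMap.apply ℝ Y v).comp (fderiv ℝ (fderiv ℝ W) z)) z := by
  have hD : DifferentiableAt ℝ (fderiv ℝ W) z :=
    (hW.fderiv_right (m := 1) (by norm_num)).differentiableAt sm
  refine (hD.hasFDerivAt.clm_apply (hasFDerivAt_const v z)).congr_fderiv ?_
  ext; simp
theorem lap_add {f g : Vn n → ℝ} (hf : ContDiffAt ℝ 2 f z) (hg : ContDiffAt ℝ 2 g z) :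
    lap (fun y => f y + g y) z = lap f z + lap g z := by
  simp only [lap, ← sum_add_distrib]
  refine sum_congr rfl fun i _ => ?_
  refine (d2_of (hf.add hg) (w1 := fun y => fderiv ℝ f y (bs n i) + fderiv ℝ g y (bs n i)) ?_
    ((diff2 hf _).add (diff2 hg _)) _).trans sm
  filter_upwards [ev2 hf, ev2 hg] with y h1 h2
  rw [fderiv_fun_add h1 h2]; rfl
theorem lap_mul {f g : Vn n → ℝ} (hf : ContDiffAt ℝ 2 f z) (hg : ContDiffAt ℝ 2 g z) :
    lap (fun y => f y * g y) z = f z * lap g z + g z * lap f z +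
      2 * ∑ i, fderiv ℝ f z (bs n i) * fderiv ℝ g z (bs n i) := by
  simp only [lap, mul_sum, ← sum_add_distrib]
  refine sum_congr rfl fun i _ => ?_
  refine (d2_of (hf.mul hg)
    (w1 := fun y => f y * fderiv ℝ g y (bs n i) + g y * fderiv ℝ f y (bs n i)) ?_
    ((((ev2 hf).self_of_nhds.hasFDerivAt).mul (diff2 hg _)).add
      (((ev2 hg).self_of_nhds.hasFDerivAt).mul (diff2 hf _))) _).trans (by simp; ring)
  filter_upwards [ev2 hf, ev2 hg] with y h1 h2
  rw [fderiv_fun_mul h1 h2]; simp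
theorem lap_comp {S : Vn n → ℝ} (hS : ContDiffAt ℝ 2 S z) {g g' : ℝ → ℝ} {g'' : ℝ}
    (hg : ContDiffAt ℝ 2 g (S z)) (h1 : ∀ᶠ s in 𝓝 (S z), HasDerivAt g (g' s) s)
    (h2 : HasDerivAt g' g'' (S z)) : lap (fun y => g (S y)) z =
      g' (S z) * lap S z + g'' * ∑ i, (fderiv ℝ S z (bs n i)) ^ 2 := by
  simp only [lap, mul_sum, ← sum_add_distrib]
  refine sum_congr rfl fun i _ => ?_
  have dS := (ev2 hS).self_of_nhds.hasFDerivAt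
  refine (d2_of (hg.comp z hS) (w1 := fun y => g' (S y) * fderiv ℝ S y (bs n i)) ?_
    ((h2.comp_hasFDerivAt z dS).mul (diff2 hS _)) _).trans (by simp; ring)
  filter_upwards [ev2 hS, hS.continuousAt.eventually h1] with y e1 e2
  exact congrArg (fun L => L (bs n i)) (e2.comp_hasFDerivAt y e1.hasFDerivAt).fderiv
theorem cda_snd : ContDiffAt ℝ 2 (fun y : Vn n => y.snd) z :=
  (IsBoundedLinearMap.contDiff (𝕜 := ℝ)
    ((LinearMap.mk ⟨fun y : Vn n => y.snd, fun _ _ => rfl⟩ fun _ _ => rfl).isLinear.with_bound 1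
      fun z => by rw [one_mul]; exact snd_le_norm z)).contDiffAt
theorem inner_e (z : Vn n) : ⟪pt 0 1, z⟫_ℝ = z.snd := by simp [inner_V, pt_fst, pt_snd]
theorem fder_snd (z v : Vn n) : fderiv ℝ (fun y : Vn n => y.snd) z v = v.snd := by
  have : (fun y : Vn n => y.snd) = innerSL ℝ (pt 0 1) := by ext; simp [inner_e]
  rw [this, ContinuousLinearMap.fderiv]; simp [inner_e]
theorem sum_snd_sq : ∑ i, (bs n i).snd ^ 2 = 1 := by
  have := (bs n).sum_sq_norm_inner_left (pt 0 1 : Vn n)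
  simp only [inner_e, norm_pt] at this
  simpa using this
theorem lap_snd {g g' : ℝ → ℝ} {g'' : ℝ}
    (hg : ContDiffAt ℝ 2 g z.snd) (h1 : ∀ᶠ s in 𝓝 z.snd, HasDerivAt g (g' s) s)
    (h2 : HasDerivAt g' g'' z.snd) : lap (fun y : Vn n => g y.snd) z = g'' := by
  rw [lap_comp cda_snd hg h1 h2]
  have : lap (fun y : Vn n => y.snd) z = 0 := sum_eq_zero fun i _ =>
    d2_of cda_snd (Eventually.of_forall fun y => fder_snd y _) (hasFDerivAt_const _ z) _
  simp [this, fder_snd, sum_snd_sq]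
theorem lap_max {D : Vn n → ℝ} (hD : ContDiffAt ℝ 2 D z) (hm : IsLocalMax D z) :
    lap D z ≤ 0 := by
  refine Finset.sum_nonpos fun i _ => ?_
  set v := bs n i
  by_contra! hpos
  have hline : Continuous fun s : ℝ => z + s • v := by fun_prop
  have h0 : z + (0 : ℝ) • v = z := by simp
  have hT : Tendsto (fun s : ℝ => z + s • v) (𝓝 0) (𝓝 z) := by simpa using hline.tendsto 0
  have hl : ∀ s : ℝ, HasDerivAt (fun s : ℝ => z + s • v) v s := fun s => by
    simpa using ((hasDerivAt_id s).smul_const v).const_add z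
  have e1 : ∀ᶠ s : ℝ in 𝓝 0, HasDerivAt (fun s : ℝ => D (z + s • v)) (fderiv ℝ D (z + s • v) v) s := by
    have := hT.eventually (ev2 hD)
    filter_upwards [this] with s hs
    exact hs.hasFDerivAt.comp_hasDerivAt s (hl s)
  have e2 : HasDerivAt (fun s : ℝ => fderiv ℝ D (z + s • v) v) (fderiv ℝ (fderiv ℝ D) z v v) 0 := by
    have := (diff2 hD v)
    rw [← h0] at this
    have := this.comp_hasDerivAt 0 (hl 0)
    simp only [h0] at this
    exact this
  have e3 : deriv (fun s : ℝ => D (z + s • v)) =ᶠ[𝓝 0] fun s => fderiv ℝ D (z + s • v) v := by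
    filter_upwards [e1] with s hs using hs.deriv
  have hmax : IsLocalMax (fun s : ℝ => D (z + s • v)) 0 := by
    have := hT.eventually hm
    filter_upwards [this] with s hs
    simpa using hs
  have hd2 : deriv (deriv fun s : ℝ => D (z + s • v)) 0 = fderiv ℝ (fderiv ℝ D) z v v := by
    rw [e3.deriv_eq, e2.deriv]
  have hmin := isLocalMin_of_deriv_deriv_pos (f := fun s : ℝ => D (z + s • v)) (x₀ := 0)
    (by rw [hd2]; exact hpos) hmax.deriv_eq_zero e1.self_of_nhds.continuousAt
  have hc : (fun s : ℝ => D (z + s • v)) =ᶠ[𝓝 0] fun _ => D (z + (0 : ℝ) • v) := by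
    filter_upwards [hmin, hmax] with s a b using le_antisymm b a
  have hc1 : deriv (fun s : ℝ => D (z + s • v)) =ᶠ[𝓝 0] fun _ => 0 := by
    refine hc.deriv.trans (Eventually.of_forall fun s => by simp)
  rw [← hd2, hc1.deriv_eq] at hpos
  simp at hpos
theorem maxprin {D : Vn n → ℝ} {t1 : ℝ} (hD : ∀ z : Vn n, t1 ≤ z.snd → ContDiffAt ℝ 2 D z)
    (hl : ∀ z : Vn n, t1 ≤ z.snd → 0 ≤ lap D z) (hb : ∀ z : Vn n, z.snd = t1 → D z ≤ 0)
    (hi : ∀ ε > 0, ∀ᶠ z in cocompact (Vn n), t1 ≤ z.snd → D z ≤ ε) (z : Vn n) (hz : t1 ≤ z.snd) :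
    D z ≤ 0 := by
  by_contra! hpos
  set τ := D z / 2 with hτ
  have hτ0 : 0 < τ := by positivity
  set e : Vn n → ℝ := fun y => τ * Real.exp (t1 - y.snd) with he
  have he1 : ∀ y : Vn n, t1 ≤ y.snd → e y ≤ τ := fun y hy => by
    have : Real.exp (t1 - y.snd) ≤ 1 := Real.exp_le_one_iff.2 (by linarith)
    simp only [he]; nlinarith
  have he0 : ∀ y, 0 < e y := fun y => by positivity
  obtain ⟨K, hK, hKs⟩ := mem_cocompact.1 (hi (τ / 2) pv)
  have hout : ∀ y : Vn n, t1 ≤ y.snd → y ∉ K → D y ≤ τ / 2 := fun y hy hyK => hKs hyK hy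
  have hzK : z ∈ K := by
    by_contra h
    have := hout z hz h
    linarith
  have hcl : IsClosed {y : Vn n | t1 ≤ y.snd} := isClosed_le continuous_const cont_snd
  have eC : ∀ y, ContDiffAt ℝ 2 e y := fun y =>
    contDiffAt_const.mul (Real.contDiff_exp.contDiffAt.comp y (contDiffAt_const.sub cda_snd))
  obtain ⟨y, ⟨hyK, hy⟩, hmax⟩ := (hK.inter_right hcl).exists_isMaxOn ⟨z, hzK, hz⟩
    (f := fun y => D y + e y) (fun y hy =>
      ((hD y hy.2).continuousAt.add (eC y).continuousAt).continuousWithinAt)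
  have hyz : D z + e z ≤ D y + e y := hmax ⟨hzK, hz⟩
  have hglob : ∀ w : Vn n, t1 ≤ w.snd → D w + e w ≤ D y + e y := by
    intro w hw
    by_cases hwK : w ∈ K
    · exact hmax ⟨hwK, hw⟩
    · have := hout w hw hwK
      have := he1 w hw
      have := he0 z
      linarith
  have hy' : t1 < y.snd := by
    refine lt_of_le_of_ne hy fun h => ?_
    have := hb y h.symm
    have := he1 y hy
    have := he0 z
    linarith
  have hloc : IsLocalMax (fun y => D y + e y) y := by
    filter_upwards [(isOpen_lt continuous_const cont_snd).mem_nhds hy'] with w hw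
    exact hglob w (le_of_lt hw)
  have h1 := lap_max ((hD y hy).add (eC y)) hloc
  rw [lap_add (hD y hy) (eC y)] at h1
  have hdg : ∀ s : ℝ, HasDerivAt (fun s => τ * Real.exp (t1 - s)) (-(τ * Real.exp (t1 - s))) s := by
    intro s
    have := (((hasDerivAt_id s).const_sub t1).exp).const_mul τ
    simpa using this
  have h2 : lap e y = e y := by
    refine (lap_snd (g := fun s => τ * Real.exp (t1 - s)) (g' := fun s => -(τ * Real.exp (t1 - s)))
      (by fun_prop) (Eventually.of_forall hdg) (hdg _).neg).trans ?_
    simp [he]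
  have := hl y hy
  have := he0 y
  linarith
noncomputable def gF (h : En n → ℝ) (z : Vn n) : ℝ := ∑ i, ‖fderiv ℝ (Fp h) z (bs n i)‖ ^ 2
theorem gF_nonneg (h : En n → ℝ) (z : Vn n) : 0 ≤ gF h z := sum_nonneg fun _ _ => sq_nonneg _
theorem subP (hh : Integrable h) (hz : 0 < z.snd) {ε : ℝ} (hε : 0 < ε)
    {a : ℝ} (ha : 0 < a) (ha1 : a ≤ 1) :
    ContDiffAt ℝ 2 (fun y => (‖Fp h y‖ ^ 2 + ε) ^ a) z ∧
    2 * a * (‖Fp h z‖ ^ 2 + ε) ^ (a - 1) * gF h z * (1 - 2 * (1 - a) * (n / (n + 1))) ≤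
      lap (fun y => (‖Fp h y‖ ^ 2 + ε) ^ a) z ∧
    lap (fun y => (‖Fp h y‖ ^ 2 + ε) ^ a) z ≤ 2 * a * (‖Fp h z‖ ^ 2 + ε) ^ (a - 1) * gF h z ∧
    ∀ v, fderiv ℝ (fun y => (‖Fp h y‖ ^ 2 + ε) ^ a) z v = a * (‖Fp h z‖ ^ 2 + ε) ^ (a - 1) * (2 * ⟪Fp h z, fderiv ℝ (Fp h) z v⟫_ℝ) := by
  have hF := Fp_smoothAt hh hz
  set S : Vn n → ℝ := fun y => ‖Fp h y‖ ^ 2 + ε with hSd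
  have hS : ContDiffAt ℝ 2 S z := (hF.norm_sq ℝ).add contDiffAt_const
  have dS : ∀ y, DifferentiableAt ℝ (Fp h) y → ∀ v, fderiv ℝ S y v = 2 * ⟪Fp h y, fderiv ℝ (Fp h) y v⟫_ℝ :=
    fun y hy v => by
      have : HasFDerivAt S _ y := hy.hasFDerivAt.norm_sq.add_const ε
      rw [this.fderiv]; simp
  have hSp : 0 < S z := by simp only [hSd]; positivity
  have hlS : lap S z = 2 * gF h z := by
    have h0 := Fp_lap hh hz
    have : lap S z = ∑ i, (2 * ‖fderiv ℝ (Fp h) z (bs n i)‖ ^ 2 +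
        2 * ⟪Fp h z, fderiv ℝ (fderiv ℝ (Fp h)) z (bs n i) (bs n i)⟫_ℝ) := by
      refine sum_congr rfl fun i _ => ?_
      refine (d2_of hS (w1 := fun y => 2 * ⟪Fp h y, fderiv ℝ (Fp h) y (bs n i)⟫_ℝ) ?_
        (((ev2 hF).self_of_nhds.hasFDerivAt.inner ℝ (diff2 hF (bs n i))).const_mul 2) _).trans ?_
      · filter_upwards [ev2 hF] with y hy using dS y hy _
      · simp [fderivInnerCLM_apply]; ring
    rw [this, sum_add_distrib, ← mul_sum, ← mul_sum, ← inner_sum]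
    rw [lap] at h0
    rw [h0, inner_zero_right, gF]; ring
  have hgS : ∑ i, (fderiv ℝ S z (bs n i)) ^ 2 = 4 * ‖fderiv ℝ (Fp h) z (Fp h z)‖ ^ 2 := by
    rw [← (bs n).sum_sq_norm_inner_left, mul_sum]
    refine sum_congr rfl fun i _ => ?_
    rw [dS z (ev2 hF).self_of_nhds, Fp_sym hh hz, norm_eq_abs, sq_abs]; ring
  have hd : ∀ (b s : ℝ), 0 < s → HasDerivAt (fun s : ℝ => s ^ b) (b * s ^ (b - 1)) s := fun b s hs =>
    Real.hasDerivAt_rpow_const (Or.inl hs.ne')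
  have hc : ContDiffAt ℝ 2 (fun s : ℝ => s ^ a) (S z) := Real.contDiffAt_rpow_const_of_ne hSp.ne'
  refine ⟨hc.comp z hS, ?_⟩
  rw [← and_assoc]
  refine ⟨?_, fun v => by
    rw [← dS z (ev2 hF).self_of_nhds]
    refine (congrArg (fun L => L v) ((hd a _ hSp).comp_hasFDerivAt z (hS.differentiableAt sm).hasFDerivAt).fderiv).trans ?_
    simp [S]⟩
  have hT := tr_bound (fderiv ℝ (Fp h) z) (Fp_sym hh hz) (Fp_trace hh hz) (Fp h z)
  rw [lap_comp hS hc (g' := fun s => a * s ^ (a - 1)) (g'' := a * ((a - 1) * S z ^ (a - 1 - 1)))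
    (by filter_upwards [lt_mem_nhds hSp] with s hs using hd a s hs)
    ((hd (a - 1) _ hSp).const_mul a), hlS, hgS]
  have h1 : S z ^ (a - 1) = S z ^ (a - 1 - 1) * S z := by
    rw [← Real.rpow_add_one hSp.ne']; ring_nf
  have h2 : 0 ≤ S z ^ (a - 1 - 1) := by positivity
  have h3 : ‖fderiv ℝ (Fp h) z (Fp h z)‖ ^ 2 ≤ n / (n + 1) * (S z * gF h z) := by
    rw [div_mul_eq_mul_div, le_div_iff₀ pv]
    have : (n : ℝ) * ‖Fp h z‖ ^ 2 * gF h z ≤ n * S z * gF h z := by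
      have := gF_nonneg h z
      gcongr; simp only [hSd]; linarith
    rw [gF] at *
    linarith
  rw [h1]
  have h4 := mul_le_mul_of_nonneg_left h3 (mul_nonneg (mul_nonneg ha.le (sub_nonneg.2 ha1)) h2)
  have h5 := mul_nonneg (sq_nonneg ‖fderiv ℝ (Fp h) z (Fp h z)‖) (mul_nonneg (mul_nonneg ha.le (sub_nonneg.2 ha1)) h2)
  constructor <;> nlinarith
theorem kk_snd (z : Vn n) : (kk z).snd = z.snd / ‖z‖ ^ (n + 1) := by
  rw [kk, smul_snd, div_eq_inv_mul]
theorem Fp_inner (hh : Integrable h) (hz : 0 < z.snd) (v : Vn n) :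
    ⟪v, Fp h z⟫_ℝ = ∫ w, h w * ⟪v, kk (z - pt w 0)⟫_ℝ := by
  rw [Fp, Po, ← integral_inner (Po_int (kk_HK n) hh hz)]
  simp [inner_smul_right]
theorem Fp_snd (hh : Integrable h) (hz : 0 < z.snd) :
    (Fp h z).snd = ∫ w, h w * (z.snd / ‖z - pt w 0‖ ^ (n + 1)) := by
  rw [← inner_e, Fp_inner hh hz]
  simp [inner_e, kk_snd, sub_snd, pt_snd]
theorem pk_le (ht : 0 < t) (v : En n) : pk n t v ≤ t / ‖pt v t‖ ^ (n + 1) := by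
  have h1 := norm_pt_le v t
  have h2 := snd_le_norm (pt v t)
  rw [pt_snd] at h2
  rw [abs_of_pos ht] at *
  have : 0 < ‖pt v t‖ := by linarith
  rw [pk]
  gcongr
  linarith
theorem le_pk (ht : 0 < t) (v : En n) : t / ‖pt v t‖ ^ (n + 1) ≤ 2 ^ (n + 1) * pk n t v := by
  have h1 := fst_le_norm (pt v t)
  have h2 := snd_le_norm (pt v t)
  rw [pt_snd, abs_of_pos ht] at h2
  rw [pt_fst] at h1
  have : 0 < ‖pt v t‖ := by linarith
  have : (t + ‖v‖) ^ (n + 1) ≤ 2 ^ (n + 1) * ‖pt v t‖ ^ (n + 1) := by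
    rw [← mul_pow]; gcongr; linarith
  rw [pk, ← mul_div_assoc, div_le_div_iff₀ pv pv]
  nlinarith
theorem F_decay (hn : n ≠ 0) (hh : Integrable h) {s : ℝ} (hs : 0 < s) :
    Tendsto (Fp h) (cocompact (Vn n) ⊓ 𝓟 {z | s ≤ z.snd}) (𝓝 0) := by
  have hc : IsCountablyGenerated (cocompact (Vn n)) := by
    rw [← Metric.cobounded_eq_cocompact, ← comap_norm_atTop]; infer_instance
  have : Tendsto (Fp h) (cocompact (Vn n) ⊓ 𝓟 {z | s ≤ z.snd}) (𝓝 (∫ w : En n, (0 : Vn n))) := by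
    obtain ⟨C, hC, hb⟩ := (kk_HK n).bound'
    refine tendsto_integral_filter_of_dominated_convergence (fun w => |h w| * (C * (s ^ n)⁻¹)) ?_ ?_ (hh.abs.mul_const _) ?_
    · filter_upwards [mem_inf_of_right (mem_principal_self _)] with z hz
      exact (Po_int (kk_HK n) hh (hs.trans_le hz)).aestronglyMeasurable
    · filter_upwards [mem_inf_of_right (mem_principal_self _)] with z hz
      refine ae_of_all _ fun w => ?_
      have hz' : 0 < z.snd := hs.trans_le hz
      rw [norm_smul, norm_eq_abs]
      gcongr
      refine (hb z hz' w).trans ?_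
      gcongr
    · refine ae_of_all _ fun w => ?_
      rw [tendsto_zero_iff_norm_tendsto_zero]
      have h1 : Tendsto (fun z : Vn n => ‖z - pt w 0‖) (cocompact (Vn n)) atTop :=
        tendsto_norm_cocompact_atTop.comp (Homeomorph.subRight (pt w 0)).isClosedEmbedding.tendsto_cocompact
      have h2 : Tendsto (fun z : Vn n => |h w| * (‖z - pt w 0‖ ^ n)⁻¹)
          (cocompact (Vn n) ⊓ 𝓟 {z | s ≤ z.snd}) (𝓝 0) := by
        simpa using ((tendsto_inv_atTop_zero.comp ((tendsto_pow_atTop hn).comp h1)).const_mul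
          |h w|).mono_left inf_le_left
      refine h2.congr' ?_
      filter_upwards [mem_inf_of_right (mem_principal_self _)] with z hz
      rw [norm_smul, kk_norm (sub_ne (hs.trans_le hz) w), norm_eq_abs]
  simpa using this
noncomputable def qq (n : ℕ) : ℝ := ((n : ℝ) - 1) / n
theorem qq_pos (hn : 2 ≤ n) : 0 < qq n := by
  have : (2 : ℝ) ≤ n := by exact_mod_cast hn
  exact div_pos (by linarith) (by linarith)
theorem qq_lt (hn : 2 ≤ n) : qq n < 1 := by
  have : (2 : ℝ) ≤ n := by exact_mod_cast hn
  rw [qq, div_lt_one (by linarith)]; linarith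
theorem lap_u {g : En n → ℝ} (hg : Integrable g) (hz : 0 < z.snd) :
    ContDiffAt ℝ 2 (fun y => (Fp g y).snd) z ∧ lap (fun y => (Fp g y).snd) z = 0 := by
  have hF := Fp_smoothAt hg hz
  have hc : ContDiffAt ℝ 2 (fun y => (Fp g y).snd) z := (cda_snd (z := Fp g z)).comp z hF
  refine ⟨hc, ?_⟩
  have h0 := congrArg (fun v => ⟪pt 0 1, v⟫_ℝ) (Fp_lap hg hz)
  simp only [lap, inner_zero_right, inner_sum] at h0
  rw [← h0]
  refine sum_congr rfl fun i _ => ?_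
  refine (d2_of hc (w1 := fun y => ⟪pt 0 1, fderiv ℝ (Fp g) y (bs n i)⟫_ℝ) ?_
    ((innerSL ℝ (pt 0 1)).hasFDerivAt.comp z (diff2 hF (bs n i))) _).trans sm
  filter_upwards [ev2 hF] with y hy
  have : (fun y => (Fp g y).snd) = fun y => innerSL ℝ (pt 0 1) (Fp g y) := by
    ext y; simp [inner_e]
  rw [this]
  have := (innerSL ℝ (pt 0 1 : Vn n)).hasFDerivAt.comp y hy.hasFDerivAt
  exact (congrArg (fun L => L (bs n i)) (HasFDerivAt.fderiv this))
theorem lap_shift {W : Vn n → ℝ} (p z : Vn n) : lap (fun y => W (y + p)) z = lap W (z + p) := by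
  simp only [lap]
  have : fderiv ℝ (fun y => W (y + p)) = fun y => fderiv ℝ W (y + p) := by
    ext1 y; rw [fderiv_comp_add_right]
  rw [this]
  simp_rw [fderiv_comp_add_right]
theorem u_lower {g : En n → ℝ} (hg : Integrable g) (h0 : ∀ y, 0 ≤ g y) (ht : 0 < t) (x : En n)
    {m : ℝ} (hm : ∀ y, dist y x < t → m ≤ g y) :
    m * ((om n).toReal / 2 ^ (n + 1)) ≤ (Fp g (pt x t)).snd := by
  have hz : 0 < (pt x t).snd := ht
  have hint : Integrable fun w => g w * ((pt x t).snd / ‖pt x t - pt w 0‖ ^ (n + 1)) := by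
    have := (innerSL ℝ (pt 0 1 : Vn n)).integrable_comp (Po_int (kk_HK n) hg hz)
    refine this.congr (ae_of_all _ fun w => ?_)
    simp [inner_smul_right, inner_e, kk_snd, sub_snd, pt_snd]
  rw [Fp_snd hg hz]
  have hpos : ∀ w, 0 ≤ (pt x t).snd / ‖pt x t - pt w 0‖ ^ (n + 1) := fun w => by positivity
  calc _ = ∫ w in ball x t, m * (t / (2 * t) ^ (n + 1)) := by
        rw [setIntegral_const, measureReal_def, vol_ball x ht, ENNReal.toReal_mul,
          ENNReal.toReal_ofReal pv, smul_eq_mul]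
        field_simp; ring
    _ ≤ ∫ w in ball x t, g w * ((pt x t).snd / ‖pt x t - pt w 0‖ ^ (n + 1)) := by
        refine setIntegral_mono_on (integrableOn_const measure_ball_lt_top.ne) hint.integrableOn measurableSet_ball fun w hw => ?_
        have e1 : t / (2 * t) ^ (n + 1) ≤ (pt x t).snd / ‖pt x t - pt w 0‖ ^ (n + 1) := by
          rw [pt_snd, pt_sub, sub_zero]
          refine le_trans ?_ (pk_le ht _)
          rw [pk]
          gcongr
          rw [mem_ball, dist_comm, dist_eq_norm] at hw
          linarith
        have e2 : 0 ≤ t / (2 * t) ^ (n + 1) := by positivity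
        exact (mul_le_mul_of_nonneg_right (hm w hw) e2).trans
          (mul_le_mul_of_nonneg_left e1 (h0 w))
    _ ≤ _ := setIntegral_le_integral hint (ae_of_all _ fun w => mul_nonneg (h0 w) (hpos w))
theorem H5a (hn : 2 ≤ n) (hh : Integrable h) {s : ℝ} (hs : 0 < s) (ht : 0 < t)
    (x : En n) {η : ℝ} (hη : 0 < η) : ∃ g : En n → ℝ, Integrable g ∧ (∀ y, 0 ≤ g y) ∧
      (∀ y, g y ≤ ‖Fp h (pt y s)‖ ^ qq n) ∧
      ‖Fp h (pt x (s + t))‖ ^ qq n ≤ 3 * η + ((om n).toReal / 2 ^ (n + 1))⁻¹ * (Fp g (pt x t)).snd := by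
  have hq := qq_pos hn
  have hq1 := qq_lt hn
  have hn2 : (2 : ℝ) ≤ n := by exact_mod_cast hn
  set A := (om n).toReal / 2 ^ (n + 1)
  have hA : 0 < A := div_pos (toReal_pos (om_pos n) (om_top n)) pv
  set ε := (η / 2) ^ (2 / qq n)
  have hε : 0 < ε := by positivity
  have hεq : ε ^ (qq n / 2) = η / 2 := by
    rw [← Real.rpow_mul pv]
    rw [show 2 / qq n * (qq n / 2) = 1 by field_simp, Real.rpow_one]
  set N : Vn n → ℝ := fun z => (‖Fp h z‖ ^ 2 + ε) ^ (qq n / 2) with hN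
  have hNge : ∀ z, ‖Fp h z‖ ^ qq n ≤ N z := fun z => by
    calc ‖Fp h z‖ ^ qq n = (‖Fp h z‖ ^ 2) ^ (qq n / 2) := by
          rw [← Real.rpow_natCast, ← Real.rpow_mul (norm_nonneg _)]; congr 1; push_cast; ring
      _ ≤ _ := by simp only [hN]; gcongr; linarith
  have hNle : ∀ z, N z ≤ ‖Fp h z‖ ^ qq n + η / 2 := fun z => by
    calc N z ≤ (‖Fp h z‖ ^ 2) ^ (qq n / 2) + ε ^ (qq n / 2) :=
          Real.rpow_add_le_add_rpow pv hε.le pv (by linarith)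
      _ = _ := by
          rw [← Real.rpow_natCast, ← Real.rpow_mul (norm_nonneg _), hεq]; congr 2; push_cast; ring
  have hFc : ContinuousOn (Fp h) {z | 0 < z.snd} := (Fp_smooth hh).continuousOn
  set P : Vn n → Vn n := fun z => pt z.fst (s + |z.snd|) with hP
  have hPc : Continuous P := cont_pt.comp (cont_fst.prodMk (continuous_const.add cont_snd.abs))
  have hPs : ∀ z, 0 < (P z).snd := fun z => by simp only [hP, pt_snd]; positivity
  set G : Vn n → ℝ := fun z => N (P z) with hG
  have hGc : Continuous G := by
    have : Continuous fun z => Fp h (P z) := hFc.comp_continuous hPc hPs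
    simp only [hG, hN]
    exact ((this.norm.pow 2).add continuous_const).rpow_const fun z => Or.inl (by have := sq_nonneg ‖Fp h (P z)‖; show ‖Fp h (P z)‖ ^ 2 + ε ≠ 0; positivity)
  have hPt : Tendsto P (cocompact (Vn n)) (cocompact (Vn n) ⊓ 𝓟 {z | s ≤ z.snd}) := by
    refine tendsto_inf.2 ⟨?_, tendsto_principal.2 (Eventually.of_forall fun z => ?_)⟩
    · rw [← Metric.cobounded_eq_cocompact, ← tendsto_norm_atTop_iff_cobounded]
      refine tendsto_atTop_mono (fun z => ?_) tendsto_norm_cobounded_atTop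
      refine le_of_sq_le_sq ?_ (norm_nonneg _)
      rw [← pt_eta z, norm_pt, hP, norm_pt]
      simp only [pt_fst, pt_snd]
      rw [← sq_abs z.snd]
      nlinarith [abs_nonneg z.snd]
    · simp [hP, pt_snd]
  have hGt : Tendsto G (cocompact (Vn n)) (𝓝 (η / 2)) := by
    have h1 := (((F_decay (by omega) hh hs).comp hPt).norm.pow 2).add_const ε
    have h2 := h1.rpow_const (p := qq n / 2) (Or.inl (by simp; positivity))
    simpa [hεq] using h2
  have hGu := hGc.uniformContinuous_of_tendsto_cocompact hGt
  obtain ⟨δ, hδ, hGδ⟩ := Metric.uniformContinuous_iff.1 hGu η hη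
  have hi0 : Continuous fun y : En n => pt y 0 := cont_pt.comp (continuous_id.prodMk continuous_const)
  set g : En n → ℝ := fun y => max (G (pt y 0) - η) 0 with hg
  have hgc : Continuous g := ((hGc.comp hi0).sub continuous_const).max continuous_const
  have hgs : HasCompactSupport g := by
    have hev : ∀ᶠ z in cocompact (Vn n), G z < η := hGt.eventually (gt_mem_nhds (by linarith))
    have hemb : Tendsto (fun y : En n => pt y 0) (cocompact (En n)) (cocompact (Vn n)) := by
      rw [← Metric.cobounded_eq_cocompact, ← Metric.cobounded_eq_cocompact,
        ← tendsto_norm_atTop_iff_cobounded]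
      exact tendsto_atTop_mono (fun y => fst_le_norm (pt y 0)) tendsto_norm_cobounded_atTop
    refine hasCompactSupport_iff_eventuallyEq.2 ?_
    rw [coclosedCompact_eq_cocompact]
    filter_upwards [hemb.eventually hev] with y hy
    simp only [hg, Pi.zero_apply, max_eq_right_iff]; linarith
  have hgi : Integrable g := hgc.integrable_of_hasCompactSupport hgs
  have hP0 : ∀ y : En n, P (pt y 0) = pt y s := fun y => by simp [hP, pt_fst, pt_snd]
  have hPp : ∀ z : Vn n, 0 ≤ z.snd → P z = z + pt 0 s := fun z hz => by
    conv_rhs => rw [← pt_eta z, pt_add]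
    simp [hP, abs_of_nonneg hz, add_comm]
  refine ⟨g, hgi, fun y => le_max_right _ _, fun y => ?_, ?_⟩
  · refine max_le ?_ pv
    have := hNle (pt y s)
    simp only [hG, hP0]; linarith
  set t1 := min (δ / 2) t
  have ht1 : 0 < t1 := lt_min (by linarith) ht
  set D : Vn n → ℝ := fun z => N (z + pt 0 s) + (-(3 * η) + (-A⁻¹) * (Fp g z).snd) with hD
  have hzp : ∀ z : Vn n, t1 ≤ z.snd → 0 < (z + pt 0 s).snd := fun z hz => by
    rw [add_snd, pt_snd]; linarith
  have hc1 : ∀ z : Vn n, t1 ≤ z.snd → ContDiffAt ℝ 2 (fun z => N (z + pt 0 s)) z := fun z hz =>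
    ((subP hh (hzp z hz) hε pv (by linarith)).1).comp z (contDiffAt_id.add contDiffAt_const)
  have hc2 : ∀ z : Vn n, t1 ≤ z.snd → ContDiffAt ℝ 2 (fun z => -A⁻¹ * (Fp g z).snd) z := fun z hz =>
    contDiffAt_const.mul (lap_u hgi (ht1.trans_le hz)).1
  have lapc : ∀ (c : ℝ) (z : Vn n), lap (fun _ => c) z = 0 := fun c z => by simp [lap]
  have main := maxprin (D := D) (t1 := t1) (fun z hz => (hc1 z hz).add (contDiffAt_const.add (hc2 z hz))) ?_ ?_ ?_
    (pt x t) (min_le_right _ _)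
  · have e1 := hNge (pt x (s + t))
    simp only [hD, pt_add, add_zero, zero_add] at main
    rw [add_comm t s] at main
    linarith
  · intro z hz
    have hz0 : 0 < z.snd := ht1.trans_le hz
    simp only [hD]
    rw [lap_add (hc1 z hz) (contDiffAt_const.add (hc2 z hz)), lap_add contDiffAt_const (hc2 z hz),
      lapc, lap_mul contDiffAt_const (lap_u hgi hz0).1, lapc, (lap_u hgi hz0).2, lap_shift]
    have := (subP hh (hzp z hz) hε (a := qq n / 2) pv (by linarith)).2.1
    have e : (1 : ℝ) - 2 * (1 - qq n / 2) * (n / (n + 1)) = 0 := by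
      rw [qq]; field_simp; ring
    rw [e, mul_zero] at this
    simpa using this
  · intro z hz
    have e1 := u_lower hgi (fun y => le_max_right _ _) ht1 z.fst (m := G (pt z.fst 0) - 2 * η) (fun y hy => by
      refine le_trans ?_ (le_max_left _ _)
      have : dist (pt y 0) (pt z.fst 0) < δ := by
        rw [dist_eq_norm, pt_sub]
        refine (norm_pt_le _ _).trans_lt ?_
        rw [← dist_eq_norm]
        have := min_le_left (δ / 2) t
        simp; linarith
      have := abs_lt.1 (hGδ this)
      linarith)
    have e2 : dist z (pt z.fst 0) < δ := by
      have : z = pt z.fst t1 := by rw [← hz, pt_eta]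
      rw [dist_eq_norm]
      nth_rw 1 [this]
      rw [pt_sub]
      refine (norm_pt_le _ _).trans_lt ?_
      have := min_le_left (δ / 2) t
      simp [abs_of_pos ht1]; linarith
    have e3 := abs_lt.1 (hGδ e2)
    have e4 : G z = N (z + pt 0 s) := by simp only [hG]; rw [hPp z (hz ▸ ht1.le)]
    have e5 : pt z.fst t1 = z := by rw [← hz, pt_eta]
    rw [e5] at e1
    have e6 : G (pt z.fst 0) - 2 * η ≤ A⁻¹ * (Fp g z).snd := by
      rw [inv_mul_eq_div, le_div_iff₀ hA]; exact e1
    simp only [hD]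
    linarith
  · intro e he
    filter_upwards [hGt.eventually (gt_mem_nhds (show η / 2 < η by linarith))] with z hz hz1
    have e4 : G z = N (z + pt 0 s) := by simp only [hG]; rw [hPp z (ht1.le.trans hz1)]
    have e1 := u_lower hgi (fun y => le_max_right _ _) (ht1.trans_le hz1) z.fst (m := 0) (fun y hy => le_max_right _ _)
    rw [pt_eta, zero_mul] at e1
    have : 0 ≤ A⁻¹ * (Fp g z).snd := by positivity
    simp only [hD]
    linarith
theorem H5 (hn : 2 ≤ n) : ∃ A : ENNReal, A ≠ ⊤ ∧ ∀ h : En n → ℝ, Integrable h → ∀ s > 0, ∀ t > 0, ∀ x : En n,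
    ‖Fp h (pt x (s + t))‖ₑ ^ qq n ≤
      A * ∫⁻ w, ofReal (pk n t (x - w)) * ‖Fp h (pt w s)‖ₑ ^ qq n := by
  have hq := qq_pos hn
  set A := ((om n).toReal / 2 ^ (n + 1))⁻¹
  have hA : 0 ≤ A := by positivity
  refine ⟨ofReal (A * 2 ^ (n + 1)), ofReal_ne_top, fun h hh s hs t ht x => ?_⟩
  refine ENNReal.le_of_forall_pos_le_add fun η hη _ => ?_
  obtain ⟨g, hg, hg0, hgF, hgx⟩ := H5a hn hh hs ht x (η := η / 3) pv
  have e0 : ∀ z, ‖Fp h z‖ₑ ^ qq n = ofReal (‖Fp h z‖ ^ qq n) := fun z => by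
    rw [← ofReal_norm_eq_enorm, ofReal_rpow_of_nonneg (norm_nonneg _) hq.le]
  have hz : 0 < (pt x t).snd := ht
  rw [e0]
  refine (ofReal_le_ofReal hgx).trans ?_
  rw [ofReal_add pv (mul_nonneg hA (by
    rw [Fp_snd hg hz]; exact integral_nonneg fun w => mul_nonneg (hg0 w) pv)), add_comm]
  refine add_le_add ?_ (by rw [mul_div_cancel₀ _ (by norm_num)]; simp)
  rw [ofReal_mul hA, ofReal_mul hA, mul_assoc]
  refine mul_le_mul_right ?_ _
  rw [Fp_snd hg hz]
  refine ((Real.ofReal_le_enorm _).trans (enorm_integral_le_lintegral_enorm _)).trans ?_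
  rw [← lintegral_const_mul' _ _ ofReal_ne_top]
  refine lintegral_mono fun w => ?_
  rw [enorm_eq_ofReal (mul_nonneg (hg0 w) pv), ← mul_assoc,
    ← ofReal_mul pv, e0, ← ofReal_mul (by rw [pk]; positivity), mul_comm]
  refine ofReal_le_ofReal ?_
  rw [pt_sub, sub_zero, pt_snd]
  exact mul_le_mul (le_pk ht _) (hgF w) (hg0 w) (by rw [pk]; positivity)
end
section
open MeasureTheory Set Filter Metric
open scoped ENNReal NNReal Topology InnerProductSpace
variable {n : ℕ} {t r : ℝ} {z : Vn n} {h : En n → ℝ}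
theorem div0 {Y : Vn n → Vn n} (hY : ContDiff ℝ 1 Y) (hi : Integrable Y)
    (hd : Integrable fun z => ∑ i, ⟪fderiv ℝ Y z (bs n i), bs n i⟫_ℝ) :
    ∫ z, ∑ i, ⟪fderiv ℝ Y z (bs n i), bs n i⟫_ℝ = 0 := by
  let χ : ContDiffBump (0 : Vn n) := ⟨1, 2, by norm_num, by norm_num⟩
  set R : ℕ → ℝ := fun k => ((k : ℝ) + 1)⁻¹ with hR
  have hR0 : ∀ k, 0 < R k := fun k => by positivity
  set c : ℕ → Vn n → ℝ := fun k z => χ (R k • z) with hc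
  have hcc : ∀ k, ContDiff ℝ 1 (c k) := fun k => χ.contDiff.comp (contDiff_const_smul _)
  have hcs : ∀ k, HasCompactSupport (c k) := fun k =>
    χ.hasCompactSupport.comp_homeomorph (Homeomorph.smulOfNeZero (R k) (hR0 k).ne')
  obtain ⟨C, hC⟩ : ∃ C, ∀ z, ‖fderiv ℝ χ z‖ ≤ C :=
    (χ.hasCompactSupport.fderiv ℝ).exists_bound_of_continuous ((χ.contDiff (n := 1)).continuous_fderiv sm)
  have hC0 : 0 ≤ C := (norm_nonneg _).trans (hC 0)
  have hcd : ∀ k z, ‖fderiv ℝ (c k) z‖ ≤ R k * C := fun k z => by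
    have : fderiv ℝ (c k) z = R k • fderiv ℝ χ (R k • z) := fderiv_comp_smul (R k)
    rw [this, norm_smul, norm_of_nonneg (hR0 k).le]
    gcongr; exact hC _
  have hRt : Tendsto R atTop (𝓝 0) := tendsto_inv_atTop_zero.comp
    (tendsto_atTop_add_const_right _ _ tendsto_natCast_atTop_atTop)
  have hYd : Differentiable ℝ Y := hY.differentiable sm
  have hYi : ∀ i, ContDiff ℝ 1 fun z => ⟪Y z, bs n i⟫_ℝ := fun i => hY.inner ℝ contDiff_const
  have hYf : ∀ i z, fderiv ℝ (fun z => ⟪Y z, bs n i⟫_ℝ) z (bs n i) = ⟪fderiv ℝ Y z (bs n i), bs n i⟫_ℝ :=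
    fun i z => by
      rw [fderiv_inner_apply ℝ (hYd z) (differentiableAt_const _)]; simp
  have hYfc : ∀ i, Continuous fun z => ⟪fderiv ℝ Y z (bs n i), bs n i⟫_ℝ := fun i =>
    ((hY.continuous_fderiv sm).clm_apply continuous_const).inner continuous_const
  have hcf : ∀ k i, Continuous fun z => fderiv ℝ (c k) z (bs n i) := fun k i =>
    ((hcc k).continuous_fderiv sm).clm_apply continuous_const
  have hcfs : ∀ k i, HasCompactSupport fun z => fderiv ℝ (c k) z (bs n i) := fun k i =>
    ((hcs k).fderiv ℝ).comp_left (g := fun L : Vn n →L[ℝ] ℝ => L (bs n i)) rfl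
  have key : ∀ k, ∫ z, c k z * ∑ i, ⟪fderiv ℝ Y z (bs n i), bs n i⟫_ℝ =
      - ∫ z, ∑ i, fderiv ℝ (c k) z (bs n i) * ⟪Y z, bs n i⟫_ℝ := by
    intro k
    have i1 : ∀ i, Integrable fun z => fderiv ℝ (c k) z (bs n i) * ⟪Y z, bs n i⟫_ℝ := fun i =>
      ((hcf k i).mul (hYi i).continuous).integrable_of_hasCompactSupport (hcfs k i).mul_right
    have i2 : ∀ i, Integrable fun z => c k z * ⟪fderiv ℝ Y z (bs n i), bs n i⟫_ℝ := fun i =>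
      ((hcc k).continuous.mul (hYfc i)).integrable_of_hasCompactSupport (hcs k).mul_right
    simp only [mul_sum]
    rw [integral_finsetSum _ fun i _ => i2 i, integral_finsetSum _ fun i _ => i1 i,
      ← Finset.sum_neg_distrib]
    refine sum_congr rfl fun i _ => ?_
    have := integral_mul_fderiv_eq_neg_fderiv_mul_of_integrable (μ := (volume : Measure (Vn n)))
      (f := c k) (g := fun z => ⟪Y z, bs n i⟫_ℝ) (v := bs n i) (i1 i) (by simpa only [hYf] using i2 i)
      (((hcc k).continuous.mul (hYi i).continuous).integrable_of_hasCompactSupport (hcs k).mul_right)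
      (fun x _ => (hcc k).differentiable sm x) (fun x _ => (hYi i).differentiable sm x)
    simpa only [hYf] using this
  have l1 : Tendsto (fun k => ∫ z, c k z * ∑ i, ⟪fderiv ℝ Y z (bs n i), bs n i⟫_ℝ) atTop
      (𝓝 (∫ z, ∑ i, ⟪fderiv ℝ Y z (bs n i), bs n i⟫_ℝ)) := by
    refine tendsto_integral_of_dominated_convergence _ (fun k => ?_) hd.norm (fun k => ae_of_all _ fun z => ?_)
      (ae_of_all _ fun z => ?_)
    · exact ((hcc k).continuous.mul (continuous_finsetSum _ fun i _ => hYfc i)).aestronglyMeasurable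
    · rw [norm_mul, norm_of_nonneg χ.nonneg]
      exact mul_le_of_le_one_left (norm_nonneg _) χ.le_one
    · refine (tendsto_const_nhds).congr' ?_
      have : Tendsto (fun k => R k • z) atTop (𝓝 0) := by simpa using hRt.smul_const z
      filter_upwards [this.eventually (closedBall_mem_nhds (0 : Vn n) one_pos)] with k hk
      rw [hc]; simp only; rw [χ.one_of_mem_closedBall hk, one_mul]
  have l2 : Tendsto (fun k => - ∫ z, ∑ i, fderiv ℝ (c k) z (bs n i) * ⟪Y z, bs n i⟫_ℝ) atTop (𝓝 0) := by
    rw [← neg_zero]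
    refine Tendsto.neg (squeeze_zero_norm (a := fun k => ∫ z, R k * (C * (n + 1)) * ‖Y z‖) (fun k => ?_) ?_)
    · refine norm_integral_le_of_norm_le (hi.norm.const_mul _) (ae_of_all _ fun z => ?_)
      refine (norm_sum_le _ _).trans ((sum_le_sum (g := fun _ => R k * C * ‖Y z‖) fun i _ => ?_).trans ?_)
      · rw [norm_mul]
        refine mul_le_mul ?_ ?_ (norm_nonneg _) (by have := hR0 k; positivity)
        · refine ((fderiv ℝ (c k) z).le_opNorm _).trans ?_
          rw [(bs n).norm_eq_one, mul_one]; exact hcd k z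
        · refine (norm_inner_le_norm _ _).trans ?_
          rw [(bs n).norm_eq_one, mul_one]
      · simp; ring_nf; rfl
    · simp only [integral_const_mul]
      simpa using (hRt.mul_const (C * (n + 1))).mul_const (∫ z, ‖Y z‖)
  exact tendsto_nhds_unique l1 (by simpa only [key] using l2)
theorem pk_tot (ht : 0 < t) : ∫⁻ w : En n, ofReal (pk n t w) ≤ 2 ^ (2 * n + 2) * om n := by
  have := pk_Mx (n := n) (f := fun _ => 1) measurable_const ht (x := 0) (y := 0) (by simpa using ht.le)
  have hM : Mx (fun _ : En n => (1 : ENNReal)) 0 ≤ om n := by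
    refine iSup₂_le fun r hr => ?_
    have h0 : ofReal (r ^ n) ≠ 0 := by simp; positivity
    rw [setLIntegral_one, vol_ball _ hr, ← mul_assoc, ENNReal.inv_mul_cancel h0 ofReal_ne_top, one_mul]
  refine le_trans ?_ (this.trans (mul_le_mul_right hM _))
  rw [← lintegral_neg_eq_self]
  simp
theorem L2K {Y : Type} [NormedAddCommGroup Y] [NormedSpace ℝ Y] {m : ℕ} {κ : Vn n → Y} (hk : HK m κ)
    (hn : n ≠ 0) (hm : n ≤ m) : ∃ C : ℝ, 0 < C ∧ ∀ h : En n → ℝ, Integrable h → ∀ t : ℝ, 0 < t →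
      ∫⁻ x, ‖Po κ h (pt x t)‖ₑ ^ 2 ≤ ofReal (C * (t ^ (2 * m - n))⁻¹) * (∫⁻ w, ‖h w‖ₑ) ^ 2 := by
  obtain ⟨C, hC, hb⟩ := hk.bound
  have hom := toReal_pos (om_pos n) (om_top n)
  refine ⟨C ^ 2 * 2 ^ (n + 1) * (2 ^ (2 * n + 2) * (om n).toReal), by positivity, fun h hh t ht => ?_⟩
  have hme : AEMeasurable (fun w => ‖h w‖ₑ) := hh.1.enorm
  set D := C ^ 2 * 2 ^ (n + 1) * (t ^ (2 * m - n))⁻¹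
  have e1 : ∀ x, ‖Po κ h (pt x t)‖ₑ ^ 2 ≤
      (∫⁻ w, ‖h w‖ₑ) * ∫⁻ w, ‖h w‖ₑ * (ofReal D * ofReal (pk n t (x - w))) := by
    intro x
    have hz : 0 < (pt x t).snd := ht
    have hmk : AEMeasurable fun w => ‖κ (pt x t - pt w 0)‖ₑ := (hk.contw hz).enorm.measurable.aemeasurable
    have a1 : ‖Po κ h (pt x t)‖ₑ ≤ ∫⁻ w, ‖h w‖ₑ * ‖κ (pt x t - pt w 0)‖ₑ := by
      refine (enorm_integral_le_lintegral_enorm _).trans (le_of_eq ?_)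
      simp only [enorm_smul]
    have a2 := ENNReal.lintegral_mul_le_Lp_mul_Lq volume Real.HolderConjugate.two_two
      (f := fun w => ‖h w‖ₑ ^ (1 / 2 : ℝ)) (g := fun w => ‖h w‖ₑ ^ (1 / 2 : ℝ) * ‖κ (pt x t - pt w 0)‖ₑ)
      (hme.pow_const _) ((hme.pow_const _).mul hmk)
    have a3 : ∀ a : ENNReal, a ^ (1 / 2 : ℝ) * a ^ (1 / 2 : ℝ) = a := fun a => by
      rw [← ENNReal.rpow_add_of_nonneg _ _ (by norm_num) (by norm_num)]; norm_num
    have a4 : ∀ a : ENNReal, (a ^ (1 / 2 : ℝ)) ^ (2 : ℝ) = a := fun a => by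
      rw [← rpow_mul]; norm_num
    have a5 : ∀ a b : ENNReal, (a ^ (1 / 2 : ℝ) * b) ^ (2 : ℝ) = a * b ^ 2 := fun a b => by
      rw [mul_rpow_of_nonneg _ _ (by norm_num), a4]; norm_cast
    simp only [Pi.mul_apply, ← mul_assoc, a3, a4, a5] at a2
    have a6 : ∀ a b : ENNReal, (a ^ (1 / 2 : ℝ) * b ^ (1 / 2 : ℝ)) ^ 2 = a * b := fun a b => by
      rw [sq, mul_mul_mul_comm, a3, a3]
    calc _ ≤ _ := pow_le_pow_left₀ pv (a1.trans a2) 2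
      _ = _ := a6 _ _
      _ ≤ _ := by
        refine mul_le_mul_right (lintegral_mono fun w => mul_le_mul_right ?_ _) _
        rw [← ofReal_mul pv, ← ofReal_norm_eq_enorm, ← ofReal_pow (norm_nonneg _)]
        refine ofReal_le_ofReal ?_
        have b1 := hb _ (sub_ne hz w)
        have b2 := snd_le_sub (pt x t) w
        rw [pt_snd] at b2
        have b3 : t / ‖pt x t - pt w 0‖ ^ (n + 1) ≤ 2 ^ (n + 1) * pk n t (x - w) := by rw [pt_sub, sub_zero]; exact le_pk ht _
        set ρ := ‖pt x t - pt w 0‖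
        have hρ : 0 < ρ := by linarith
        have b4 : (ρ ^ m)⁻¹ ^ 2 ≤ (t ^ (2 * m - n))⁻¹ * (t / ρ ^ (n + 1)) := by
          rw [inv_pow, ← pow_mul, show m * 2 = (2 * m - n - 1) + (n + 1) by omega,
            show 2 * m - n = (2 * m - n - 1) + 1 by omega, pow_succ t, Nat.add_sub_cancel, pow_add]
          have : (t ^ (2 * m - n - 1) * t)⁻¹ * (t / ρ ^ (n + 1)) = (t ^ (2 * m - n - 1) * ρ ^ (n + 1))⁻¹ := by
            field_simp
          rw [this]
          gcongr
        calc _ ≤ (C * (ρ ^ m)⁻¹) ^ 2 := by gcongr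
          _ = C ^ 2 * (ρ ^ m)⁻¹ ^ 2 := by ring
          _ ≤ C ^ 2 * ((t ^ (2 * m - n))⁻¹ * (2 ^ (n + 1) * pk n t (x - w))) := by
            refine mul_le_mul_of_nonneg_left (b4.trans ?_) pv
            exact mul_le_mul_of_nonneg_left b3 pv
          _ = _ := by ring
  refine (lintegral_mono e1).trans ?_
  rw [lintegral_const_mul' _ _ hh.2.ne, lintegral_lintegral_swap]
  · have e2 : ∀ w, ∫⁻ x, ‖h w‖ₑ * (ofReal D * ofReal (pk n t (x - w))) ≤
        ‖h w‖ₑ * (ofReal D * (2 ^ (2 * n + 2) * om n)) := fun w => by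
      rw [lintegral_const_mul' _ _ enorm_ne_top, lintegral_const_mul' _ _ ofReal_ne_top]
      refine mul_le_mul_right (mul_le_mul_right ?_ _) _
      rw [lintegral_sub_right_eq_self (fun x => ofReal (pk n t x))]
      exact pk_tot ht
    refine (mul_le_mul_right (lintegral_mono e2) _).trans ?_
    rw [lintegral_mul_const'' _ hme, ← mul_assoc, ← sq, mul_comm]
    refine mul_le_mul_left (le_of_eq ?_) _
    have hD0 : 0 ≤ D := by positivity
    rw [show C ^ 2 * 2 ^ (n + 1) * (2 ^ (2 * n + 2) * (om n).toReal) * (t ^ (2 * m - n))⁻¹ =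
      D * (2 ^ (2 * n + 2) * (om n).toReal) by simp only [D]; ring]
    clear_value D
    rw [ofReal_mul (p := D) hD0,
      ofReal_mul (p := 2 ^ (2 * n + 2)) pv, ofReal_toReal (om_top n)]
    norm_num [ofReal_pow]
  · refine AEMeasurable.mul (hme.comp_snd) (AEMeasurable.const_mul ?_ _)
    refine (Measurable.ennreal_ofReal ?_).aemeasurable
    unfold pk
    fun_prop
def strip (n : ℕ) (a b : ℝ) : Set (Vn n) := {z | a ≤ z.snd ∧ z.snd ≤ b}
theorem strip_meas (a b : ℝ) : MeasurableSet (strip n a b) :=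
  (measurableSet_le measurable_const cont_snd.measurable).inter (measurableSet_le cont_snd.measurable measurable_const)
theorem lint_V (f : Vn n → ENNReal) (hf : AEMeasurable f) : ∫⁻ z, f z = ∫⁻ t, ∫⁻ x, f (pt x t) := by
  rw [← (vol_pt n).map_eq, lintegral_map' (by rwa [(vol_pt n).map_eq]) cont_pt.measurable.aemeasurable,
    Measure.volume_eq_prod, lintegral_prod_symm]
  exact hf.comp_quasiMeasurePreserving (vol_pt n).quasiMeasurePreserving
theorem strip_lint {f : Vn n → ENNReal} (a b : ℝ) (hf : AEMeasurable f (volume.restrict (strip n a b))) :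
    ∫⁻ z in strip n a b, f z = ∫⁻ t in Icc a b, ∫⁻ x, f (pt x t) := by
  rw [← lintegral_indicator (strip_meas a b), lint_V _ ((aemeasurable_indicator_iff (strip_meas a b)).2 hf),
    ← lintegral_indicator measurableSet_Icc]
  congr 1; ext t
  by_cases ht : t ∈ Icc a b
  · rw [indicator_of_mem ht]
    congr 1; ext x
    exact indicator_of_mem (s := strip n a b) (a := pt x t) ht f
  · rw [indicator_of_notMem ht]
    have : ∀ x, (strip n a b).indicator f (pt x t) = 0 := fun x =>
      indicator_of_notMem (s := strip n a b) (a := pt x t) ht f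
    simp [this]
theorem hs_aesm {Y : Type} [NormedAddCommGroup Y] [NormedSpace ℝ Y] {f : Vn n → Y} {a b : ℝ} (ha : 0 < a)
    (hf : ∀ z : Vn n, 0 < z.snd → ContinuousAt f z) : AEStronglyMeasurable f (volume.restrict (strip n a b)) := by
  have : ContinuousOn f (strip n a b) := fun z hz => (hf z (ha.trans_le hz.1)).continuousWithinAt
  exact this.aestronglyMeasurable (strip_meas a b)
theorem strip_Po {Y : Type} [NormedAddCommGroup Y] [NormedSpace ℝ Y] {m : ℕ} {κ : Vn n → Y} (hk : HK m κ)
    (hn : n ≠ 0) (hm : n ≤ m) (hh : Integrable h) {a b : ℝ} (ha : 0 < a) :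
    IntegrableOn (fun z => ‖Po κ h z‖ ^ 2) (strip n a b) := by
  obtain ⟨C, hC, hb⟩ := L2K hk hn hm
  have hc : ∀ z : Vn n, 0 < z.snd → ContinuousAt (fun z => ‖Po κ h z‖ ^ 2) z := fun z hz =>
    (Po_hasFDerivAt hk hh hz).continuousAt.norm.pow 2
  have hm := hs_aesm (b := b) ha hc
  refine ⟨hm, ?_⟩
  rw [hasFiniteIntegral_iff_enorm, strip_lint a b hm.enorm]
  have : ∀ t ∈ Icc a b, ∫⁻ x, ‖‖Po κ h (pt x t)‖ ^ 2‖ₑ ≤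
      ofReal (C * (a ^ (2 * m - n))⁻¹) * (∫⁻ w, ‖h w‖ₑ) ^ 2 := fun t ht => by
    simp only [enorm_pow, enorm_norm]
    have := ht.1
    refine (hb h hh t (ha.trans_le ht.1)).trans (mul_le_mul_left (ofReal_le_ofReal ?_) _)
    gcongr
  refine (setLIntegral_mono' measurableSet_Icc this).trans_lt ?_
  rw [setLIntegral_const]
  exact ENNReal.mul_lt_top (ENNReal.mul_lt_top ofReal_lt_top (ENNReal.pow_lt_top hh.2))
    measure_Icc_lt_top
noncomputable def lq (h : En n → ℝ) (z : Vn n) : ℝ := ‖Fp h z‖ ^ 2 + ‖fderiv ℝ (Fp h) z‖ ^ 2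
theorem strip_int (hn : n ≠ 0) (hh : Integrable h) {a b : ℝ} (ha : 0 < a) :
    IntegrableOn (lq h) (strip n a b) := by
  refine (strip_Po (kk_HK n) hn le_rfl hh ha).add ?_
  refine (strip_Po (kk_HK n).fderiv hn (Nat.le_succ n) hh ha).congr_fun (fun z hz => ?_) (strip_meas a b)
  have hz : 0 < z.snd := ha.trans_le hz.1
  simp only [Fp_fderiv hh hz]
theorem divg {X : Vn n → Vn n} (hX : ∀ z : Vn n, 0 < z.snd → ContDiffAt ℝ 1 X z) {g : ℝ → ℝ}
    (hg : ContDiff ℝ 1 g) {a b : ℝ} (ha : 0 < a) (hs : ∀ t, t ∉ Icc a b → g t = 0)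
    (hi : IntegrableOn X (strip n a b))
    (hd : IntegrableOn (fun z => ∑ i, ⟪fderiv ℝ X z (bs n i), bs n i⟫_ℝ) (strip n a b)) :
    ∫ z in strip n a b, (deriv g z.snd * (X z).snd + g z.snd * ∑ i, ⟪fderiv ℝ X z (bs n i), bs n i⟫_ℝ) = 0 := by
  set Y : Vn n → Vn n := fun z => g z.snd • X z with hYd
  have hgd : Differentiable ℝ g := hg.differentiable sm
  have hz0 : ∀ z : Vn n, z ∉ strip n a b → g z.snd = 0 := fun z hz => hs _ hz
  have hgc : HasCompactSupport g := HasCompactSupport.intro isCompact_Icc hs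
  have hdz : ∀ t, t ∉ Icc a b → deriv g t = 0 := fun t ht => by
    have : g =ᶠ[𝓝 t] fun _ => 0 := by
      filter_upwards [isClosed_Icc.isOpen_compl.mem_nhds ht] with s hs' using hs s hs'
    rw [this.deriv_eq]; simp
  obtain ⟨M, hM⟩ := hgc.exists_bound_of_continuous hg.continuous
  obtain ⟨M', hM'⟩ := hgc.deriv.exists_bound_of_continuous (hg.continuous_deriv sm)
  have hloc : ∀ z : Vn n, z.snd < a → Y =ᶠ[𝓝 z] fun _ => 0 := fun z hz => by
    filter_upwards [(isOpen_lt cont_snd continuous_const).mem_nhds hz] with y hy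
    rw [hYd]; simp only
    rw [hs _ fun h => absurd h.1 (not_le.2 hy), zero_smul]
  have hsn : ∀ z : Vn n, ContDiffAt ℝ 1 (fun y : Vn n => g y.snd) z := fun z =>
    hg.contDiffAt.comp z (cda_snd.of_le (by norm_num))
  have hY : ContDiff ℝ 1 Y := by
    rw [contDiff_iff_contDiffAt]
    intro z
    by_cases hz : 0 < z.snd
    · exact (hsn z).smul (hX z hz)
    · exact contDiffAt_const.congr_of_eventuallyEq (hloc z (by linarith))
  have hfd : ∀ z : Vn n, ∑ i, ⟪fderiv ℝ Y z (bs n i), bs n i⟫_ℝ = (strip n a b).indicator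
      (fun z => deriv g z.snd * (X z).snd + g z.snd * ∑ i, ⟪fderiv ℝ X z (bs n i), bs n i⟫_ℝ) z := by
    intro z
    by_cases hz : 0 < z.snd
    · have e1 : fderiv ℝ Y z = g z.snd • fderiv ℝ X z + (fderiv ℝ (fun y : Vn n => g y.snd) z).smulRight (X z) :=
        fderiv_fun_smul ((hsn z).differentiableAt sm) ((hX z hz).differentiableAt sm)
      have e2 : ∀ v, fderiv ℝ (fun y : Vn n => g y.snd) z v = deriv g z.snd * v.snd := fun v => by
        have := ((hgd z.snd).hasDerivAt.comp_hasFDerivAt z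
          ((cda_snd (z := z)).differentiableAt sm).hasFDerivAt).fderiv
        refine (congrArg (fun L => L v) this).trans ?_
        simp [fder_snd]
      have e3 : ∑ i, (bs n i).snd * ⟪X z, bs n i⟫_ℝ = (X z).snd := by
        rw [← inner_e, ← (bs n).sum_inner_mul_inner]
        refine sum_congr rfl fun i _ => ?_
        rw [inner_e, real_inner_comm]
      have e4 : ∑ i, ⟪fderiv ℝ Y z (bs n i), bs n i⟫_ℝ =
          deriv g z.snd * (X z).snd + g z.snd * ∑ i, ⟪fderiv ℝ X z (bs n i), bs n i⟫_ℝ := by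
        rw [← e3, mul_sum, mul_sum, ← sum_add_distrib]
        refine sum_congr rfl fun i _ => ?_
        rw [e1]; simp [e2, inner_add_left, inner_smul_left]; ring
      rw [e4]
      by_cases h : z ∈ strip n a b
      · rw [indicator_of_mem h]
      · rw [indicator_of_notMem h, hz0 z h, hdz _ h]; simp
    · have h : z ∉ strip n a b := fun h => by have := h.1; linarith
      rw [indicator_of_notMem h, (hloc z (by linarith)).fderiv_eq]; simp
  have hmg : Measurable fun z : Vn n => g z.snd := (hg.continuous.comp cont_snd).measurable
  have hmg' : Measurable fun z : Vn n => deriv g z.snd :=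
    ((hg.continuous_deriv sm).comp cont_snd).measurable
  have hYi : Integrable Y := by
    have : Y = (strip n a b).indicator Y := by
      ext1 z
      by_cases h : z ∈ strip n a b
      · rw [indicator_of_mem h]
      · rw [indicator_of_notMem h, hYd]; simp [hz0 z h]
    rw [this, integrable_indicator_iff (strip_meas a b)]
    exact hi.bdd_smul M hmg.aestronglyMeasurable (ae_of_all _ fun z => hM _)
  have hint : IntegrableOn (fun z => deriv g z.snd * (X z).snd + g z.snd *
      ∑ i, ⟪fderiv ℝ X z (bs n i), bs n i⟫_ℝ) (strip n a b) := by
    refine Integrable.add ?_ (hd.bdd_mul (c := M) hmg.aestronglyMeasurable (ae_of_all _ fun z => hM _))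
    refine Integrable.bdd_mul (c := M') ?_ hmg'.aestronglyMeasurable (ae_of_all _ fun z => hM' _)
    exact hi.norm.mono (cont_snd.comp_aestronglyMeasurable hi.1) (ae_of_all _ fun z => by
      rw [norm_norm]; exact snd_le_norm _)
  have := div0 hY hYi (by
    simp only [hfd]; rwa [integrable_indicator_iff (strip_meas a b)])
  simp only [hfd] at this
  rwa [integral_indicator (strip_meas a b)] at this
theorem green {W : Vn n → ℝ} (hW : ∀ z : Vn n, 0 < z.snd → ContDiffAt ℝ 2 W z) {g : ℝ → ℝ}
    (hg : ContDiff ℝ 2 g) {a b : ℝ} (ha : 0 < a) (hs : ∀ t, t ∉ Icc a b → g t = 0)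
    (h0 : IntegrableOn W (strip n a b)) (h1 : IntegrableOn (fderiv ℝ W) (strip n a b))
    (h2 : IntegrableOn (lap W) (strip n a b)) :
    ∫ z in strip n a b, g z.snd * lap W z = ∫ z in strip n a b, W z * deriv (deriv g) z.snd := by
  have hgd : ContDiff ℝ 1 (deriv g) := (contDiff_succ_iff_deriv (n := 1).1 hg).2.2
  have hdz : ∀ t, t ∉ Icc a b → deriv g t = 0 := fun t ht => by
    have : g =ᶠ[𝓝 t] fun _ => 0 := by
      filter_upwards [isClosed_Icc.isOpen_compl.mem_nhds ht] with s hs' using hs s hs'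
    rw [this.deriv_eq]; simp
  set X : Vn n → Vn n := fun z => ∑ i, fderiv ℝ W z (bs n i) • bs n i with hX
  have hXc : ∀ z : Vn n, 0 < z.snd → ContDiffAt ℝ 1 X z := fun z hz =>
    ContDiffAt.sum fun i _ => ((((hW z hz).fderiv_right (m := 1) (by norm_num)).clm_apply contDiffAt_const).smul contDiffAt_const)
  have hXs : ∀ z, (X z).snd = fderiv ℝ W z (pt 0 1) := fun z => by
    rw [← inner_e, hX]
    simp only [inner_sum, inner_smul_right]
    conv_rhs => rw [← (bs n).sum_repr' (pt 0 1)]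
    simp [real_inner_comm, mul_comm]
  have hXd : ∀ z ∈ strip n a b, ∑ i, ⟪fderiv ℝ X z (bs n i), bs n i⟫_ℝ = lap W z := fun z hz => by
    have hz : 0 < z.snd := ha.trans_le hz.1
    have hF : HasFDerivAt X (∑ j, ((ContinuousLinearMap.apply ℝ ℝ (bs n j)).comp
        (fderiv ℝ (fderiv ℝ W) z)).smulRight (bs n j)) z :=
      HasFDerivAt.fun_sum fun j _ => (diff2 (hW z hz) (bs n j)).smul_const (bs n j)
    rw [lap, hF.fderiv]
    refine sum_congr rfl fun i _ => ?_
    simp [sum_inner, inner_smul_left, orthonormal_iff_ite.1 (bs n).orthonormal]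
  have E1 := divg hXc (hg.of_le (by norm_num)) ha hs (by
    refine Integrable.mono' (h1.norm.const_mul (n + 1)) (hs_aesm ha fun z hz => (hXc z hz).continuousAt)
      (ae_of_all _ fun z => ?_)
    refine (norm_sum_le _ _).trans ((sum_le_sum (g := fun _ => ‖fderiv ℝ W z‖) fun i _ => ?_).trans ?_)
    · rw [norm_smul, (bs n).norm_eq_one, mul_one]
      refine ((fderiv ℝ W z).le_opNorm _).trans ?_
      rw [(bs n).norm_eq_one, mul_one]
    · simp) (h2.congr_fun (fun z hz => (hXd z hz).symm) (strip_meas a b))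
  have hVc : ∀ z : Vn n, 0 < z.snd → ContDiffAt ℝ 1 (fun z => W z • (pt 0 1 : Vn n)) z := fun z hz =>
    ((hW z hz).of_le (by norm_num)).smul contDiffAt_const
  have hVd : ∀ z ∈ strip n a b, ∑ i, ⟪fderiv ℝ (fun z => W z • (pt 0 1 : Vn n)) z (bs n i), bs n i⟫_ℝ =
      fderiv ℝ W z (pt 0 1) := fun z hz => by
    have hz : 0 < z.snd := ha.trans_le hz.1
    rw [fderiv_smul_const ((hW z hz).differentiableAt sm)]
    conv_rhs => rw [← (bs n).sum_repr' (pt 0 1)]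
    simp [inner_smul_left, real_inner_comm, mul_comm]
  have h1e : IntegrableOn (fun z => fderiv ℝ W z (pt 0 1)) (strip n a b) := h1.apply_continuousLinearMap _
  have E2 := divg hVc hgd ha hdz (h0.smul_const _)
    (h1e.congr_fun (fun z hz => (hVd z hz).symm) (strip_meas a b))
  rw [setIntegral_congr_fun (strip_meas a b) (g := fun z => deriv g z.snd * fderiv ℝ W z (pt 0 1) + g z.snd * lap W z)
    fun z hz => by simp only [hXd z hz, hXs]] at E1
  rw [setIntegral_congr_fun (strip_meas a b) (g := fun z => W z * deriv (deriv g) z.snd + deriv g z.snd * fderiv ℝ W z (pt 0 1))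
    fun z hz => by simp only [hVd z hz, smul_snd, pt_snd]; ring] at E2
  obtain ⟨M, hM⟩ := (HasCompactSupport.intro isCompact_Icc hs).exists_bound_of_continuous hg.continuous
  obtain ⟨M', hM'⟩ := (HasCompactSupport.intro isCompact_Icc hdz).exists_bound_of_continuous hgd.continuous
  obtain ⟨M'', hM''⟩ := (HasCompactSupport.intro isCompact_Icc hdz).deriv.exists_bound_of_continuous
    (hgd.continuous_deriv sm)
  have i1 : IntegrableOn (fun z => deriv g z.snd * fderiv ℝ W z (pt 0 1)) (strip n a b) :=
    h1e.bdd_mul (c := M') (hgd.continuous.comp cont_snd).aestronglyMeasurable (ae_of_all _ fun z => hM' _)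
  have i2 : IntegrableOn (fun z => g z.snd * lap W z) (strip n a b) :=
    h2.bdd_mul (c := M) (hg.continuous.comp cont_snd).aestronglyMeasurable (ae_of_all _ fun z => hM _)
  have i3 : IntegrableOn (fun z => W z * deriv (deriv g) z.snd) (strip n a b) :=
    h0.mul_bdd (c := M'') ((hgd.continuous_deriv sm).comp cont_snd).aestronglyMeasurable (ae_of_all _ fun z => hM'' _)
  rw [integral_add i1 i2] at E1
  rw [integral_add i3 i1] at E2
  linarith
noncomputable def sg (s : ℝ) : ℝ := smoothTransition (s - 1)
theorem sg_cd : ContDiff ℝ 2 sg := smoothTransition.contDiff.comp (contDiff_id.sub contDiff_const)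
theorem sg_mono : Monotone sg := fun a b h => smoothTransition.monotone (by linarith)
theorem sg_zero {s : ℝ} (h : s ≤ 1) : sg s = 0 := smoothTransition.zero_of_nonpos (by linarith)
theorem sg_one {s : ℝ} (h : 2 ≤ s) : sg s = 1 := smoothTransition.one_of_one_le (by linarith)
theorem sg_nonneg (s : ℝ) : 0 ≤ sg s := smoothTransition.nonneg _
theorem sg_le (s : ℝ) : sg s ≤ 1 := smoothTransition.le_one _
noncomputable def sge (ε t : ℝ) : ℝ := sg (t / ε)
theorem sge_cd (ε : ℝ) : ContDiff ℝ 2 (sge ε) := sg_cd.comp (contDiff_id.div_const ε)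
theorem sge_d0 {ε : ℝ} (hε : 0 < ε) (t : ℝ) : 0 ≤ deriv (sge ε) t :=
  Monotone.deriv_nonneg fun a b h => sg_mono (by gcongr)
theorem sge_dz {ε t : ℝ} (hε : 0 < ε) (ht : t ∉ Icc ε (2 * ε)) : deriv (sge ε) t = 0 := by
  rw [mem_Icc, not_and_or, not_le, not_le] at ht
  rcases ht with ht | ht
  · have : sge ε =ᶠ[𝓝 t] fun _ => 0 := by
      filter_upwards [isOpen_Iio.mem_nhds (show t ∈ Iio ε from ht)] with s hs
      exact sg_zero (by rw [div_le_one hε]; exact (show s < ε from hs).le)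
    rw [this.deriv_eq]; simp
  · have : sge ε =ᶠ[𝓝 t] fun _ => 1 := by
      filter_upwards [isOpen_Ioi.mem_nhds (show t ∈ Ioi (2 * ε) from ht)] with s hs
      exact sg_one (by rw [le_div_iff₀ hε]; exact (show 2 * ε < s from hs).le)
    rw [this.deriv_eq]; simp
theorem sge_int {ε a b : ℝ} (hε : 0 < ε) (ha : a ≤ ε) (hb : 2 * ε ≤ b) :
    ∫⁻ t in Icc a b, ofReal (deriv (sge ε) t) = 1 := by
  have hc : Continuous (deriv (sge ε)) := (sge_cd ε).continuous_deriv (by norm_num)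
  rw [← restrict_Ioc_eq_restrict_Icc, ← ofReal_integral_eq_lintegral_ofReal hc.integrableOn_Ioc
    (ae_of_all _ fun t => sge_d0 hε t), ← intervalIntegral.integral_of_le (by linarith),
    intervalIntegral.integral_deriv_eq_sub (fun x _ => (sge_cd ε).differentiable (by norm_num) x)
    (hc.intervalIntegrable _ _), sge, sge, sg_one (by rwa [le_div_iff₀ hε]), sg_zero (by rwa [div_le_one hε])]
  simp
theorem strip_le {f : Vn n → ENNReal} {a b : ℝ} (hf : AEMeasurable f (volume.restrict (strip n a b)))
    {c : ℝ → ℝ} (hc : Continuous c) {Q : ENNReal} (hQ : ∀ t ∈ Icc a b, c t ≠ 0 → ∫⁻ x, f (pt x t) ≤ Q) :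
    ∫⁻ z in strip n a b, ofReal (c z.snd) * f z ≤ Q * ∫⁻ t in Icc a b, ofReal (c t) := by
  rw [strip_lint (f := fun z => ofReal (c z.snd) * f z) a b
      ((hc.comp cont_snd).measurable.ennreal_ofReal.aemeasurable.mul hf),
    ← lintegral_const_mul _ hc.measurable.ennreal_ofReal]
  refine setLIntegral_mono' measurableSet_Icc fun t ht => ?_
  simp only [pt_snd]
  rw [lintegral_const_mul' _ _ ofReal_ne_top, mul_comm]
  by_cases h : c t = 0
  · simp [h]
  · exact mul_le_mul_left (hQ t ht h) _
theorem strip_ge {f : Vn n → ENNReal} {a b : ℝ} (hf : AEMeasurable f (volume.restrict (strip n a b)))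
    {c : ℝ → ℝ} (hc : Continuous c) {Q : ENNReal} (hQ : ∀ t ∈ Icc a b, c t ≠ 0 → Q ≤ ∫⁻ x, f (pt x t)) :
    Q * ∫⁻ t in Icc a b, ofReal (c t) ≤ ∫⁻ z in strip n a b, ofReal (c z.snd) * f z := by
  rw [strip_lint (f := fun z => ofReal (c z.snd) * f z) a b
      ((hc.comp cont_snd).measurable.ennreal_ofReal.aemeasurable.mul hf),
    ← lintegral_const_mul _ hc.measurable.ennreal_ofReal]
  refine setLIntegral_mono' measurableSet_Icc fun t ht => ?_
  simp only [pt_snd]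
  rw [lintegral_const_mul' _ _ ofReal_ne_top, mul_comm]
  by_cases h : c t = 0
  · simp [h]
  · exact mul_le_mul_right (hQ t ht h) _
theorem u_pk (hh : Integrable h) (ht : 0 < t) (x : En n) :
    ‖(Fp h (pt x t)).snd‖ₑ ≤ 2 ^ (n + 1) * ∫⁻ w, ofReal (pk n t (x - w)) * ‖h w‖ₑ := by
  rw [Fp_snd hh (show 0 < (pt x t).snd from ht), ← lintegral_const_mul' _ _ (by finiteness)]
  refine (enorm_integral_le_lintegral_enorm _).trans (lintegral_mono fun w => ?_)
  rw [enorm_mul, pt_sub, sub_zero, pt_snd, mul_comm, ← mul_assoc]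
  refine mul_le_mul_left ?_ _
  have h0 : 0 ≤ t / ‖pt (x - w) t‖ ^ (n + 1) := by positivity
  rw [enorm_eq_ofReal h0, show (2 : ENNReal) ^ (n + 1) = ofReal (2 ^ (n + 1)) by
    norm_num [ofReal_pow], ← ofReal_mul pv]
  exact ofReal_le_ofReal (le_pk ht _)
theorem u_Mx (hh : Integrable h) : ∃ f : En n → ENNReal, Measurable f ∧ f =ᵐ[volume] (fun x => ‖h x‖ₑ) ∧
    ∀ t > 0, ∀ x y : En n, dist x y ≤ t → ‖(Fp h (pt y t)).snd‖ₑ ≤ 2 ^ (n + 1) * 2 ^ (2 * n + 2) * Mx f x := by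
  have hm : AEMeasurable fun x => ‖h x‖ₑ := hh.1.enorm
  refine ⟨hm.mk, hm.measurable_mk, hm.ae_eq_mk.symm, fun t ht x y hxy => (u_pk hh ht y).trans ?_⟩
  rw [mul_assoc]
  refine mul_le_mul_right ?_ _
  refine le_trans (le_of_eq (lintegral_congr_ae ?_)) (pk_Mx hm.measurable_mk ht hxy)
  filter_upwards [hm.ae_eq_mk] with w hw
  rw [hw]
theorem u_L2 (n : ℕ) (hn : n ≠ 0) : ∃ C : ENNReal, C ≠ ⊤ ∧ ∀ h : En n → ℝ, Integrable h → ∀ t > 0,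
    ∫⁻ x, ‖(Fp h (pt x t)).snd‖ₑ ^ 2 ≤ C * ∫⁻ x, ‖h x‖ₑ ^ 2 := by
  obtain ⟨C, hC, hM⟩ := Mx_strong n hn (p := 2) (by norm_num)
  refine ⟨(2 ^ (n + 1) * 2 ^ (2 * n + 2)) ^ 2 * C, by finiteness, fun h hh t ht => ?_⟩
  obtain ⟨f, hf, hfe, hb⟩ := u_Mx hh
  calc _ ≤ ∫⁻ x, (2 ^ (n + 1) * 2 ^ (2 * n + 2)) ^ 2 * Mx f x ^ (2 : ℝ) := lintegral_mono fun x => by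
        have := pow_le_pow_left₀ pv (hb t ht x x (by simpa using ht.le)) 2
        rw [mul_pow (_ * _)] at this
        exact_mod_cast this
    _ = (2 ^ (n + 1) * 2 ^ (2 * n + 2)) ^ 2 * ∫⁻ x, Mx f x ^ (2 : ℝ) :=
        lintegral_const_mul' _ _ (by finiteness)
    _ ≤ _ := by
      rw [mul_assoc]
      refine mul_le_mul_right ((hM f hf).trans (mul_le_mul_right (le_of_eq (lintegral_congr_ae ?_)) _)) _
      filter_upwards [hfe] with x hx
      rw [hx]; norm_cast
theorem H6 (n : ℕ) (hn : n ≠ 0) : ∃ C : ENNReal, C ≠ ⊤ ∧ ∀ h : En n → ℝ, Integrable h → ∀ ε > 0, ∀ η : ENNReal, η ≠ 0 →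
    ∃ s ∈ Icc ε (2 * ε), ∫⁻ x, ‖Fp h (pt x s)‖ₑ ^ 2 ≤ C * (∫⁻ x, ‖h x‖ₑ ^ 2) + η := by
  obtain ⟨C, hC, hu⟩ := u_L2 n hn
  refine ⟨2 * C + 1, by finiteness, fun h hh ε hε η hη => ?_⟩
  by_cases hη' : η = ⊤
  · exact ⟨ε, ⟨le_rfl, by linarith⟩, by simp [hη']⟩
  by_contra! hcon
  by_cases hh2 : ∫⁻ x, ‖h x‖ₑ ^ 2 = ⊤
  · have := hcon ε ⟨le_rfl, by linarith⟩
    rw [hh2] at this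
    simp [ENNReal.mul_top] at this
  obtain ⟨C1, hC1, hL⟩ := L2K (kk_HK n) hn le_rfl
  have hh1 : (∫⁻ w, ‖h w‖ₑ) ^ 2 ≠ ⊤ := pow_ne_top hh.2.ne
  obtain ⟨R, hR, hRε⟩ : ∃ R : ℝ, ofReal (C1 * (R ^ (2 * n - n))⁻¹) * (∫⁻ w, ‖h w‖ₑ) ^ 2 < η ∧ ε < R := by
    have t1 : Tendsto (fun R : ℝ => ofReal (C1 * (R ^ (2 * n - n))⁻¹) * (∫⁻ w, ‖h w‖ₑ) ^ 2) atTop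
        (𝓝 (ofReal (C1 * 0) * (∫⁻ w, ‖h w‖ₑ) ^ 2)) :=
      ENNReal.Tendsto.mul_const (tendsto_ofReal (((tendsto_pow_atTop (by omega)).inv_tendsto_atTop).const_mul _))
        (Or.inr hh1)
    rw [mul_zero, ofReal_zero, zero_mul] at t1
    exact ((t1.eventually_lt_const pv).and (eventually_gt_atTop ε)).exists
  have hR0 : 0 < R := hε.trans hRε
  set X : Vn n → Vn n := fun z => (2 * ⟪pt 0 1, Fp h z⟫_ℝ) • Fp h z - ⟪Fp h z, Fp h z⟫_ℝ • (pt 0 1 : Vn n) with hX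
  have hXc : ∀ z : Vn n, 0 < z.snd → ContDiffAt ℝ 1 X z := fun z hz => by
    have hF : ContDiffAt ℝ 1 (Fp h) z := (Fp_smoothAt hh hz).of_le (by norm_num)
    exact ((contDiffAt_const.mul (contDiffAt_const.inner ℝ hF)).smul hF).sub ((hF.inner ℝ hF).smul contDiffAt_const)
  have hXd : ∀ z ∈ strip n ε (2 * R), ∑ i, ⟪fderiv ℝ X z (bs n i), bs n i⟫_ℝ = 0 := fun z hz => by
    have hz : 0 < z.snd := hε.trans_le hz.1
    have hF := ((Fp_smoothAt hh hz).differentiableAt sm).hasFDerivAt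
    set D := fderiv ℝ (Fp h) z
    have h1 := ((((hasFDerivAt_const (pt 0 1 : Vn n) z).inner ℝ hF).const_mul 2).smul hF).sub
      ((hF.inner ℝ hF).smul_const (pt 0 1 : Vn n))
    have h2 : ∀ v, fderiv ℝ X z v = (2 * ⟪pt 0 1, Fp h z⟫_ℝ) • D v + (2 * ⟪pt 0 1, D v⟫_ℝ) • Fp h z
        - (2 * ⟪D v, Fp h z⟫_ℝ) • pt 0 1 := fun v => by
      refine (congrArg (fun L => L v) h1.fderiv).trans ?_
      simp [real_inner_comm (D v) (Fp h z)]; ring_nf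
    have h3 : ∀ (w : Vn n) , ∑ i, ⟪w, D (bs n i)⟫_ℝ * ⟪Fp h z, bs n i⟫_ℝ = ⟪D w, Fp h z⟫_ℝ := fun w => by
      rw [← (bs n).sum_inner_mul_inner]
      refine sum_congr rfl fun i _ => ?_
      rw [← Fp_sym hh hz, real_inner_comm (bs n i) (Fp h z)]
    have h4 : ∑ i, ⟪D (bs n i), Fp h z⟫_ℝ * ⟪pt 0 1, bs n i⟫_ℝ = ⟪D (pt 0 1), Fp h z⟫_ℝ := by
      rw [Fp_sym hh hz, ← (bs n).sum_inner_mul_inner]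
      refine sum_congr rfl fun i _ => ?_
      rw [Fp_sym hh hz, mul_comm]
    have h5 := Fp_trace hh hz
    simp only [h2, inner_sub_left, inner_add_left, inner_smul_left, sum_add_distrib, Finset.sum_sub_distrib]
    simp only [RCLike.conj_to_real, mul_assoc, ← mul_sum]
    rw [h3, h4, h5]; ring
  have hq := strip_int hn hh (b := 2 * R) hε
  have hFq : ∀ z, ‖Fp h z‖ ^ 2 ≤ lq h z := fun z => by simp only [lq]; nlinarith [sq_nonneg ‖fderiv ℝ (Fp h) z‖]
  have hFc : ∀ z : Vn n, 0 < z.snd → ContinuousAt (Fp h) z := fun z hz => (Fp_smoothAt hh hz).continuousAt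
  have hD := divg hXc (g := fun t => sge ε t - sge R t) (((sge_cd ε).sub (sge_cd R)).of_le (by norm_num)) hε (fun t ht => by
      rw [mem_Icc, not_and_or, not_le, not_le] at ht
      rcases ht with ht | ht
      · simp only [sge]; rw [sg_zero (by rw [div_le_one hε]; exact ht.le), sg_zero (by rw [div_le_one hR0]; linarith), sub_zero]
      · simp only [sge]; rw [sg_one (by rw [le_div_iff₀ hε]; linarith), sg_one (by rw [le_div_iff₀ hR0]; linarith), sub_self])
    (by
      refine Integrable.mono' (hq.const_mul 3) (hs_aesm hε fun z hz => (hXc z hz).continuousAt) (ae_of_all _ fun z => ?_)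
      refine (norm_sub_le _ _).trans ?_
      have h1 := snd_le_norm (Fp h z)
      have h2 : ‖(pt 0 1 : Vn n)‖ = 1 := by
        have := norm_pt (0 : En n) 1
        simp at this; rcases this with h | h; exacts [h, by linarith [norm_nonneg (pt (0 : En n) 1)]]
      rw [norm_smul, norm_smul, h2, inner_e, real_inner_self_eq_norm_sq, norm_mul, norm_eq_abs (Fp h z).snd]
      simp
      nlinarith [hFq z, norm_nonneg (Fp h z)])
    (integrableOn_zero.congr_fun (fun z hz => (hXd z hz).symm) (strip_meas _ _))
  have dd : ∀ t, deriv (fun t => sge ε t - sge R t) t = deriv (sge ε) t - deriv (sge R) t := fun t =>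
    deriv_fun_sub ((sge_cd ε).differentiable (by norm_num) t) ((sge_cd R).differentiable (by norm_num) t)
  have i0 : IntegrableOn (fun z => ‖Fp h z‖ ^ 2) (strip n ε (2 * R)) :=
    Integrable.mono' hq (hs_aesm hε fun z hz => (hFc z hz).norm.pow 2) (ae_of_all _ fun z => by
      rw [norm_of_nonneg pv]; exact hFq z)
  have i1 : IntegrableOn (fun z => (Fp h z).snd ^ 2) (strip n ε (2 * R)) :=
    Integrable.mono' i0 (hs_aesm hε fun z hz => (cont_snd.continuousAt.comp (hFc z hz)).pow 2) (ae_of_all _ fun z => by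
      rw [norm_of_nonneg pv, ← sq_abs]
      exact pow_le_pow_left₀ (abs_nonneg _) (snd_le_norm _) 2)
  have hmul : ∀ {r : ℝ}, 0 < r → ∀ {f : Vn n → ℝ}, IntegrableOn f (strip n ε (2 * R)) →
      IntegrableOn (fun z => deriv (sge r) z.snd * f z) (strip n ε (2 * R)) := fun {r} hr f hf => by
    have hc : Continuous (deriv (sge r)) := (sge_cd r).continuous_deriv (by norm_num)
    obtain ⟨M, hM⟩ := (HasCompactSupport.intro isCompact_Icc fun t ht => sge_dz hr ht).exists_bound_of_continuous hc
    exact hf.bdd_mul (c := M) (hc.comp cont_snd).aestronglyMeasurable (ae_of_all _ fun z => hM _)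
  have key : ∫ z in strip n ε (2 * R), deriv (sge ε) z.snd * ‖Fp h z‖ ^ 2 ≤
      2 * (∫ z in strip n ε (2 * R), deriv (sge ε) z.snd * (Fp h z).snd ^ 2) +
      ∫ z in strip n ε (2 * R), deriv (sge R) z.snd * ‖Fp h z‖ ^ 2 := by
    have e1 : ∫ z in strip n ε (2 * R), (deriv (sge ε) z.snd * ‖Fp h z‖ ^ 2 -
        (2 * (deriv (sge ε) z.snd * (Fp h z).snd ^ 2) + deriv (sge R) z.snd * ‖Fp h z‖ ^ 2 -
        2 * (deriv (sge R) z.snd * (Fp h z).snd ^ 2))) = 0 := by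
      refine neg_eq_zero.1 (Eq.trans ?_ hD)
      rw [← integral_neg]
      refine setIntegral_congr_fun (strip_meas _ _) fun z hz => ?_
      have : (X z).snd = 2 * (Fp h z).snd * (Fp h z).snd - ‖Fp h z‖ ^ 2 * 1 := by
        simp only [hX, sub_snd, smul_snd, pt_snd, inner_e, real_inner_self_eq_norm_sq]
      simp only [hXd z hz, dd, this]
      ring
    have j1 := hmul hε i0
    have j2 := hmul hε i1
    have j3 := hmul hR0 i0
    have j4 := hmul hR0 i1
    have j5 : IntegrableOn (fun z => 2 * (deriv (sge ε) z.snd * (Fp h z).snd ^ 2) + deriv (sge R) z.snd * ‖Fp h z‖ ^ 2)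
      (strip n ε (2 * R)) := (j2.const_mul 2).add j3
    have j6 : IntegrableOn (fun z => 2 * (deriv (sge ε) z.snd * (Fp h z).snd ^ 2) + deriv (sge R) z.snd * ‖Fp h z‖ ^ 2 -
      2 * (deriv (sge R) z.snd * (Fp h z).snd ^ 2)) (strip n ε (2 * R)) := j5.sub (j4.const_mul 2)
    rw [integral_sub j1 j6, integral_sub j5 (j4.const_mul 2),
      integral_add (j2.const_mul 2) j3, integral_const_mul, integral_const_mul] at e1
    have : 0 ≤ ∫ z in strip n ε (2 * R), deriv (sge R) z.snd * (Fp h z).snd ^ 2 :=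
      integral_nonneg fun z => mul_nonneg (sge_d0 hR0 _) (sq_nonneg _)
    linarith
  have conv : ∀ {r : ℝ}, 0 < r → ∀ {f : Vn n → ℝ}, (∀ z, 0 ≤ f z) → IntegrableOn f (strip n ε (2 * R)) →
      ofReal (∫ z in strip n ε (2 * R), deriv (sge r) z.snd * f z) =
      ∫⁻ z in strip n ε (2 * R), ofReal (deriv (sge r) z.snd) * ofReal (f z) := fun {r} hr f f0 hf => by
    rw [ofReal_integral_eq_lintegral_ofReal (hmul hr hf) (ae_of_all _ fun z => mul_nonneg (sge_d0 hr _) (f0 z))]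
    simp only [ofReal_mul (sge_d0 hr _)]
  have key2 := ofReal_le_ofReal key
  rw [ofReal_add (mul_nonneg zero_le_two (integral_nonneg fun z => mul_nonneg (sge_d0 hε _) (sq_nonneg _)))
    (integral_nonneg fun z => mul_nonneg (sge_d0 hR0 _) (sq_nonneg _)), ofReal_mul zero_le_two,
    conv hε (fun z => sq_nonneg _) i0, conv hε (fun z => sq_nonneg _) i1, conv hR0 (fun z => sq_nonneg _) i0] at key2
  have o1 : ∀ z, ofReal (‖Fp h z‖ ^ 2) = ‖Fp h z‖ₑ ^ 2 := fun z => by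
    rw [ofReal_pow (norm_nonneg _), ofReal_norm_eq_enorm]
  have o2 : ∀ z, ofReal ((Fp h z).snd ^ 2) = ‖(Fp h z).snd‖ₑ ^ 2 := fun z => by
    rw [← sq_abs, ofReal_pow (abs_nonneg _), ← norm_eq_abs, ofReal_norm_eq_enorm]
  simp only [o1, o2] at key2
  have m1 : AEMeasurable (fun z => ‖Fp h z‖ₑ ^ 2) (volume.restrict (strip n ε (2 * R))) :=
    ((hs_aesm hε hFc).enorm).pow_const 2
  have m2 : AEMeasurable (fun z => ‖(Fp h z).snd‖ₑ ^ 2) (volume.restrict (strip n ε (2 * R))) :=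
    ((hs_aesm hε fun z hz => cont_snd.continuousAt.comp (hFc z hz)).enorm).pow_const 2
  have cc : ∀ r, Continuous (deriv (sge r)) := fun r => (sge_cd r).continuous_deriv (by norm_num)
  have nz : ∀ {r t : ℝ}, 0 < r → deriv (sge r) t ≠ 0 → t ∈ Icc r (2 * r) := fun hr h => by
    by_contra h'; exact h (sge_dz hr h')
  have k1 := strip_ge m1 (cc ε) (Q := 2 * C * (∫⁻ x, ‖h x‖ₑ ^ 2) + η) fun t _ ht =>
    le_trans (by gcongr; exact le_self_add) (hcon t (nz hε ht)).le
  have k2 := strip_le m2 (cc ε) (Q := C * (∫⁻ x, ‖h x‖ₑ ^ 2)) fun t ht _ => hu h hh t (hε.trans_le ht.1)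
  have k3 := strip_le m1 (cc R) (Q := ofReal (C1 * (R ^ (2 * n - n))⁻¹) * (∫⁻ w, ‖h w‖ₑ) ^ 2) fun t _ ht => by
    have htR := (nz hR0 ht).1
    refine (hL h hh t (hR0.trans_le htR)).trans (mul_le_mul_left (ofReal_le_ofReal ?_) _)
    gcongr
  rw [sge_int hε le_rfl (by linarith), mul_one] at k1 k2
  rw [sge_int hR0 hRε.le le_rfl, mul_one] at k3
  have fin : 2 * C * (∫⁻ x, ‖h x‖ₑ ^ 2) + η ≤ 2 * (C * (∫⁻ x, ‖h x‖ₑ ^ 2)) +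
      ofReal (C1 * (R ^ (2 * n - n))⁻¹) * (∫⁻ w, ‖h w‖ₑ) ^ 2 :=
    k1.trans (key2.trans (add_le_add (by simpa using mul_le_mul_right k2 _) k3))
  rw [← mul_assoc] at fin
  exact absurd (ENNReal.le_of_add_le_add_left (by finiteness) fin) (not_le.2 hR)
noncomputable def Fs (h : En n → ℝ) (x : En n) : ENNReal := ⨆ y, ⨆ t, ⨆ _ : dist y x < t, ‖Fp h (pt y t)‖ₑ
theorem le_Fs (h : En n → ℝ) {x y : En n} (ht : dist y x < t) : ‖Fp h (pt y t)‖ₑ ≤ Fs h x :=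
  le_iSup_of_le y (le_iSup_of_le t (le_iSup_of_le ht le_rfl))
theorem Fs_le (h : En n → ℝ) {x : En n} {c : ENNReal} (H : ∀ y t, dist y x < t → ‖Fp h (pt y t)‖ₑ ≤ c) : Fs h x ≤ c :=
  iSup_le fun y => iSup_le fun t => iSup_le fun ht => H y t ht
theorem Fs_open (h : En n → ℝ) (l : ENNReal) : IsOpen {x | l < Fs h x} := by
  refine isOpen_iff_mem_nhds.2 fun x hx => ?_
  replace hx : l < Fs h x := hx
  simp only [Fs, lt_iSup_iff] at hx
  obtain ⟨y, t, ht, hl⟩ := hx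
  filter_upwards [(isOpen_lt ((continuous_const (y := y)).dist continuous_id) continuous_const).mem_nhds ht] with x' hx'
  exact hl.trans_le (le_Fs h hx')
theorem Fs_meas (h : En n → ℝ) : Measurable (Fs h) := measurable_of_Ioi fun l => (Fs_open h l).measurableSet
theorem Ft_cont (hh : Integrable h) {s : ℝ} (hs : 0 < s) : Continuous fun x => Fp h (pt x s) :=
  continuous_iff_continuousAt.2 fun x => ContinuousAt.comp (f := fun x => pt x s) (g := Fp h)
    ((Fp_smoothAt hh (z := pt x s) hs).continuousAt) (cont_pt.comp (continuous_id.prodMk continuous_const)).continuousAt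
theorem Fs_Lp (hn : 2 ≤ n) {p : ℝ} (hp : qq n < p) : ∃ C : ENNReal, C ≠ ⊤ ∧ ∀ h : En n → ℝ, Integrable h →
    ∀ s : ℕ → ℝ, (∀ k, 0 < s k) → Tendsto s atTop (𝓝 0) →
    ∫⁻ x, Fs h x ^ p ≤ C * liminf (fun k => ∫⁻ x, ‖Fp h (pt x (s k))‖ₑ ^ p) atTop := by
  have hq := qq_pos hn
  obtain ⟨A, hA, hF⟩ := H5 hn
  obtain ⟨C, hC, hM⟩ := Mx_strong n (by omega) (p := p / qq n) (by rwa [one_lt_div hq])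
  have hp0 : 0 < p := hq.trans hp
  have hpq : 0 < p / qq n := by positivity
  have hA' : (A * 2 ^ (2 * n + 2)) ^ (p / qq n) ≠ ⊤ := by finiteness
  refine ⟨(A * 2 ^ (2 * n + 2)) ^ (p / qq n) * C, by finiteness, fun h hh s hs0 hs => ?_⟩
  set f : ℕ → En n → ENNReal := fun k w => ‖Fp h (pt w (s k))‖ₑ ^ qq n
  have hf : ∀ k, Measurable (f k) := fun k => (Ft_cont hh (hs0 k)).enorm.measurable.pow_const _
  have h1 : ∀ x, Fs h x ^ p ≤ liminf (fun k => (A * 2 ^ (2 * n + 2)) ^ (p / qq n) * Mx (f k) x ^ (p / qq n)) atTop := by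
    intro x
    rw [← ENNReal.le_rpow_inv_iff hp0]
    refine Fs_le h fun y t ht => ?_
    rw [ENNReal.le_rpow_inv_iff hp0]
    refine le_liminf_of_le (by isBoundedDefault) ?_
    filter_upwards [hs.eventually_lt_const (sub_pos.2 ht)] with k hk
    have ht' : 0 < t - s k := by have := dist_nonneg (x := y) (y := x); linarith
    have e1 := hF h hh (s k) (hs0 k) (t - s k) ht' y
    rw [add_sub_cancel] at e1
    have e2 := e1.trans (mul_le_mul_right (pk_Mx (hf k) ht' (x := x) (by rw [dist_comm]; linarith)) A)
    have e3 := rpow_le_rpow e2 hpq.le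
    rw [← rpow_mul, mul_div_cancel₀ _ hq.ne', ← mul_assoc, mul_rpow_of_nonneg _ _ hpq.le] at e3
    exact e3
  calc _ ≤ _ := lintegral_mono h1
    _ ≤ liminf (fun k => ∫⁻ x, (A * 2 ^ (2 * n + 2)) ^ (p / qq n) * Mx (f k) x ^ (p / qq n)) atTop :=
      lintegral_liminf_le fun k => ((Mx_meas _).pow_const _).const_mul _
    _ ≤ liminf (fun k => ((A * 2 ^ (2 * n + 2)) ^ (p / qq n) * C) * ∫⁻ x, ‖Fp h (pt x (s k))‖ₑ ^ p) atTop := by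
      refine liminf_le_liminf (Eventually.of_forall fun k => ?_)
      rw [lintegral_const_mul _ ((Mx_meas _).pow_const _), mul_assoc]
      refine mul_le_mul_right ((hM (f k) (hf k)).trans (le_of_eq ?_)) _
      congr 2; ext x
      rw [← rpow_mul, mul_div_cancel₀ _ hq.ne']
    _ = _ := ENNReal.liminf_const_mul_of_ne_top (by finiteness)
theorem H7 (hn : 2 ≤ n) : ∃ C : ENNReal, C ≠ ⊤ ∧ ∀ h : En n → ℝ, Integrable h →
    ∫⁻ x, Fs h x ^ 2 ≤ C * ∫⁻ x, ‖h x‖ₑ ^ 2 := by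
  obtain ⟨C1, hC1, h6⟩ := H6 n (by omega)
  obtain ⟨C, hC, hF⟩ := Fs_Lp hn (p := 2) (by have := qq_lt hn; linarith)
  refine ⟨C * C1, by finiteness, fun h hh => ?_⟩
  choose s hs hb using fun k : ℕ => h6 h hh (1 / ((k : ℝ) + 1)) pv (((k : ENNReal) + 1)⁻¹)
    (ENNReal.inv_ne_zero.2 (by finiteness))
  have t0 : Tendsto (fun k : ℕ => 1 / ((k : ℝ) + 1)) atTop (𝓝 0) := tendsto_one_div_add_atTop_nhds_zero_nat
  have t1 : Tendsto s atTop (𝓝 0) := by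
    refine tendsto_of_tendsto_of_tendsto_of_le_of_le t0 (by simpa using t0.const_mul 2) (fun k => (hs k).1) (fun k => (hs k).2)
  have := hF h hh s (fun k => lt_of_lt_of_le pv (hs k).1) t1
  simp only [ENNReal.rpow_ofNat] at this
  refine this.trans ?_
  rw [mul_assoc]
  refine mul_le_mul_right ?_ _
  have t2 : Tendsto (fun k : ℕ => C1 * (∫⁻ x, ‖h x‖ₑ ^ 2) + ((k : ENNReal) + 1)⁻¹) atTop (𝓝 (C1 * (∫⁻ x, ‖h x‖ₑ ^ 2) + 0)) :=
    tendsto_const_nhds.add (by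
      have := (ENNReal.tendsto_inv_nat_nhds_zero).comp (tendsto_add_atTop_nat 1)
      simpa [comp_def] using this)
  rw [add_zero] at t2
  exact (liminf_le_liminf (Eventually.of_forall hb)).trans_eq t2.liminf_eq
theorem LP (hh : Integrable h) : ∀ᵐ x, ∀ ε : ENNReal, ε ≠ 0 → ∃ δ : ℝ, 0 < δ ∧ ∀ r, 0 < r → r ≤ δ →
    ∫⁻ y in ball x r, ‖h y - h x‖ₑ ≤ ε * ofReal (r ^ n) := by
  filter_upwards [IsUnifLocDoublingMeasure.ae_tendsto_average_norm_sub (μ := (volume : Measure (En n))) hh.locallyIntegrable 1] with x hx ε hε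
  by_cases hε' : ε = ⊤
  · exact ⟨1, one_pos, fun r hr _ => by
      rw [hε', ENNReal.top_mul (by simp; positivity)]; exact le_top⟩
  have h1 := hx (fun _ : ℝ => x) id (l := 𝓝[>] 0) tendsto_id (by
    filter_upwards [self_mem_nhdsWithin] with r hr
    exact mem_closedBall_self (by simpa using (mem_Ioi.1 hr).le))
  have hc : 0 < (ε / om n).toReal := toReal_pos (by simp [hε, om_top]) (div_ne_top hε' (om_pos n))
  obtain ⟨δ, hδ, hd⟩ := mem_nhdsGT_iff_exists_Ioc_subset.1 (h1.eventually_lt_const hc)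
  refine ⟨δ, hδ, fun r hr hrd => ?_⟩
  have h2 : (⨍ y in closedBall x (id r), ‖h y - h x‖) < (ε / om n).toReal := hd ⟨hr, hrd⟩
  have hi : IntegrableOn (fun y => ‖h y - h x‖) (closedBall x r) := (hh.integrableOn.sub (integrableOn_const (by
    rw [vol_cball x hr.le]; have := om_top n; finiteness))).norm
  have hv : volume (closedBall x r) = ofReal (r ^ n) * om n := vol_cball x hr.le
  have hv0 : volume (closedBall x r) ≠ 0 := by rw [hv]; simp [om_pos]; positivity
  have hv1 : volume (closedBall x r) ≠ ⊤ := by rw [hv]; have := om_top n; finiteness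
  calc _ ≤ ∫⁻ y in closedBall x r, ‖h y - h x‖ₑ := lintegral_mono_set ball_subset_closedBall
    _ = ofReal (∫ y in closedBall x r, ‖h y - h x‖) := by
      rw [ofReal_integral_eq_lintegral_ofReal hi (ae_of_all _ fun _ => norm_nonneg _)]; simp only [ofReal_norm_eq_enorm]
    _ ≤ ofReal ((ε / om n).toReal * (volume (closedBall x r)).toReal) := by
      refine ofReal_le_ofReal ?_
      simp only [id, setAverage_eq, smul_eq_mul, Measure.real] at h2
      rw [inv_mul_lt_iff₀ (toReal_pos hv0 hv1)] at h2
      linarith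
    _ = _ := by
      rw [← ENNReal.toReal_mul, ofReal_toReal (by have := div_ne_top hε' (om_pos n); finiteness), hv, mul_comm (ofReal _), ← mul_assoc,
        ENNReal.div_mul_cancel (om_pos n) (om_top n)]
theorem LP_Mx (hh : Integrable h) : ∀ᵐ x, ‖h x‖ₑ * om n ≤ Mx (fun y => ‖h y‖ₑ) x := by
  filter_upwards [LP hh] with x hx
  refine ENNReal.le_of_forall_pos_le_add fun ε hε _ => ?_
  obtain ⟨r, hr, h1⟩ := hx ε (by simpa using hε.ne')
  have h0 : ofReal (r ^ n) ≠ 0 := by simp; positivity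
  rw [← ENNReal.mul_le_mul_iff_right h0 ofReal_ne_top]
  calc _ = ∫⁻ y in ball x r, ‖h x‖ₑ := by rw [setLIntegral_const, vol_ball x hr]; ring
    _ ≤ ∫⁻ y in ball x r, (‖h y‖ₑ + ‖h y - h x‖ₑ) := lintegral_mono fun y => by
        have := enorm_sub_le (E := ℝ) (a := h y) (b := h y - h x)
        rwa [sub_sub_cancel] at this
    _ ≤ _ := by
      rw [lintegral_add_left' hh.1.enorm.restrict, mul_add]
      exact add_le_add (le_Mx _ x hr) ((h1 r hr le_rfl).trans_eq (mul_comm _ _))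
theorem pk_far {t δ : ℝ} (ht : 0 < t) (hδ : 0 < δ) {v : En n} (hv : δ ≤ ‖v‖) :
    pk n t v ≤ t * (2 ^ (n + 1) / δ) * pk n δ v := by
  have : t * (2 ^ (n + 1) / δ) * pk n δ v = t * (2 / (δ + ‖v‖)) ^ (n + 1) := by
    rw [pk, div_pow]; field_simp
  rw [this, pk, div_eq_mul_inv, ← inv_pow]
  gcongr
  rw [inv_eq_one_div, div_le_div_iff₀ pv pv]; linarith
theorem pk_cont (n : ℕ) {t : ℝ} (ht : 0 < t) : Continuous (pk n t) := by
  unfold pk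
  exact continuous_const.div (by fun_prop) fun v => by positivity
theorem LP_pk (hh : Integrable h) : ∀ᵐ x,
    Tendsto (fun t => ∫⁻ w, ofReal (pk n t (x - w)) * ‖h w - h x‖ₑ) (𝓝[>] 0) (𝓝 0) := by
  filter_upwards [LP hh] with x hx
  refine ENNReal.tendsto_nhds_zero.2 fun ε hε => ?_
  set e : ENNReal := ε / 2 / 2 ^ (2 * n + 2)
  have he : e ≠ 0 := (ENNReal.div_pos (ENNReal.half_pos hε.ne').ne' (by finiteness)).ne'
  obtain ⟨δ, hδ, h1⟩ := hx e he
  set g := hh.1.mk h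
  have hg : h =ᵐ[volume] g := hh.1.ae_eq_mk
  have hgm : Measurable g := hh.1.stronglyMeasurable_mk.measurable
  set f : En n → ENNReal := (ball x δ).indicator fun w => ‖g w - h x‖ₑ
  have hf : Measurable f := (hgm.sub_const _).enorm.indicator measurableSet_ball
  have hM : Mx f x ≤ e := by
    refine iSup_le fun r => iSup_le fun hr => ?_
    have h0 : ofReal (r ^ n) ≠ 0 := by simp; positivity
    rw [ENNReal.inv_mul_le_iff h0 ofReal_ne_top, setLIntegral_indicator measurableSet_ball, mul_comm]
    have e1 : ∀ ρ : ℝ, 0 < ρ → ρ ≤ δ → ∫⁻ w in ball x ρ, ‖g w - h x‖ₑ ≤ e * ofReal (ρ ^ n) := fun ρ h2 h3 => by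
      refine le_trans (le_of_eq ?_) (h1 ρ h2 h3)
      exact lintegral_congr_ae (ae_restrict_of_ae (hg.mono fun w hw => by simp only [hw]))
    rcases le_total r δ with h2 | h2
    · exact (lintegral_mono_set inter_subset_right).trans (e1 r hr h2)
    · exact (lintegral_mono_set inter_subset_left).trans ((e1 δ hδ le_rfl).trans (by gcongr))
  set I : ENNReal := ∫⁻ w, ofReal (pk n δ (x - w)) * ‖g w - h x‖ₑ
  have hI : I ≠ ⊤ := by
    have : I ≤ ∫⁻ w, (ofReal ((δ ^ n)⁻¹) * ‖h w‖ₑ + ofReal (pk n δ (x - w)) * ‖h x‖ₑ) := by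
      refine lintegral_mono_ae (hg.mono fun w hw => ?_)
      rw [← hw]
      refine (mul_le_mul_right (enorm_sub_le (E := ℝ)) _).trans ?_
      rw [mul_add]
      gcongr
      rw [pk, inv_eq_one_div, div_le_div_iff₀ pv pv, pow_succ]
      have : δ ^ n * δ ≤ (δ + ‖x - w‖) ^ n * (δ + ‖x - w‖) := by
        gcongr <;> linarith [norm_nonneg (x - w)]
      linarith
    refine ne_top_of_le_ne_top ?_ this
    rw [lintegral_add_left' (hh.1.enorm.const_mul _), lintegral_const_mul' _ _ ofReal_ne_top, lintegral_mul_const' _ _ sm,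
      lintegral_sub_left_eq_self (fun w => ofReal (pk n δ w)) x]
    have a1 := (pk_tot (n := n) hδ)
    have a2 : (∫⁻ w : En n, ofReal (pk n δ w)) ≠ ⊤ := ne_top_of_le_ne_top (by have := om_top n; finiteness) a1
    have a3 : (∫⁻ w, ‖h w‖ₑ) ≠ ⊤ := hh.2.ne
    finiteness
  have h3 : Tendsto (fun t : ℝ => ofReal (t * (2 ^ (n + 1) / δ)) * I) (𝓝[>] 0) (𝓝 (ofReal (0 * (2 ^ (n + 1) / δ)) * I)) :=
    ENNReal.Tendsto.mul_const (tendsto_ofReal ((tendsto_nhdsWithin_of_tendsto_nhds tendsto_id).mul_const _)) (Or.inr hI)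
  rw [zero_mul, ofReal_zero, zero_mul] at h3
  filter_upwards [ENNReal.tendsto_nhds_zero.1 h3 _ (ENNReal.half_pos hε.ne'), self_mem_nhdsWithin] with t ht ht0
  replace ht0 : 0 < t := ht0
  calc _ ≤ ∫⁻ w, (ofReal (pk n t (x - w)) * f w + ofReal (t * (2 ^ (n + 1) / δ)) * (ofReal (pk n δ (x - w)) * ‖g w - h x‖ₑ)) := by
        refine lintegral_mono_ae (hg.mono fun w hw => ?_)
        by_cases hw' : w ∈ ball x δ
        · simp only [f, indicator_of_mem hw', ← hw]; exact le_self_add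
        · rw [← hw, ← mul_assoc, ← ofReal_mul pv]
          refine le_trans ?_ le_add_self
          gcongr
          exact pk_far ht0 hδ (by rw [mem_ball, not_lt, dist_comm, dist_eq_norm] at hw'; exact hw')
    _ ≤ ε / 2 + ε / 2 := by
      rw [lintegral_add_left (by have := (pk_cont n ht0).measurable; fun_prop), lintegral_const_mul' _ _ ofReal_ne_top]
      refine add_le_add (((pk_Mx hf ht0 (by simpa using ht0.le)).trans (mul_le_mul_right hM _)).trans_eq ?_) ht
      exact ENNReal.mul_div_cancel sm (by finiteness)
    _ = ε := ENNReal.add_halves ε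
theorem sub_hasSum {ι M : Type*} [AddCommMonoid M] [TopologicalSpace M] {f : ι → M} (h : ∀ a b, f a ≠ 0 → f b ≠ 0 → a = b) :
    (HasSum f 0 ∧ ∀ a, f a = 0) ∨ ∃ a, HasSum f (f a) := by
  by_cases H : ∀ a, f a = 0
  · exact Or.inl ⟨by simp [funext H, hasSum_zero], H⟩
  · push Not at H
    obtain ⟨a, ha⟩ := H
    exact Or.inr ⟨a, hasSum_single a fun b hb => by by_contra h0; exact hb (h b a h0 ha)⟩
theorem CZ (hn : 2 ≤ n) (hh : Integrable h) {l : ENNReal} (hl : l ≠ 0) (hl' : l ≠ ⊤) :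
    ∃ (u : Set (En n)) (r : En n → ℝ) (b : u → En n → ℝ) (g : En n → ℝ), u.Countable ∧ (∀ a ∈ u, 0 < r a) ∧
      (∑' a : u, volume (closedBall (a : En n) (r a)) ≤ 5 ^ n * om n * l⁻¹ * ∫⁻ x, ‖h x‖ₑ) ∧ Integrable g ∧
      (∀ᵐ w, ‖g w‖ₑ ≤ 25 ^ n * l / om n) ∧ (∫⁻ x, ‖g x‖ₑ ≤ 3 * ∫⁻ x, ‖h x‖ₑ) ∧ (∀ a, Integrable (b a)) ∧ (∀ a, ∫ x, b a x = 0) ∧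
      (∀ (a : u) x, x ∉ closedBall (a : En n) (5 * r a) → b a x = 0) ∧ (∑' a, ∫⁻ x, ‖b a x‖ₑ ≤ 2 * ∫⁻ x, ‖h x‖ₑ) ∧
      (∀ w, HasSum (fun a => b a w) (h w - g w)) := by
  set I := ∫⁻ x, ‖h x‖ₑ
  have hI : I ≠ ⊤ := hh.2.ne
  set O := {x | l < Mx (fun y => ‖h y‖ₑ) x}
  have hOo : IsOpen O := Mx_open _ _
  have hOv : volume O ≤ 5 ^ n * om n * l⁻¹ * I := Mx_weak (by omega) _ hl hl'
  have hOf : volume O ≠ ⊤ := ne_top_of_le_ne_top (by have := om_top n; finiteness) hOv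
  have : NeZero n := ⟨by omega⟩
  have hne : Oᶜ.Nonempty := by
    rw [nonempty_compl]; intro h0
    rw [h0, measure_univ_of_isAddLeftInvariant] at hOf; exact hOf rfl
  have hcl : IsClosed Oᶜ := hOo.isClosed_compl
  set r : En n → ℝ := fun x => infDist x Oᶜ / 10
  have hr : ∀ x ∈ O, 0 < r x := fun x hx => by
    have := (hcl.notMem_iff_infDist_pos hne).1 (by simpa using hx : x ∉ Oᶜ)
    positivity
  have hsub : ∀ x ∈ O, closedBall x (5 * r x) ⊆ O := fun x hx y hy => by
    by_contra hy'
    have h1 := infDist_le_dist_of_mem (x := x) (s := Oᶜ) hy'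
    rw [mem_closedBall, dist_comm] at hy
    have := hr x hx
    simp only [r] at *; linarith
  have hB : ∀ x ∈ O, closedBall x (r x) ⊆ closedBall x (5 * r x) := fun x hx => closedBall_subset_closedBall (by linarith [hr x hx])
  have hR : ∃ R, ∀ x ∈ O, r x ≤ R := by
    refine ⟨1 + (volume O / om n).toReal, fun x hx => ?_⟩
    have h0 : volume O / om n ≠ ⊤ := div_ne_top hOf (om_pos n)
    have h1 : ofReal (r x ^ n) ≤ volume O / om n := by
      rw [ENNReal.le_div_iff_mul_le (Or.inl (om_pos n)) (Or.inl (om_top n)), ← vol_cball x (hr x hx).le]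
      exact measure_mono ((hB x hx).trans (hsub x hx))
    have h2 := (ofReal_le_iff_le_toReal h0).1 h1
    rcases le_total (r x) 1 with h3 | h3
    · linarith [toReal_nonneg (a := volume O / om n)]
    · linarith [le_self_pow₀ h3 (show n ≠ 0 by omega)]
  obtain ⟨R, hR⟩ := hR
  obtain ⟨u, hu, huc, hd, hcov⟩ := vitali5 O r R hr hR
  have := huc.to_subtype
  obtain ⟨e, he⟩ := Countable.exists_injective_nat u
  set B : u → Set (En n) := fun a => closedBall (a : En n) (r a)
  set Q : u → Set (En n) := fun a => closedBall (a : En n) (5 * r a) \ ⋃ b : u, ⋃ _ : e b < e a, closedBall (b : En n) (5 * r b)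
  have hBm : ∀ a, MeasurableSet (B a) := fun a => measurableSet_closedBall
  have hQm : ∀ a, MeasurableSet (Q a) := fun a => measurableSet_closedBall.diff
    (MeasurableSet.iUnion fun b => MeasurableSet.iUnion fun _ => measurableSet_closedBall)
  have hQs : ∀ a, Q a ⊆ closedBall (a : En n) (5 * r a) := fun a => diff_subset
  have hBd : ∀ a b x, x ∈ B a → x ∈ B b → a = b := fun a b x h1 h2 => by
    by_contra hab
    exact disjoint_left.1 (hd a.2 b.2 (fun h => hab (Subtype.ext h))) h1 h2
  have hQd : ∀ a b x, x ∈ Q a → x ∈ Q b → a = b := fun a b x h1 h2 => by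
    rcases lt_trichotomy (e a) (e b) with h3 | h3 | h3
    · exact absurd (mem_iUnion.2 ⟨a, mem_iUnion.2 ⟨h3, h1.1⟩⟩) h2.2
    · exact he h3
    · exact absurd (mem_iUnion.2 ⟨b, mem_iUnion.2 ⟨h3, h2.1⟩⟩) h1.2
  have hQO : ∀ x ∈ O, ∃ a, x ∈ Q a := fun x hx => by
    have hex : ∃ k, ∃ a : u, e a = k ∧ x ∈ closedBall (a : En n) (5 * r a) := by
      obtain ⟨b, hb, hxb⟩ := hcov x hx
      exact ⟨_, ⟨b, hb⟩, rfl, hxb (mem_closedBall_self (hr x hx).le)⟩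
    classical
    obtain ⟨a, ha, hxa⟩ := find_spec hex
    refine ⟨a, hxa, fun h0 => ?_⟩
    simp only [mem_iUnion] at h0
    obtain ⟨b, hb, hxb⟩ := h0
    exact find_min hex (ha ▸ hb) ⟨b, rfl, hxb⟩
  have hvB : ∀ a : u, volume (B a) = ofReal (r a ^ n) * om n := fun a => vol_cball _ (hr a (hu a.2)).le
  have hv0 : ∀ a : u, volume (B a) ≠ 0 := fun a => by have := hr a (hu a.2); rw [hvB]; simp [om_pos]; positivity
  have hv1 : ∀ a : u, volume (B a) ≠ ⊤ := fun a => by rw [hvB]; have := om_top n; finiteness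
  set c : u → ℝ := fun a => (volume (B a)).toReal⁻¹ * ∫ x in Q a, h x
  have hcA : ∀ a, ‖c a‖ₑ * volume (B a) ≤ ∫⁻ x in Q a, ‖h x‖ₑ := fun a => by
    have h1 : ‖(volume (B a)).toReal⁻¹‖ₑ = (volume (B a))⁻¹ := by
      rw [enorm_inv (toReal_pos (hv0 a) (hv1 a)).ne', enorm_of_nonneg toReal_nonneg, ofReal_toReal (hv1 a)]
    rw [enorm_mul, h1, mul_right_comm, ENNReal.inv_mul_cancel (hv0 a) (hv1 a), one_mul]
    exact enorm_integral_le_lintegral_enorm _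
  have hcl : ∀ a, ‖c a‖ₑ ≤ 25 ^ n * l / om n := fun a => by
    have ha := hr a (hu a.2)
    obtain ⟨p, hp, hpa⟩ := (infDist_lt_iff (x := (a : En n)) hne (r := 20 * r a)).1 (by simp only [r] at *; linarith)
    have h1 : ∫⁻ x in Q a, ‖h x‖ₑ ≤ ofReal ((25 * r a) ^ n) * l := by
      refine (lintegral_mono_set fun x hx => ?_).trans ((le_Mx _ p pv).trans (mul_le_mul_right (not_lt.1 (show ¬ l < Mx _ p from hp)) _))
      have := hQs a hx
      rw [mem_closedBall] at this
      rw [mem_ball]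
      linarith [dist_triangle x a p]
    rw [← ENNReal.mul_le_mul_iff_left (hv0 a) (hv1 a)]
    refine ((hcA a).trans h1).trans_eq ?_
    rw [hvB, mul_pow, ofReal_mul pv, mul_comm (ofReal (r a ^ n)), ← mul_assoc, ENNReal.div_mul_cancel (om_pos n) (om_top n),
      ofReal_pow (by norm_num)]
    simp; ring
  set b : u → En n → ℝ := fun a x => (Q a).indicator h x - (B a).indicator (fun _ => c a) x
  have hb1 : ∀ a, Integrable ((Q a).indicator h) := fun a => hh.indicator (hQm a)
  have hb2 : ∀ a, Integrable ((B a).indicator fun _ => c a) := fun a => (integrable_indicator_iff (hBm a)).2 (integrableOn_const (hv1 a))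
  have hbi : ∀ a, Integrable (b a) := fun a => (hb1 a).sub (hb2 a)
  have hbs : ∑' a, ∫⁻ x, ‖b a x‖ₑ ≤ 2 * I := by
    have h1 : ∀ a, ∫⁻ x, ‖b a x‖ₑ ≤ 2 * ∫⁻ x in Q a, ‖h x‖ₑ := fun a => by
      refine (lintegral_mono fun x => enorm_sub_le (E := ℝ)).trans ?_
      rw [lintegral_add_left' (hb1 a).1.enorm, two_mul]
      simp only [enorm_indicator_eq_indicator_enorm]
      rw [lintegral_indicator (hQm a), lintegral_indicator (hBm a), setLIntegral_const]
      exact add_le_add le_rfl (hcA a)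
    refine (tsum_le_tsum h1).trans ?_
    rw [ENNReal.tsum_mul_left, ← lintegral_iUnion hQm fun a b hab => disjoint_left.2 fun x h1 h2 => hab (hQd a b x h1 h2)]
    exact mul_le_mul_right (setLIntegral_le_lintegral _ _) _
  set g : En n → ℝ := fun w => Oᶜ.indicator h w + ∑' a, (B a).indicator (fun _ => c a) w
  have hind : ∀ {S : u → Set (En n)}, (∀ a b x, x ∈ S a → x ∈ S b → a = b) → ∀ (f : u → En n → ℝ) w,
      ∀ a b, (S a).indicator (f a) w ≠ 0 → (S b).indicator (f b) w ≠ 0 → a = b := fun hS f w a b h1 h2 =>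
    hS a b w (mem_of_indicator_ne_zero h1) (mem_of_indicator_ne_zero h2)
  have hs1 : ∀ w, HasSum (fun a => (Q a).indicator h w) (O.indicator h w) := fun w => by
    by_cases hw : w ∈ O
    · obtain ⟨a, ha⟩ := hQO w hw
      rw [indicator_of_mem hw, ← indicator_of_mem ha h]
      exact hasSum_single a fun b hb => indicator_of_notMem (fun h0 => hb (hQd b a w h0 ha)) _
    · rw [indicator_of_notMem hw]
      have : (fun a => (Q a).indicator h w) = fun _ => 0 := funext fun a => indicator_of_notMem (fun h0 => hw (hsub a (hu a.2) (hQs a h0))) _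
      rw [this]; exact hasSum_zero
  have hs2 : ∀ w, HasSum (fun a => b a w) (h w - g w) := fun w => by
    have h1 : Summable fun a => (B a).indicator (fun _ => c a) w := by
      rcases sub_hasSum (hind hBd (fun a _ => c a) w) with h1 | ⟨a, h1⟩
      · exact h1.1.summable
      · exact h1.summable
    have h2 := (hs1 w).sub h1.hasSum
    have h3 : O.indicator h w + Oᶜ.indicator h w = h w := congrFun (indicator_self_add_compl O h) w
    have h4 : h w - g w = O.indicator h w - ∑' a, (B a).indicator (fun _ => c a) w := by
      change h w - (Oᶜ.indicator h w + ∑' a, (B a).indicator (fun _ => c a) w) = _; linarith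
    rw [h4]; exact h2
  have hbe : ∫⁻ w, ‖h w - g w‖ₑ ≤ 2 * I := by
    refine (lintegral_mono fun w => ?_).trans ((lintegral_tsum fun a => (hbi a).1.enorm).trans_le hbs)
    rw [← (hs2 w).tsum_eq]; exact enorm_tsum_le_tsum_enorm
  have hbb : Integrable fun w => h w - g w := by
    refine ⟨aestronglyMeasurable_of_tendsto_ae atTop (f := fun (s : Finset u) w => ∑ a ∈ s, b a w)
      (fun s => (integrable_finsetSum s fun a _ => hbi a).1) (ae_of_all _ hs2), ?_⟩
    exact lt_of_le_of_lt hbe (by finiteness)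
  refine ⟨u, r, b, g, huc, fun a ha => hr a (hu ha), ?_, ?_, ?_, ?_, hbi, fun a => ?_, fun a x hx => ?_, hbs, hs2⟩
  · rw [← measure_iUnion (fun a b hab => disjoint_left.2 fun x h1 h2 => hab (hBd a b x h1 h2)) hBm]
    exact (measure_mono (iUnion_subset fun a : u => (hB a (hu a.2)).trans (hsub a (hu a.2)))).trans hOv
  · exact (hh.sub hbb).congr (ae_of_all _ fun w => by simp)
  · filter_upwards [LP_Mx hh] with w hw
    by_cases hwO : w ∈ O
    · simp only [g, indicator_of_notMem (show w ∉ Oᶜ by simpa using hwO), zero_add]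
      rcases sub_hasSum (hind hBd (fun a _ => c a) w) with h1 | ⟨a, h1⟩
      · rw [h1.1.tsum_eq]; simp
      · rw [h1.tsum_eq]
        refine le_trans ?_ (hcl a)
        rw [enorm_indicator_eq_indicator_enorm]
        exact indicator_le_self' (fun _ _ => zero_le) w
    · have : ∀ a, (B a).indicator (fun _ => c a) w = 0 := fun a => indicator_of_notMem (fun h0 => hwO (hsub a (hu a.2) (hB a (hu a.2) h0))) _
      simp only [g, indicator_of_mem (show w ∈ Oᶜ from hwO), this, tsum_zero, add_zero]
      rw [ENNReal.le_div_iff_mul_le (Or.inl (om_pos n)) (Or.inl (om_top n))]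
      refine (hw.trans (not_lt.1 hwO)).trans (le_mul_of_one_le_left zero_le (one_le_pow₀ (by norm_num)))
  · calc _ ≤ ∫⁻ w, (‖h w‖ₑ + ‖h w - g w‖ₑ) := lintegral_mono fun w => by
          have := enorm_sub_le (E := ℝ) (a := h w) (b := h w - g w)
          rwa [sub_sub_cancel] at this
      _ ≤ I + 2 * I := by rw [lintegral_add_left' hh.1.enorm]; exact add_le_add le_rfl hbe
      _ = _ := by ring
  · simp only [b]
    rw [integral_sub (hb1 a) (hb2 a), integral_indicator (hQm a), integral_indicator (hBm a), setIntegral_const, smul_eq_mul, Measure.real,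
      mul_inv_cancel_left₀ (toReal_pos (hv0 a) (hv1 a)).ne', sub_self]
  · simp only [b]
    rw [indicator_of_notMem (fun h0 => hx (hQs a h0)), indicator_of_notMem (fun h0 => hx (hB a (hu a.2) h0)), sub_zero]
theorem kk_lip (n : ℕ) : ∃ C : ℝ, 0 < C ∧ ∀ (c x y w : En n) (t r : ℝ), dist y x < t → 0 < r → 20 * r < dist x c →
    dist w c ≤ 5 * r → ‖kk (pt y t - pt w 0) - kk (pt y t - pt c 0)‖ ≤ C * pk n r (x - c) := by
  obtain ⟨C, hC, hb⟩ := (kk_HK n).fderiv.bound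
  refine ⟨C * 5 ^ (n + 1) * 5, by positivity, fun c x y w t r hy hr hx hw => ?_⟩
  have h1 : dist x c / 2 ≤ ‖pt y t - pt c 0‖ := by
    have e1 := fst_le_norm (pt y t - pt c 0)
    have e2 := snd_le_norm (pt y t - pt c 0)
    rw [pt_sub, sub_zero] at e1 e2
    rw [pt_fst] at e1
    rw [pt_snd] at e2
    rw [pt_sub, sub_zero]
    have := dist_triangle x y c
    rw [dist_comm x y, dist_eq_norm y c] at this
    have := le_abs_self t
    linarith
  have h2 : ∀ z ∈ closedBall (pt y t - pt c 0) (5 * r), (r + ‖x - c‖) / 5 ≤ ‖z‖ := fun z hz => by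
    rw [mem_closedBall, dist_comm, dist_eq_norm] at hz
    have := norm_sub_norm_le (pt y t - pt c 0) z
    rw [← dist_eq_norm x c]; linarith
  have h3 : ∀ z ∈ closedBall (pt y t - pt c 0) (5 * r), z ≠ 0 := fun z hz h0 => by
    have := h2 z hz
    rw [h0, norm_zero] at this
    linarith [norm_nonneg (x - c)]
  have h4 : ‖(pt y t - pt w 0) - (pt y t - pt c 0)‖ ≤ 5 * r := by
    rw [sub_sub_sub_cancel_left, pt_sub, sub_zero]
    refine (norm_pt_le _ _).trans ?_
    rw [abs_zero, add_zero, ← dist_eq_norm, dist_comm]; exact hw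
  have h5 := Convex.norm_image_sub_le_of_norm_fderiv_le (𝕜 := ℝ) (f := kk) (C := C * 5 ^ (n + 1) / (r + ‖x - c‖) ^ (n + 1))
    (fun z hz => ((kk_HK n).contAt (h3 z hz)).differentiableAt sm)
    (fun z hz => (hb z (h3 z hz)).trans ?_) (convex_closedBall _ _) (mem_closedBall_self pv) (y := pt y t - pt w 0)
    (by rw [mem_closedBall, dist_eq_norm]; exact h4)
  · refine h5.trans ((mul_le_mul_of_nonneg_left h4 pv).trans_eq ?_)
    rw [pk]; ring
  · have : C * 5 ^ (n + 1) / (r + ‖x - c‖) ^ (n + 1) = C * (((r + ‖x - c‖) / 5) ^ (n + 1))⁻¹ := by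
      rw [div_pow, inv_div]; ring
    rw [this]
    have := h2 z hz
    gcongr
theorem H8 (hn : 2 ≤ n) : ∃ C : ENNReal, C ≠ ⊤ ∧ ∀ h : En n → ℝ, Integrable h → ∀ l : ENNReal, l ≠ 0 → l ≠ ⊤ →
    volume {x | 2 * l < Fs h x} ≤ C * l⁻¹ * ∫⁻ x, ‖h x‖ₑ := by
  obtain ⟨C2, hC2, h7⟩ := H7 hn
  obtain ⟨C1, hC1, hlip⟩ := kk_lip n
  have hom := om_top n
  have hom' : (om n)⁻¹ ≠ ⊤ := inv_ne_top.2 (om_pos n)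
  refine ⟨20 ^ n * (5 ^ n * om n) + C2 * (25 ^ n / om n * 3) + ofReal C1 * (2 ^ (2 * n + 2) * om n) * 2, by
    rw [div_eq_mul_inv]; finiteness, fun h hh l hl hl' => ?_⟩
  obtain ⟨u, r, b, g, huc, hr, hv, hg, hgl, hgI, hbi, hb0, hbs, hbI, hsum⟩ := CZ hn hh hl hl'
  set I := ∫⁻ x, ‖h x‖ₑ
  have hI : I ≠ ⊤ := hh.2.ne
  have := huc.to_subtype
  set Bad : En n → ENNReal := fun x => ∑' a : u, ofReal (C1 * pk n (r a) (x - a)) * ∫⁻ w, ‖b a w‖ₑ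
  have hm : ∀ a : u, Measurable fun x : En n => ofReal (C1 * pk n (r a) (x - a)) := fun a => by
    have := (pk_cont n (hr a a.2)).measurable; fun_prop
  have hBm : Measurable Bad := Measurable.tsum fun a => (hm a).mul_const _
  have hBad : ∫⁻ x, Bad x ≤ ofReal C1 * (2 ^ (2 * n + 2) * om n) * 2 * I := by
    rw [lintegral_tsum fun a => ((hm a).mul_const _).aemeasurable, mul_assoc]
    refine le_trans ?_ (mul_le_mul_right hbI _)
    rw [← ENNReal.tsum_mul_left]
    refine tsum_le_tsum fun a => ?_
    rw [lintegral_mul_const _ (hm a)]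
    refine mul_le_mul_left ?_ _
    simp only [ofReal_mul hC1.le]
    rw [lintegral_const_mul' _ _ ofReal_ne_top, lintegral_sub_right_eq_self (fun x => ofReal (pk n (r a) x))]
    exact mul_le_mul_right (pk_tot (hr a a.2)) _
  have hpt : ∀ x : En n, (∀ a : u, 20 * r a < dist x (a : En n)) → Fs h x ≤ Fs g x + Bad x := fun x hx => by
    refine Fs_le h fun y t hyt => ?_
    have ht : 0 < t := lt_of_le_of_lt dist_nonneg hyt
    have hz : 0 < (pt y t).snd := ht
    have i1 : ∀ a, Integrable fun w => b a w • kk (pt y t - pt w 0) := fun a => Po_int (kk_HK n) (hbi a) hz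
    have i2 := Po_int (kk_HK n) hg hz
    obtain ⟨C3, hC3, hkb⟩ := (kk_HK n).bound'
    have i3 : Integrable fun w => h w - g w := hh.sub hg
    have e1 : Fp h (pt y t) = Fp g (pt y t) + ∫ w, (h w - g w) • kk (pt y t - pt w 0) := by
      rw [Fp, Fp, Po, Po, ← integral_add i2 (Po_int (kk_HK n) i3 hz)]
      congr 1; ext1 w; rw [← add_smul]; congr 1; ring
    have hsb : ∑' a, ∫⁻ w, ‖b a w‖ₑ ≠ ⊤ := ne_top_of_le_ne_top (by finiteness) hbI
    have e2 := hasSum_integral_of_summable_integral_norm i1 (by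
      refine Summable.of_nonneg_of_le (fun a => integral_nonneg fun _ => norm_nonneg _) (fun a => ?_)
        ((ENNReal.summable_toReal hsb).mul_left (C3 * (t ^ n)⁻¹))
      rw [← integral_norm_eq_lintegral_enorm (hbi a).1, ← integral_const_mul]
      refine integral_mono (i1 a).norm ((hbi a).norm.const_mul _) fun w => ?_
      simp only [norm_smul]
      rw [mul_comm]
      exact mul_le_mul_of_nonneg_right (hkb _ hz w) (norm_nonneg _))
    have e3 : ∀ w, ∑' a, b a w • kk (pt y t - pt w 0) = (h w - g w) • kk (pt y t - pt w 0) := fun w =>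
      ((hsum w).smul_const _).tsum_eq
    simp only [e3] at e2
    rw [e1, ← e2.tsum_eq]
    refine (enorm_add_le _ _).trans (add_le_add (le_Fs g hyt) (enorm_tsum_le_tsum_enorm.trans (tsum_le_tsum fun a => ?_)))
    have e4 : ∫ w, b a w • kk (pt y t - pt w 0) = ∫ w, b a w • (kk (pt y t - pt w 0) - kk (pt y t - pt a 0)) := by
      simp only [smul_sub]
      rw [integral_sub (i1 a) ((hbi a).smul_const _), integral_smul_const, hb0 a, zero_smul, sub_zero]
    rw [e4]
    refine (enorm_integral_le_lintegral_enorm _).trans ?_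
    rw [← lintegral_const_mul' _ _ ofReal_ne_top]
    refine lintegral_mono fun w => ?_
    rw [enorm_smul, mul_comm]
    by_cases hw : w ∈ closedBall (a : En n) (5 * r a)
    · refine mul_le_mul_left ?_ _
      rw [← ofReal_norm_eq_enorm]
      exact ofReal_le_ofReal (hlip a x y w t (r a) hyt (hr a a.2) (hx a) hw)
    · rw [hbs a w hw]; simp
  have hsub : {x | 2 * l < Fs h x} ⊆ (⋃ a : u, closedBall (a : En n) (20 * r a)) ∪ ({x | l ^ 2 ≤ Fs g x ^ 2} ∪ {x | l ≤ Bad x}) := by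
    intro x hx
    by_contra H
    simp only [mem_union, mem_iUnion, not_or, not_exists, mem_closedBall, not_le, Set.mem_ofPred_eq] at H
    have h1 : 2 * l < _ := lt_of_lt_of_le hx (hpt x H.1)
    have h2 : Fs g x ≤ l := by
      by_contra h0
      exact absurd (pow_le_pow_left' (not_le.1 h0).le 2) (not_le.2 H.2.1)
    rw [two_mul] at h1
    exact absurd (add_le_add h2 H.2.2.le) (not_le.2 h1)
  refine (measure_mono hsub).trans ((measure_union_le _ _).trans ((add_le_add le_rfl (measure_union_le _ _)).trans ?_))
  rw [add_mul, add_mul, add_mul, add_mul, add_assoc]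
  refine add_le_add ?_ (add_le_add ?_ ?_)
  · refine (measure_iUnion_le _).trans ?_
    have : ∀ a : u, volume (closedBall (a : En n) (20 * r a)) = 20 ^ n * volume (closedBall (a : En n) (r a)) := fun a => by
      have := hr a a.2
      rw [vol_cball _ pv, vol_cball _ this.le, mul_pow, ofReal_mul pv, ofReal_pow (by norm_num), mul_assoc]
      simp
    simp only [this]
    rw [ENNReal.tsum_mul_left]
    exact (mul_le_mul_right hv _).trans_eq (by ring)
  · refine (meas_ge_le_lintegral_div ((Fs_meas g).pow_const 2).aemeasurable (by simpa using hl) (by finiteness)).trans ?_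
    have h1 : ∫⁻ x, ‖g x‖ₑ ^ 2 ≤ (25 ^ n * l / om n) * (3 * I) := by
      refine le_trans ?_ (mul_le_mul_right hgI _)
      rw [← lintegral_const_mul'' _ hg.1.enorm]
      refine lintegral_mono_ae (hgl.mono fun w hw => ?_)
      rw [sq]; exact mul_le_mul_left hw _
    refine (ENNReal.div_le_div_right ((h7 g hg).trans (mul_le_mul_right h1 _)) _).trans_eq ?_
    simp only [div_eq_mul_inv, sq, ENNReal.mul_inv (Or.inl hl) (Or.inl hl')]
    calc _ = C2 * (25 ^ n * (om n)⁻¹ * 3) * (l * l⁻¹) * l⁻¹ * I := by ring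
      _ = _ := by rw [ENNReal.mul_inv_cancel hl hl', mul_one]
  · refine (meas_ge_le_lintegral_div hBm.aemeasurable hl hl').trans ((ENNReal.div_le_div_right hBad _).trans_eq ?_)
    rw [div_eq_mul_inv]; ring
noncomputable def pp (n : ℕ) (t : ℝ) (v : En n) : ℝ := t / ‖pt v t‖ ^ (n + 1)
noncomputable def cP (n : ℕ) : ℝ := ∫ v, pp n 1 v
theorem pt_ne (ht : 0 < t) (v : En n) : 0 < ‖pt v t‖ := by
  have := snd_le_norm (pt v t); rw [pt_snd, abs_of_pos ht] at this; linarith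
theorem pp_nonneg (ht : 0 < t) (v : En n) : 0 ≤ pp n t v := by unfold pp; positivity
theorem pp_cont (ht : 0 < t) : Continuous (pp n t) :=
  continuous_const.div ((cont_pt.comp (continuous_id.prodMk continuous_const)).norm.pow _) fun v => (pow_pos (pt_ne ht v) _).ne'
theorem pk_nonneg (ht : 0 < t) (v : En n) : 0 ≤ pk n t v := by unfold pk; positivity
theorem pk_integrable (n : ℕ) {t : ℝ} (ht : 0 < t) : Integrable (pk n t) :=
  ⟨(pk_cont n ht).aestronglyMeasurable, by
    refine lt_of_le_of_lt (lintegral_mono fun v => ?_) (lt_of_le_of_lt (pk_tot (n := n) ht) (by have := om_top n; finiteness))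
    rw [enorm_of_nonneg (pk_nonneg ht v)]⟩
theorem dom_pk {g : En n → ℝ} {t C : ℝ} (ht : 0 < t) (hg : Measurable g) (hb : ∀ v, |g v| ≤ C * pk n t v) : Integrable g :=
  ((pk_integrable n ht).const_mul C).mono' hg.aestronglyMeasurable (ae_of_all _ hb)
theorem pp_le (ht : 0 < t) (v : En n) : |pp n t v| ≤ 2 ^ (n + 1) * pk n t v := by
  rw [abs_of_nonneg (pp_nonneg ht v)]; exact le_pk ht v
theorem pp_integrable (ht : 0 < t) : Integrable (pp n t) := dom_pk ht (pp_cont ht).measurable (pp_le ht)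
theorem pp_tot (ht : 0 < t) : ∫ v, pp n t v = cP n := by
  have h1 := Measure.integral_comp_smul (volume : Measure (En n)) (pp n 1) t⁻¹
  have h2 : ∀ v, pp n 1 (t⁻¹ • v) = t ^ n * pp n t v := fun v => by
    have : pt v t = t • pt (t⁻¹ • v) 1 := by
      refine ofLp_injective _ (Prod.ext ?_ ?_)
      · change v = t • t⁻¹ • v; rw [smul_inv_smul₀ ht.ne']
      · change t = t * 1; ring
    rw [pp, pp, this, norm_smul, mul_pow, norm_of_nonneg ht.le]
    have := pt_ne one_pos (t⁻¹ • v); field_simp; ring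
  simp only [h2] at h1
  rw [integral_const_mul, finrank_euclideanSpace_fin, inv_pow, inv_inv, abs_of_nonneg pv, smul_eq_mul] at h1
  exact mul_left_cancel₀ pv h1
theorem cP_pos (n : ℕ) : 0 < cP n := by
  refine (integral_pos_iff_support_of_nonneg (pp_nonneg one_pos) (pp_integrable one_pos)).2 ?_
  rw [Function.support_eq_univ fun v => by rw [pp]; have := pt_ne one_pos v; positivity]
  exact (isOpen_univ.measure_pos volume univ_nonempty)
theorem ker_lim (hh : Integrable h) {c C : ℝ} {κ : ℝ → En n → ℝ} (hm : ∀ t, 0 < t → Measurable (κ t))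
    (hb : ∀ t, 0 < t → ∀ v, |κ t v| ≤ C * pk n t v) (hc : ∀ t, 0 < t → ∫ v, κ t v = c) {x : En n}
    (hx : Tendsto (fun t => ∫⁻ w, ofReal (pk n t (x - w)) * ‖h w - h x‖ₑ) (𝓝[>] 0) (𝓝 0)) :
    Tendsto (fun t => ∫ w, h w * κ t (x - w)) (𝓝[>] 0) (𝓝 (c * h x)) := by
  rw [tendsto_iff_edist_tendsto_0]
  have h1 := ENNReal.Tendsto.const_mul (a := ofReal C) hx (Or.inr ofReal_ne_top)
  rw [mul_zero] at h1
  refine tendsto_of_tendsto_of_tendsto_of_le_of_le' tendsto_const_nhds h1 (Eventually.of_forall fun _ => zero_le) ?_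
  filter_upwards [self_mem_nhdsWithin] with t ht
  replace ht : 0 < t := ht
  have hpk : ∀ v, pk n t v ≤ (t ^ n)⁻¹ := fun v => by
    rw [pk, inv_eq_one_div, div_le_div_iff₀ pv pv, pow_succ]
    have : t ^ n * t ≤ (t + ‖v‖) ^ n * (t + ‖v‖) := by gcongr <;> linarith [norm_nonneg v]
    linarith
  have hC : 0 ≤ C := by
    have := (abs_nonneg _).trans (hb t ht 0)
    exact nonneg_of_mul_nonneg_left this (by rw [pk, norm_zero]; positivity)
  have i1 : Integrable fun w => κ t (x - w) := (dom_pk ht (hm t ht) (hb t ht)).comp_sub_left x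
  have i2 : Integrable fun w => h w * κ t (x - w) := hh.mul_bdd (c := C * (t ^ n)⁻¹) i1.1
    (ae_of_all _ fun w => (hb t ht _).trans (mul_le_mul_of_nonneg_left (hpk _) hC))
  have e1 : c * h x = ∫ w, h x * κ t (x - w) := by
    rw [integral_const_mul, integral_sub_left_eq_self (fun w => κ t w), hc t ht, mul_comm]
  rw [e1, edist_eq_enorm_sub, ← integral_sub i2 (i1.const_mul _), ← lintegral_const_mul' _ _ ofReal_ne_top]
  refine (enorm_integral_le_lintegral_enorm _).trans (lintegral_mono fun w => ?_)
  rw [← sub_mul, enorm_mul, mul_comm, ← mul_assoc, ← ofReal_mul hC]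
  refine mul_le_mul_left ?_ _
  rw [enorm_eq_ofReal_abs]
  exact ofReal_le_ofReal (hb t ht _)
theorem Fp_snd' (hh : Integrable h) (ht : 0 < t) (x : En n) : (Fp h (pt x t)).snd = ∫ w, h w * pp n t (x - w) := by
  rw [Fp_snd hh (show 0 < (pt x t).snd from ht)]
  simp only [pt_sub, sub_zero, pp, pt_snd]
theorem Fp_fst (hh : Integrable h) (ht : 0 < t) (x : En n) (j : Fin n) :
    (Fp h (pt x t)).fst j = ∫ w, h w * ((x - w) j / ‖pt (x - w) t‖ ^ (n + 1)) := by
  have hv : ∀ z : Vn n, ⟪pt (single j 1) 0, z⟫_ℝ = z.fst j := fun z => by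
    rw [inner_V, pt_fst, pt_snd, EuclideanSpace.inner_single_left]; simp
  rw [← hv, Fp_inner hh (show 0 < (pt x t).snd from ht)]
  refine integral_congr_ae (ae_of_all _ fun w => ?_)
  simp only [hv, kk, pt_sub, sub_zero]
  change h w * ((‖pt (x - w) t‖ ^ (n + 1))⁻¹ * (x - w) j) = _
  ring
noncomputable def Dk (j : Fin n) (t : ℝ) (v : En n) : ℝ := {y : En n | t < ‖y‖}.indicator (fun y => y j / ‖y‖ ^ (n + 1)) v - v j / ‖pt v t‖ ^ (n + 1)
theorem abs_coord (v : En n) (j : Fin n) : |v j| ≤ ‖v‖ := by simpa using PiLp.norm_apply_le v j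
theorem Dk_le (j : Fin n) (ht : 0 < t) (v : En n) : |Dk j t v| ≤ ((n + 1) * 2 ^ (n + 1)) * pk n t v := by
  have hN := pt_ne ht v
  have hv := abs_coord v j
  by_cases h : t < ‖v‖
  · have h0 : 0 < ‖v‖ := ht.trans h
    have e1 : Dk j t v = v j * ((‖v‖ ^ (n + 1))⁻¹ * (1 - (‖v‖ / ‖pt v t‖) ^ (n + 1))) := by
      rw [Dk, indicator_of_mem (show v ∈ {y : En n | t < ‖y‖} from h), div_pow]; field_simp
    have h1 : ‖v‖ / ‖pt v t‖ ≤ 1 := (div_le_one hN).2 (by simpa [pt_fst] using fst_le_norm (pt v t))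
    have h2 : 1 - ‖v‖ / ‖pt v t‖ ≤ t / ‖v‖ := by
      have e3 := norm_pt_le v t
      rw [abs_of_pos ht] at e3
      rw [sub_le_iff_le_add, ← sub_le_iff_le_add', le_div_iff₀ hN]
      calc _ ≤ (1 - t / ‖v‖) * (‖v‖ + t) := mul_le_mul_of_nonneg_left e3 (by rw [sub_nonneg, div_le_one h0]; exact h.le)
        _ = ‖v‖ - t * (t / ‖v‖) := by field_simp; ring
        _ ≤ _ := sub_le_self _ pv
    have h0' : 0 ≤ ‖v‖ / ‖pt v t‖ := by positivity
    have h3 := one_add_mul_le_pow (a := ‖v‖ / ‖pt v t‖ - 1) (by linarith) (n + 1)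
    have h4 : 1 - (‖v‖ / ‖pt v t‖) ^ (n + 1) ≤ (n + 1) * (t / ‖v‖) := by
      rw [add_sub_cancel] at h3; push_cast at h3
      nlinarith
    have h5 : 0 ≤ 1 - (‖v‖ / ‖pt v t‖) ^ (n + 1) := sub_nonneg.2 (pow_le_one₀ pv h1)
    rw [e1, abs_mul, abs_of_nonneg (mul_nonneg pv h5)]
    calc _ ≤ ‖v‖ * ((‖v‖ ^ (n + 1))⁻¹ * ((n + 1) * (t / ‖v‖))) := by gcongr
      _ = (n + 1) * (t * (‖v‖⁻¹) ^ (n + 1)) := by rw [inv_pow]; field_simp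
      _ ≤ (n + 1) * (t * (2 / (t + ‖v‖)) ^ (n + 1)) := by
        gcongr
        rw [inv_eq_one_div, div_le_div_iff₀ h0 pv]; linarith
      _ = _ := by rw [pk, div_pow]; ring
  · rw [Dk, indicator_of_notMem (show v ∉ {y : En n | t < ‖y‖} from h), zero_sub, abs_neg, abs_div, abs_of_nonneg (show 0 ≤ ‖pt v t‖ ^ (n + 1) by positivity)]
    calc _ ≤ t / ‖pt v t‖ ^ (n + 1) := by gcongr; linarith
      _ ≤ 1 * 2 ^ (n + 1) * pk n t v := by rw [one_mul]; exact le_pk ht v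
      _ ≤ _ := by
        have := pk_nonneg ht v
        gcongr; linarith [(n.cast_nonneg : (0 : ℝ) ≤ n)]
theorem coord_cont (j : Fin n) : Continuous fun v : En n => v j := (proj (𝕜 := ℝ) j).continuous
theorem Dk_meas (j : Fin n) : Measurable (Dk j t) := by
  refine Measurable.sub (Measurable.indicator ?_ (measurableSet_lt measurable_const measurable_norm)) ?_
  · exact (coord_cont j).measurable.div (measurable_norm.pow_const _)
  · exact (coord_cont j).measurable.div ((cont_pt.comp (continuous_id.prodMk continuous_const)).norm.measurable.pow_const _)
theorem Dk_odd (j : Fin n) (t : ℝ) : ∫ v, Dk j t v = 0 := by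
  have h1 : ∀ v : En n, Dk j t (-v) = - Dk j t v := fun v => by
    have e : ‖pt (-v) t‖ = ‖pt v t‖ := by
      rw [← sq_eq_sq₀ (norm_nonneg _) (norm_nonneg _), norm_pt, norm_pt, norm_neg]
    have e2 : (-v) j = - v j := rfl
    by_cases h : t < ‖v‖
    · rw [Dk, Dk, indicator_of_mem (show v ∈ {y : En n | t < ‖y‖} from h), indicator_of_mem (show -v ∈ {y : En n | t < ‖y‖} by simpa using h), e, e2, norm_neg]; ring
    · rw [Dk, Dk, indicator_of_notMem (show v ∉ {y : En n | t < ‖y‖} from h), indicator_of_notMem (show -v ∉ {y : En n | t < ‖y‖} by simpa using h), e, e2]; ring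
  have h2 := integral_neg_eq_self (Dk j t) (volume : Measure (En n))
  simp only [h1] at h2
  rw [integral_neg] at h2; linarith
theorem PV_diff (hh : Integrable h) (j : Fin n) (ht : 0 < t) (x : En n) :
    ∫ w, h w * Dk j t (x - w) = (∫ y in {y : En n | t < ‖y‖}, (y j / ‖y‖ ^ (n + 1)) * h (x - y)) - (Fp h (pt x t)).fst j := by
  have hms : MeasurableSet {y : En n | t < ‖y‖} := measurableSet_lt measurable_const measurable_norm
  have e1 : ∫ y in {y : En n | t < ‖y‖}, (y j / ‖y‖ ^ (n + 1)) * h (x - y) =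
      ∫ w, h w * {y : En n | t < ‖y‖}.indicator (fun y => y j / ‖y‖ ^ (n + 1)) (x - w) := by
    rw [← integral_indicator hms, ← integral_sub_left_eq_self _ volume x]
    refine integral_congr_ae (ae_of_all _ fun w => ?_)
    simp only [indicator_apply]
    split_ifs <;> simp [mul_comm]
  rw [e1, Fp_fst hh ht, ← integral_sub]
  · simp only [Dk, mul_sub]
  · refine hh.mul_bdd (c := (t ^ n)⁻¹) ?_ (ae_of_all _ fun w => ?_)
    · exact (((coord_cont j).measurable.div (measurable_norm.pow_const _)).indicator hms |>.comp (measurable_const.sub measurable_id)).aestronglyMeasurable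
    · by_cases h : t < ‖x - w‖
      · rw [indicator_of_mem (show x - w ∈ {y : En n | t < ‖y‖} from h), norm_div, norm_eq_abs, norm_pow, norm_norm]
        have h0 := ht.trans h
        calc _ ≤ ‖x - w‖ / ‖x - w‖ ^ (n + 1) := by gcongr; exact abs_coord _ j
          _ = (‖x - w‖ ^ n)⁻¹ := by rw [pow_succ]; field_simp
          _ ≤ _ := by gcongr
      · rw [indicator_of_notMem (show x - w ∉ {y : En n | t < ‖y‖} from h), norm_zero]; positivity
  · refine hh.mul_bdd (c := (t ^ n)⁻¹) ?_ (ae_of_all _ fun w => ?_)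
    · exact ((coord_cont j).measurable.div ((cont_pt.comp (continuous_id.prodMk continuous_const)).norm.measurable.pow_const _)
        |>.comp (measurable_const.sub measurable_id)).aestronglyMeasurable
    · have h0 := pt_ne ht (x - w)
      have h1 : t ≤ ‖pt (x - w) t‖ := by simpa [pt_snd, abs_of_pos ht] using snd_le_norm (pt (x - w) t)
      rw [norm_div, norm_eq_abs, norm_pow, norm_norm]
      calc _ ≤ ‖pt (x - w) t‖ / ‖pt (x - w) t‖ ^ (n + 1) := by
            gcongr; exact (abs_coord _ j).trans (by simpa [pt_fst] using fst_le_norm (pt (x - w) t))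
        _ = (‖pt (x - w) t‖ ^ n)⁻¹ := by rw [pow_succ]; field_simp
        _ ≤ _ := by gcongr
theorem Fp_sub {h f : En n → ℝ} (hh : Integrable h) (hf : Integrable f) (hz : 0 < z.snd) :
    Fp (fun x => h x - f x) z = Fp h z - Fp f z := by
  simp only [Fp, Po, sub_smul]
  exact integral_sub (Po_int (kk_HK n) hh hz) (Po_int (kk_HK n) hf hz)
theorem Fp_diff (hh : Integrable h) (hz : 0 < z.snd) : HasFDerivAt (Fp h) (fderiv ℝ (Fp h) z) z :=
  ((Fp_smoothAt hh hz).differentiableAt sm).hasFDerivAt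
theorem inner_j (j : Fin n) (z : Vn n) : ⟪pt (single j 1) 0, z⟫_ℝ = z.fst j := by
  rw [inner_V, pt_fst, pt_snd, EuclideanSpace.inner_single_left]; simp
theorem norm_j (j : Fin n) : ‖(pt (single j 1) 0 : Vn n)‖ ≤ 1 := by
  refine (norm_pt_le _ _).trans ?_; simp
theorem u_lip {f : En n → ℝ} (hf : Integrable f) {L : ℝ} (hL : ∀ x y, |f x - f y| ≤ L * ‖x - y‖) (ht : 0 < t) (x y : En n) :
    |(Fp f (pt x t)).snd - (Fp f (pt y t)).snd| ≤ cP n * L * ‖x - y‖ := by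
  have e : ∀ x : En n, (Fp f (pt x t)).snd = ∫ w, f (x - w) * pp n t w := fun x => by
    rw [Fp_snd' hf ht, ← integral_sub_left_eq_self _ volume x]; simp
  have hi : ∀ x : En n, Integrable fun w => f (x - w) * pp n t w := fun x => by
    refine (hf.comp_sub_left x).mul_bdd (c := (t ^ n)⁻¹) (pp_cont ht).aestronglyMeasurable (ae_of_all _ fun w => ?_)
    have h1 : t ≤ ‖pt w t‖ := by simpa [pt_snd, abs_of_pos ht] using snd_le_norm (pt w t)
    rw [norm_of_nonneg (pp_nonneg ht w), pp]
    calc _ ≤ t / t ^ (n + 1) := by gcongr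
      _ = _ := by rw [pow_succ]; field_simp
  rw [e, e, ← integral_sub (hi x) (hi y), ← pp_tot ht, mul_assoc, ← integral_mul_const]
  refine (norm_integral_le_integral_norm (G := ℝ) _).trans (integral_mono_of_nonneg (ae_of_all _ fun w => norm_nonneg _) ((pp_integrable ht).mul_const _) (ae_of_all _ fun w => ?_))
  change ‖f (x - w) * pp n t w - f (y - w) * pp n t w‖ ≤ pp n t w * (L * ‖x - y‖)
  rw [← sub_mul, norm_mul, mul_comm, norm_of_nonneg (pp_nonneg ht w)]
  refine mul_le_mul_of_nonneg_left ?_ (pp_nonneg ht w)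
  simpa using hL (x - w) (y - w)
theorem vert_lip {f : En n → ℝ} (hf : Integrable f) {L : NNReal} (hL : LipschitzWith L f) (x : En n) (j : Fin n) :
    ∃ l, Tendsto (fun t => (Fp f (pt x t)).fst j) (𝓝[>] 0) (𝓝 l) := by
  have hc := (cP_pos n).le
  set M : NNReal := ⟨cP n, hc⟩ * L
  set a : Vn n := pt (single j 1) 0
  have hd : ∀ t ∈ Ioi (0 : ℝ), HasDerivWithinAt (fun t => (Fp f (pt x t)).fst j) ⟪a, fderiv ℝ (Fp f) (pt x t) (pt 0 1)⟫_ℝ (Ioi 0) t := fun t ht => by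
    have h1 : HasDerivAt (fun t : ℝ => (pt x t : Vn n)) (pt 0 1) t := by
      have : (fun t : ℝ => (pt x t : Vn n)) = fun t => pt x 0 + t • pt 0 1 := by
        ext1 t; refine ofLp_injective _ (Prod.ext ?_ ?_)
        · change x = x + t • 0; simp
        · change t = 0 + t * 1; simp
      rw [this]; simpa using ((hasDerivAt_id t).smul_const (pt 0 1 : Vn n)).const_add (pt x 0)
    have h2 := (Fp_diff hf (show 0 < (pt x t).snd from ht)).comp_hasDerivAt t h1
    have h3 := ((innerSL ℝ a).hasFDerivAt.comp_hasDerivAt t h2).hasDerivWithinAt (s := Ioi 0)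
    refine h3.congr (fun s _ => ?_) ?_ <;> simp [a, inner_j]
  have hb : ∀ t ∈ Ioi (0 : ℝ), ‖⟪a, fderiv ℝ (Fp f) (pt x t) (pt 0 1)⟫_ℝ‖₊ ≤ M := fun t ht => by
    have hz : 0 < (pt x t).snd := ht
    rw [← NNReal.coe_le_coe, coe_nnnorm, ← Fp_sym hf hz, real_inner_comm, inner_e]
    have h1 : HasDerivAt (fun s : ℝ => (pt (x + s • single j 1) t : Vn n)) a 0 := by
      have : (fun s : ℝ => (pt (x + s • single j 1) t : Vn n)) = fun s => pt x t + s • a := by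
        ext1 s; refine ofLp_injective _ (Prod.ext rfl ?_)
        change t = t + s * 0; simp
      rw [this]; simpa using ((hasDerivAt_id (0 : ℝ)).smul_const a).const_add (pt x t)
    have h2 := HasFDerivAt.comp_hasDerivAt (l := Fp f) (l' := fderiv ℝ (Fp f) (pt x t)) (f := fun s : ℝ => (pt (x + s • single j 1) t : Vn n)) 0 (by simpa using Fp_diff hf hz) h1
    have h3 := (innerSL ℝ (pt 0 1)).hasFDerivAt.comp_hasDerivAt (0 : ℝ) h2
    have h4 : LipschitzWith M fun s : ℝ => (Fp f (pt (x + s • single j 1) t)).snd := by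
      refine LipschitzWith.of_dist_le_mul fun s s' => ?_
      rw [dist_eq]
      refine (u_lip hf (L := L) (fun x y => by simpa [dist_eq, dist_eq_norm] using hL.dist_le_mul x y) ht _ _).trans (le_of_eq ?_)
      have : M = cP n * (L : ℝ) := rfl
      rw [this, add_sub_add_left_eq_sub, ← sub_smul, norm_smul]; simp [dist_eq]
    have h5 := HasDerivAt.le_of_lipschitz (h3.congr_of_eventuallyEq (f₁ := fun s : ℝ => (Fp f (pt (x + s • single j 1) t)).snd) (Eventually.of_forall fun s => by simp [inner_e])) h4
    simpa [inner_e] using h5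
  obtain ⟨g, hg, he⟩ := ((convex_Ioi (0 : ℝ)).lipschitzOnWith_of_nnnorm_hasDerivWithin_le hd hb).extend_real
  exact ⟨g 0, ((hg.continuous.tendsto 0).mono_left nhdsWithin_le_nhds).congr' (eventually_nhdsWithin_of_forall fun t ht => (he ht).symm)⟩
theorem vert_lim (hn : 2 ≤ n) (hh : Integrable h) (j : Fin n) :
    ∀ᵐ x, ∃ l, Tendsto (fun t => (Fp h (pt x t)).fst j) (𝓝[>] 0) (𝓝 l) := by
  obtain ⟨C, hC, H⟩ := H8 hn
  have key : ∀ k : ℕ, ∀ᵐ x, ∃ l, ∀ᶠ t in 𝓝[>] (0 : ℝ), |(Fp h (pt x t)).fst j - l| ≤ 3 * (1 / ((k : ℝ) + 1)) := fun k => by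
    set e : ℝ := 1 / ((k : ℝ) + 1)
    have he : 0 < e := by positivity
    refine le_antisymm (ENNReal.le_of_forall_pos_le_add fun η hη _ => ?_) zero_le
    set l : ENNReal := ofReal e
    have hl : l ≠ 0 := by simpa [l] using he
    have hD0 : C * l⁻¹ ≠ ⊤ := mul_ne_top hC (inv_ne_top.2 hl)
    obtain ⟨θ, hθ, hθ'⟩ : ∃ θ : ℝ, 0 < θ ∧ C * l⁻¹ * ofReal θ ≤ η := by
      refine ⟨(η / ((C * l⁻¹).toNNReal + 1) : NNReal), by positivity, ?_⟩
      rw [← ENNReal.coe_toNNReal hD0, ofReal_coe_nnreal, ← ENNReal.coe_mul, ENNReal.coe_le_coe, mul_div_left_comm]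
      refine mul_le_of_le_one_right' ((div_le_one pv).2 sm)
    obtain ⟨f, hf1, hf2, hf3⟩ := MemLp.exist_eLpNorm_sub_le (p := 1) sm le_rfl (memLp_one_iff_integrable.2 hh) hθ
    have hfi : Integrable f := hf2.continuous.integrable_of_hasCompactSupport hf1
    obtain ⟨L, hL⟩ := ContDiff.lipschitzWith_of_hasCompactSupport hf1 hf2 sm
    rw [eLpNorm_one_eq_lintegral_enorm] at hf3
    rw [zero_add]
    refine (measure_mono fun x hx => ?_).trans ((H _ (hh.sub hfi) l hl ofReal_ne_top).trans ((mul_le_mul_right hf3 _).trans hθ'))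
    change ¬ _ at hx
    change 2 * l < _
    by_contra h0
    refine hx ?_
    obtain ⟨m, hm⟩ := vert_lip hfi hL x j
    refine ⟨m, ?_⟩
    filter_upwards [self_mem_nhdsWithin, (tendsto_order.1 hm).1 (m - e) (by linarith), (tendsto_order.1 hm).2 (m + e) (by linarith)] with t ht h1 h2
    have hz : 0 < (pt x t).snd := ht
    have h3 : ‖Fp (h - f) (pt x t)‖ₑ ≤ 2 * l := (le_Fs _ (by simpa using ht)).trans (not_lt.1 h0)
    have h4 : ‖Fp h (pt x t) - Fp f (pt x t)‖ ≤ 2 * e := by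
      rw [← Fp_sub hh hfi hz, ← ofReal_le_ofReal_iff pv, ofReal_norm_eq_enorm, ofReal_mul sm, ofReal_ofNat]
      exact h3
    have h5 := (abs_coord _ j).trans ((fst_le_norm _).trans h4)
    rw [sub_fst] at h5
    change |(Fp h (pt x t)).fst j - (Fp f (pt x t)).fst j| ≤ _ at h5
    rw [abs_le] at h5 ⊢; constructor <;> linarith
  filter_upwards [ae_all_iff.2 key] with x hx
  refine cauchy_map_iff_exists_tendsto.1 (Metric.cauchy_iff.2 ⟨inferInstance, fun ε hε => ?_⟩)
  obtain ⟨k, hk⟩ := exists_nat_one_div_lt (show 0 < ε / 7 by positivity)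
  obtain ⟨l, hl⟩ := hx k
  refine ⟨_, image_mem_map hl, ?_⟩
  rintro _ ⟨s, hs, rfl⟩ _ ⟨t, ht, rfl⟩
  have h1 : |(Fp h (pt x s)).fst j - l| ≤ _ := hs
  have h2 : |(Fp h (pt x t)).fst j - l| ≤ _ := ht
  have h3 := abs_sub_le ((Fp h (pt x s)).fst j) l ((Fp h (pt x t)).fst j)
  rw [abs_sub_comm l] at h3
  rw [dist_eq]; linarith
noncomputable def F0 (h : En n → ℝ) (x : En n) : Vn n := pt (toLp 2 fun j => rieszTransform n h j x) (cP n * h x)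
theorem H9 (hn : 2 ≤ n) (hh : Integrable h) :
    ∀ᵐ x, Tendsto (fun t => Fp h (pt x t)) (𝓝[>] 0) (𝓝 (F0 h x)) := by
  filter_upwards [LP_pk hh, ae_all_iff.2 (vert_lim hn hh)] with x hx hl
  have h1 : Tendsto (fun t => (Fp h (pt x t)).snd) (𝓝[>] 0) (𝓝 (cP n * h x)) :=
    (ker_lim hh (fun t ht => (pp_cont ht).measurable) (fun t ht => pp_le ht) (fun t ht => pp_tot ht) hx).congr'
      (eventually_nhdsWithin_of_forall fun t ht => (Fp_snd' hh ht x).symm)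
  have h2 : ∀ j, Tendsto (fun t => (Fp h (pt x t)).fst j) (𝓝[>] 0) (𝓝 (rieszTransform n h j x)) := fun j => by
    obtain ⟨l, hl⟩ := hl j
    have h3 := ker_lim hh (fun t _ => Dk_meas j (t := t)) (fun t ht => Dk_le j ht) (fun t ht => Dk_odd j t) hx
    rw [zero_mul] at h3
    have h4 : Tendsto (fun t => ∫ y in {y : En n | t < ‖y‖}, (y j / ‖y‖ ^ (n + 1)) * h (x - y)) (𝓝[>] 0) (𝓝 l) := by
      have := h3.add hl
      rw [zero_add] at this
      exact this.congr' (eventually_nhdsWithin_of_forall fun t ht => by rw [PV_diff hh j ht]; ring)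
    rw [rieszTransform, h4.limUnder_eq]; exact hl
  have h3 : Tendsto (fun t => (Fp h (pt x t)).fst) (𝓝[>] 0) (𝓝 (toLp 2 fun j => rieszTransform n h j x)) :=
    ((PiLp.continuous_toLp 2 _).tendsto _).comp (tendsto_pi_nhds.2 h2)
  exact (cont_pt.tendsto (_, _)).comp (h3.prodMk_nhds h1)
theorem Fs_q (hn : 2 ≤ n) (hh : Integrable h) : ∃ g : En n → ENNReal, Measurable g ∧ (∀ x, Fs h x ^ qq n ≤ 1 + g x) ∧ ∫⁻ x, g x ≠ ⊤ := by
  obtain ⟨C, hC, H⟩ := H8 hn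
  have hq := qq_pos hn
  have hq1 := qq_lt hn
  set φ : ℝ → ENNReal := fun l => ofReal (qq n * l ^ (qq n - 1))
  have hφ : Measurable φ := by fun_prop
  have hms : MeasurableSet {p : En n × ℝ | ofReal p.2 < Fs h p.1} :=
    measurableSet_lt (ENNReal.measurable_ofReal.comp measurable_snd) ((Fs_meas h).comp measurable_fst)
  have hjm : Measurable fun p : En n × ℝ => φ p.2 * (if ofReal p.2 < Fs h p.1 then 1 else 0) :=
    (hφ.comp measurable_snd).mul (Measurable.ite hms measurable_const measurable_const)
  refine ⟨fun x => ∫⁻ l in Ioi (1 : ℝ), φ l * (if ofReal l < Fs h x then 1 else 0), hjm.lintegral_prod_right', fun x => ?_, ?_⟩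
  · have h1 := layer hq 1
    rw [ENNReal.one_rpow, ← Ioc_union_Ioi_eq_Ioi zero_le_one, lintegral_union measurableSet_Ioi (Ioc_disjoint_Ioi le_rfl)] at h1
    rw [layer hq, ← Ioc_union_Ioi_eq_Ioi zero_le_one, lintegral_union measurableSet_Ioi (Ioc_disjoint_Ioi le_rfl)]
    refine add_le_add_left ((lintegral_mono_ae ?_).trans (le_self_add.trans h1.ge)) _
    have : ∀ᵐ l : ℝ ∂volume.restrict (Ioc 0 1), l ≠ 1 := ae_restrict_of_ae (Measure.ae_ne volume 1)
    filter_upwards [this, ae_restrict_mem measurableSet_Ioc] with l h2 h3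
    refine mul_le_mul_right ?_ _
    rw [if_pos (show ofReal l < 1 by rw [ENNReal.ofReal_lt_one]; exact lt_of_le_of_ne h3.2 h2)]
    split_ifs <;> simp
  · rw [lintegral_lintegral_swap (f := fun x l => φ l * (if ofReal l < Fs h x then 1 else 0)) hjm.aemeasurable]
    refine ne_top_of_le_ne_top (b := ∫⁻ l in Ioi (1 : ℝ), ofReal (l ^ (qq n - 2)) * (ofReal (qq n) * (C * 2 * ∫⁻ x, ‖h x‖ₑ))) ?_ (setLIntegral_mono (by fun_prop) fun l hl => ?_)
    · rw [lintegral_mul_const _ (by fun_prop)]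
      have h1 : Integrable (fun l : ℝ => l ^ (qq n - 2)) (volume.restrict (Ioi 1)) := integrableOn_Ioi_rpow_of_lt (by linarith) one_pos
      have h2 := hh.2.ne
      have h3 : ∫⁻ l in Ioi (1 : ℝ), ofReal (l ^ (qq n - 2)) ≠ ⊤ := h1.lintegral_lt_top.ne
      finiteness
    · replace hl : 1 < l := hl
      have hl0 : 0 < l := by linarith
      rw [lintegral_const_mul _ (Measurable.ite (measurableSet_lt measurable_const (Fs_meas h)) measurable_const measurable_const)]
      have e : ∫⁻ x, (if ofReal l < Fs h x then 1 else 0) = volume {x | ofReal l < Fs h x} := by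
        rw [← lintegral_indicator_one (measurableSet_lt measurable_const (Fs_meas h))]
        refine lintegral_congr fun x => ?_; simp [indicator_apply]
      have h1 := H h hh (ofReal (l / 2)) (by simpa using hl0) ofReal_ne_top
      rw [show 2 * ofReal (l / 2) = ofReal l by
        rw [← ofReal_ofNat, ← ofReal_mul (by norm_num)]; congr 1; ring] at h1
      rw [e]
      refine (mul_le_mul_right h1 _).trans (le_of_eq ?_)
      have e2 : ofReal (qq n * l ^ (qq n - 1)) * (ofReal (l / 2))⁻¹ = ofReal (l ^ (qq n - 2)) * ofReal (qq n) * 2 := by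
        rw [← ofReal_inv_of_pos pv, ← ofReal_mul pv, ← ofReal_mul pv, ← ofReal_ofNat, ← ofReal_mul pv]
        congr 1
        rw [show qq n - 1 = (qq n - 2) + 1 by ring, Real.rpow_add_one hl0.ne']; field_simp
      calc _ = (ofReal (qq n * l ^ (qq n - 1)) * (ofReal (l / 2))⁻¹) * (C * ∫⁻ x, ‖h x‖ₑ) := by simp only [φ]; ring
        _ = _ := by rw [e2]; ring
theorem F0_aesm (hn : 2 ≤ n) (hh : Integrable h) : AEStronglyMeasurable (F0 h) := by
  refine aestronglyMeasurable_of_tendsto_ae atTop (f := fun (k : ℕ) x => Fp h (pt x (1 / ((k : ℝ) + 1)))) (fun k => (Ft_cont hh pv).aestronglyMeasurable) ?_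
  filter_upwards [H9 hn hh] with x hx
  refine hx.comp (tendsto_nhdsWithin_iff.2 ⟨tendsto_one_div_add_atTop_nhds_zero_nat, Eventually.of_forall fun k => ?_⟩)
  change (0 : ℝ) < _; positivity
theorem H10 (hn : 2 ≤ n) : ∃ C : ENNReal, C ≠ ⊤ ∧ ∀ h : En n → ℝ, Integrable h → ∫⁻ x, Fs h x ≤ C * ∫⁻ x, ‖F0 h x‖ₑ := by
  have hq := qq_pos hn
  obtain ⟨A, hA, hF⟩ := H5 hn
  obtain ⟨C, hC, hM⟩ := Mx_strong n (by omega) (p := 1 / qq n) (by rw [one_lt_div hq]; exact qq_lt hn)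
  have hpq : 0 < 1 / qq n := by positivity
  have hA' : (A * 2 ^ (2 * n + 2)) ^ (1 / qq n) ≠ ⊤ := by finiteness
  refine ⟨(A * 2 ^ (2 * n + 2)) ^ (1 / qq n) * C, by finiteness, fun h hh => ?_⟩
  have hm : AEMeasurable (fun x => ‖F0 h x‖ₑ ^ qq n) := (F0_aesm hn hh).enorm.pow_const _
  obtain ⟨g, hg, hg1, hg2⟩ := Fs_q hn hh
  have key : ∀ t > 0, ∀ x : En n, ‖Fp h (pt x t)‖ₑ ^ qq n ≤ A * ∫⁻ w, ofReal (pk n t (x - w)) * ‖F0 h w‖ₑ ^ qq n := fun t ht x => by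
    have hs0 : Tendsto (fun k : ℕ => 1 / ((k : ℝ) + 1)) atTop (𝓝[>] 0) := tendsto_nhdsWithin_iff.2 ⟨tendsto_one_div_add_atTop_nhds_zero_nat, Eventually.of_forall fun k => show (0 : ℝ) < _ by positivity⟩
    have hpm : Measurable fun w => ofReal (pk n t (x - w)) := ENNReal.measurable_ofReal.comp ((pk_cont n ht).measurable.comp (measurable_const.sub measurable_id))
    have h1 : Tendsto (fun k : ℕ => ∫⁻ w, ofReal (pk n t (x - w)) * ‖Fp h (pt w (1 / ((k : ℝ) + 1)))‖ₑ ^ qq n) atTop (𝓝 (∫⁻ w, ofReal (pk n t (x - w)) * ‖F0 h w‖ₑ ^ qq n)) := by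
      refine tendsto_lintegral_of_dominated_convergence' (fun w => ofReal (pk n t (x - w)) * 1 + ofReal ((t ^ n)⁻¹) * g w) (fun k => (hpm.mul ((Ft_cont hh pv).enorm.measurable.pow_const _)).aemeasurable) (fun k => ae_of_all _ fun w => ?_) ?_ ?_
      · have hk : ofReal (pk n t (x - w)) ≤ ofReal ((t ^ n)⁻¹) := by
          refine ofReal_le_ofReal ?_
          rw [pk, inv_eq_one_div, div_le_div_iff₀ pv pv, pow_succ]
          have : t ^ n * t ≤ (t + ‖x - w‖) ^ n * (t + ‖x - w‖) := by gcongr <;> linarith [norm_nonneg (x - w)]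
          linarith
        calc _ ≤ ofReal (pk n t (x - w)) * (1 + g w) := by
              refine mul_le_mul_right (le_trans (rpow_le_rpow (le_Fs h ?_) hq.le) (hg1 w)) _
              rw [dist_self]; positivity
          _ ≤ _ := by rw [mul_add]; exact add_le_add_right (mul_le_mul_left hk _) _
      · rw [lintegral_add_left (f := fun w => ofReal (pk n t (x - w)) * 1) (hpm.mul measurable_const), lintegral_const_mul _ hg]
        have : ∫⁻ w, ofReal (pk n t (x - w)) * 1 ≠ ⊤ := by
          simp only [mul_one]
          rw [lintegral_sub_left_eq_self (fun w => ofReal (pk n t w))]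
          exact (pk_integrable n ht).lintegral_lt_top.ne
        finiteness
      · filter_upwards [H9 hn hh] with w hw
        refine ENNReal.Tendsto.const_mul ?_ (Or.inr ofReal_ne_top)
        exact ((hw.comp hs0).enorm).ennrpow_const _
    have h2 : Tendsto (fun k : ℕ => ‖Fp h (pt x (1 / ((k : ℝ) + 1) + t))‖ₑ ^ qq n) atTop (𝓝 (‖Fp h (pt x t)‖ₑ ^ qq n)) := by
      have e1 : Tendsto (fun k : ℕ => (pt x (1 / ((k : ℝ) + 1) + t) : Vn n)) atTop (𝓝 (pt x t)) := by
        refine (cont_pt.tendsto (x, t)).comp (tendsto_const_nhds.prodMk_nhds ?_)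
        simpa using tendsto_one_div_add_atTop_nhds_zero_nat.add_const t
      exact (((Fp_smoothAt hh (show 0 < (pt x t).snd from ht)).continuousAt.tendsto.comp e1).enorm).ennrpow_const _
    exact le_of_tendsto_of_tendsto' h2 (ENNReal.Tendsto.const_mul h1 (Or.inr hA)) fun k => hF h hh _ pv t ht x
  have h1 : ∀ x, Fs h x ≤ (A * 2 ^ (2 * n + 2)) ^ (1 / qq n) * Mx (hm.mk _) x ^ (1 / qq n) := fun x => by
    refine Fs_le h fun y t ht => ?_
    have ht' : 0 < t := dist_nonneg.trans_lt ht
    have e1 := key t ht' y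
    rw [lintegral_congr_ae (g := fun w => ofReal (pk n t (y - w)) * hm.mk _ w) (by filter_upwards [hm.ae_eq_mk] with w hw; rw [hw])] at e1
    have e2 := e1.trans (mul_le_mul_right (pk_Mx hm.measurable_mk ht' (x := x) (by rw [dist_comm]; exact ht.le)) A)
    have e3 := rpow_le_rpow e2 hpq.le
    rwa [← rpow_mul, mul_div_cancel₀ _ hq.ne', rpow_one, ← mul_assoc, mul_rpow_of_nonneg _ _ hpq.le] at e3
  refine (lintegral_mono h1).trans ?_
  rw [lintegral_const_mul _ ((Mx_meas _).pow_const _), mul_assoc]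
  refine mul_le_mul_right ((hM _ hm.measurable_mk).trans (le_of_eq ?_)) _
  congr 1
  refine lintegral_congr_ae ?_
  filter_upwards [hm.ae_eq_mk] with w hw
  rw [← hw, ← rpow_mul, mul_div_cancel₀ _ hq.ne', rpow_one]
noncomputable def GG (s : ℝ) : ℝ := s * sg s
noncomputable def g2 : ℝ → ℝ := deriv (deriv GG)
noncomputable def gg (ε R t : ℝ) : ℝ := ε * GG (t / ε) - R * GG (t / R)
theorem GG_cd : ContDiff ℝ 2 GG := contDiff_id.mul sg_cd
theorem GG_cd1 : ContDiff ℝ 1 (deriv GG) := (contDiff_succ_iff_deriv.1 (show ContDiff ℝ (1 + 1) GG from GG_cd)).2.2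
theorem g2_cont : Continuous g2 := GG_cd1.continuous_deriv le_rfl
theorem GG_d1 : ∀ s < (1 : ℝ), deriv GG s = 0 := fun s hs => by
  have : GG =ᶠ[𝓝 s] fun _ => 0 := by filter_upwards [gt_mem_nhds hs] with y hy; rw [GG, sg_zero hy.le, mul_zero]
  rw [this.deriv_eq, deriv_const]
theorem GG_d2 : ∀ s > (2 : ℝ), deriv GG s = 1 := fun s hs => by
  have : GG =ᶠ[𝓝 s] id := by filter_upwards [lt_mem_nhds hs] with y hy; rw [GG, sg_one hy.le, mul_one]; rfl
  rw [this.deriv_eq, deriv_id]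
theorem g2_zero {s : ℝ} (h : s ∉ Icc (1 : ℝ) 2) : g2 s = 0 := by
  rcases lt_or_ge s 1 with h1 | h1
  · have : deriv GG =ᶠ[𝓝 s] fun _ => 0 := by filter_upwards [gt_mem_nhds h1] with y hy using GG_d1 y hy
    rw [g2, this.deriv_eq, deriv_const]
  · have h2 : 2 < s := lt_of_not_ge fun h2 => h ⟨h1, h2⟩
    have : deriv GG =ᶠ[𝓝 s] fun _ => 1 := by filter_upwards [lt_mem_nhds h2] with y hy using GG_d2 y hy
    rw [g2, this.deriv_eq, deriv_const]
theorem g2_bd : ∃ M : ℝ, 0 < M ∧ ∀ s, |g2 s| ≤ M := by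
  obtain ⟨M, hM⟩ := isCompact_Icc.exists_bound_of_continuousOn (s := Icc (1 : ℝ) 2) g2_cont.continuousOn
  refine ⟨max M 1, by positivity, fun s => ?_⟩
  by_cases h : s ∈ Icc (1 : ℝ) 2
  · exact (hM s h).trans (le_max_left _ _)
  · rw [g2_zero h, abs_zero]; positivity
theorem gg_eq {ε R : ℝ} (hε : 0 < ε) (hR : 0 < R) (t : ℝ) : gg ε R t = t * (sg (t / ε) - sg (t / R)) := by
  rw [gg, GG, GG]; field_simp
theorem gg_cd (ε R : ℝ) : ContDiff ℝ 2 (gg ε R) :=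
  (contDiff_const.mul (GG_cd.comp (contDiff_id.div_const ε))).sub (contDiff_const.mul (GG_cd.comp (contDiff_id.div_const R)))
theorem gg_d2 {ε R : ℝ} (hε : 0 < ε) (hR : 0 < R) (t : ℝ) : deriv (deriv (gg ε R)) t = ε⁻¹ * g2 (t / ε) - R⁻¹ * g2 (t / R) := by
  have d1 : ∀ c : ℝ, 0 < c → ∀ t, HasDerivAt (fun t => c * GG (t / c)) (deriv GG (t / c)) t := fun c hc t => by
    have := (((GG_cd.differentiable sm).differentiableAt (x := t / c)).hasDerivAt.comp t ((hasDerivAt_id t).div_const c)).const_mul c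
    refine this.congr_deriv ?_; field_simp
  have d2 : ∀ c : ℝ, 0 < c → ∀ t, HasDerivAt (fun t => deriv GG (t / c)) (c⁻¹ * g2 (t / c)) t := fun c hc t => by
    have := ((GG_cd1.differentiable sm).differentiableAt (x := t / c)).hasDerivAt.comp t ((hasDerivAt_id t).div_const c)
    refine this.congr_deriv ?_; rw [g2]; ring
  have e : deriv (gg ε R) = fun t => deriv GG (t / ε) - deriv GG (t / R) := funext fun t => ((d1 ε hε t).sub (d1 R hR t)).deriv
  rw [e]; exact ((d2 ε hε t).sub (d2 R hR t)).deriv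
theorem gg_zero {ε R : ℝ} (hε : 0 < ε) (hR : ε ≤ R) : ∀ t, t ∉ Icc ε (2 * R) → gg ε R t = 0 := fun t ht => by
  have hR0 := hε.trans_le hR
  rw [gg_eq hε hR0]
  rcases lt_or_ge t ε with h | h
  · rw [sg_zero ((div_le_one hε).2 h.le), sg_zero ((div_le_one hR0).2 (h.le.trans hR))]; simp
  · have h2 : 2 * R < t := lt_of_not_ge fun h2 => ht ⟨h, h2⟩
    rw [sg_one (by rw [le_div_iff₀ hε]; linarith), sg_one (by rw [le_div_iff₀ hR0]; linarith)]; simp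
theorem gg_nonneg {ε R t : ℝ} (hε : 0 < ε) (hR : ε ≤ R) (ht : 0 < t) : 0 ≤ gg ε R t := by
  rw [gg_eq hε (hε.trans_le hR)]
  exact mul_nonneg ht.le (sub_nonneg.2 (sg_mono (by gcongr)))
theorem gg_le {ε R t : ℝ} (hε : 0 < ε) (hR : ε ≤ R) (ht : 0 < t) : gg ε R t ≤ t := by
  rw [gg_eq hε (hε.trans_le hR)]
  exact mul_le_of_le_one_right ht.le (by linarith [sg_le (t / ε), sg_nonneg (t / R)])
theorem gg_id {ε R t : ℝ} (hε : 0 < ε) (hR : ε ≤ R) (h1 : 2 * ε ≤ t) (h2 : t ≤ R) : gg ε R t = t := by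
  rw [gg_eq hε (hε.trans_le hR), sg_one (by rwa [le_div_iff₀ hε]), sg_zero ((div_le_one (hε.trans_le hR)).2 h2)]; ring
theorem g2_lint {M : ℝ} (hM : ∀ s, |g2 s| ≤ M) {c : ℝ} (hc : 0 < c) (S : Set ℝ) : ∫⁻ t in S, ‖c⁻¹ * g2 (t / c)‖ₑ ≤ ofReal M := by
  refine (setLIntegral_le_lintegral _ _).trans ?_
  have : ∀ t, ‖c⁻¹ * g2 (t / c)‖ₑ ≤ (Icc c (2 * c)).indicator (fun _ => ofReal (c⁻¹ * M)) t := fun t => by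
    by_cases h : t ∈ Icc c (2 * c)
    · rw [indicator_of_mem h, enorm_eq_ofReal_abs, abs_mul, abs_of_pos (inv_pos.2 hc)]
      exact ofReal_le_ofReal (mul_le_mul_of_nonneg_left (hM _) pv)
    · rw [g2_zero fun h' => h ⟨by simpa using (le_div_iff₀ hc).1 h'.1, by simpa using (div_le_iff₀ hc).1 h'.2⟩]; simp
  refine (lintegral_mono this).trans ?_
  rw [lintegral_indicator measurableSet_Icc, setLIntegral_const, volume_Icc, ← ENNReal.ofReal_mul' (by linarith)]
  exact ofReal_le_ofReal (le_of_eq (by field_simp; ring))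
def Wok (W : Vn n → ℝ) : Prop := (∀ z : Vn n, 0 < z.snd → ContDiffAt ℝ 2 W z) ∧ ∀ a b : ℝ, 0 < a →
  IntegrableOn W (strip n a b) ∧ IntegrableOn (fderiv ℝ W) (strip n a b) ∧ IntegrableOn (lap W) (strip n a b)
theorem hs_eq (n : ℕ) : hs n = ⋃ k : ℕ, strip n (2 * (1 / ((k : ℝ) + 1))) (k + 1) := by
  ext z; simp only [mem_iUnion]
  constructor
  · intro (hz : 0 < z.snd)
    obtain ⟨k, hk⟩ := exists_nat_one_div_lt (show 0 < z.snd / 2 by positivity)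
    obtain ⟨m, hm⟩ := exists_nat_ge z.snd
    refine ⟨max k m, ?_, ?_⟩
    · have : 1 / (((max k m : ℕ) : ℝ) + 1) ≤ 1 / ((k : ℝ) + 1) := by gcongr; exact le_max_left _ _
      linarith
    · have : (m : ℝ) ≤ (max k m : ℕ) := by gcongr; exact le_max_right _ _
      linarith
  · rintro ⟨k, hk⟩
    exact lt_of_lt_of_le pv hk.1
theorem H11g : ∃ M : ENNReal, M ≠ ⊤ ∧ ∀ (n : ℕ) (W : Vn n → ℝ), Wok W → (∀ z : Vn n, 0 < z.snd → 0 ≤ lap W z) →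
    ∀ A : ENNReal, (∀ t > 0, ∫⁻ x, ‖W (pt x t)‖ₑ ≤ A) → ∫⁻ z in hs n, ofReal (z.snd * lap W z) ≤ M * A := by
  obtain ⟨M, hM0, hM⟩ := g2_bd
  refine ⟨2 * ofReal M, by finiteness, fun n W hW hl A hA => ?_⟩
  rw [hs_eq, setLIntegral_iUnion_of_directed _ (directed_of_isDirected_le fun k m hkm z hz => ?_)]
  · refine iSup_le fun k => ?_
    set ε : ℝ := 1 / ((k : ℝ) + 1)
    set R : ℝ := (k : ℝ) + 1
    have hε : 0 < ε := by positivity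
    have hR0 : 0 < R := by positivity
    have hR : ε ≤ R := by
      have h1 : 1 ≤ R := by simp [R]
      have h2 : ε ≤ 1 := by rw [div_le_one hR0]; exact h1
      linarith
    obtain ⟨h0, h1, h2⟩ := hW.2 ε (2 * R) hε
    have hg := green hW.1 (gg_cd ε R) hε (gg_zero hε hR) h0 h1 h2
    have hmg : Measurable fun z : Vn n => gg ε R z.snd := ((gg_cd ε R).continuous.comp cont_snd).measurable
    calc _ ≤ ∫⁻ z in strip n (2 * ε) R, ofReal (gg ε R z.snd * lap W z) := by
          refine setLIntegral_mono_ae' (strip_meas _ _) (ae_of_all _ fun z hz => ?_)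
          rw [gg_id hε hR hz.1 hz.2]
      _ ≤ ∫⁻ z in strip n ε (2 * R), ofReal (gg ε R z.snd * lap W z) :=
        lintegral_mono_set fun z hz => ⟨by linarith [hz.1], by linarith [hz.2]⟩
      _ = ofReal (∫ z in strip n ε (2 * R), gg ε R z.snd * lap W z) := by
        rw [ofReal_integral_eq_lintegral_ofReal]
        · refine h2.bdd_mul (c := 2 * R) hmg.aestronglyMeasurable ((ae_restrict_iff' (strip_meas _ _)).2 (ae_of_all _ fun z hz => ?_))
          have := hε.trans_le hz.1
          rw [norm_of_nonneg (gg_nonneg hε hR this)]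
          exact (gg_le hε hR this).trans hz.2
        · refine (ae_restrict_iff' (strip_meas _ _)).2 (ae_of_all _ fun z hz => ?_)
          have := hε.trans_le hz.1
          exact mul_nonneg (gg_nonneg hε hR this) (hl z this)
      _ ≤ ∫⁻ z in strip n ε (2 * R), ‖W z * deriv (deriv (gg ε R)) z.snd‖ₑ := by
        rw [hg]; exact (Real.ofReal_le_enorm _).trans (enorm_integral_le_lintegral_enorm _)
      _ = ∫⁻ t in Icc ε (2 * R), ∫⁻ x, ‖W (pt x t)‖ₑ * ‖deriv (deriv (gg ε R)) t‖ₑ := by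
        rw [strip_lint]
        · simp only [enorm_mul, pt_snd]
        · refine (h0.1.mul ?_).enorm
          have : Continuous (deriv (deriv (gg ε R))) := by
            rw [funext (gg_d2 hε hR0)]
            have := g2_cont; fun_prop
          exact (this.comp cont_snd).aestronglyMeasurable
      _ ≤ ∫⁻ t in Icc ε (2 * R), A * (‖ε⁻¹ * g2 (t / ε)‖ₑ + ‖R⁻¹ * g2 (t / R)‖ₑ) := by
        refine setLIntegral_mono_ae' measurableSet_Icc (ae_of_all _ fun t ht => ?_)
        rw [lintegral_mul_const' _ _ enorm_ne_top, gg_d2 hε hR0]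
        exact mul_le_mul' (hA t (hε.trans_le ht.1)) enorm_sub_le
      _ ≤ A * (ofReal M + ofReal M) := by
        have m1 : ∀ c : ℝ, Measurable fun t => ‖c⁻¹ * g2 (t / c)‖ₑ := fun c => by have := g2_cont.measurable; fun_prop
        rw [lintegral_const_mul (f := fun t => ‖ε⁻¹ * g2 (t / ε)‖ₑ + ‖R⁻¹ * g2 (t / R)‖ₑ) _ ((m1 ε).add (m1 R)), lintegral_add_left (m1 ε)]
        gcongr
        · exact g2_lint hM hε _
        · exact g2_lint hM hR0 _
      _ = _ := by ring
  · refine ⟨le_trans ?_ hz.1, hz.2.trans ?_⟩ <;> gcongr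
noncomputable def Gr (h : En n → ℝ) (z : Vn n) : Vn n := fderiv ℝ (Fp h) z (pt 0 1)
theorem u_fd (hh : Integrable h) (hz : 0 < z.snd) (v : Vn n) :
    fderiv ℝ (fun y => (Fp h y).snd) z v = ⟪v, Gr h z⟫_ℝ := by
  have h1 := ((innerSL ℝ (pt 0 1)).hasFDerivAt (x := Fp h z)).comp z (Fp_diff hh hz)
  have h2 : (innerSL ℝ (pt 0 1) ∘ Fp h : Vn n → ℝ) = fun y => (Fp h y).snd := by ext y; simp [inner_e]
  rw [h2] at h1
  rw [h1.fderiv, Gr, ← Fp_sym hh hz, real_inner_comm]; simp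
theorem Gr_cont (hh : Integrable h) (hz : 0 < z.snd) : ContinuousAt (Gr h) z :=
  (((Fp_smoothAt hh hz).fderiv_right (m := 1) (by norm_num)).continuousAt).clm_apply continuousAt_const
theorem norm_e : ‖(pt 0 1 : Vn n)‖ = 1 := by
  rw [← sq_eq_sq₀ (norm_nonneg _) zero_le_one, norm_pt]; simp
theorem Gr_le (h : En n → ℝ) (z : Vn n) : ‖Gr h z‖ ≤ ‖fderiv ℝ (Fp h) z‖ := by
  refine (le_opNorm _ _).trans (by rw [norm_e, mul_one])
theorem Gr_gF (hh : Integrable h) (hz : 0 < z.snd) : ‖Gr h z‖ ^ 2 ≤ gF h z := by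
  rw [← (bs n).sum_sq_norm_inner_right, gF]
  refine sum_le_sum fun i _ => ?_
  rw [Gr, ← Fp_sym hh hz, real_inner_comm, inner_e]
  gcongr; exact snd_le_norm _
theorem lap_uu {h k : En n → ℝ} (hh : Integrable h) (hk : Integrable k) (hz : 0 < z.snd) :
    lap (fun y => (Fp h y).snd * (Fp k y).snd) z = 2 * ⟪Gr h z, Gr k z⟫_ℝ := by
  rw [lap_mul (lap_u hh hz).1 (lap_u hk hz).1, (lap_u hh hz).2, (lap_u hk hz).2, ← (bs n).sum_inner_mul_inner]
  simp only [u_fd hh hz, u_fd hk hz, real_inner_comm]; simp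
theorem lap_cont {W : Vn n → ℝ} (hW : ContDiffAt ℝ 2 W z) : ContinuousAt (lap W) z := by
  have h1 : ContinuousAt (fderiv ℝ (fderiv ℝ W)) z := ((hW.fderiv_right (m := 1) (by norm_num)).fderiv_right (m := 0) (by norm_num)).continuousAt
  exact tendsto_finsetSum _ fun i _ => (h1.clm_apply continuousAt_const).clm_apply continuousAt_const
theorem Wok_of (hn : n ≠ 0) {W : Vn n → ℝ} (hW : ∀ z : Vn n, 0 < z.snd → ContDiffAt ℝ 2 W z) {h k : En n → ℝ} (hh : Integrable h) (hk : Integrable k) (c : ℝ)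
    (h0 : ∀ z : Vn n, 0 < z.snd → |W z| ≤ c * (lq h z + lq k z)) (h1 : ∀ z : Vn n, 0 < z.snd → ‖fderiv ℝ W z‖ ≤ c * (lq h z + lq k z))
    (h2 : ∀ z : Vn n, 0 < z.snd → |lap W z| ≤ c * (lq h z + lq k z)) : Wok W := by
  refine ⟨hW, fun a b ha => ?_⟩
  have hi : IntegrableOn (fun z => c * (lq h z + lq k z)) (strip n a b) := ((strip_int hn hh ha).add (strip_int hn hk ha)).const_mul c
  have hp : ∀ z ∈ strip n a b, 0 < z.snd := fun z hz => ha.trans_le hz.1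
  have hae : ∀ {p : Vn n → Prop}, (∀ z : Vn n, 0 < z.snd → p z) → ∀ᵐ z ∂volume.restrict (strip n a b), p z := fun H =>
    (ae_restrict_iff' (strip_meas a b)).2 (ae_of_all _ fun z hz => H z (hp z hz))
  exact ⟨hi.mono' (hs_aesm ha fun z hz => (hW z hz).continuousAt) (hae h0),
    hi.mono' (hs_aesm ha fun z hz => ((hW z hz).fderiv_right (m := 1) (by norm_num)).continuousAt) (hae h1),
    hi.mono' (hs_aesm ha fun z hz => lap_cont (hW z hz)) (hae h2)⟩
theorem uu_ok (hn : n ≠ 0) {h k : En n → ℝ} (hh : Integrable h) (hk : Integrable k) : Wok (fun y => (Fp h y).snd * (Fp k y).snd) := by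
  have hu : ∀ (h : En n → ℝ) (z : Vn n), |(Fp h z).snd| ≤ ‖Fp h z‖ := fun h z => snd_le_norm _
  refine Wok_of hn (fun z hz => (lap_u hh hz).1.mul (lap_u hk hz).1) hh hk 2 (fun z hz => ?_) (fun z hz => ?_) (fun z hz => ?_)
  · rw [abs_mul, lq, lq]
    nlinarith [mul_le_mul (hu h z) (hu k z) (abs_nonneg _) (norm_nonneg _), sq_nonneg (‖Fp h z‖ - ‖Fp k z‖), sq_nonneg ‖fderiv ℝ (Fp h) z‖, sq_nonneg ‖fderiv ℝ (Fp k) z‖, sq_nonneg (‖Fp h z‖ + ‖Fp k z‖)]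
  · refine ContinuousLinearMap.opNorm_le_bound _ (by rw [lq, lq]; positivity) fun v => ?_
    have e := fderiv_mul (((lap_u hh hz).1).differentiableAt sm) (((lap_u hk hz).1).differentiableAt sm)
    have e' : fderiv ℝ (fun y => (Fp h y).snd * (Fp k y).snd) z v = (Fp h z).snd * ⟪v, Gr k z⟫_ℝ + (Fp k z).snd * ⟪v, Gr h z⟫_ℝ := by
      refine (congrArg (fun L => L v) e).trans ?_
      rw [← u_fd hh hz, ← u_fd hk hz]; simp
    rw [e']
    have hb : ∀ h k : En n → ℝ, ‖(Fp h z).snd * ⟪v, Gr k z⟫_ℝ‖ ≤ ‖Fp h z‖ * ‖fderiv ℝ (Fp k) z‖ * ‖v‖ := fun h k => by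
      rw [norm_mul, mul_assoc, mul_comm ‖fderiv ℝ (Fp k) z‖]
      exact mul_le_mul (hu h z) ((norm_inner_le_norm _ _).trans (mul_le_mul_of_nonneg_left (Gr_le k z) (norm_nonneg _))) (norm_nonneg _) (norm_nonneg _)
    refine (norm_add_le _ _).trans ((add_le_add (hb h k) (hb k h)).trans ?_)
    rw [← add_mul]
    refine mul_le_mul_of_nonneg_right ?_ (norm_nonneg _)
    rw [lq, lq]
    nlinarith [sq_nonneg (‖Fp h z‖ - ‖fderiv ℝ (Fp k) z‖), sq_nonneg (‖Fp k z‖ - ‖fderiv ℝ (Fp h) z‖), sq_nonneg ‖Fp h z‖, sq_nonneg ‖Fp k z‖, sq_nonneg ‖fderiv ℝ (Fp h) z‖, sq_nonneg ‖fderiv ℝ (Fp k) z‖]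
  · rw [lap_uu hh hk hz, abs_mul, abs_two, lq, lq]
    have h1 := (abs_real_inner_le_norm (Gr h z) (Gr k z)).trans (mul_le_mul (Gr_le h z) (Gr_le k z) (norm_nonneg _) (norm_nonneg _))
    nlinarith [sq_nonneg (‖fderiv ℝ (Fp h) z‖ - ‖fderiv ℝ (Fp k) z‖), sq_nonneg ‖Fp h z‖, sq_nonneg ‖Fp k z‖, sq_nonneg (‖fderiv ℝ (Fp h) z‖ + ‖fderiv ℝ (Fp k) z‖)]
theorem H11u (n : ℕ) (hn : n ≠ 0) : ∃ C : ENNReal, C ≠ ⊤ ∧ ∀ h : En n → ℝ, Integrable h →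
    ∫⁻ z in hs n, ofReal (z.snd * ‖Gr h z‖ ^ 2) ≤ C * ∫⁻ x, ‖h x‖ₑ ^ 2 := by
  obtain ⟨M, hM, H⟩ := H11g
  obtain ⟨C, hC, HC⟩ := u_L2 n hn
  refine ⟨M * C, by finiteness, fun h hh => ?_⟩
  have := H n _ (uu_ok hn hh hh) (fun z hz => by rw [lap_uu hh hh hz, real_inner_self_eq_norm_sq]; positivity) (C * ∫⁻ x, ‖h x‖ₑ ^ 2)
    (fun t ht => by have := HC h hh t ht; simp only [sq] at this ⊢; simpa only [enorm_mul] using this)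
  rw [mul_assoc]
  refine le_trans (setLIntegral_mono_ae' (hs_open n).measurableSet (ae_of_all _ fun z hz => ofReal_le_ofReal ?_)) this
  replace hz : 0 < z.snd := hz
  rw [lap_uu hh hh hz, real_inner_self_eq_norm_sq]
  exact mul_le_mul_of_nonneg_left (by nlinarith [sq_nonneg ‖Gr h z‖]) hz.le
theorem gF_le (h : En n → ℝ) (z : Vn n) : gF h z ≤ (n + 1) * ‖fderiv ℝ (Fp h) z‖ ^ 2 := by
  rw [gF]
  refine (Finset.sum_le_card_nsmul _ _ (‖fderiv ℝ (Fp h) z‖ ^ 2) fun i _ => ?_).trans sm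
  gcongr; refine (le_opNorm _ _).trans sm
theorem H11N (n : ℕ) (hn : n ≠ 0) : ∃ C : ENNReal, C ≠ ⊤ ∧ ∀ h : En n → ℝ, Integrable h → ∀ δ > 0,
    ∫⁻ z in hs n, ofReal (z.snd * (gF h z / √(‖Fp h z‖ ^ 2 + δ ^ 2))) ≤ C * ∫⁻ x, Fs h x := by
  obtain ⟨M, hM, H⟩ := H11g
  refine ⟨(n + 1 : ENNReal) * M, by finiteness, fun h hh δ hδ => ?_⟩
  set N : Vn n → ℝ := fun z => (‖Fp h z‖ ^ 2 + δ ^ 2) ^ (1 / 2 : ℝ)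
  set W : Vn n → ℝ := fun z => N z + -δ
  have hNs : ∀ z, N z = √(‖Fp h z‖ ^ 2 + δ ^ 2) := fun z => (Real.sqrt_eq_rpow _).symm
  have hNδ : ∀ z, δ ≤ N z := fun z => by rw [hNs]; exact Real.le_sqrt_of_sq_le (by nlinarith [sq_nonneg ‖Fp h z‖])
  have hN0 : ∀ z, 0 < N z := fun z => hδ.trans_le (hNδ z)
  have hN2 : ∀ z, N z ^ 2 = ‖Fp h z‖ ^ 2 + δ ^ 2 := fun z => by rw [hNs]; exact Real.sq_sqrt pv
  have hNi : ∀ z, (‖Fp h z‖ ^ 2 + δ ^ 2) ^ (1 / 2 - 1 : ℝ) = (N z)⁻¹ := fun z => by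
    rw [← Real.rpow_neg pv]; norm_num
  have hP : ∀ z : Vn n, 0 < z.snd → _ := fun z hz => subP hh hz (show 0 < δ ^ 2 by positivity) (a := 1 / 2) (by norm_num) (by norm_num)
  have hWl : ∀ z : Vn n, 0 < z.snd → lap W z = lap N z := fun z hz => by
    have : lap (fun _ : Vn n => -δ) z = 0 := by simp [lap]
    rw [lap_add (hP z hz).1 contDiffAt_const, this, add_zero]
  have hl1 : ∀ z : Vn n, 0 < z.snd → gF h z / N z ≤ (n + 1) * lap W z := fun z hz => by
    rw [hWl z hz]
    have h1 := (hP z hz).2.1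
    rw [hNi, show (2 * (1 / 2 : ℝ) * (N z)⁻¹ * gF h z * (1 - 2 * (1 - 1 / 2) * (n / (n + 1)))) = gF h z / N z / (n + 1) by field_simp; ring, div_le_iff₀ pv] at h1
    linarith
  have hl2 : ∀ z : Vn n, 0 < z.snd → lap W z ≤ gF h z / N z := fun z hz => by
    rw [hWl z hz]
    have h1 := (hP z hz).2.2.1
    rw [hNi] at h1
    refine h1.trans (le_of_eq ?_); field_simp
  have hl0 : ∀ z : Vn n, 0 < z.snd → 0 ≤ lap W z := fun z hz => by
    have h1 := (div_nonneg (gF_nonneg h z) (hN0 z).le).trans (hl1 z hz)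
    exact nonneg_of_mul_nonneg_right h1 pv
  have hW0 : ∀ z, 0 ≤ W z := fun z => by simp only [W]; linarith [hNδ z]
  have hWF : ∀ z, W z ≤ ‖Fp h z‖ := fun z => by
    have : N z ≤ ‖Fp h z‖ + δ := le_of_sq_le_sq (by rw [hN2]; nlinarith [mul_nonneg (norm_nonneg (Fp h z)) hδ.le]) pv
    simp only [W]; linarith
  have hok : Wok W := by
    refine Wok_of hn (fun z hz => (hP z hz).1.add contDiffAt_const) hh hh ((n + 1) * δ⁻¹) (fun z hz => ?_) (fun z hz => ?_) (fun z hz => ?_)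
    · rw [abs_of_nonneg (hW0 z)]
      have h1 : W z * δ ≤ lq h z := by simp only [W, lq]; nlinarith [hN2 z, hNδ z, sq_nonneg ‖fderiv ℝ (Fp h) z‖]
      have h2 : 0 ≤ lq h z := by rw [lq]; positivity
      have h3 : W z ≤ δ⁻¹ * lq h z := by rw [← div_eq_inv_mul, le_div_iff₀ hδ]; exact h1
      have h4 : 0 ≤ δ⁻¹ * lq h z := by positivity
      have h5 : (0 : ℝ) ≤ n := n.cast_nonneg
      nlinarith [mul_nonneg h5 h4]
    · have h2 : 0 ≤ lq h z := by rw [lq]; positivity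
      refine ContinuousLinearMap.opNorm_le_bound _ pv fun v => ?_
      have e : fderiv ℝ W z = fderiv ℝ N z := fderiv_add_const _
      rw [e, (hP z hz).2.2.2 v, hNi]
      have h3 := (abs_real_inner_le_norm (Fp h z) (fderiv ℝ (Fp h) z v)).trans (mul_le_mul_of_nonneg_left (le_opNorm _ v) (norm_nonneg _))
      have h4 : (N z)⁻¹ ≤ δ⁻¹ := by gcongr; exact hNδ z
      have h5 : ‖Fp h z‖ * (‖fderiv ℝ (Fp h) z‖ * ‖v‖) ≤ lq h z * ‖v‖ := by
        rw [← mul_assoc, lq]; gcongr; nlinarith [sq_nonneg (‖Fp h z‖ - ‖fderiv ℝ (Fp h) z‖), sq_nonneg (‖Fp h z‖ + ‖fderiv ℝ (Fp h) z‖)]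
      have hNp := hN0 z
      calc _ = (N z)⁻¹ * |⟪Fp h z, fderiv ℝ (Fp h) z v⟫_ℝ| := by
            rw [norm_eq_abs, abs_mul, abs_mul, abs_mul, abs_of_pos (inv_pos.2 hNp)]; norm_num; ring
        _ ≤ δ⁻¹ * (lq h z * ‖v‖) := by gcongr; exact h3.trans h5
        _ ≤ ((n + 1) * δ⁻¹) * (lq h z + lq h z) * ‖v‖ := by
          have h6 : 0 ≤ δ⁻¹ * (lq h z * ‖v‖) := by positivity
          have h5 : (0 : ℝ) ≤ n := n.cast_nonneg
          nlinarith [mul_nonneg h5 h6]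
    · rw [abs_of_nonneg (hl0 z hz)]
      have h2 : 0 ≤ ‖Fp h z‖ ^ 2 := by positivity
      calc _ ≤ gF h z / N z := hl2 z hz
        _ ≤ (n + 1) * ‖fderiv ℝ (Fp h) z‖ ^ 2 / δ := by gcongr; exacts [gF_le h z, hNδ z]
        _ = ((n + 1) * δ⁻¹) * ‖fderiv ℝ (Fp h) z‖ ^ 2 := by ring
        _ ≤ _ := by
          gcongr; rw [lq]; nlinarith [sq_nonneg ‖fderiv ℝ (Fp h) z‖]
  have hfin := H n W hok hl0 (∫⁻ x, Fs h x) fun t ht => lintegral_mono fun x => by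
    refine le_trans ?_ (le_Fs h (y := x) (t := t) (by simpa using ht))
    rw [← ofReal_norm_eq_enorm, ← ofReal_norm_eq_enorm, norm_of_nonneg (hW0 _)]
    exact ofReal_le_ofReal (hWF _)
  rw [mul_assoc]
  refine le_trans ?_ (mul_le_mul_right hfin _)
  rw [← lintegral_const_mul' _ _ (by finiteness)]
  refine setLIntegral_mono_ae' (hs_open n).measurableSet (ae_of_all _ fun z hz => ?_)
  replace hz : 0 < z.snd := hz
  rw [← hNs, show (n + 1 : ENNReal) = ofReal (n + 1) by rw [ofReal_add pv (by norm_num)]; simp, ← ofReal_mul pv]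
  refine ofReal_le_ofReal ?_
  rw [mul_left_comm]
  exact mul_le_mul_of_nonneg_left (hl1 z hz) hz.le
def tent (x : En n) (r : ℝ) : Set (Vn n) := {z | dist z.fst x < r ∧ 0 < z.snd ∧ z.snd < r}
theorem rad_le (hn : n ≠ 0) {a b : En n} {r s : ℝ} (hr : 0 ≤ r) (hs : 0 ≤ s) (h : volume (closedBall a r) ≤ volume (closedBall b s)) : r ≤ s := by
  rw [vol_cball _ hr, vol_cball _ hs, ENNReal.mul_le_mul_iff_left (om_pos n) (om_top n), ofReal_le_ofReal_iff pv] at h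
  exact le_of_pow_le_pow_left₀ hn hs h
theorem tent_cov (hn : n ≠ 0) (ν : Measure (Vn n)) (A : ENNReal) (hν : ∀ (x : En n) (r : ℝ), 0 < r → ν (tent x r) ≤ A * ofReal (r ^ n))
    {O : Set (En n)} (hO : IsOpen O) (hf : volume O ≠ ⊤) :
    ν {z | 0 < z.snd ∧ ball z.fst z.snd ⊆ O} ≤ A * (11 ^ n * (om n)⁻¹) * volume O := by
  haveI : NeZero n := ⟨hn⟩
  have hne : Oᶜ.Nonempty := by
    by_contra h
    rw [not_nonempty_iff_eq_empty, compl_empty_iff] at h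
    rw [h] at hf; exact hf (measure_univ_of_isAddLeftInvariant _)
  set r : En n → ℝ := fun y => infDist y Oᶜ / 2
  have hr : ∀ y ∈ O, 0 < r y := fun y hy => half_pos ((hO.isClosed_compl.notMem_iff_infDist_pos hne).1 (by simpa using hy))
  have hsub : ∀ y ∈ O, closedBall y (r y) ⊆ O := fun y hy w hw => by
    by_contra h
    have := infDist_le_dist_of_mem (x := y) (s := Oᶜ) h
    have h2 := hr y hy
    have h3 : dist w y ≤ infDist y Oᶜ / 2 := hw
    rw [dist_comm] at h3; simp only [r] at h2; linarith
  obtain ⟨M, hM⟩ : ∃ M : ℝ, ∀ y ∈ O, r y ≤ M := by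
    by_contra! h
    refine hf (ENNReal.eq_top_of_forall_nnreal_le fun c => ?_)
    obtain ⟨R, hR0, hR⟩ : ∃ R : ℝ, 0 ≤ R ∧ (c : ENNReal) ≤ volume (closedBall (0 : En n) R) := by
      have h1 : Tendsto (fun k : ℕ => volume (closedBall (0 : En n) k)) atTop (𝓝 ⊤) := by
        have := tendsto_measure_iUnion_atTop (μ := volume) (s := fun k : ℕ => closedBall (0 : En n) k) fun a b hab => closedBall_subset_closedBall (by exact_mod_cast hab)
        rwa [iUnion_closedBall_nat, measure_univ_of_isAddLeftInvariant] at this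
      obtain ⟨k, hk⟩ := (h1.eventually (lt_mem_nhds (ENNReal.coe_lt_top (r := c)))).exists
      exact ⟨k, by positivity, hk.le⟩
    obtain ⟨y, hy, hRy⟩ := h R
    refine hR.trans (le_trans ?_ (measure_mono (hsub y hy)))
    rw [vol_cball _ hR0, vol_cball _ (hR0.trans hRy.le)]
    gcongr
  obtain ⟨u, huO, huc, hud, hcov⟩ := vitali5 O r M hr hM
  haveI := huc.to_subtype
  calc _ ≤ ν (⋃ b : u, tent (b : En n) (11 * r b)) := by
        refine measure_mono fun z hz => ?_
        have hy : z.fst ∈ O := hz.2 (mem_ball_self hz.1)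
        obtain ⟨b, hb, hbs⟩ := hcov _ hy
        have h1 := rad_le hn (hr _ hy).le (by have := hr b (huO hb); positivity) (measure_mono hbs)
        have h2 : dist z.fst b ≤ 5 * r b := hbs (mem_closedBall_self (hr _ hy).le)
        have h3 : z.snd ≤ 2 * r z.fst := by
          rw [show 2 * r z.fst = infDist z.fst Oᶜ by simp only [r]; ring]
          refine (le_infDist hne).2 fun w hw => ?_
          by_contra! h; exact hw (hz.2 (by rwa [mem_ball, dist_comm]))
        have := hr b (huO hb)
        exact mem_iUnion.2 ⟨⟨b, hb⟩, by simp only; linarith, hz.1, by simp only; linarith⟩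
    _ ≤ ∑' b : u, ν (tent (b : En n) (11 * r b)) := measure_iUnion_le _
    _ ≤ ∑' b : u, A * (11 ^ n * (om n)⁻¹) * volume (closedBall (b : En n) (r b)) := by
        refine tsum_le_tsum fun b => (hν _ _ (by have := hr b (huO b.2); positivity)).trans (le_of_eq ?_)
        rw [vol_cball _ (hr b (huO b.2)).le, mul_pow, ofReal_mul pv, mul_assoc, mul_assoc]
        congr 1
        rw [mul_comm (ofReal (r b ^ n)), ← mul_assoc (om n)⁻¹, ENNReal.inv_mul_cancel (om_pos n) (om_top n), one_mul]
        congr 1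
        rw [ofReal_pow (by norm_num)]; norm_num
    _ ≤ _ := by
        rw [ENNReal.tsum_mul_left]
        refine mul_le_mul_right ?_ _
        rw [← measure_biUnion huc hud fun _ _ => measurableSet_closedBall] <;> try rfl
        exact measure_mono (iUnion₂_subset fun b hb => hsub b (huO hb))
theorem H12 (hn : n ≠ 0) (ν : Measure (Vn n)) {A : ENNReal} (hA : A ≠ ⊤) (hν : ∀ (x : En n) (r : ℝ), 0 < r → ν (tent x r) ≤ A * ofReal (r ^ n))
    (hm : AEMeasurable (fun z => ‖Fp h z‖) (ν.restrict (hs n))) (hf : ∫⁻ x, Fs h x ≠ ⊤) :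
    ∫⁻ z in hs n, ‖Fp h z‖ₑ ∂ν ≤ A * (11 ^ n * (om n)⁻¹) * ∫⁻ x, Fs h x := by
  have hae : ∀ᵐ x, Fs h x ≠ ⊤ := (ae_lt_top (Fs_meas h) hf).mono fun x hx => hx.ne
  have e1 : ∫⁻ x, Fs h x = ∫⁻ l in Ioi (0 : ℝ), volume {x | l < (Fs h x).toReal} := by
    rw [← lintegral_eq_lintegral_meas_lt _ (ae_of_all _ fun x => toReal_nonneg) (Fs_meas h).ennreal_toReal.aemeasurable]
    exact lintegral_congr_ae (hae.mono fun x hx => (ofReal_toReal hx).symm)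
  have e2 : ∀ l : ℝ, 0 < l → volume {x | l < (Fs h x).toReal} = volume {x | ofReal l < Fs h x} := fun l hl =>
    measure_congr (hae.mono fun x hx => propext (ENNReal.ofReal_lt_iff_lt_toReal hl.le hx).symm)
  simp_rw [← ofReal_norm_eq_enorm]
  rw [lintegral_eq_lintegral_meas_lt _ (ae_of_all _ fun x => norm_nonneg _) hm, e1]
  have hA2 : A * (11 ^ n * (om n)⁻¹) ≠ ⊤ := by
    have := om_pos n; finiteness
  rw [← lintegral_const_mul' _ _ hA2]
  refine setLIntegral_mono_ae' measurableSet_Ioi (ae_of_all _ fun l hl => ?_)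
  rw [e2 l hl, Measure.restrict_apply' (hs_open n).measurableSet]
  refine le_trans (measure_mono ?_) (tent_cov hn ν A hν (Fs_open h _) ?_)
  · rintro z ⟨hz : l < ‖Fp h z‖, hz2 : 0 < z.snd⟩
    refine ⟨hz2, fun y hy => ?_⟩
    have := le_Fs h (x := y) (y := z.fst) (t := z.snd) (by rwa [dist_comm])
    refine lt_of_lt_of_le ?_ this
    rw [pt_eta, ← ofReal_norm_eq_enorm]
    exact (ENNReal.ofReal_lt_ofReal_iff (lt_trans hl hz)).2 hz
  · have hl' : ofReal l ≠ 0 := by simpa using hl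
    refine ne_top_of_le_ne_top (div_ne_top hf hl') (le_trans (measure_mono fun x hx => ?_) (meas_ge_le_lintegral_div (Fs_meas h).aemeasurable hl' ofReal_ne_top))
    exact (show ofReal l < Fs h x from hx).le
theorem Gr_eq (hh : Integrable h) (hz : 0 < z.snd) : Gr h z = ∫ w, h w • fderiv ℝ kk (z - pt w 0) (pt 0 1) := by
  rw [Gr, Fp_fderiv hh hz, Po, ContinuousLinearMap.integral_apply (Po_int (kk_HK n).fderiv hh hz)]; rfl
theorem z_pp (hz : 0 < z.snd) (w : En n) : (‖z - pt w 0‖ ^ (n + 1))⁻¹ = z.snd⁻¹ * pp n z.snd (z.fst - w) := by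
  have : z - pt w 0 = pt (z.fst - w) z.snd := by conv_lhs => rw [← pt_eta z, pt_sub, sub_zero]
  rw [this, pp]; field_simp
theorem g_bd (n : ℕ) : ∃ C : ℝ, 0 < C ∧ ∀ z v : Vn n, z ≠ 0 → ‖fderiv ℝ kk z v‖ ≤ C * (‖z‖ ^ (n + 1))⁻¹ * ‖v‖ := by
  obtain ⟨C, hC, hb⟩ := (kk_HK n).fderiv.bound
  exact ⟨C, hC, fun z v hz => (le_opNorm _ _).trans (by gcongr; exact hb z hz)⟩
theorem g_int (hz : 0 < z.snd) : Integrable fun w : En n => fderiv ℝ kk (z - pt w 0) (pt 0 1) := by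
  obtain ⟨C, hC, hb⟩ := g_bd n
  refine (((pp_integrable hz).comp_sub_left z.fst).const_mul (C * z.snd⁻¹)).mono' ?_ (ae_of_all _ fun w => ?_)
  · exact (((kk_HK n).fderiv.contw hz).clm_apply continuous_const).aestronglyMeasurable
  · refine (hb _ _ (sub_ne hz w)).trans (le_of_eq ?_)
    rw [norm_e, z_pp hz]; ring
theorem g_zero (hz : 0 < z.snd) : ∫ w : En n, fderiv ℝ kk (z - pt w 0) (pt 0 1) = 0 := by
  obtain ⟨C, hC, hb⟩ := g_bd n
  refine ext_inner_left ℝ fun v => ?_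
  rw [inner_zero_right, ← integral_inner (g_int hz)]
  have hs : ∀ s ∈ ball (0 : ℝ) (z.snd / (2 * (‖v‖ + 1))), ‖s • v‖ ≤ z.snd / 2 := fun s hs => by
    rw [mem_ball_zero_iff, lt_div_iff₀ pv] at hs
    rw [norm_smul]; nlinarith [norm_nonneg s]
  have hs2 : ∀ s ∈ ball (0 : ℝ) (z.snd / (2 * (‖v‖ + 1))), 0 < (z + s • v).snd := fun s h => by
    have := (abs_le.1 ((snd_le_norm _).trans (hs s h))).1
    rw [add_snd]; linarith
  have hε : 0 < z.snd / (2 * (‖v‖ + 1)) := by positivity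
  have hc : ∀ s : ℝ, 0 < (z + s • v).snd → ∀ w : En n, (kk (z + s • v - pt w 0)).snd = pp n (z + s • v).snd ((z + s • v).fst - w) := fun s h w => by
    rw [kk, smul_snd, z_pp h, sub_snd, pt_snd, sub_zero]; field_simp
  have key := hasDerivAt_integral_of_dominated_loc_of_deriv_le (μ := (volume : Measure (En n))) (𝕜 := ℝ) (F := fun (s : ℝ) w => (kk (z + s • v - pt w 0)).snd)
    (F' := fun (s : ℝ) w => (fderiv ℝ kk (z + s • v - pt w 0) v).snd) (x₀ := (0 : ℝ)) (bound := fun w => C * ‖v‖ * 2 ^ (n + 1) * z.snd⁻¹ * pp n z.snd (z.fst - w)) (ball_mem_nhds _ hε)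
    ?_ ?_ ?_ ?_ ?_ ?_
  · have e : (fun s : ℝ => ∫ w : En n, (kk (z + s • v - pt w 0)).snd) =ᶠ[𝓝 0] fun _ => cP n := by
      filter_upwards [ball_mem_nhds _ hε] with s h
      simp only [hc s (hs2 s h)]
      rw [integral_sub_left_eq_self (fun w => pp n (z + s • v).snd w), pp_tot (hs2 s h)]
    have := (key.2.congr_of_eventuallyEq e.symm).unique (hasDerivAt_const _ _)
    simp only [zero_smul, add_zero] at this
    refine (integral_congr_ae (ae_of_all _ fun w => ?_)).trans this
    rw [← kk_sym (sub_ne hz w), real_inner_comm, inner_e]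
  · filter_upwards [ball_mem_nhds _ hε] with s h
    exact (cont_snd.comp ((kk_HK n).contw (hs2 s h))).aestronglyMeasurable
  · simp only [hc 0 (by simpa using hz)]
    simpa using (pp_integrable hz).comp_sub_left z.fst
  · simp only [zero_smul, add_zero]
    exact (cont_snd.comp (((kk_HK n).fderiv.contw hz).clm_apply continuous_const)).aestronglyMeasurable
  · refine ae_of_all _ fun w s h => (snd_le_norm _).trans ((hb _ _ (sub_ne (hs2 s h) w)).trans ?_)
    have h1 : ‖z - pt w 0‖ ≤ 2 * ‖z + s • v - pt w 0‖ := by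
      have h2 := snd_le_sub z w
      have h3 := norm_sub_le (z + s • v - pt w 0) (s • v)
      rw [show z + s • v - pt w 0 - s • v = z - pt w 0 by abel] at h3
      linarith [hs s h]
    have h0 : 0 < ‖z - pt w 0‖ := norm_pos_iff.2 (sub_ne hz w)
    calc _ ≤ C * (((‖z - pt w 0‖ / 2) ^ (n + 1))⁻¹) * ‖v‖ := by gcongr; linarith
      _ = C * ‖v‖ * 2 ^ (n + 1) * (‖z - pt w 0‖ ^ (n + 1))⁻¹ := by rw [div_pow]; field_simp
      _ = _ := by rw [z_pp hz]; ring
  · exact ((pp_integrable hz).comp_sub_left z.fst).const_mul _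
  · refine ae_of_all _ fun w s h => ?_
    have h1 := (((kk_HK n).contAt (sub_ne (hs2 s h) w)).differentiableAt sm).hasFDerivAt
    have h2 : HasDerivAt (fun s : ℝ => z + s • v - pt w 0) v s := by
      simpa using ((((hasDerivAt_id s).smul_const v).const_add z).sub_const (pt w 0))
    have h3 := (innerSL ℝ (pt 0 1 : Vn n)).hasFDerivAt.comp_hasDerivAt s (h1.comp_hasDerivAt s h2)
    simpa [comp_def, inner_e] using h3
def Bm (A : ENNReal) (β : En n → ℝ) : Prop := ∀ x r, 0 < r → ∃ c : ℝ, ∫⁻ y in ball x r, ‖β y - c‖ₑ ^ 2 ≤ A ^ 2 * ofReal (r ^ n)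
theorem Bm1 {A : ENNReal} (h0 : A ≠ 0) (h1 : A ≠ ⊤) {f : En n → ENNReal} {x : En n} (hr : 0 < r)
    (hf : ∫⁻ y in ball x r, f y ^ 2 ≤ A ^ 2 * ofReal (r ^ n)) : ∫⁻ y in ball x r, f y ≤ (om n + 1) * A * ofReal (r ^ n) := by
  calc _ ≤ ∫⁻ y in ball x r, (A + A⁻¹ * f y ^ 2) := lintegral_mono fun y => by
        rcases le_total (f y) A with h | h
        · exact h.trans le_self_add
        · refine le_trans ?_ le_add_self
          calc f y = A⁻¹ * A * f y := by rw [ENNReal.inv_mul_cancel h0 h1, one_mul]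
            _ ≤ A⁻¹ * f y * f y := by gcongr
            _ = _ := by ring
    _ ≤ A * (ofReal (r ^ n) * om n) + A⁻¹ * (A ^ 2 * ofReal (r ^ n)) := by
        rw [lintegral_add_left measurable_const, setLIntegral_const, vol_ball x hr, lintegral_const_mul' _ _ (by simp [h0])]
        gcongr
    _ = A * (ofReal (r ^ n) * om n) + (A⁻¹ * A) * A * ofReal (r ^ n) := by ring
    _ = _ := by rw [ENNReal.inv_mul_cancel h0 h1]; ring
theorem p2 (k : ℕ) (hr : 0 < r) : ofReal ((2 ^ (k + 1) * r) ^ n) = 2 ^ n * ofReal ((2 ^ k * r) ^ n) := by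
  rw [show (2 ^ (k + 1) * r) ^ n = 2 ^ n * (2 ^ k * r) ^ n by ring, ofReal_mul pv, ofReal_pow (by norm_num)]; norm_num
theorem Bmk {A : ENNReal} (h0 : A ≠ 0) (h1 : A ≠ ⊤) {β : En n → ℝ} (hβ : Bm A β) (hm : AEMeasurable β) {x : En n} (hr : 0 < r) {c0 : ℝ}
    (hc0 : ∫⁻ y in ball x r, ‖β y - c0‖ₑ ^ 2 ≤ A ^ 2 * ofReal (r ^ n)) (k : ℕ) :
    ∫⁻ y in ball x (2 ^ k * r), ‖β y - c0‖ₑ ≤ (k + 1) * ((1 + 2 ^ n) * ((om n + 1) * A)) * ofReal ((2 ^ k * r) ^ n) := by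
  set M := (om n + 1) * A
  suffices H : ∃ c : ℝ, ∫⁻ y in ball x (2 ^ k * r), ‖β y - c‖ₑ ≤ M * ofReal ((2 ^ k * r) ^ n) ∧ ‖c - c0‖ₑ * om n ≤ k * ((1 + 2 ^ n) * M) by
    obtain ⟨c, h1, h2⟩ := H
    calc _ ≤ ∫⁻ y in ball x (2 ^ k * r), (‖β y - c‖ₑ + ‖c - c0‖ₑ) := lintegral_mono fun y => by
          rw [show β y - c0 = (β y - c) + (c - c0) by ring]; exact enorm_add_le _ _
      _ ≤ M * ofReal ((2 ^ k * r) ^ n) + k * ((1 + 2 ^ n) * M) * ofReal ((2 ^ k * r) ^ n) := by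
          rw [lintegral_add_right _ measurable_const, setLIntegral_const, vol_ball x pv]
          refine add_le_add h1 ?_
          rw [mul_comm (ofReal _), ← mul_assoc]; gcongr
      _ = (k * (1 + 2 ^ n) + 1) * M * ofReal ((2 ^ k * r) ^ n) := by ring
      _ ≤ (k * (1 + 2 ^ n) + (1 + 2 ^ n)) * M * ofReal ((2 ^ k * r) ^ n) := by gcongr; exact le_self_add
      _ = _ := by ring
  induction k with
  | zero => exact ⟨c0, by simpa using Bm1 h0 h1 hr hc0, by simp⟩
  | succ k ih =>
    obtain ⟨c, i1, i2⟩ := ih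
    obtain ⟨c', hc'⟩ := hβ x (2 ^ (k + 1) * r) pv
    have hc' := Bm1 h0 h1 pv hc'
    refine ⟨c', hc', ?_⟩
    have hv : ofReal ((2 ^ k * r) ^ n) ≠ 0 := by simpa using (show (0 : ℝ) < (2 ^ k * r) ^ n by positivity)
    have hd : ‖c' - c‖ₑ * om n ≤ (1 + 2 ^ n) * M := by
      rw [← ENNReal.mul_le_mul_iff_left hv ofReal_ne_top]
      calc _ = ∫⁻ y in ball x (2 ^ k * r), ‖c' - c‖ₑ := by rw [setLIntegral_const, vol_ball x pv]; ring
        _ ≤ ∫⁻ y in ball x (2 ^ k * r), (‖β y - c‖ₑ + ‖β y - c'‖ₑ) := lintegral_mono fun y => by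
          rw [show c' - c = (β y - c) - (β y - c') by ring]; exact enorm_sub_le
        _ ≤ M * ofReal ((2 ^ k * r) ^ n) + M * ofReal ((2 ^ (k + 1) * r) ^ n) := by
          rw [lintegral_add_left' (hm.sub_const c).enorm.restrict]
          refine add_le_add i1 (le_trans (lintegral_mono_set (ball_subset_ball ?_)) hc')
          gcongr <;> norm_num
        _ = _ := by rw [p2 k hr]; ring
    calc _ ≤ (‖c' - c‖ₑ + ‖c - c0‖ₑ) * om n := by
          gcongr; rw [show c' - c0 = (c' - c) + (c - c0) by ring]; exact enorm_add_le _ _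
      _ ≤ (1 + 2 ^ n) * M + k * ((1 + 2 ^ n) * M) := by rw [add_mul]; gcongr
      _ = _ := by push_cast; ring
theorem sum_k : ∑' k : ℕ, ((k : ENNReal) + 2) * (2 ^ k)⁻¹ ≠ ⊤ := by
  have h1 : Summable fun k : ℕ => ((k : ℝ) + 2) * (1 / 2) ^ k := by
    simp_rw [add_mul]
    refine Summable.add ?_ (summable_geometric_two.mul_left 2)
    simpa using summable_pow_mul_geometric_of_norm_lt_one 1 (r := (1 / 2 : ℝ)) (by norm_num)
  convert h1.tsum_ofReal_ne_top using 4 with k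
  rw [ofReal_mul pv, ofReal_add pv (by norm_num), ofReal_natCast, ofReal_pow (by norm_num),
    one_div, ofReal_inv_of_pos (by norm_num), ENNReal.inv_pow]; norm_num
theorem cover_k {x : En n} (hr : 0 < r) (f : En n → ENNReal) : ∫⁻ y in (ball x r)ᶜ, f y ≤ ∑' k : ℕ, ∫⁻ y in ball x (2 ^ (k + 1) * r) \ ball x (2 ^ k * r), f y := by
  refine le_trans (lintegral_mono_set fun y hy => ?_) (lintegral_iUnion_le _ _)
  have hy : r ≤ dist y x := by simpa using hy
  obtain ⟨k, h1, h2⟩ := exists_nat_pow_near (show 1 ≤ dist y x / r by rwa [one_le_div hr]) (one_lt_two)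
  rw [le_div_iff₀ hr] at h1
  rw [div_lt_iff₀ hr] at h2
  exact mem_iUnion.2 ⟨k, h2, by simpa using h1⟩
theorem far_k (n : ℕ) : ∃ C : ENNReal, C ≠ ⊤ ∧ ∀ (A : ENNReal) (β : En n → ℝ), A ≠ 0 → A ≠ ⊤ → Bm A β → AEMeasurable β → ∀ (x : En n) (r : ℝ) (c : ℝ), 0 < r →
    ∫⁻ y in ball x (2 * r), ‖β y - c‖ₑ ^ 2 ≤ A ^ 2 * ofReal ((2 * r) ^ n) → ∀ z ∈ tent x r,
    ∫⁻ w in (ball x (2 * r))ᶜ, ‖β w - c‖ₑ * ‖fderiv ℝ kk (z - pt w 0) (pt 0 1)‖ₑ ≤ C * A * (ofReal r)⁻¹ := by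
  obtain ⟨C, hC, hb⟩ := g_bd n
  refine ⟨ofReal (C * 4 ^ n) * ((1 + 2 ^ n) * (om n + 1)) * ∑' k : ℕ, ((k : ENNReal) + 2) * (2 ^ k)⁻¹,
    by have := sum_k; have := om_top n; finiteness, fun A β h0 h1 hβ hm x r c hr hc z hz => (cover_k pv _).trans ?_⟩
  calc _ ≤ ∑' k : ℕ, ofReal (C * 4 ^ n) * ((1 + 2 ^ n) * (om n + 1)) * A * (ofReal r)⁻¹ * (((k : ENNReal) + 2) * (2 ^ k)⁻¹) := by
        refine tsum_le_tsum fun k => ?_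
        calc _ ≤ ∫⁻ w in ball x (2 ^ (k + 1) * (2 * r)) \ ball x (2 ^ k * (2 * r)), ‖β w - c‖ₑ * ofReal (C * ((2 ^ k * r) ^ (n + 1))⁻¹) := by
              refine setLIntegral_mono_ae' (measurableSet_ball.diff measurableSet_ball) (ae_of_all _ fun w hw => mul_le_mul_right ?_ _)
              rw [← ofReal_norm_eq_enorm]
              refine ofReal_le_ofReal ((hb _ _ (sub_ne hz.2.1 w)).trans ?_)
              rw [norm_e, mul_one]
              gcongr
              have h2 : 2 ^ k * (2 * r) ≤ dist w x := by simpa using hw.2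
              have h3 := fst_le_norm (z - pt w 0)
              rw [sub_fst, pt_fst, ← dist_eq_norm] at h3
              have h4 := dist_triangle_left w x z.fst
              have h5 : r ≤ 2 ^ k * r := le_mul_of_one_le_left hr.le (one_le_pow₀ one_le_two)
              linarith [hz.1]
          _ ≤ ((k + 1 : ℕ) + 1) * ((1 + 2 ^ n) * ((om n + 1) * A)) * ofReal ((2 ^ (k + 1) * (2 * r)) ^ n) * ofReal (C * ((2 ^ k * r) ^ (n + 1))⁻¹) := by
              rw [lintegral_mul_const' _ _ ofReal_ne_top]
              gcongr
              exact (lintegral_mono_set diff_subset).trans (Bmk h0 h1 hβ hm pv hc (k + 1))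
          _ = ((k + 1 : ℕ) + 1) * ((1 + 2 ^ n) * ((om n + 1) * A)) * (ofReal (C * 4 ^ n) * (ofReal r)⁻¹ * (2 ^ k)⁻¹) := by
              rw [mul_assoc, ← ofReal_mul pv, ← ofReal_inv_of_pos hr, show ((2 : ENNReal) ^ k)⁻¹ = ofReal ((2 ^ k)⁻¹) by
                rw [ofReal_inv_of_pos pv, ofReal_pow (by norm_num)]; norm_num, ← ofReal_mul pv, ← ofReal_mul pv]
              congr 2
              rw [show (4 : ℝ) = 2 * 2 by norm_num]; simp only [mul_pow, pow_succ]; field_simp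
          _ = _ := by push_cast; ring
    _ = _ := by rw [ENNReal.tsum_mul_left]; ring
theorem tent_vol (x : En n) (hr : 0 < r) : MeasurableSet (tent x r) ∧ volume (tent x r) ≤ ofReal r * (ofReal (r ^ n) * om n) := by
  have hm : MeasurableSet (tent x r) := ((isOpen_lt (cont_fst.dist continuous_const) continuous_const).inter ((isOpen_lt continuous_const cont_snd).inter (isOpen_lt cont_snd continuous_const))).measurableSet
  refine ⟨hm, ?_⟩
  rw [← lintegral_indicator_one hm, lint_V _ (measurable_one.indicator hm).aemeasurable]
  calc _ ≤ ∫⁻ t in Icc 0 r, ofReal (r ^ n) * om n := by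
        rw [← lintegral_indicator measurableSet_Icc]
        refine lintegral_mono fun t => ?_
        by_cases ht : t ∈ Icc 0 r
        · rw [indicator_of_mem ht, ← vol_ball x hr, ← lintegral_indicator_one measurableSet_ball]
          refine lintegral_mono fun y => ?_
          by_cases h : pt y t ∈ tent x r
          · rw [indicator_of_mem h, indicator_of_mem (by simpa [pt_fst] using h.1)]; rfl
          · rw [indicator_of_notMem h]; exact zero_le
        · rw [indicator_of_notMem ht, nonpos_iff_eq_zero]
          refine (lintegral_congr fun y => indicator_of_notMem (fun h => ht ?_) _).trans lintegral_zero
          have := h.2; simp only [pt_snd] at this; exact ⟨this.1.le, this.2.le⟩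
    _ = _ := by rw [setLIntegral_const, volume_Icc, sub_zero]; ring
theorem H13 (hn : n ≠ 0) : ∃ C : ENNReal, C ≠ ⊤ ∧ ∀ (A : ENNReal) (β : En n → ℝ), A ≠ 0 → A ≠ ⊤ → Bm A β → Integrable β → ∀ (x : En n) (r : ℝ), 0 < r →
    ∫⁻ z in tent x r, ofReal (z.snd * ‖Gr β z‖ ^ 2) ≤ C * A ^ 2 * ofReal (r ^ n) := by
  obtain ⟨C1, hC1, H1⟩ := far_k n
  obtain ⟨C2, hC2, H2⟩ := H11u n hn
  refine ⟨2 * C2 * 2 ^ n + 2 * C1 ^ 2 * om n, by have := om_top n; finiteness, fun A β h0 h1 hβ hi x r hr => ?_⟩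
  obtain ⟨c, hc⟩ := hβ x (2 * r) pv
  set β1 : En n → ℝ := indicator (ball x (2 * r)) fun w => β w - c
  have hi1 : Integrable β1 := (integrable_indicator_iff measurableSet_ball).2 (hi.integrableOn.sub (integrableOn_const (by rw [vol_ball x pv]; have := om_top n; finiteness)))
  obtain ⟨htm, htv⟩ := tent_vol x hr
  have hfar : ∀ z ∈ tent x r, ‖Gr β z - Gr β1 z‖ₑ ≤ C1 * A * (ofReal r)⁻¹ := fun z hz => by
    refine le_trans ?_ (H1 A β h0 h1 hβ hi.1.aemeasurable x r c hr hc z hz)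
    have hz0 := hz.2.1
    have i1 : Integrable fun w => β w • fderiv ℝ kk (z - pt w 0) (pt 0 1) := by
      simpa using (Po_int (kk_HK n).fderiv hi hz0).apply_continuousLinearMap (pt 0 1)
    have i2 : Integrable fun w => β1 w • fderiv ℝ kk (z - pt w 0) (pt 0 1) := by
      simpa using (Po_int (kk_HK n).fderiv hi1 hz0).apply_continuousLinearMap (pt 0 1)
    have i3 : Integrable fun w => c • fderiv ℝ kk (z - pt w 0) (pt 0 1 : Vn n) := (g_int hz0).smul c
    have i12 : Integrable fun w => β w • fderiv ℝ kk (z - pt w 0) (pt 0 1 : Vn n) - β1 w • fderiv ℝ kk (z - pt w 0) (pt 0 1) := i1.sub i2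
    have e : Gr β z - Gr β1 z = ∫ w, (β w - β1 w - c) • fderiv ℝ kk (z - pt w 0) (pt 0 1) := by
      have e1 : ∫ w, c • fderiv ℝ kk (z - pt w 0) (pt 0 1 : Vn n) = 0 := by rw [integral_smul, g_zero hz0, smul_zero]
      rw [Gr_eq hi hz0, Gr_eq hi1 hz0, ← integral_sub i1 i2, ← sub_zero (∫ w, (β w • _ - _)), ← e1, ← integral_sub i12 i3]
      simp only [sub_smul]
    rw [e, ← lintegral_indicator measurableSet_ball.compl]
    refine (enorm_integral_le_lintegral_enorm _).trans (lintegral_mono fun w => ?_)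
    rw [enorm_smul]
    by_cases hw : w ∈ ball x (2 * r)
    · simp [β1, hw]
    · simp only [β1, indicator_of_notMem hw, sub_zero]
      rw [indicator_of_mem (by simpa using hw)]
  have hL2 : ∫⁻ w, ‖β1 w‖ₑ ^ 2 ≤ A ^ 2 * ofReal ((2 * r) ^ n) := by
    refine le_trans (le_of_eq ?_) hc
    rw [← lintegral_indicator measurableSet_ball]
    congr 1; ext w; by_cases hw : w ∈ ball x (2 * r) <;> simp [β1, hw]
  have hr' : ofReal r ≠ 0 := by simpa using hr
  calc _ ≤ ∫⁻ z in tent x r, (2 * ofReal (z.snd * ‖Gr β1 z‖ ^ 2) + 2 * (ofReal r * (C1 * A * (ofReal r)⁻¹) ^ 2)) := by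
        refine setLIntegral_mono_ae' htm (ae_of_all _ fun z hz => ?_)
        have h3 : z.snd * ‖Gr β z‖ ^ 2 ≤ 2 * (z.snd * ‖Gr β1 z‖ ^ 2) + 2 * (r * ‖Gr β z - Gr β1 z‖ ^ 2) := by
          have h4 := norm_add_le (Gr β1 z) (Gr β z - Gr β1 z)
          rw [add_sub_cancel] at h4
          have h5 : ‖Gr β z‖ ^ 2 ≤ 2 * ‖Gr β1 z‖ ^ 2 + 2 * ‖Gr β z - Gr β1 z‖ ^ 2 := by
            nlinarith [norm_nonneg (Gr β z), sq_nonneg (‖Gr β1 z‖ - ‖Gr β z - Gr β1 z‖)]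
          nlinarith [mul_le_mul_of_nonneg_left h5 hz.2.1.le, mul_le_mul_of_nonneg_right hz.2.2.le (sq_nonneg ‖Gr β z - Gr β1 z‖)]
        have := hz.2.1
        refine (ofReal_le_ofReal h3).trans ?_
        rw [ofReal_add pv pv, ofReal_mul (by norm_num), ofReal_mul (p := 2) (by norm_num), ofReal_mul (p := r) hr.le,
          ofReal_pow (norm_nonneg _), ofReal_norm_eq_enorm]
        norm_num
        gcongr; exact hfar z hz
    _ ≤ 2 * (C2 * (A ^ 2 * ofReal ((2 * r) ^ n))) + 2 * (ofReal r * (C1 * A * (ofReal r)⁻¹) ^ 2) * (ofReal r * (ofReal (r ^ n) * om n)) := by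
        rw [lintegral_add_right _ measurable_const, setLIntegral_const, lintegral_const_mul' _ _ sm]
        gcongr
        exact (lintegral_mono_set fun z hz => hz.2.1).trans ((H2 β1 hi1).trans (by gcongr))
    _ = 2 * (C2 * (A ^ 2 * ofReal ((2 * r) ^ n))) + 2 * (C1 * A) ^ 2 * (ofReal r * (ofReal r)⁻¹) ^ 2 * (ofReal (r ^ n) * om n) := by ring
    _ = _ := by
        rw [ENNReal.mul_inv_cancel hr' ofReal_ne_top, mul_pow 2 r, ofReal_mul pv, ofReal_pow zero_le_two]; norm_num; ring
theorem pp_far {δ t : ℝ} (hδ : 0 < δ) (ht : 0 < t) {v : En n} (hv : δ ≤ ‖v‖) : pp n t v ≤ 2 ^ (n + 1) * (t / δ) * pp n δ v := by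
  have h1 : ‖pt v δ‖ ≤ 2 * ‖pt v t‖ := by
    have h2 := norm_pt_le v δ
    have h3 := fst_le_norm (pt v t)
    rw [abs_of_pos hδ] at h2; rw [pt_fst] at h3; linarith
  have := pt_ne hδ v
  rw [pp, pp]
  calc t / ‖pt v t‖ ^ (n + 1) ≤ t / (‖pt v δ‖ / 2) ^ (n + 1) := by gcongr; linarith
    _ = _ := by rw [div_pow]; field_simp
theorem pp_neg (t : ℝ) (v : En n) : pp n t (-v) = pp n t v := by
  rw [pp, pp, show ‖pt (-v) t‖ = ‖pt v t‖ by rw [← sq_eq_sq₀ (norm_nonneg _) (norm_nonneg _), norm_pt, norm_pt, norm_neg]]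
theorem abs_int_le {α : Type*} {m0 : MeasurableSpace α} {μ : Measure α} {f g : α → ℝ} (hg : Integrable g μ) (h : ∀ x, |f x| ≤ g x) : |∫ x, f x ∂μ| ≤ ∫ x, g x ∂μ :=
  norm_integral_le_of_norm_le (f := f) hg (ae_of_all _ h)
theorem pp_av (ht : 0 < t) (x : En n) : ∫ w, pp n t (x - w) = cP n := by rw [integral_sub_left_eq_self (fun w => pp n t w), pp_tot ht]
theorem pp_bd (ht : 0 < t) (x : En n) {f : En n → ℝ} {M : ℝ} (hf : ∀ w, |f w| ≤ M) : |∫ w, f w * pp n t (x - w)| ≤ M * cP n := by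
  rw [← pp_av ht x, ← integral_const_mul]
  refine abs_int_le (((pp_integrable ht).comp_sub_left x).const_mul M) fun w => ?_
  rw [abs_mul, abs_of_nonneg (pp_nonneg ht _)]
  exact mul_le_mul_of_nonneg_right (hf w) (pp_nonneg ht _)
theorem pp_mi (ht : 0 < t) (x : En n) {f : En n → ℝ} {M : ℝ} (hm : AEStronglyMeasurable f) (hf : ∀ w, |f w| ≤ M) : Integrable fun w => f w * pp n t (x - w) :=
  ((pp_integrable ht).comp_sub_left x).bdd_mul (c := M) hm (ae_of_all _ hf)
theorem u_unif {β : En n → ℝ} (hc : Continuous β) (hs : HasCompactSupport β) {η : ℝ} (hη : 0 < η) :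
    ∃ t0 > 0, ∀ t, 0 < t → t ≤ t0 → ∀ x, |(Fp β (pt x t)).snd - cP n * β x| ≤ η := by
  obtain ⟨M, hM⟩ := hs.exists_bound_of_continuous hc
  have hM0 : 0 ≤ M := (norm_nonneg _).trans (hM 0)
  have hcP := cP_pos n
  obtain ⟨δ, hδ, hu⟩ := Metric.uniformContinuous_iff.1 (hs.uniformContinuous_of_continuous hc) (η / (2 * cP n)) pv
  refine ⟨η * δ / (2 * (2 * M + 1) * 2 ^ (n + 1) * cP n), by positivity, fun t ht htt x => ?_⟩
  rw [Fp_snd' (hc.integrable_of_hasCompactSupport hs) ht, ← pp_av ht x, mul_comm _ (β x), ← integral_const_mul, ← integral_sub (pp_mi ht x hc.aestronglyMeasurable hM) (((pp_integrable ht).comp_sub_left x).const_mul _)]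
  refine (abs_int_le (g := fun w => η / (2 * cP n) * pp n t (x - w) + 2 * M * 2 ^ (n + 1) * (t / δ) * pp n δ (x - w)) ?_ fun w => ?_).trans ?_
  · exact (((pp_integrable ht).comp_sub_left x).const_mul _).add (((pp_integrable hδ).comp_sub_left x).const_mul _)
  · have p1 := pp_nonneg ht (x - w)
    have p2 := pp_nonneg hδ (x - w)
    rw [← sub_mul, abs_mul, abs_of_nonneg p1]
    rcases lt_or_ge (dist w x) δ with h | h
    · have := (hu h).le
      rw [dist_eq_norm] at this
      exact (mul_le_mul_of_nonneg_right (b := |β w - β x|) this p1).trans (le_add_of_nonneg_right pv)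
    · rw [dist_comm, dist_eq_norm] at h
      refine le_trans ?_ (le_add_of_nonneg_left pv)
      calc _ ≤ (2 * M) * (2 ^ (n + 1) * (t / δ) * pp n δ (x - w)) := by
            gcongr
            · exact (norm_sub_le (β w) (β x)).trans (by linarith [hM w, hM x])
            · exact pp_far hδ ht h
        _ = _ := by ring
  · rw [integral_add (((pp_integrable ht).comp_sub_left x).const_mul _) (((pp_integrable hδ).comp_sub_left x).const_mul _), integral_const_mul, integral_const_mul, pp_av ht, pp_av hδ]
    have h1 : 2 * M * 2 ^ (n + 1) * (t / δ) * cP n ≤ (2 * M + 1) * 2 ^ (n + 1) * ((η * δ / (2 * (2 * M + 1) * 2 ^ (n + 1) * cP n)) / δ) * cP n := by gcongr; linarith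
    have h2 : (2 * M + 1) * 2 ^ (n + 1) * ((η * δ / (2 * (2 * M + 1) * 2 ^ (n + 1) * cP n)) / δ) * cP n = η / 2 := by field_simp
    have h3 : η / (2 * cP n) * cP n = η / 2 := by field_simp
    linarith
theorem u_cont {β : En n → ℝ} (hβ : Integrable β) (ht : 0 < t) : Continuous fun x => (Fp β (pt x t)).snd :=
  continuous_iff_continuousAt.2 fun x => (cont_snd.continuousAt.comp (Fp_smoothAt hβ (z := pt x t) ht).continuousAt).comp (f := fun x => pt x t) (cont_pt.comp (continuous_id.prodMk continuous_const)).continuousAt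
theorem Phi_eq (hh : Integrable h) {f : En n → ℝ} (hf : Continuous f) {M : ℝ} (hM : ∀ w, |f w| ≤ M) (ht : 0 < t) :
    ∫ x, (Fp h (pt x t)).snd * f x = ∫ w, h w * ∫ x, f x * pp n t (w - x) := by
  have i1 : Integrable (fun p : En n × En n => f p.1 * (h p.2 * pp n t (p.1 - p.2))) (volume.prod volume) :=
    (hh.convolution_integrand (ContinuousLinearMap.mul ℝ ℝ) (pp_integrable ht)).bdd_mul (c := M) (hf.comp continuous_fst).aestronglyMeasurable (ae_of_all _ fun p => hM p.1)
  calc _ = ∫ x, ∫ w, f x * (h w * pp n t (x - w)) := by simp_rw [integral_const_mul, Fp_snd' hh ht, mul_comm]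
    _ = ∫ w, ∫ x, f x * (h w * pp n t (x - w)) := integral_integral_swap i1
    _ = _ := by
      congr 1; ext w; rw [← integral_const_mul]; congr 1; ext x; rw [← neg_sub w x, pp_neg]; ring
theorem Phi_bd (hh : Integrable h) {f : En n → ℝ} (hf : Continuous f) {M : ℝ} (hM : ∀ w, |f w| ≤ M) (ht : 0 < t) :
    |∫ x, (Fp h (pt x t)).snd * f x| ≤ M * cP n * ∫ w, |h w| := by
  rw [Phi_eq hh hf hM ht, ← integral_const_mul]
  refine abs_int_le (hh.abs.const_mul _) fun w => ?_
  rw [abs_mul, mul_comm]; exact mul_le_mul_of_nonneg_right (pp_bd ht w hM) (abs_nonneg _)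
theorem Phi_0 (hh : Integrable h) {β : En n → ℝ} (hc : Continuous β) (hs : HasCompactSupport β) {η : ℝ} (hη : 0 < η) :
    ∃ t0 > 0, ∀ t, 0 < t → t ≤ t0 → |(∫ x, (Fp h (pt x t)).snd * (Fp β (pt x t)).snd) - cP n ^ 2 * ∫ x, h x * β x| ≤ η := by
  have hcP := cP_pos n
  have hh0 : 0 ≤ ∫ w, |h w| := integral_nonneg fun _ => abs_nonneg _
  have hi : Integrable β := hc.integrable_of_hasCompactSupport hs
  obtain ⟨M, hM⟩ := hs.exists_bound_of_continuous hc
  obtain ⟨t0, ht0, H⟩ := u_unif hc hs (η := η / (2 * cP n * ((∫ w, |h w|) + 1))) pv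
  refine ⟨t0, ht0, fun t ht htt => ?_⟩
  set η' := η / (2 * cP n * ((∫ w, |h w|) + 1))
  have H := H t ht htt
  have hu : ∀ x, |(Fp β (pt x t)).snd| ≤ M * cP n := fun x => by rw [Fp_snd' hi ht]; exact pp_bd ht x hM
  have hM0 : 0 ≤ M := (norm_nonneg _).trans (hM 0)
  have i0 : Integrable fun w => h w * ∫ x, (Fp β (pt x t)).snd * pp n t (w - x) := by
    refine hh.mul_bdd (c := M * cP n * cP n) ?_ (ae_of_all _ fun w => pp_bd ht w hu)
    have : ∀ w, ∫ x, (Fp β (pt x t)).snd * pp n t (w - x) = ∫ x, (Fp β (pt (w - x) t)).snd * pp n t x := fun w => by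
      rw [← integral_sub_left_eq_self _ volume w]; simp
    simp_rw [this]
    refine (continuous_of_dominated (bound := fun x => M * cP n * pp n t x) (fun w => ?_) (fun w => ae_of_all _ fun x => ?_) ((pp_integrable ht).const_mul _) (ae_of_all _ fun x => ?_)).aestronglyMeasurable
    · exact ((((u_cont hi ht).comp (continuous_const.sub continuous_id)).mul (pp_cont ht))).aestronglyMeasurable
    · rw [norm_mul, norm_of_nonneg (pp_nonneg ht _)]; exact mul_le_mul_of_nonneg_right (hu _) (pp_nonneg ht _)
    · exact ((u_cont hi ht).comp (continuous_id.sub continuous_const)).mul continuous_const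
  rw [Phi_eq hh (u_cont hi ht) hu ht, ← integral_const_mul, ← integral_sub i0 ((hh.mul_bdd (c := M) hc.aestronglyMeasurable (ae_of_all _ hM)).const_mul _)]
  refine (abs_int_le (hh.abs.const_mul (2 * cP n * η')) fun w => ?_).trans ?_
  · have e1 := pp_bd ht w (f := fun x => (Fp β (pt x t)).snd - cP n * β x) H
    have j1 := pp_mi ht w (u_cont hi ht).aestronglyMeasurable hu
    have j2 := (pp_mi ht w hc.aestronglyMeasurable hM).const_mul (cP n)
    simp_rw [sub_mul, mul_assoc] at e1
    rw [integral_sub j1 j2, integral_const_mul, ← Fp_snd' hi ht] at e1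
    have e2 := H w
    rw [show ∀ I : ℝ, h w * I - cP n ^ 2 * (h w * β w) = h w * ((I - cP n * (Fp β (pt w t)).snd) + cP n * ((Fp β (pt w t)).snd - cP n * β w)) by intro I; ring, abs_mul, mul_comm]
    refine mul_le_mul_of_nonneg_right ((abs_add_le _ _).trans ?_) (abs_nonneg _)
    rw [abs_mul, abs_of_pos hcP]
    nlinarith
  · rw [integral_const_mul]
    calc _ ≤ 2 * cP n * η' * ((∫ w, |h w|) + 1) := by gcongr; linarith
      _ = η := by simp only [η']; field_simp
theorem Phi_inf (hn : n ≠ 0) (hh : Integrable h) {β : En n → ℝ} (hi : Integrable β) {η : ℝ} (hη : 0 < η) :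
    ∃ R > 0, ∀ t, R ≤ t → |∫ x, (Fp h (pt x t)).snd * (Fp β (pt x t)).snd| ≤ η := by
  obtain ⟨C, hC, H⟩ := Po_bound (kk_HK n)
  have hl : Tendsto (fun t : ℝ => C * (t ^ n)⁻¹ * (∫ w, |β w|) * cP n * ∫ w, |h w|) atTop (𝓝 0) := by
    have := (tendsto_inv_atTop_zero.comp (tendsto_pow_atTop (α := ℝ) hn))
    simpa using (((this.const_mul C).mul_const (∫ w, |β w|)).mul_const (cP n)).mul_const (∫ w, |h w|)
  obtain ⟨R, hR⟩ := eventually_atTop.1 (hl.eventually (gt_mem_nhds hη))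
  refine ⟨max R 1, by positivity, fun t ht => ?_⟩
  have ht0 : 0 < t := lt_of_lt_of_le pv ht
  exact (Phi_bd hh (u_cont hi ht0) (fun x => (snd_le_norm _).trans (H β hi (pt x t) ht0)) ht0).trans (hR t ((le_max_left _ _).trans ht)).le
theorem stripI {f : Vn n → ℝ} {a b : ℝ} (hf : IntegrableOn f (strip n a b)) :
    ∫ z in strip n a b, f z = (∫ t in Icc a b, ∫ x, f (pt x t)) ∧ IntegrableOn (fun t => ∫ x, f (pt x t)) (Icc a b) := by
  have h1 := (vol_pt n).restrict_preimage (strip_meas (n := n) a b)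
  have e : ((fun p : En n × ℝ => pt p.1 p.2) ⁻¹' strip n a b) = univ ×ˢ Icc a b := by ext p; simp [strip, pt_snd]
  rw [e, Measure.volume_eq_prod, ← Measure.prod_restrict, Measure.restrict_univ] at h1
  have h2 : Integrable (fun p : En n × ℝ => f (pt p.1 p.2)) (volume.prod (volume.restrict (Icc a b))) := h1.integrable_comp_of_integrable hf
  refine ⟨?_, h2.integral_prod_right⟩
  rw [← integral_prod_symm _ h2, ← h1.map_eq, integral_map h1.aemeasurable (by rw [h1.map_eq]; exact hf.1)]
theorem H14a (hn : n ≠ 0) {h β : En n → ℝ} (hh : Integrable h) (hc : Continuous β) (hs' : HasCompactSupport β) :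
    ‖cP n ^ 2 * ∫ x, h x * β x‖ₑ ≤ 2 * ∫⁻ z in hs n, ofReal (z.snd * (‖Gr h z‖ * ‖Gr β z‖)) := by
  have hi : Integrable β := hc.integrable_of_hasCompactSupport hs'
  obtain ⟨M, hM0, hM⟩ := g2_bd
  refine ENNReal.le_of_forall_pos_le_add fun η hη _ => ?_
  replace hη : (0 : ℝ) < η := hη
  obtain ⟨t0, ht0, H0⟩ := Phi_0 hh hc hs' (η := η / (2 * M)) pv
  obtain ⟨R0, hR0, H1⟩ := Phi_inf hn hh hi (η := η / (2 * M)) pv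
  set Φ : ℝ → ℝ := fun t => ∫ x, (Fp h (pt x t)).snd * (Fp β (pt x t)).snd
  set X := cP n ^ 2 * ∫ x, h x * β x
  set ε := t0 / 2 with hε
  have hε0 : 0 < ε := by positivity
  set R := max R0 ε
  have hεR : ε ≤ R := le_max_right _ _
  have hR : 0 < R := hε0.trans_le hεR
  set W : Vn n → ℝ := fun y => (Fp h y).snd * (Fp β y).snd
  obtain ⟨hW, hW2⟩ := uu_ok hn hh hi
  obtain ⟨w0, w1, w2⟩ := hW2 (ε / 2) (3 * R) pv
  have hgr := green hW (gg_cd ε R) (a := ε / 2) (b := 3 * R) pv (fun t ht => gg_zero hε0 hεR t fun h => ht ⟨by linarith [h.1], by linarith [h.2]⟩) w0 w1 w2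
  set G : ℝ → ℝ := fun t => deriv (deriv (gg ε R)) t
  have hG : ∀ t, G t = ε⁻¹ * g2 (t / ε) - R⁻¹ * g2 (t / R) := gg_d2 hε0 hR
  have hGc : Continuous G := by
    rw [show G = fun t => ε⁻¹ * g2 (t / ε) - R⁻¹ * g2 (t / R) from funext hG]
    have := g2_cont; fun_prop
  have hgc : ∀ c : ℝ, Continuous fun t => c⁻¹ * g2 (t / c) := fun c => by have := g2_cont; fun_prop
  obtain ⟨MG, hMG⟩ : ∃ MG, ∀ t, |G t| ≤ MG := ⟨ε⁻¹ * M + R⁻¹ * M, fun t => by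
    rw [hG]; refine (abs_sub _ _).trans ?_
    rw [abs_mul, abs_mul, abs_of_pos (inv_pos.2 hε0), abs_of_pos (inv_pos.2 hR)]; gcongr <;> exact hM _⟩
  have wG : IntegrableOn (fun z => W z * G z.snd) (strip n (ε / 2) (3 * R)) :=
    Integrable.mul_bdd (c := MG) w0 (hGc.comp cont_snd).aestronglyMeasurable (ae_of_all _ fun z => hMG _)
  obtain ⟨s1, s2⟩ := stripI wG
  simp only [pt_snd, integral_mul_const] at s1 s2
  change IntegrableOn (fun t => Φ t * G t) _ at s2
  change _ = ∫ t in _, Φ t * G t at s1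
  have hX : X = ∫ t in Icc (ε / 2) (3 * R), X * (ε⁻¹ * g2 (t / ε)) := by
    rw [integral_const_mul, integral_Icc_eq_integral_Ioc, ← intervalIntegral.integral_of_le (by linarith), intervalIntegral.integral_eq_sub_of_hasDerivAt (f := fun t => deriv GG (t / ε))]
    · rw [GG_d2 _ (by rw [gt_iff_lt, lt_div_iff₀ hε0]; linarith), GG_d1 _ (by rw [div_lt_one hε0]; linarith)]; ring
    · intro t _
      have := ((GG_cd1.differentiable one_ne_zero (t / ε)).hasDerivAt).comp t ((hasDerivAt_id t).div_const ε)
      simpa [comp_def, g2, mul_comm] using this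
    · exact (hgc ε).intervalIntegrable _ _
  have hXi : IntegrableOn (fun t => X * (ε⁻¹ * g2 (t / ε))) (Icc (ε / 2) (3 * R)) := (continuous_const.mul (hgc ε)).integrableOn_Icc
  have hd : ‖X - ∫ t in Icc (ε / 2) (3 * R), Φ t * G t‖ₑ ≤ η := by
    conv_lhs => rw [hX]
    rw [← integral_sub hXi s2]
    refine (enorm_integral_le_lintegral_enorm _).trans ?_
    calc _ ≤ ∫⁻ t in Icc (ε / 2) (3 * R), ofReal (η / (2 * M)) * (‖ε⁻¹ * g2 (t / ε)‖ₑ + ‖R⁻¹ * g2 (t / R)‖ₑ) := by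
          refine setLIntegral_mono_ae' measurableSet_Icc (ae_of_all _ fun t ht => ?_)
          rw [hG, show X * (ε⁻¹ * g2 (t / ε)) - Φ t * (ε⁻¹ * g2 (t / ε) - R⁻¹ * g2 (t / R)) = (X - Φ t) * (ε⁻¹ * g2 (t / ε)) + Φ t * (R⁻¹ * g2 (t / R)) by ring, mul_add]
          refine (enorm_add_le _ _).trans (add_le_add ?_ ?_)
          · by_cases h1 : t / ε ∈ Icc (1 : ℝ) 2
            · rw [enorm_mul]; gcongr
              rw [enorm_eq_ofReal_abs, abs_sub_comm]
              have h2 := (div_le_iff₀ hε0).1 h1.2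
              exact ofReal_le_ofReal (H0 t (by linarith [ht.1]) (by linarith))
            · simp [g2_zero h1]
          · by_cases h1 : t / R ∈ Icc (1 : ℝ) 2
            · rw [enorm_mul]; gcongr
              rw [enorm_eq_ofReal_abs]
              have h2 := (one_le_div hR).1 h1.1
              exact ofReal_le_ofReal (H1 t ((le_max_left _ _).trans h2))
            · simp [g2_zero h1]
      _ ≤ ofReal (η / (2 * M)) * (ofReal M + ofReal M) := by
          rw [lintegral_const_mul' _ _ sm, lintegral_add_left (hgc ε).enorm.measurable]
          gcongr <;> exact g2_lint hM (by assumption) _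
      _ = η := by
          rw [← ofReal_add hM0.le hM0.le, ← ofReal_mul pv, show η / (2 * M) * (M + M) = η by field_simp; ring]; simp
  rw [show X = (∫ t in Icc (ε / 2) (3 * R), Φ t * G t) + (X - ∫ t in Icc (ε / 2) (3 * R), Φ t * G t) by ring]
  refine (enorm_add_le _ _).trans (add_le_add ?_ hd)
  rw [← s1]
  change ‖∫ z in strip n (ε / 2) (3 * R), W z * deriv (deriv (gg ε R)) z.snd‖ₑ ≤ _
  rw [← hgr]
  refine (enorm_integral_le_lintegral_enorm _).trans ?_
  rw [← lintegral_const_mul' _ _ sm]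
  have hsub : strip n (ε / 2) (3 * R) ⊆ hs n := fun z hz => lt_of_lt_of_le pv hz.1
  refine le_trans (setLIntegral_mono_ae' (strip_meas _ _) (ae_of_all _ fun z hz => ?_)) (lintegral_mono_set hsub)
  have hz0 : 0 < z.snd := hsub hz
  rw [lap_uu hh hi hz0, ← ofReal_norm_eq_enorm, show (2 : ENNReal) = ofReal 2 by simp, ← ofReal_mul (by norm_num)]
  refine ofReal_le_ofReal ?_
  rw [norm_mul, norm_mul, norm_of_nonneg (gg_nonneg hε0 hεR hz0), Real.norm_two, mul_left_comm]
  gcongr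
  · exact gg_le hε0 hεR hz0
  · exact norm_inner_le_norm _ _
theorem hs_aem {Y : Type} [TopologicalSpace Y] [TopologicalSpace.PseudoMetrizableSpace Y] [MeasurableSpace Y] [BorelSpace Y] {f : Vn n → Y}
    (hf : ∀ z : Vn n, 0 < z.snd → ContinuousAt f z) : AEMeasurable f (volume.restrict (hs n)) :=
  ContinuousOn.aemeasurable (fun z hz => (hf z hz).continuousWithinAt) (hs_open n).measurableSet
theorem H14 (hn : n ≠ 0) : ∃ C : ENNReal, C ≠ ⊤ ∧ ∀ (A : ENNReal) (h β : En n → ℝ), A ≠ 0 → A ≠ ⊤ → Bm A β → Continuous β → HasCompactSupport β → Integrable h →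
    ∫⁻ x, Fs h x ≠ ⊤ → ‖∫ x, h x * β x‖ₑ ≤ C * A * ∫⁻ x, Fs h x := by
  obtain ⟨C1, hC1, H1⟩ := H11N n hn
  obtain ⟨C2, hC2, H2⟩ := H11u n hn
  obtain ⟨C3, hC3, H3⟩ := H13 hn
  have hcP := cP_pos n
  refine ⟨ofReal ((cP n ^ 2)⁻¹) * (2 * (C1 + C3 * (11 ^ n * (om n)⁻¹))), by have := om_pos n; finiteness, fun A h β h0 h1 hB hc hs' hh hF => ?_⟩
  have hi : Integrable β := hc.integrable_of_hasCompactSupport hs'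
  suffices H : 2 * ∫⁻ z in hs n, ofReal (z.snd * (‖Gr h z‖ * ‖Gr β z‖)) ≤ 2 * (C1 + C3 * (11 ^ n * (om n)⁻¹)) * A * ∫⁻ x, Fs h x by
    have := (H14a hn hh hc hs').trans H
    rw [enorm_mul, enorm_eq_ofReal_abs, abs_of_pos pv] at this
    calc _ = ofReal ((cP n ^ 2)⁻¹) * (ofReal (cP n ^ 2) * ‖∫ x, h x * β x‖ₑ) := by
          rw [← mul_assoc, ← ofReal_mul pv, inv_mul_cancel₀ pv]; simp
      _ ≤ _ := mul_le_mul_right this _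
      _ = _ := by ring
  have hL2 : ∫⁻ x, ‖β x‖ₑ ^ 2 ≠ ⊤ := by
    have h2 := ((hc.memLp_of_hasCompactSupport hs' (μ := volume) (p := 2)).2)
    have := (lintegral_rpow_enorm_lt_top_of_eLpNorm_lt_top two_ne_zero sm h2).ne
    simpa using this
  set d : Vn n → ENNReal := fun z => ofReal (z.snd * ‖Gr β z‖ ^ 2)
  have hd : AEMeasurable d (volume.restrict (hs n)) := hs_aem fun z hz =>
    ENNReal.continuous_ofReal.continuousAt.comp (cont_snd.continuousAt.mul ((Gr_cont hi hz).norm.pow 2))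
  have hFm : AEMeasurable (fun z => ‖Fp h z‖) (volume.restrict (hs n)) := hs_aem fun z hz => (Fp_smoothAt hh hz).continuousAt.norm
  set ν := (volume.restrict (hs n)).withDensity d
  have hac : ν.restrict (hs n) ≪ volume.restrict (hs n) := Measure.restrict_le_self.absolutelyContinuous.trans (withDensity_absolutelyContinuous _ _)
  have hνr : ν.restrict (hs n) = ν := by
    rw [restrict_withDensity (hs_open n).measurableSet, Measure.restrict_restrict (hs_open n).measurableSet, inter_self]
  have hCar : ∫⁻ z in hs n, d z * ‖Fp h z‖ₑ ≤ C3 * A ^ 2 * (11 ^ n * (om n)⁻¹) * ∫⁻ x, Fs h x := by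
    have := H12 hn ν (A := C3 * A ^ 2) (h := h) (by finiteness) (fun x r hr => ?_) (hFm.mono_ac hac) hF
    · rw [hνr, lintegral_withDensity_eq_lintegral_mul₀ hd] at this
      · exact this
      · exact (hs_aem fun z hz => (Fp_smoothAt hh hz).continuousAt.enorm)
    · rw [withDensity_apply _ (tent_vol x hr).1, Measure.restrict_restrict (tent_vol x hr).1]
      exact (lintegral_mono_set inter_subset_left).trans (H3 A β h0 h1 hB hi x r hr)
  have key : ∀ δ > 0, ∫⁻ z in hs n, ofReal (z.snd * (‖Gr h z‖ * ‖Gr β z‖)) ≤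
      (C1 + C3 * (11 ^ n * (om n)⁻¹)) * A * (∫⁻ x, Fs h x) + ofReal δ * (A⁻¹ * (C2 * ∫⁻ x, ‖β x‖ₑ ^ 2)) := fun δ hδ => by
    calc _ ≤ ∫⁻ z in hs n, (A * ofReal (z.snd * (gF h z / √(‖Fp h z‖ ^ 2 + δ ^ 2))) + A⁻¹ * (d z * ‖Fp h z‖ₑ + ofReal δ * d z)) := by
          refine setLIntegral_mono_ae' (hs_open n).measurableSet (ae_of_all _ fun z hz => ?_)
          replace hz : 0 < z.snd := hz
          set N := √(‖Fp h z‖ ^ 2 + δ ^ 2)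
          have hN : 0 < N := Real.sqrt_pos.2 pv
          have hN2 : N ≤ ‖Fp h z‖ + δ := Real.sqrt_le_iff.2 ⟨by positivity, by nlinarith [norm_nonneg (Fp h z)]⟩
          have hA : 0 < A.toReal := toReal_pos h0 h1
          have e : d z * ‖Fp h z‖ₑ + ofReal δ * d z = ofReal (z.snd * ‖Gr β z‖ ^ 2 * (‖Fp h z‖ + δ)) := by
            simp only [d]; rw [← ofReal_norm_eq_enorm, mul_comm (ofReal δ), ← mul_add, ← ofReal_add (norm_nonneg _) hδ.le, ← ofReal_mul pv]
          have := gF_nonneg h z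
          rw [e, ← ofReal_toReal h1, ← ofReal_inv_of_pos hA, ← ofReal_mul hA.le, ← ofReal_mul pv, ← ofReal_add pv pv]
          refine ofReal_le_ofReal ?_
          calc _ ≤ z.snd * (A.toReal * (‖Gr h z‖ ^ 2 / N) + A.toReal⁻¹ * (‖Gr β z‖ ^ 2 * N)) := by
                refine mul_le_mul_of_nonneg_left ?_ hz.le
                have h3 : 0 ≤ (A.toReal * ‖Gr h z‖ - N * ‖Gr β z‖) ^ 2 / (A.toReal * N) := by positivity
                have h4 : A.toReal * (‖Gr h z‖ ^ 2 / N) + A.toReal⁻¹ * (‖Gr β z‖ ^ 2 * N) = (A.toReal * ‖Gr h z‖ - N * ‖Gr β z‖) ^ 2 / (A.toReal * N) + 2 * (‖Gr h z‖ * ‖Gr β z‖) := by field_simp; ring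
                have h5 : 0 ≤ ‖Gr h z‖ * ‖Gr β z‖ := by positivity
                linarith
            _ ≤ z.snd * (A.toReal * (gF h z / N) + A.toReal⁻¹ * (‖Gr β z‖ ^ 2 * (‖Fp h z‖ + δ))) := by gcongr; exact Gr_gF hh hz
            _ = _ := by ring
      _ ≤ A * (C1 * ∫⁻ x, Fs h x) + A⁻¹ * (C3 * A ^ 2 * (11 ^ n * (om n)⁻¹) * (∫⁻ x, Fs h x) + ofReal δ * (C2 * ∫⁻ x, ‖β x‖ₑ ^ 2)) := by
          have m1 : AEMeasurable (fun z => d z * ‖Fp h z‖ₑ) (volume.restrict (hs n)) := hd.mul (hs_aem fun z hz => (Fp_smoothAt hh hz).continuousAt.enorm)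
          have m2 : AEMeasurable (fun z => A⁻¹ * (d z * ‖Fp h z‖ₑ + ofReal δ * d z)) (volume.restrict (hs n)) := (m1.add (hd.const_mul _)).const_mul _
          rw [lintegral_add_right' _ m2, lintegral_const_mul' _ _ h1, lintegral_const_mul' _ _ (by simp [h0]), lintegral_add_left' m1, lintegral_const_mul' _ _ sm]
          gcongr
          · exact H1 h hh δ hδ
          · exact H2 β hi
      _ = A * (C1 * ∫⁻ x, Fs h x) + ((A⁻¹ * A) * (C3 * A * (11 ^ n * (om n)⁻¹) * (∫⁻ x, Fs h x)) + ofReal δ * (A⁻¹ * (C2 * ∫⁻ x, ‖β x‖ₑ ^ 2))) := by ring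
      _ = _ := by rw [ENNReal.inv_mul_cancel h0 h1]; ring
  rw [mul_assoc 2, mul_assoc 2]
  gcongr
  have hZ : A⁻¹ * (C2 * ∫⁻ x, ‖β x‖ₑ ^ 2) ≠ ⊤ := by finiteness
  have ht : Tendsto (fun δ : ℝ => (C1 + C3 * (11 ^ n * (om n)⁻¹)) * A * (∫⁻ x, Fs h x) + ofReal δ * (A⁻¹ * (C2 * ∫⁻ x, ‖β x‖ₑ ^ 2))) (𝓝[>] 0) (𝓝 ((C1 + C3 * (11 ^ n * (om n)⁻¹)) * A * (∫⁻ x, Fs h x) + ofReal 0 * (A⁻¹ * (C2 * ∫⁻ x, ‖β x‖ₑ ^ 2)))) :=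
    tendsto_const_nhds.add (ENNReal.Tendsto.mul_const (ENNReal.continuous_ofReal.tendsto 0 |>.mono_left nhdsWithin_le_nhds) (Or.inr hZ))
  rw [ofReal_zero, zero_mul, add_zero] at ht
  exact ge_of_tendsto ht (by filter_upwards [self_mem_nhdsWithin] with δ hδ using key δ hδ)
noncomputable def bb (t : ℝ) (g : En n → Vn n) (y : En n) : ℝ := ∫ x, ⟪g x, kk (pt x t - pt y 0)⟫_ℝ
theorem kk_t (ht : 0 < t) (x y : En n) : ‖kk (pt x t - pt y 0)‖ ≤ (t ^ n)⁻¹ := by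
  rw [kk_norm (sub_ne (z := pt x t) ht y)]; gcongr; exact snd_le_sub (pt x t) y
theorem kk_c (ht : 0 < t) : Continuous fun p : En n × En n => kk (pt p.1 t - pt p.2 0) := by
  refine continuous_iff_continuousAt.2 fun p => ((kk_HK n).contAt (sub_ne (z := pt p.1 t) ht p.2)).continuousAt.comp (f := fun p : En n × En n => pt p.1 t - pt p.2 0) ?_
  exact ((cont_pt.comp (continuous_fst.prodMk continuous_const)).sub (cont_pt.comp (continuous_snd.prodMk continuous_const))).continuousAt
theorem bb_int (ht : 0 < t) {g : En n → Vn n} (hg : Integrable g) (y : En n) : Integrable fun x => ⟪g x, kk (pt x t - pt y 0)⟫_ℝ := by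
  refine (hg.norm.mul_const ((t ^ n)⁻¹)).mono' (hg.1.inner ((kk_c ht).comp (continuous_id.prodMk continuous_const)).aestronglyMeasurable) (ae_of_all _ fun x => ?_)
  exact (norm_inner_le_norm _ _).trans (mul_le_mul_of_nonneg_left (kk_t ht x y) (norm_nonneg _))
theorem bb_bd (ht : 0 < t) {g : En n → Vn n} (hg : Integrable g) (y : En n) : |bb t g y| ≤ (∫ x, ‖g x‖) * (t ^ n)⁻¹ := by
  rw [← integral_mul_const]
  exact abs_int_le (hg.norm.mul_const _) fun x => (abs_real_inner_le_norm _ _).trans (mul_le_mul_of_nonneg_left (kk_t ht x y) (norm_nonneg _))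
theorem bb_cont (ht : 0 < t) {g : En n → Vn n} (hg : Integrable g) : Continuous (bb t g) := by
  refine continuous_of_dominated (bound := fun x => ‖g x‖ * (t ^ n)⁻¹) (fun y => (bb_int ht hg y).1) (fun y => ae_of_all _ fun x => ?_) (hg.norm.mul_const _) (ae_of_all _ fun x => ?_)
  · exact (norm_inner_le_norm _ _).trans (mul_le_mul_of_nonneg_left (kk_t ht x y) (norm_nonneg _))
  · exact (innerSL ℝ (g x)).continuous.comp ((kk_HK n).contw (z := pt x t) ht)
theorem bb_dual (ht : 0 < t) {g : En n → Vn n} (hg : Integrable g) (hh : Integrable h) :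
    ∫ x, ⟪g x, Fp h (pt x t)⟫_ℝ = ∫ y, h y * bb t g y := by
  have i1 : Integrable (fun p : En n × En n => h p.2 * ⟪g p.1, kk (pt p.1 t - pt p.2 0)⟫_ℝ) (volume.prod volume) := by
    refine ((hg.norm.mul_prod hh.norm).mul_const ((t ^ n)⁻¹)).mono' (hh.1.comp_snd.mul (hg.1.comp_fst.inner (kk_c ht).aestronglyMeasurable)) (ae_of_all _ fun p => ?_)
    rw [norm_mul, mul_comm ‖g p.1‖, mul_assoc]
    gcongr
    exact (norm_inner_le_norm _ _).trans (by gcongr; exact kk_t ht _ _)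
  simp_rw [Fp_inner hh (z := pt _ t) ht, bb, ← integral_const_mul]
  exact integral_integral_swap i1
theorem bb_zero (hn : n ≠ 0) (ht : 0 < t) {g : En n → Vn n} (hg : Integrable g) : Tendsto (bb t g) (cocompact (En n)) (𝓝 0) := by
  rw [← cobounded_eq_cocompact, ← comap_norm_atTop]
  rw [show (0 : ℝ) = ∫ x : En n, 0 by simp]
  refine tendsto_integral_filter_of_dominated_convergence (fun x => ‖g x‖ * (t ^ n)⁻¹) (Eventually.of_forall fun y => (bb_int ht hg y).1) (Eventually.of_forall fun y => ae_of_all _ fun x => ?_) (hg.norm.mul_const _) (ae_of_all _ fun x => ?_)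
  · exact (norm_inner_le_norm _ _).trans (mul_le_mul_of_nonneg_left (kk_t ht x y) (norm_nonneg _))
  · have h1 : Tendsto (fun y : En n => ‖g x‖ * ((‖y‖ - ‖x‖) ^ n)⁻¹) (comap norm atTop) (𝓝 0) := by
      have := (tendsto_inv_atTop_zero.comp ((tendsto_pow_atTop (α := ℝ) hn).comp ((tendsto_atTop_add_const_right _ (-‖x‖) tendsto_id).comp (tendsto_comap (f := fun y : En n => ‖y‖))))).const_mul ‖g x‖
      simpa [comp_def, sub_eq_add_neg] using this
    refine squeeze_zero_norm' ?_ h1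
    filter_upwards [(tendsto_comap (f := fun y : En n => ‖y‖) (x := atTop)).eventually (eventually_gt_atTop ‖x‖)] with y hy
    refine (norm_inner_le_norm _ _).trans ?_
    rw [kk_norm (sub_ne (z := pt x t) ht y)]
    have h3 := fst_le_norm (pt x t - pt y 0)
    rw [sub_fst, pt_fst, pt_fst, norm_sub_rev] at h3
    have := norm_sub_norm_le y x
    have h4 : 0 < ‖y‖ - ‖x‖ := sub_pos.2 hy
    gcongr
    linarith
theorem amgm {a b l : ENNReal} (h0 : l ≠ 0) (h1 : l ≠ ⊤) : a * b ≤ l * a ^ 2 + l⁻¹ * b ^ 2 := by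
  rcases le_total b (l * a) with h | h
  · exact (mul_le_mul_right h a).trans ((by ring : a * (l * a) = l * a ^ 2).le.trans le_self_add)
  · refine le_trans ?_ le_add_self
    calc a * b = l⁻¹ * (l * a) * b := by rw [← mul_assoc, ENNReal.inv_mul_cancel h0 h1, one_mul]
      _ ≤ l⁻¹ * b * b := by gcongr
      _ = _ := by ring
theorem bb_L2 (hn : 2 ≤ n) : ∃ C : ENNReal, C ≠ ⊤ ∧ ∀ t > 0, ∀ g : En n → Vn n, Integrable g → ∀ S, MeasurableSet S → volume S ≠ ⊤ →
    ∫⁻ y in S, ‖bb t g y‖ₑ ^ 2 ≤ C * ∫⁻ x, ‖g x‖ₑ ^ 2 := by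
  obtain ⟨C, hC, H⟩ := H7 hn
  refine ⟨2 * (2 * (C + 1)), by finiteness, fun t ht g hg S hS hvS => ?_⟩
  set h : En n → ℝ := S.indicator (bb t g)
  have hh : Integrable h := (integrable_indicator_iff hS).2 (Measure.integrableOn_of_bounded hvS (bb_cont ht hg).aestronglyMeasurable (ae_of_all _ fun y => bb_bd ht hg y))
  set X := ∫⁻ y in S, ‖bb t g y‖ₑ ^ 2
  have hX : X = ∫⁻ y, ‖h y‖ₑ ^ 2 := by
    simp only [X]; rw [← lintegral_indicator hS]; congr 1; ext y; by_cases hy : y ∈ S <;> simp [h, hy]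
  have hXt : X ≠ ⊤ := by
    refine ((setLIntegral_mono' hS fun y _ => show ‖bb t g y‖ₑ ^ 2 ≤ ofReal ((∫ x, ‖g x‖) * (t ^ n)⁻¹) ^ 2 from ?_).trans_lt ?_).ne
    · gcongr; rw [enorm_eq_ofReal_abs]; exact ofReal_le_ofReal (bb_bd ht hg y)
    · rw [setLIntegral_const]; finiteness
  have hl : (2 * (C + 1))⁻¹ ≠ 0 := by simp; finiteness
  have key : X ≤ (2 * (C + 1))⁻¹ * (C * X) + 2 * (C + 1) * ∫⁻ x, ‖g x‖ₑ ^ 2 := by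
    calc X = ‖∫ x, ⟪g x, Fp h (pt x t)⟫_ℝ‖ₑ := by
          rw [bb_dual ht hg hh, ← ofReal_norm_eq_enorm, norm_of_nonneg, ofReal_integral_eq_lintegral_ofReal, hX]
          · congr 1; ext y; by_cases hy : y ∈ S <;> simp [h, hy, ← sq, enorm_eq_ofReal_abs, ← ofReal_pow]
          · exact hh.mul_bdd (bb_cont ht hg).aestronglyMeasurable (ae_of_all _ fun y => bb_bd ht hg y)
          · exact ae_of_all _ fun y => by by_cases hy : y ∈ S <;> simp [h, hy, mul_self_nonneg]
          · exact integral_nonneg fun y => by by_cases hy : y ∈ S <;> simp [h, hy, mul_self_nonneg]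
      _ ≤ ∫⁻ x, ((2 * (C + 1))⁻¹ * Fs h x ^ 2 + 2 * (C + 1) * ‖g x‖ₑ ^ 2) := by
          refine (enorm_integral_le_lintegral_enorm _).trans (lintegral_mono fun x => ?_)
          have h1 : ‖⟪g x, Fp h (pt x t)⟫_ℝ‖ₑ ≤ Fs h x * ‖g x‖ₑ := by
            calc _ ≤ ‖g x‖ₑ * ‖Fp h (pt x t)‖ₑ := by
                  rw [← ofReal_norm_eq_enorm, ← ofReal_norm_eq_enorm, ← ofReal_norm_eq_enorm, ← ofReal_mul (norm_nonneg _)]; exact ofReal_le_ofReal (norm_inner_le_norm _ _)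
              _ ≤ _ := by rw [mul_comm]; gcongr; exact le_Fs h (by simpa using ht)
          have := amgm (a := Fs h x) (b := ‖g x‖ₑ) hl sm
          rw [inv_inv] at this; exact h1.trans this
      _ ≤ _ := by
          rw [lintegral_add_left ((Fs_meas h).pow_const 2 |>.const_mul _), lintegral_const_mul' _ _ sm, lintegral_const_mul' _ _ (by finiteness), hX]
          gcongr; exact H h hh
  have h2 : (2 * (C + 1))⁻¹ * (C * X) ≤ X / 2 := by
    calc _ ≤ (2 * (C + 1))⁻¹ * ((C + 1) * X) := by gcongr; exact le_self_add
      _ = (C + 1)⁻¹ * (C + 1) * (X / 2) := by rw [ENNReal.mul_inv sm sm, div_eq_mul_inv]; ring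
      _ = _ := by rw [ENNReal.inv_mul_cancel sm (by finiteness), one_mul]
  have h3 : X / 2 + X / 2 ≤ X / 2 + 2 * (C + 1) * ∫⁻ x, ‖g x‖ₑ ^ 2 := by rw [ENNReal.add_halves]; exact key.trans (by gcongr)
  have h4 := (ENNReal.add_le_add_iff_left (div_ne_top hXt two_ne_zero)).1 h3
  calc X = X / 2 + X / 2 := (ENNReal.add_halves X).symm
    _ ≤ _ := add_le_add h4 h4
    _ = _ := by ring
theorem H15 (hn : 2 ≤ n) : ∃ C : ENNReal, C ≠ ⊤ ∧ ∀ t > 0, ∀ g : En n → Vn n, Integrable g → (∀ x, ‖g x‖ ≤ 1) → ∀ x0 r, 0 < r → ∃ c : ℝ,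
    ∫⁻ y in ball x0 r, ‖bb t g y - c‖ₑ ^ 2 ≤ C * ofReal (r ^ n) := by
  obtain ⟨C1, hC1, H1⟩ := bb_L2 hn
  obtain ⟨C2, hC2, H2⟩ := kk_lip n
  have pkt : ∀ r > 0, ∫ v, pk n r v = ∫ v, pk n 1 v := fun r hr => by
    have h2 : ∀ v, pk n r v = (r ^ n)⁻¹ * pk n 1 (r⁻¹ • v) := fun v => by
      have : ‖r⁻¹ • v‖ = ‖v‖ / r := by rw [norm_smul, norm_of_nonneg pv]; ring
      simp only [pk, this]; rw [show 1 + ‖v‖ / r = (r + ‖v‖) / r by field_simp, div_pow]; have := norm_nonneg v; field_simp; ring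
    simp_rw [h2]
    rw [integral_const_mul, Measure.integral_comp_smul, finrank_euclideanSpace_fin, inv_pow, inv_inv, abs_of_pos pv, smul_eq_mul, ← mul_assoc, inv_mul_cancel₀ pv, one_mul]
  set P := ∫ v, pk n 1 v
  refine ⟨2 * (C1 * (20 ^ n * om n)) + 2 * (ofReal (C2 * P) ^ 2 * om n), by have := om_top n; finiteness, fun t ht g hg hg1 x0 r hr => ?_⟩
  set N := closedBall x0 (20 * r)
  have i1 : Integrable (N.indicator g) := hg.indicator measurableSet_closedBall
  have i2 : Integrable (Nᶜ.indicator g) := hg.indicator measurableSet_closedBall.compl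
  have hsum : ∀ y, bb t g y = bb t (N.indicator g) y + bb t (Nᶜ.indicator g) y := fun y => by
    rw [bb, bb, bb, ← integral_add (bb_int ht i1 y) (bb_int ht i2 y)]
    congr 1; ext x; rw [← inner_add_left, indicator_self_add_compl_apply]
  have hfar : ∀ y ∈ ball x0 r, ‖bb t (Nᶜ.indicator g) y - bb t (Nᶜ.indicator g) x0‖ₑ ≤ ofReal (C2 * P) := fun y hy => by
    rw [enorm_eq_ofReal_abs, bb, bb, ← integral_sub (bb_int ht i2 y) (bb_int ht i2 x0)]
    refine ofReal_le_ofReal ((abs_int_le (g := fun x => C2 * pk n r (x - x0)) (((pk_integrable n hr).comp_sub_right x0).const_mul C2) fun x => ?_).trans ?_)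
    · rw [← inner_sub_right]
      by_cases hx : x ∈ N
      · rw [indicator_of_notMem (by simpa using hx), inner_zero_left, abs_zero]; have := pk_nonneg hr (x - x0); positivity
      · rw [indicator_of_mem hx]
        refine (abs_real_inner_le_norm _ _).trans ?_
        have h3 := H2 x0 x x y t r (by simpa using ht) hr (by simpa [N] using hx) (by have : dist y x0 < r := hy; linarith)
        exact (mul_le_of_le_one_left (norm_nonneg _) (hg1 x)).trans h3
    · rw [integral_const_mul, integral_sub_right_eq_self, pkt r hr]
  refine ⟨bb t (Nᶜ.indicator g) x0, ?_⟩
  calc _ ≤ ∫⁻ y in ball x0 r, (2 * ‖bb t (N.indicator g) y‖ₑ ^ 2 + 2 * ofReal (C2 * P) ^ 2) := by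
        refine setLIntegral_mono' measurableSet_ball fun y hy => ?_
        rw [hsum, add_sub_assoc, ← mul_add]
        refine le_trans ?_ (mul_le_mul_right (add_le_add_right (pow_le_pow_left₀ zero_le (hfar y hy) 2) _) _)
        set p := bb t (N.indicator g) y
        set q := bb t (Nᶜ.indicator g) y - bb t (Nᶜ.indicator g) x0
        rw [← ofReal_norm_eq_enorm, ← ofReal_norm_eq_enorm, ← ofReal_norm_eq_enorm, ← ofReal_pow (norm_nonneg _), ← ofReal_pow (norm_nonneg _), ← ofReal_pow (norm_nonneg _),
          ← ofReal_add pv pv, show (2 : ENNReal) = ofReal 2 by simp, ← ofReal_mul (by norm_num)]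
        refine ofReal_le_ofReal ?_
        simp only [norm_eq_abs, sq_abs]; nlinarith [sq_nonneg (p - q)]
    _ ≤ 2 * (C1 * (20 ^ n * (ofReal (r ^ n) * om n))) + 2 * ofReal (C2 * P) ^ 2 * (ofReal (r ^ n) * om n) := by
        rw [lintegral_add_right _ measurable_const, setLIntegral_const, vol_ball x0 hr, lintegral_const_mul' _ _ sm]
        gcongr
        refine (H1 t ht _ i1 _ measurableSet_ball (by rw [vol_ball x0 hr]; have := om_top n; finiteness)).trans ?_
        gcongr
        calc _ ≤ ∫⁻ x, N.indicator 1 x := lintegral_mono fun x => by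
              by_cases hx : x ∈ N
              · simp only [indicator_of_mem hx, Pi.one_apply]
                exact pow_le_one₀ zero_le (by rw [← ofReal_norm_eq_enorm]; simpa using ofReal_le_ofReal (hg1 x))
              · simp [hx]
          _ = _ := by
              rw [lintegral_indicator_one measurableSet_closedBall, vol_cball x0 pv, mul_pow, ofReal_mul pv, ofReal_pow (by norm_num), mul_assoc]; norm_num
    _ = _ := by ring
end
section
open MeasureTheory Set Filter Metric
open scoped ENNReal NNReal Topology InnerProductSpace Convolution ContDiff
variable {n : ℕ} {t r : ℝ} {F : Type*} [NormedAddCommGroup F] [NormedSpace ℝ F]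
theorem lin_aff {k : En n → ENNReal} (hk : Measurable k) (x : En n) {s : ℝ} (hs : 1 / 2 ≤ s) :
    ∫⁻ y, k (x + s • y) ≤ 2 ^ n * ∫⁻ y, k y := by
  have h0 : s ≠ 0 := by linarith
  have h1 : ∫⁻ y, k (x + s • y) = ∫⁻ z, k (x + z) ∂(Measure.map (s • ·) volume) :=
    (lintegral_map (hk.comp (measurable_const_add x)) (measurable_const_smul s)).symm
  rw [h1, Measure.map_addHaar_smul _ h0, lintegral_smul_measure, lintegral_add_left_eq_self k x]
  refine mul_le_mul_left (ENNReal.ofReal_le_of_le_toReal ?_) _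
  simp only [finrank_euclideanSpace, Fintype.card_fin, ENNReal.toReal_pow, ENNReal.toReal_ofNat]
  rw [abs_of_nonneg pv, ← inv_pow]
  exact pow_le_pow_left₀ pv ((inv_le_comm₀ (by linarith) (by norm_num)).2
    (by linarith)) n
theorem poinC1 {g : En n → F} (hg : ContDiff ℝ 1 g) (a : En n) (hr : 0 < r) :
    ∫⁻ x in ball a r, ∫⁻ y in ball a r, ‖g x - g y‖ₑ ≤
      ofReal (2 ^ (n + 1) * r ^ (n + 1)) * om n * ∫⁻ w in ball a r, ‖fderiv ℝ g w‖ₑ := by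
  set k : En n → ENNReal := (ball a r).indicator fun w => ‖fderiv ℝ g w‖ₑ with hk
  have hkm : Measurable k :=
    (hg.continuous_fderiv one_ne_zero).enorm.measurable.indicator measurableSet_ball
  have h1 : ∀ x ∈ ball a r, ∀ y ∈ ball a r, ‖g x - g y‖ₑ ≤
      ∫⁻ s in Icc (0 : ℝ) 1, ofReal (2 * r) * k ((1 - s) • y + s • x) := by
    intro x hx y hy
    have hl : ∀ s : ℝ, HasDerivAt (fun s : ℝ => (1 - s) • y + s • x) (x - y) s := fun s => by
      have := (((hasDerivAt_id s).const_sub 1).smul_const y).add ((hasDerivAt_id s).smul_const x)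
      exact this.congr_deriv (by module)
    have hd : ∀ s : ℝ, HasDerivAt (fun s : ℝ => g ((1 - s) • y + s • x))
        (fderiv ℝ g ((1 - s) • y + s • x) (x - y)) s := fun s =>
      ((hg.differentiable one_ne_zero) _).hasFDerivAt.comp_hasDerivAt s (hl s)
    have := enorm_sub_le_lintegral_deriv_of_contDiffOn_Icc
      (f := fun s : ℝ => g ((1 - s) • y + s • x)) (a := 0) (b := 1)
      (hg.comp (by fun_prop)).contDiffOn zero_le_one
    simp only [sub_zero, one_smul, zero_smul, add_zero, sub_self, zero_add] at this
    refine this.trans (setLIntegral_mono' measurableSet_Icc fun s hs => ?_)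
    rw [(hd s).deriv, hk, indicator_of_mem, mul_comm]
    · refine (ContinuousLinearMap.le_opNorm_enorm _ _).trans (mul_le_mul_right ?_ _)
      rw [← ofReal_norm_eq_enorm]
      refine ofReal_le_ofReal ?_
      rw [← dist_eq_norm]
      have := dist_triangle_right x y a
      rw [mem_ball] at hx hy; linarith
    · exact (convex_ball a r) hy hx (by linarith [hs.2]) hs.1 (by ring)
  have hmm : Measurable fun p : (En n × En n) × ℝ => k ((1 - p.2) • p.1.2 + p.2 • p.1.1) :=
    hkm.comp (by fun_prop)
  have h2 : ∀ s ∈ Icc (0 : ℝ) 1, ∫⁻ x in ball a r, ∫⁻ y in ball a r, k ((1 - s) • y + s • x) ≤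
      volume (ball a r) * (2 ^ n * ∫⁻ w, k w) := by
    intro s hs
    rcases le_total s (1 / 2) with h | h
    · calc _ ≤ ∫⁻ x in ball a r, (2 ^ n * ∫⁻ w, k w) := lintegral_mono fun x => by
            refine (setLIntegral_le_lintegral _ _).trans ?_
            simpa only [add_comm] using lin_aff hkm (s • x) (s := 1 - s) (by linarith)
        _ = _ := by rw [setLIntegral_const, mul_comm]
    · have : Measurable fun p : En n × En n => k ((1 - s) • p.2 + s • p.1) := hkm.comp (by fun_prop)
      rw [lintegral_lintegral_swap this.aemeasurable]
      calc _ ≤ ∫⁻ x in ball a r, (2 ^ n * ∫⁻ w, k w) := lintegral_mono fun y => by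
            refine (setLIntegral_le_lintegral _ _).trans ?_
            exact lin_aff hkm ((1 - s) • y) h
        _ = _ := by rw [setLIntegral_const, mul_comm]
  calc _ ≤ ∫⁻ x in ball a r, ∫⁻ y in ball a r, ∫⁻ s in Icc (0 : ℝ) 1,
        ofReal (2 * r) * k ((1 - s) • y + s • x) :=
        setLIntegral_mono' measurableSet_ball fun x hx =>
          setLIntegral_mono' measurableSet_ball fun y hy => h1 x hx y hy
    _ = ∫⁻ s in Icc (0 : ℝ) 1, ∫⁻ x in ball a r, ∫⁻ y in ball a r,
        ofReal (2 * r) * k ((1 - s) • y + s • x) := by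
        have e1 : ∀ x, ∫⁻ y in ball a r, ∫⁻ s in Icc (0 : ℝ) 1,
            ofReal (2 * r) * k ((1 - s) • y + s • x) = ∫⁻ s in Icc (0 : ℝ) 1,
            ∫⁻ y in ball a r, ofReal (2 * r) * k ((1 - s) • y + s • x) := fun x =>
          lintegral_lintegral_swap ((hkm.comp (by fun_prop)).const_mul _).aemeasurable
        simp_rw [e1]
        rw [lintegral_lintegral_swap]
        have : Measurable fun p : (En n × ℝ) × En n =>
            ofReal (2 * r) * k ((1 - p.1.2) • p.2 + p.1.2 • p.1.1) :=
          (hkm.comp (by fun_prop)).const_mul _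
        exact this.lintegral_prod_right'.aemeasurable
    _ = ∫⁻ s in Icc (0 : ℝ) 1, ofReal (2 * r) * ∫⁻ x in ball a r, ∫⁻ y in ball a r,
        k ((1 - s) • y + s • x) := by
        congr with s
        rw [← lintegral_const_mul' _ _ ofReal_ne_top]
        congr with x
        rw [← lintegral_const_mul' _ _ ofReal_ne_top]
    _ ≤ ∫⁻ s in Icc (0 : ℝ) 1, ofReal (2 * r) * (volume (ball a r) *
        (2 ^ n * ∫⁻ w, k w)) := setLIntegral_mono' measurableSet_Icc fun s hs =>
          mul_le_mul_right (h2 s hs) _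
    _ = _ := by
        rw [setLIntegral_const, volume_Icc, vol_ball a hr, hk,
          lintegral_indicator measurableSet_ball]
        have : (2 : ENNReal) ^ n = ofReal (2 ^ n) := by
          rw [ofReal_pow (by norm_num)]; simp
        rw [this, show (2 : ℝ) ^ (n + 1) * r ^ (n + 1) = 2 * r * (r ^ n * 2 ^ n) by ring,
          ofReal_mul (p := 2 * r) pv, ofReal_mul (p := r ^ n) pv, ← this]
        simp; ring
def WD (f : En n → En n) (G : En n → En n →L[ℝ] En n) : Prop :=
  Continuous f ∧ LocallyIntegrable G volume ∧ ∀ η : En n → ℝ, ContDiff ℝ (⊤ : ℕ∞) η →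
    HasCompactSupport η → ∀ i j : Fin n, ∫ x, f x i * fderiv ℝ η x (single j 1) =
      - ∫ x, (G x (single j 1)) i * η x
theorem moll {f : En n → En n} {G : En n → En n →L[ℝ] En n} (h : WD f G)
    (ρ : ContDiffBump (0 : En n)) :
    ContDiff ℝ 1 (ρ.normed volume ⋆[lsmul ℝ ℝ, volume] f) ∧ ∀ x,
    ‖fderiv ℝ (ρ.normed volume ⋆[lsmul ℝ ℝ, volume] f) x‖ₑ ≤
      ∫⁻ w, ‖ρ.normed volume (x - w)‖ₑ * ‖G w‖ₑ := by
  obtain ⟨hf, hG, hw⟩ := h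
  have hc := ρ.hasCompactSupport_normed (μ := (volume : Measure (En n)))
  have hs : ∀ m : ℕ∞, ContDiff ℝ m (ρ.normed (volume : Measure (En n))) := fun m => ρ.contDiff_normed
  refine ⟨hc.contDiff_convolution_left _ (hs 1) hf.locallyIntegrable, fun x => ?_⟩
  have hd := hc.hasFDerivAt_convolution_left (lsmul ℝ ℝ) (hs 1)
    (hf.locallyIntegrable (μ := volume)) x
  set η : En n → ℝ := fun w => ρ.normed volume (x - w) with hη
  have hηs : ContDiff ℝ (⊤ : ℕ∞) η := (hs ⊤).comp (by fun_prop)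
  have hηc : HasCompactSupport η := hc.comp_homeomorph (Homeomorph.subLeft x)
  have hηG : Integrable (fun w => η w • G w) :=
    hG.integrable_smul_left_of_hasCompactSupport hηs.continuous hηc
  have key : fderiv ℝ (ρ.normed volume ⋆[lsmul ℝ ℝ, volume] f) x =
      ∫ w, η w • G w := by
    rw [hd.fderiv]
    have hint := (hc.fderiv ℝ).convolutionExists_left
      ((lsmul ℝ ℝ : ℝ →L[ℝ] En n →L[ℝ] En n).precompL (En n))
      ((hs 1).continuous_fderiv one_ne_zero) (hf.locallyIntegrable (μ := volume)) x
    refine ContinuousLinearMap.coe_injective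
      ((EuclideanSpace.basisFun (Fin n) ℝ).toBasis.ext fun j => ?_)
    ext i
    set ev : (En n →L[ℝ] En n) →L[ℝ] ℝ := (proj i).comp
      (ContinuousLinearMap.apply ℝ (En n) (single j 1)) with hev
    have e1 := ev.integral_comp_comm hint
    have e2 := ev.integral_comp_comm hηG
    have e3 : ∀ A : En n →L[ℝ] En n, ev A = A (single j 1) i := fun A => rfl
    simp only [OrthonormalBasis.coe_toBasis, EuclideanSpace.basisFun_apply,
      coe_coe]
    rw [← e3, ← e3, ← e2, convolution, ← e1]
    have hd2 : ∀ w, fderiv ℝ η w = -fderiv ℝ (ρ.normed volume) (x - w) := fun w => by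
      have h1 : HasFDerivAt (ρ.normed volume) (fderiv ℝ (ρ.normed volume) (x - w)) (x - w) :=
        ((hs 1).differentiable one_ne_zero _).hasFDerivAt
      have : HasFDerivAt η _ w := h1.comp w ((hasFDerivAt_id w).const_sub x)
      rw [this.fderiv]; ext; simp
    have := hw η hηs hηc i j
    rw [← integral_sub_left_eq_self _ volume x]
    simp only [e3, ContinuousLinearMap.precompL_apply, sub_sub_cancel,
      ContinuousLinearMap.lsmul_apply, PiLp.smul_apply, smul_eq_mul, ContinuousLinearMap.smul_apply]
    simp only [hd2, ContinuousLinearMap.neg_apply, mul_neg, integral_neg, neg_inj] at this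
    simpa only [mul_comm] using this
  rw [key]
  refine (enorm_integral_le_lintegral_enorm _).trans_eq (lintegral_congr fun w => ?_)
  rw [enorm_smul]
theorem eps_le {a b X : ENNReal} (hX : X ≠ ⊤) (h : ∀ δ : ℝ, 0 < δ → a ≤ b + ofReal δ * X) :
    a ≤ b := by
  have : Tendsto (fun δ : ℝ => b + ofReal δ * X) (𝓝[>] 0) (𝓝 (b + ofReal 0 * X)) :=
    ((ENNReal.Tendsto.mul_const (tendsto_ofReal tendsto_id) (Or.inr hX)).const_add b).mono_left
      nhdsWithin_le_nhds
  simpa using ge_of_tendsto this (eventually_mem_nhdsWithin.mono fun δ hδ => h δ hδ)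
theorem Qa {f : En n → En n} {G : En n → En n →L[ℝ] En n} (h : WD f G) {u : En n → F}
    (hu : ContDiff ℝ 1 u) (a : En n) (hr : 0 < r) :
    ∫⁻ x in ball a r, ∫⁻ y in ball a r, ‖u (f x) - u (f y)‖ₑ ≤
      ofReal (2 ^ (n + 1) * r ^ (n + 1)) * om n *
        ∫⁻ w in ball a (2 * r), ‖fderiv ℝ u (f w)‖ₑ * ‖G w‖ₑ := by
  have hK : IsCompact (closedBall a (2 * r)) := isCompact_closedBall _ _
  have hDu := hu.continuous_fderiv one_ne_zero
  have hf := h.1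
  set C := ofReal (2 ^ (n + 1) * r ^ (n + 1)) * om n with hC
  have hCt : C ≠ ⊤ := mul_ne_top ofReal_ne_top (om_top n)
  set V := volume (ball a r) with hV
  have hGi : ∫⁻ w in ball a (2 * r), ‖G w‖ₑ ≠ ⊤ :=
    ((h.2.1.integrableOn_isCompact hK).mono_set ball_subset_closedBall).2.ne
  refine eps_le (X := C * (∫⁻ w in ball a (2 * r), ‖G w‖ₑ) + 2 * V * V) (add_ne_top.2
    ⟨mul_ne_top hCt hGi, mul_ne_top (mul_ne_top sm
      measure_ball_lt_top.ne) measure_ball_lt_top.ne⟩) fun δ hδ => ?_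
  have hunif := (hK.image hf).uniformContinuousAt_of_continuousAt (fun p => (u p, fderiv ℝ u p))
    (fun p _ => (hu.continuous.prodMk hDu).continuousAt) (dist_mem_uniformity hδ)
  obtain ⟨d, hd, hd'⟩ := mem_uniformity_dist.1 hunif
  obtain ⟨e, he, he'⟩ := mem_uniformity_dist.1 (hK.uniformContinuousAt_of_continuousAt f
    (fun p _ => hf.continuousAt) (dist_mem_uniformity (half_pos hd)))
  have hm : 0 < min e r := lt_min he hr
  let ρ : ContDiffBump (0 : En n) := ⟨min e r / 2, min e r, half_pos hm, half_lt_self hm⟩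
  obtain ⟨g1, g2⟩ := moll h ρ
  set fe := ρ.normed volume ⋆[lsmul ℝ ℝ, volume] f with hfe
  have hB : ∀ w ∈ ball a r, w ∈ closedBall a (2 * r) := fun w hw =>
    closedBall_subset_closedBall (by linarith) (ball_subset_closedBall hw)
  have h1 : ∀ w ∈ ball a r, dist (fe w) (f w) ≤ d / 2 := fun w hw =>
    ρ.dist_normed_convolution_le hf.aestronglyMeasurable fun z hz => by
      rw [dist_comm]
      exact (he' (a := w) (b := z) (by rw [dist_comm]; exact lt_of_lt_of_le hz (min_le_left _ _))
        (hB w hw)).le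
  have h2 : ∀ w ∈ ball a r, ‖u (f w) - u (fe w)‖ₑ ≤ ofReal δ := fun w hw => by
    have := hd' (a := f w) (b := fe w) (by rw [dist_comm]; linarith [h1 w hw]) ⟨w, hB w hw, rfl⟩
    rw [← ofReal_norm_eq_enorm, ← dist_eq_norm]
    exact ofReal_le_ofReal ((le_max_left _ _).trans (show dist (_, _) (_, _) < δ from this).le)
  have h3 : ∀ w ∈ ball a r, ∀ z, dist z w < min e r → z ∈ ball a (2 * r) ∧
      ‖fderiv ℝ u (fe w)‖ₑ ≤ ‖fderiv ℝ u (f z)‖ₑ + ofReal δ := fun w hw z hz => by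
    have hz2 : z ∈ ball a (2 * r) := by
      rw [mem_ball] at hw ⊢
      linarith [dist_triangle z w a, min_le_right e r]
    refine ⟨hz2, ?_⟩
    have h5 := he' (a := w) (b := z) (by rw [dist_comm]; exact hz.trans_le (min_le_left _ _)) (hB w hw)
    have := hd' (a := f z) (b := fe w) (by
      rw [dist_comm]; linarith [h1 w hw, dist_triangle (fe w) (f w) (f z), (show dist _ _ < _ from h5)])
      ⟨z, ball_subset_closedBall hz2, rfl⟩
    have h6 := (le_max_right _ _).trans (show dist (_, _) (_, _) < δ from this).le
    rw [dist_comm, dist_eq_norm] at h6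
    rw [← ofReal_norm_eq_enorm, ← ofReal_norm_eq_enorm, ← ofReal_add (norm_nonneg _) hδ.le]
    exact ofReal_le_ofReal ((norm_le_norm_add_norm_sub' _ _).trans (by gcongr))
  have h4 : ∫⁻ w in ball a r, ‖fderiv ℝ (u ∘ fe) w‖ₑ ≤
      ∫⁻ z in ball a (2 * r), (‖fderiv ℝ u (f z)‖ₑ + ofReal δ) * ‖G z‖ₑ := by
    have hGm := h.2.1.aestronglyMeasurable.enorm
    have hm1 : Continuous fun p : En n × En n => ‖ρ.normed volume (p.1 - p.2)‖ₑ :=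
      (ρ.continuous_normed.comp (continuous_fst.sub continuous_snd)).enorm
    have hm2 : AEMeasurable (fun z => (‖fderiv ℝ u (f z)‖ₑ + ofReal δ) * ‖G z‖ₑ)
        (volume.restrict (ball a (2 * r))) :=
      (((hDu.comp hf).enorm.measurable.add_const _).aemeasurable.mul hGm).restrict
    calc _ ≤ ∫⁻ w in ball a r, ∫⁻ z in ball a (2 * r), ‖ρ.normed volume (w - z)‖ₑ *
          ((‖fderiv ℝ u (f z)‖ₑ + ofReal δ) * ‖G z‖ₑ) := by
          refine setLIntegral_mono' measurableSet_ball fun w hw => ?_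
          rw [fderiv_comp w ((hu.differentiable one_ne_zero) _) ((g1.differentiable one_ne_zero) _)]
          refine (ContinuousLinearMap.opENorm_comp_le _ _).trans ((mul_le_mul_right (g2 w) _).trans ?_)
          rw [← lintegral_const_mul' _ _ enorm_ne_top, ← lintegral_indicator measurableSet_ball]
          refine lintegral_mono fun z => ?_
          by_cases hz : dist z w < min e r
          · rw [indicator_of_mem (h3 w hw z hz).1, mul_left_comm]
            exact mul_le_mul_right (mul_le_mul_left (h3 w hw z hz).2 _) _
          · have : ρ.normed volume (w - z) = 0 := by
              rw [← Function.notMem_support, ρ.support_normed_eq, mem_ball_zero_iff, ← dist_eq_norm,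
                dist_comm]
              exact hz
            simp [this]
      _ = ∫⁻ z in ball a (2 * r), (∫⁻ w in ball a r, ‖ρ.normed volume (w - z)‖ₑ) *
          ((‖fderiv ℝ u (f z)‖ₑ + ofReal δ) * ‖G z‖ₑ) := by
          rw [lintegral_lintegral_swap]
          · refine lintegral_congr fun z => lintegral_mul_const'' _ ?_
            exact (hm1.comp (.prodMk_left z)).measurable.aemeasurable
          · exact hm1.measurable.aemeasurable.mul (hm2.comp_snd)
      _ ≤ ∫⁻ z in ball a (2 * r), 1 * ((‖fderiv ℝ u (f z)‖ₑ + ofReal δ) * ‖G z‖ₑ) := by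
          refine lintegral_mono fun z => mul_le_mul_left ((setLIntegral_le_lintegral _ _).trans ?_) _
          rw [lintegral_sub_right_eq_self (fun w => ‖ρ.normed volume w‖ₑ) z]
          have := ofReal_integral_eq_lintegral_ofReal (ρ.integrable_normed (μ := volume))
            (Eventually.of_forall fun x => ρ.nonneg_normed x)
          rw [ρ.integral_normed, ENNReal.ofReal_one] at this
          rw [this]
          exact lintegral_mono fun x => by rw [enorm_eq_ofReal (ρ.nonneg_normed x)]
      _ = _ := by simp only [one_mul]
  calc _ ≤ ∫⁻ x in ball a r, ∫⁻ y in ball a r, (‖(u ∘ fe) x - (u ∘ fe) y‖ₑ + 2 * ofReal δ) :=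
        setLIntegral_mono' measurableSet_ball fun x hx => setLIntegral_mono' measurableSet_ball
          fun y hy => by
        have e1 := h2 x hx
        have e2 := h2 y hy
        rw [enorm_sub_rev] at e2
        calc _ = ‖((u ∘ fe) x - (u ∘ fe) y) + ((u (f x) - u (fe x)) + (u (fe y) - u (f y)))‖ₑ := by
              congr 1; simp only [Function.comp]; abel
          _ ≤ _ := (enorm_add_le _ _).trans (add_le_add_right ((enorm_add_le _ _).trans
              ((add_le_add e1 e2).trans_eq (two_mul _).symm)) _)
    _ = (∫⁻ x in ball a r, ∫⁻ y in ball a r, ‖(u ∘ fe) x - (u ∘ fe) y‖ₑ) +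
        ofReal δ * (2 * V * V) := by
        simp only [lintegral_add_right _ measurable_const, setLIntegral_const]
        rw [← hV]; ring
    _ ≤ C * (∫⁻ z in ball a (2 * r), (‖fderiv ℝ u (f z)‖ₑ + ofReal δ) * ‖G z‖ₑ) +
        ofReal δ * (2 * V * V) :=
        add_le_add_left ((poinC1 (hu.comp g1) a hr).trans (mul_le_mul_right h4 _)) _
    _ = _ := by
        simp only [add_mul]
        rw [lintegral_add_right' _ (h.2.1.aestronglyMeasurable.enorm.restrict.const_mul _),
          lintegral_const_mul' _ _ ofReal_ne_top]
        ring
def PI (f : En n → F) (g : En n → ENNReal) : Prop := Continuous f ∧ ∀ a r, 0 < r →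
  ∫⁻ x in ball a r, ∫⁻ y in ball a r, ‖f x - f y‖ₑ ≤
    ofReal (2 ^ (n + 1) * r ^ (n + 1)) * om n * ∫⁻ w in ball a (2 * r), g w
noncomputable def DD (f : En n → F) (a : En n) (r : ℝ) : ENNReal := ∫⁻ y in ball a r, ‖f y - f a‖ₑ
noncomputable def cT (n : ℕ) : ENNReal := ofReal (2 ^ (2 * n + 1)) * (om n)⁻¹
theorem cT_top (n : ℕ) : cT n ≠ ⊤ :=
  mul_ne_top ofReal_ne_top (inv_ne_top.2 (om_pos n))
theorem Tel {f : En n → F} {g : En n → ENNReal} (h : PI f g) (a : En n) (hr : 0 < r) :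
    DD f a r ≤ volume (ball a r) * (cT n * ∑' k : ℕ, ofReal (r / 2 ^ k) *
      (ofReal ((r / 2 ^ k) ^ n))⁻¹ * ∫⁻ w in ball a (2 * (r / 2 ^ k)), g w) := by
  have hp : ∀ k : ℕ, 0 < r / 2 ^ k := fun k => by positivity
  set t : ℕ → ENNReal := fun k => ofReal (r / 2 ^ k) *
      (ofReal ((r / 2 ^ k) ^ n))⁻¹ * ∫⁻ w in ball a (2 * (r / 2 ^ k)), g w with ht
  set v : ℕ → ENNReal := fun k => volume (ball a (r / 2 ^ k)) with hv
  have v0 : ∀ k, v k ≠ 0 := fun k => (measure_ball_pos volume a (hp k)).ne'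
  have vt : ∀ k, v k ≠ ⊤ := fun k => measure_ball_lt_top.ne
  set D : ℕ → ENNReal := fun k => (v k)⁻¹ * DD f a (r / 2 ^ k) with hD
  have hDe : ∀ k, DD f a (r / 2 ^ k) = v k * D k := fun k => by
    rw [hD]; simp only []; rw [← mul_assoc, ENNReal.mul_inv_cancel (v0 k) (vt k), one_mul]
  have hfm : ∀ c, Measurable fun y => ‖f y - c‖ₑ := fun c => (h.1.sub continuous_const).enorm.measurable
  have rec1 : ∀ k, D k ≤ cT n * t k + D (k + 1) := by
    intro k
    have hsub : ball a (r / 2 ^ (k + 1)) ⊆ ball a (r / 2 ^ k) := ball_subset_ball (by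
      gcongr <;> simp)
    have e1 : v (k + 1) * (v k * D k) ≤ (∫⁻ y in ball a (r / 2 ^ k), ∫⁻ z in ball a (r / 2 ^ k),
        ‖f y - f z‖ₑ) + v k * (v (k + 1) * D (k + 1)) := by
      calc _ = ∫⁻ y in ball a (r / 2 ^ k), ∫⁻ z in ball a (r / 2 ^ (k + 1)), ‖f y - f a‖ₑ := by
            simp only [setLIntegral_const]
            rw [lintegral_mul_const _ (hfm _), ← hDe, mul_comm]; rfl
        _ ≤ ∫⁻ y in ball a (r / 2 ^ k), ((∫⁻ z in ball a (r / 2 ^ k), ‖f y - f z‖ₑ) +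
            DD f a (r / 2 ^ (k + 1))) := lintegral_mono fun y => by
            refine le_trans ?_ (add_le_add_left (lintegral_mono_set hsub) _)
            rw [DD, ← lintegral_add_right _ (hfm _)]
            refine lintegral_mono fun z => ?_
            have := enorm_add_le (f y - f z) (f z - f a)
            rwa [sub_add_sub_cancel] at this
        _ = _ := by
            rw [lintegral_add_right _ measurable_const, setLIntegral_const, ← hDe, mul_comm (v k)]
    have e2 := e1.trans (add_le_add_left (h.2 a _ (hp k)) _)
    have hq := mul_ne_zero (v0 (k + 1)) (v0 k)
    have hqt := mul_ne_top (vt (k + 1)) (vt k)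
    rw [← ENNReal.mul_le_mul_iff_right hq hqt]
    refine (le_trans (le_of_eq (by ring)) e2).trans (le_of_eq ?_)
    rw [mul_add]
    congr 1
    · simp only [hv, ht, cT]
      rw [vol_ball a (hp k), vol_ball a (hp (k + 1))]
      have h1 : ofReal (2 ^ (n + 1) * (r / 2 ^ k) ^ (n + 1)) =
          ofReal ((r / 2 ^ (k + 1)) ^ n) * ofReal (2 ^ (2 * n + 1)) *
            ofReal (r / 2 ^ k) := by
        rw [← ofReal_mul pv, ← ofReal_mul pv]
        congr 1
        rw [pow_succ (2 : ℝ) k, ← div_div, div_pow _ (2 : ℝ)]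
        generalize r / 2 ^ k = q
        field_simp; ring
      have h2 : ofReal ((r / 2 ^ k) ^ n) * (ofReal ((r / 2 ^ k) ^ n))⁻¹ = 1 :=
        ENNReal.mul_inv_cancel (by simpa using pow_pos (hp k) n) ofReal_ne_top
      have h3 := ENNReal.mul_inv_cancel (om_pos n) (om_top n)
      rw [h1]
      generalize ∫⁻ w in ball a (2 * (r / 2 ^ k)), g w = I
      generalize ofReal ((r / 2 ^ k) ^ n) = x at *
      calc _ = ofReal ((r / 2 ^ (k + 1)) ^ n) * ofReal (2 ^ (2 * n + 1)) *
            ofReal (r / 2 ^ k) * om n * I * (x * x⁻¹) * (om n * (om n)⁻¹) := by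
            rw [h2, h3]; ring
        _ = _ := by ring
    · ring
  have rec2 : ∀ N, D 0 ≤ cT n * (∑ k ∈ Finset.range N, t k) + D N := by
    intro N
    induction N with
    | zero => simp
    | succ N ih =>
      rw [Finset.sum_range_succ, mul_add, add_assoc]
      exact ih.trans (add_le_add_right (rec1 N) _)
  have key : D 0 ≤ cT n * ∑' k, t k := by
    refine ENNReal.le_of_forall_pos_le_add fun ε hε _ => ?_
    obtain ⟨d, hd, hd'⟩ := Metric.continuous_iff.1 h.1 a ε hε
    obtain ⟨N, hN⟩ := exists_pow_lt_of_lt_one (div_pos hd hr) (show (1 / 2 : ℝ) < 1 by norm_num)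
    refine (rec2 N).trans (add_le_add (mul_le_mul_right (ENNReal.sum_le_tsum _) _) ?_)
    rw [hD]; simp only []
    rw [← ENNReal.div_eq_inv_mul]
    refine ENNReal.div_le_of_le_mul ?_
    rw [hv]; simp only []
    rw [← setLIntegral_const]
    refine setLIntegral_mono' measurableSet_ball fun y hy => ?_
    have h1 : r / 2 ^ N < d := by
      have := (lt_div_iff₀ hr).1 hN
      rw [div_pow, one_pow] at this; rw [div_eq_mul_inv]; rw [one_div] at this; linarith
    have := hd' y (lt_trans hy h1)
    rw [dist_eq_norm] at this
    rw [← ofReal_norm_eq_enorm, ofReal_le_iff_le_toReal sm]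
    simpa using this.le
  have h0 := hDe 0
  simp only [pow_zero, div_one, hv] at h0
  rw [h0]
  exact mul_le_mul_right key _
theorem two_pt {f : En n → F} (hf : Continuous f) {a b : En n} {d : ℝ} (h : dist b a ≤ d) :
    ‖f a - f b‖ₑ * volume (ball b d) ≤ DD f b d + DD f a (2 * d) := by
  have hsub : ball b d ⊆ ball a (2 * d) := ball_subset_ball' (by linarith)
  refine le_trans ?_ (add_le_add_right (lintegral_mono_set hsub) _)
  rw [DD, ← setLIntegral_const, ← lintegral_add_left
    (show Measurable fun y => ‖f y - f b‖ₑ from (hf.sub continuous_const).enorm.measurable)]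
  refine lintegral_mono fun y => ?_
  have := enorm_add_le (f a - f y) (f y - f b)
  rw [sub_add_sub_cancel, enorm_sub_rev (f a) (f y), add_comm] at this
  exact this
theorem TelM {f : En n → F} {g : En n → ENNReal} (h : PI f g) (a : En n) (hr : 0 < r)
    {M : ENNReal} (hM : ∀ s, 0 < s → s ≤ 2 * r → ∫⁻ w in ball a s, g w ≤ ofReal (s ^ n) * M) :
    DD f a r ≤ volume (ball a r) * (cT n * (2 ^ (n + 1) * (ofReal r * M))) := by
  refine (Tel h a hr).trans (mul_le_mul_right (mul_le_mul_right ?_ _) _)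
  have hp : ∀ k : ℕ, 0 < r / 2 ^ k := fun k => by positivity
  calc _ ≤ ∑' k : ℕ, ofReal (r / 2 ^ k) * (2 ^ n * M) := tsum_le_tsum fun k => by
        rw [mul_assoc]
        refine mul_le_mul_right ?_ _
        have h1 := hM (2 * (r / 2 ^ k)) pv (by
          gcongr; exact div_le_self hr.le (one_le_pow₀ (by norm_num)))
        rw [← ENNReal.div_eq_inv_mul]
        refine ENNReal.div_le_of_le_mul (h1.trans_eq ?_)
        rw [mul_pow, ofReal_mul pv, ofReal_pow (by norm_num)]
        simp; ring
    _ = _ := by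
        rw [ENNReal.tsum_mul_right, ← ENNReal.ofReal_tsum_of_nonneg (fun k => (hp k).le)
          (summable_geometric_two' (2 * r) |>.congr fun k => by ring), show
          (∑' k : ℕ, r / 2 ^ k) = 2 * r from (tsum_congr fun k => by ring).trans
          (tsum_geometric_two' (2 * r)), ofReal_mul (by norm_num)]
        simp; ring
end
section
open MeasureTheory Set Filter Metric
open scoped ENNReal NNReal Topology InnerProductSpace
variable {n : ℕ} {t r : ℝ} {z : Vn n} {h : En n → ℝ}
theorem WD.sub_lin {f : En n → En n} {G : En n → En n →L[ℝ] En n} (h : WD f G)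
    (A : En n →L[ℝ] En n) : WD (fun x => f x - A x) (fun x => G x - A) := by
  refine ⟨h.1.sub A.continuous, h.2.1.sub (locallyIntegrable_const A), fun η hη hc i j => ?_⟩
  set v : En n := single j 1
  have hdc : Continuous fun x => fderiv ℝ η x v :=
    (hη.continuous_fderiv sm).clm_apply continuous_const
  have hds : HasCompactSupport fun x => fderiv ℝ η x v := hc.fderiv_apply ℝ v
  have ci : ∀ q : En n → En n, Continuous q → Continuous fun x => q x i := fun q hq =>
    (proj (𝕜 := ℝ) i).continuous.comp hq
  have i1 : ∀ q : En n → En n, Continuous q → Integrable fun x => q x i * fderiv ℝ η x v := fun q hq =>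
    ((ci q hq).mul hdc).integrable_of_hasCompactSupport (hds.mul_left)
  have i2 : Integrable fun x => (A v) i * η x :=
    (continuous_const.mul hη.continuous).integrable_of_hasCompactSupport hc.mul_left
  have i3 : Integrable fun x => (G x v) i * η x := by
    have := h.2.1.integrable_smul_left_of_hasCompactSupport hη.continuous hc
    have := ((proj (𝕜 := ℝ) i).comp
      (ContinuousLinearMap.apply ℝ (En n) v)).integrable_comp this
    exact this.congr (Eventually.of_forall fun x => by simp [mul_comm])
  have hA : ∀ x, HasFDerivAt (fun x => (A x) i) ((proj (𝕜 := ℝ) i).comp A) x := fun x =>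
    ((proj (𝕜 := ℝ) i).comp A).hasFDerivAt
  have e1 := integral_mul_fderiv_eq_neg_fderiv_mul_of_integrable (μ := (volume : Measure (En n)))
    (f := fun x => (A x) i) (g := η) (v := v) (by simp only [(hA _).fderiv]; exact i2)
    (i1 A A.continuous) (((ci A A.continuous).mul
      hη.continuous).integrable_of_hasCompactSupport hc.mul_left) (fun x _ => (hA x).differentiableAt)
    (fun x _ => hη.differentiable sm x)
  simp only [(hA _).fderiv] at e1
  have e2 := h.2.2 η hη hc i j
  simp only [PiLp.sub_apply, sub_mul, ContinuousLinearMap.sub_apply]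
  rw [integral_sub (i1 f h.1) (i1 A A.continuous), integral_sub i3 i2, e2, e1]
  simp only [ContinuousLinearMap.comp_apply, PiLp.proj_apply]
  ring
theorem WD.pi {f : En n → En n} {G : En n → En n →L[ℝ] En n} (h : WD f G) :
    PI f (fun x => ‖G x‖ₑ) := by
  refine ⟨h.1, fun a r hr => (Qa h contDiff_id a hr).trans (mul_le_mul_right
    (lintegral_mono fun w => ?_) _)⟩
  rw [fderiv_id]
  have h1 : ‖ContinuousLinearMap.id ℝ (En n)‖ₑ ≤ 1 := by
    rw [← ofReal_norm_eq_enorm, ENNReal.ofReal_le_one]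
    exact ContinuousLinearMap.norm_id_le
  calc _ ≤ 1 * ‖G w‖ₑ := by gcongr
    _ = _ := one_mul _
theorem leb {H : Type*} [NormedAddCommGroup H] [NormedSpace ℝ H] (hn : n ≠ 0) {G : En n → H}
    (h : LocallyIntegrable G volume) (R : ℝ) :
    ∃ E : ℕ → Set (En n), (∀ k, MeasurableSet (E k)) ∧ volume (ball 0 R \ ⋃ k, E k) = 0 ∧
      ∀ k, ∀ a ∈ E k, ∀ ε : ℝ, 0 < ε → ∃ δ > 0, ∀ b ∈ E k, dist b a < δ → ∀ p ∈ E k,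
        dist p a ≤ dist b a → ∀ s, 0 < s → s ≤ 4 * dist b a →
          ∫⁻ w in ball p s, ‖G w - G a‖ₑ ≤ ofReal (s ^ n) *
            ((1 + 2 * om n) * ofReal ε) := by
  set GR := (ball (0 : En n) R).indicator G with hGR
  have hGi : Integrable GR := ((h.integrableOn_isCompact (isCompact_closedBall 0 R)).mono_set
    ball_subset_closedBall).integrable_indicator measurableSet_ball
  choose g hgc hg1 hg2 hg3 using fun m : ℕ => hGi.exists_hasCompactSupport_lintegral_sub_le
    (ε := (4⁻¹ : ENNReal) ^ m) (pow_ne_zero _ sm)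
  set bad : ℕ → Set (En n) := fun m => {x | (2⁻¹ : ENNReal) ^ m < Mx (fun y => ‖GR y - g m y‖ₑ) x} ∪
    {x | (2⁻¹ : ENNReal) ^ m ≤ ‖GR x - g m x‖ₑ} with hbad
  have hp0 : ∀ m : ℕ, (2⁻¹ : ENNReal) ^ m ≠ 0 := fun m => pow_ne_zero _ sm
  have hpt : ∀ m : ℕ, (2⁻¹ : ENNReal) ^ m ≠ ⊤ := fun m => pow_ne_top sm
  have hbm : ∀ m, volume (bad m) ≤ (5 ^ n * om n + 1) * 2⁻¹ ^ m := by
    intro m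
    have h4 : ((2⁻¹ : ENNReal) ^ m)⁻¹ * 4⁻¹ ^ m = 2⁻¹ ^ m := by
      have : (4⁻¹ : ENNReal) = 2⁻¹ * 2⁻¹ := by
        rw [← ENNReal.mul_inv sm sm]; norm_num
      rw [this, mul_pow, ← mul_assoc, ENNReal.inv_mul_cancel (hp0 m) (hpt m), one_mul]
    refine (measure_union_le _ _).trans ?_
    rw [add_mul, one_mul]
    refine add_le_add ((Mx_weak hn _ (hp0 m) (hpt m)).trans ?_)
      ((meas_ge_le_lintegral_div (hGi.1.sub (hg2 m).aestronglyMeasurable).enorm (hp0 m) (hpt m)).trans ?_)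
    · rw [mul_assoc]
      exact mul_le_mul_right ((mul_le_mul_right (hg1 m) _).trans_eq h4) _
    · rw [ENNReal.div_eq_inv_mul]
      exact (mul_le_mul_right (hg1 m) _).trans_eq h4
  have hsum : ∑' m, volume (toMeasurable volume (bad m)) ≠ ⊤ := by
    simp_rw [measure_toMeasurable]
    refine ne_top_of_le_ne_top ?_ (tsum_le_tsum hbm)
    rw [ENNReal.tsum_mul_left, ENNReal.tsum_geometric]
    refine mul_ne_top (add_ne_top.2 ⟨mul_ne_top sm (om_top n), by simp⟩) ?_
    simp
  refine ⟨fun M => ball 0 R ∩ ⋂ m, ⋂ (_ : M ≤ m), (toMeasurable volume (bad m))ᶜ,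
    fun M => measurableSet_ball.inter (MeasurableSet.iInter fun m => MeasurableSet.iInter fun _ =>
      (measurableSet_toMeasurable _ _).compl), ?_, ?_⟩
  · refine measure_mono_null ?_ (measure_limsup_atTop_eq_zero hsum)
    rintro x ⟨hx, hx2⟩
    rw [limsup_eq_iInf_iSup_of_nat]
    simp only [iInf_eq_iInter, iSup_eq_iUnion, mem_iInter, mem_iUnion]
    intro M
    by_contra hc
    push Not at hc
    exact hx2 (mem_iUnion.2 ⟨M, hx, by simpa using hc⟩)
  · rintro M a ⟨haR, ha⟩ ε hε
    have hgood : ∀ p ∈ ball (0 : En n) R ∩ ⋂ m, ⋂ (_ : M ≤ m), (toMeasurable volume (bad m))ᶜ,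
        ∀ m, M ≤ m → Mx (fun y => ‖GR y - g m y‖ₑ) p ≤ 2⁻¹ ^ m ∧ ‖GR p - g m p‖ₑ ≤ 2⁻¹ ^ m := by
      intro p hp m hm
      have h1 := fun hq => (mem_iInter₂.1 hp.2 m hm) (subset_toMeasurable volume (bad m) hq)
      simp only [hbad, mem_union, mem_setOf_eq, not_or, not_lt, not_le] at h1
      constructor
      · by_contra hc; exact h1 (Or.inl (not_le.1 hc))
      · by_contra hc; exact h1 (Or.inr (not_le.1 hc).le)
    obtain ⟨m, hmM, hm⟩ : ∃ m, M ≤ m ∧ (2⁻¹ : ENNReal) ^ m ≤ ofReal ε := by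
      have := (ENNReal.tendsto_pow_atTop_nhds_zero_of_lt_one (r := 2⁻¹) sm).eventually
        (gt_mem_nhds (ENNReal.ofReal_pos.2 hε))
      obtain ⟨m, h1, h2⟩ := ((eventually_ge_atTop M).and this).exists
      exact ⟨m, h1, h2.le⟩
    obtain ⟨d1, hd1, hd1'⟩ := Metric.continuous_iff.1 (hg2 m) a ε hε
    obtain ⟨d2, hd2, hd2'⟩ := Metric.isOpen_iff.1 isOpen_ball a haR
    refine ⟨min d1 d2 / 8, by positivity, fun b _ hb p hp hpa s hs hsd => ?_⟩
    calc _ ≤ ∫⁻ w in ball p s, (‖GR w - g m w‖ₑ + 2 * ofReal ε) := by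
          refine setLIntegral_mono' measurableSet_ball fun w hw => ?_
          have hwa : dist w a < min d1 d2 := by
            have := dist_triangle w p a; rw [mem_ball] at hw; linarith
          have hwR : GR w = G w := indicator_of_mem (hd2' (hwa.trans_le (min_le_right _ _))) _
          have haR' : GR a = G a := indicator_of_mem haR _
          have h1 : ‖g m w - g m a‖ₑ ≤ ofReal ε := by
            rw [← ofReal_norm_eq_enorm, ← dist_eq_norm]
            exact ofReal_le_ofReal (hd1' w (hwa.trans_le (min_le_left _ _))).le
          have h2 : ‖g m a - G a‖ₑ ≤ ofReal ε := by
            rw [← haR', enorm_sub_rev]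
            exact (hgood a ⟨haR, ha⟩ m hmM).2.trans hm
          rw [hwR, two_mul]
          have h3 := edist_triangle4 (G w) (g m w) (g m a) (G a)
          simp only [edist_eq_enorm_sub] at h3
          refine h3.trans ?_
          rw [add_assoc]
          exact add_le_add_right (add_le_add h1 h2) _
      _ ≤ ofReal (s ^ n) * ofReal ε + 2 * ofReal ε *
          (ofReal (s ^ n) * om n) := by
          rw [lintegral_add_right _ measurable_const, setLIntegral_const, vol_ball p hs]
          exact add_le_add_left ((le_Mx _ p hs).trans
            (mul_le_mul_right ((hgood p hp m hmM).1.trans hm) _)) _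
      _ = _ := by ring
theorem area0 (hn : n ≠ 0) {f : En n → En n} {G : En n → En n →L[ℝ] En n} (h : WD f G) (R : ℝ) :
    ∃ E : ℕ → Set (En n), (∀ k, MeasurableSet (E k)) ∧ volume (ball 0 R \ ⋃ k, E k) = 0 ∧
      ∀ k, ∀ a ∈ E k, HasFDerivWithinAt f (G a) (E k) a := by
  obtain ⟨E, h1, h2, h3⟩ := leb hn h.2.1 R
  refine ⟨E, h1, h2, fun k a ha => ?_⟩
  have hPI := (h.sub_lin (G a)).pi
  replace h3 := h3 k a ha
  generalize G a = A at *
  obtain ⟨C', hC'⟩ : ∃ C', cT n * (2 ^ (n + 1) * (1 + 2 ^ (n + 1)) * (1 + 2 * om n)) = C' := ⟨_, rfl⟩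
  have hCt : C' ≠ ⊤ := by
    rw [← hC']
    refine mul_ne_top (cT_top n) (mul_ne_top (by finiteness) ?_)
    exact add_ne_top.2 ⟨by simp, mul_ne_top sm (om_top n)⟩
  have hC0 : 0 ≤ C'.toReal := toReal_nonneg
  rw [hasFDerivWithinAt_iff_isLittleO, Asymptotics.isLittleO_iff]
  intro ε hε
  obtain ⟨e, he⟩ : ∃ e, e = ε / (C'.toReal + 1) := ⟨_, rfl⟩
  have he0 : 0 < e := by rw [he]; positivity
  obtain ⟨δ, hδ, h4⟩ := h3 e he0
  filter_upwards [mem_nhdsWithin_of_mem_nhds (ball_mem_nhds a hδ), self_mem_nhdsWithin] with b hb hbE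
  rcases eq_or_ne b a with rfl | hne
  · simp
  have hdp : 0 < dist b a := dist_pos.2 hne
  have hM := h4 b hbE hb
  have t1 := TelM hPI b hdp (fun s hs h2 => hM b hbE le_rfl s hs (by linarith))
  have t2 := TelM hPI a (r := 2 * dist b a) (by linarith)
    (fun s hs h2 => hM a ha (by simpa using hdp.le) s hs (by linarith))
  have t3 := (two_pt hPI.1 (le_refl (dist b a))).trans (add_le_add t1 t2)
  rw [vol_ball a (by linarith : 0 < 2 * dist b a), mul_pow, ofReal_mul pv,
    mul_assoc (ofReal _), ← vol_ball b hdp, ofReal_mul zero_le_two,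
    ofReal_pow zero_le_two] at t3
  have hv0 : volume (ball b (dist b a)) ≠ 0 := (measure_ball_pos volume b hdp).ne'
  have t4 : ‖f a - A a - (f b - A b)‖ₑ ≤ ofReal (C'.toReal * e * dist b a) := by
    rw [← ENNReal.mul_le_mul_iff_left hv0 measure_ball_lt_top.ne]
    refine t3.trans (le_of_eq ?_)
    rw [ofReal_mul pv, ofReal_mul hC0, ofReal_toReal hCt, ← hC']
    simp only [ofReal_ofNat]
    ring
  rw [← ofReal_norm_eq_enorm, ofReal_le_ofReal_iff pv, norm_sub_rev] at t4
  rw [← dist_eq_norm b a]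
  have e1 : f b - f a - A (b - a) = f b - A b - (f a - A a) := by rw [map_sub]; abel
  rw [e1]
  refine t4.trans (mul_le_mul_of_nonneg_right ?_ hdp.le)
  rw [he, ← mul_div_assoc, div_le_iff₀ pv]; nlinarith
theorem area {f : En n → En n} {G : En n → En n →L[ℝ] En n} (hn : n ≠ 0) (h : WD f G)
    (hi : Function.Injective f) : ∃ N, volume N = 0 ∧ MeasurableSet N ∧
      ∀ A, MeasurableSet A → Disjoint A N →
        volume (f '' A) = ∫⁻ x in A, ofReal |(G x).det| := by
  choose E hE1 hE2 hE3 using fun k : ℕ => area0 hn h k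
  set D : ℕ → Set (En n) := fun k => E k.unpair.1 k.unpair.2
  have hDm : ∀ k, MeasurableSet (D k) := fun k => hE1 _ _
  refine ⟨(⋃ k, D k)ᶜ, ?_, (MeasurableSet.iUnion hDm).compl, fun A hA hd => ?_⟩
  · refine measure_mono_null ?_ (measure_iUnion_null hE2)
    intro x hx
    obtain ⟨k, hk⟩ := exists_nat_gt ‖x‖
    refine mem_iUnion.2 ⟨k, by simpa using hk, fun hx2 => hx ?_⟩
    obtain ⟨j, hj⟩ := mem_iUnion.1 hx2
    exact mem_iUnion.2 ⟨Nat.pair k j, by simpa [D] using hj⟩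
  · have hAe : A = ⋃ k, A ∩ disjointed D k := by
      rw [← inter_iUnion, iUnion_disjointed, eq_comm, inter_eq_left]
      exact disjoint_compl_right_iff_subset.1 hd
    have hm : ∀ k, MeasurableSet (A ∩ disjointed D k) := fun k =>
      hA.inter (MeasurableSet.disjointed hDm k)
    have hdj : Pairwise (Function.onFun Disjoint fun k => A ∩ disjointed D k) := fun i j hij =>
      (disjoint_disjointed D hij).mono inter_subset_right inter_subset_right
    conv_lhs => rw [hAe]
    conv_rhs => rw [hAe]
    rw [image_iUnion, measure_iUnion (fun i j hij => (disjoint_image_iff hi).2 (hdj hij))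
      (fun k => (hm k).image_of_continuousOn_injOn h.1.continuousOn hi.injOn),
      lintegral_iUnion hm hdj]
    refine tsum_congr fun k => ?_
    refine (lintegral_abs_det_fderiv_eq_addHaar_image volume (hm k) (fun x hx => ?_) hi.injOn).symm
    have hx' := disjointed_subset D k hx.2
    exact (hE3 _ _ x hx').mono (inter_subset_right.trans (disjointed_subset D k))
theorem hold (hn : 2 ≤ n) {μ : Measure (En n)} {g : En n → ENNReal} (hg : AEMeasurable g μ) :
    (∫⁻ x, g x ∂μ) ^ n ≤ (∫⁻ x, g x ^ n ∂μ) * μ univ ^ (n - 1) := by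
  have hn0 : (n : ℝ) ≠ 0 := by positivity
  have hn1 : (1 : ℝ) < n := by exact_mod_cast hn
  have h := ENNReal.lintegral_mul_le_Lp_mul_Lq μ (Real.HolderConjugate.conjExponent hn1) hg
    (aemeasurable_const (b := (1 : ENNReal)))
  simp only [Pi.mul_apply, mul_one, ENNReal.one_rpow, lintegral_one, rpow_natCast] at h
  have h2 := pow_le_pow_left' h n
  rw [mul_pow, ← rpow_natCast (_ ^ (1 / (n : ℝ))), ← rpow_mul,
    one_div_mul_cancel hn0, rpow_one, ← rpow_natCast (μ univ ^ _),
    ← rpow_mul] at h2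
  have e : 1 / Real.conjExponent n * (n : ℝ) = ((n - 1 : ℕ) : ℝ) := by
    rw [Nat.cast_sub (by omega), Real.conjExponent]; field_simp; simp
  rwa [e, rpow_natCast] at h2
theorem cap (hn : 2 ≤ n) {κ : ENNReal} (hκ : κ ≠ 0) (hκt : κ ≠ ⊤) : ∃ C : ENNReal, C ≠ ⊤ ∧
    ∀ (f : En n → ℝ) (g : En n → ENNReal), PI f g → AEMeasurable g → ∀ (r L T : ℝ) (o : En n)
      (S : Set (En n)), 0 < r → (∀ t ∈ Icc T (T + L), ∃ a ∈ S, dist a o = t) →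
      (∀ a ∈ S, κ * volume (ball a r) ≤ DD f a r) →
      ofReal L ≤ C * ofReal r * ∫⁻ x, g x ^ n := by
  have hn0 : (n : ℝ) ≠ 0 := by positivity
  obtain ⟨q, hq1, hqn⟩ : ∃ q : ENNReal, q < 1 ∧ q ^ n = 2⁻¹ := by
    refine ⟨(2⁻¹ : ENNReal) ^ (1 / n : ℝ), ENNReal.rpow_lt_one sm pv, ?_⟩
    rw [← rpow_natCast, ← rpow_mul, one_div_mul_cancel hn0, rpow_one]
  set W := cT n * (1 - q)⁻¹ with hW
  have hWt : W ≠ ⊤ := mul_ne_top (cT_top n) (inv_ne_top.2 (tsub_pos_of_lt hq1).ne')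
  have hW0 : W ≠ 0 := by
    have : cT n ≠ 0 := mul_ne_zero sm (ENNReal.inv_ne_zero.2 (om_top n))
    exact mul_ne_zero this (ENNReal.inv_ne_zero.2 (by finiteness))
  set k' := κ / 2 / W with hk'
  have hk0 : k' ≠ 0 := (ENNReal.div_pos (ENNReal.half_pos hκ).ne' hWt).ne'
  have hkt : k' ≠ ⊤ := div_ne_top (div_ne_top hκt sm) hW0
  set X := (k' ^ n)⁻¹ * (2 ^ n * om n) ^ (n - 1) with hX
  have hXt : X ≠ ⊤ := mul_ne_top (inv_ne_top.2 (pow_ne_zero _ hk0))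
    (pow_ne_top (mul_ne_top (by finiteness) (om_top n)))
  refine ⟨20 * X, mul_ne_top sm hXt, fun f g hf hg r L T o S hr hS hD => ?_⟩
  have h1 : ∀ a ∈ S, ∃ k : ℕ, ofReal (r / 2 ^ k) ≤
      X * ofReal r * ∫⁻ x in ball a (2 * (r / 2 ^ k)), g x ^ n := by
    intro a ha
    have h2 := (hD a ha).trans (Tel hf a hr)
    rw [mul_comm κ, ENNReal.mul_le_mul_iff_right (measure_ball_pos volume a hr).ne'
      measure_ball_lt_top.ne] at h2
    obtain ⟨k, hk⟩ : ∃ k : ℕ, k' * q ^ k ≤ ofReal (r / 2 ^ k) *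
      (ofReal ((r / 2 ^ k) ^ n))⁻¹ * ∫⁻ w in ball a (2 * (r / 2 ^ k)), g w := by
      by_contra hc
      push Not at hc
      have h3 : κ ≤ κ / 2 := calc
        κ ≤ cT n * ∑' k : ℕ, k' * q ^ k :=
          h2.trans (mul_le_mul_right (tsum_le_tsum fun k => (hc k).le) _)
        _ = W * k' := by rw [ENNReal.tsum_mul_left, ENNReal.tsum_geometric, hW]; ring
        _ ≤ κ / 2 := ENNReal.mul_div_le
      exact absurd h3 (not_le.2 (ENNReal.half_lt_self hκ hκt))
    refine ⟨k, ?_⟩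
    have hp : 0 < r / 2 ^ k := by positivity
    set s := r / 2 ^ k with hs
    have h4 := pow_le_pow_left' hk n
    have h5 := hold hn (hg.restrict (s := ball a (2 * s)))
    rw [Measure.restrict_apply_univ, vol_ball a pv] at h5
    rw [mul_pow, mul_pow, mul_pow, ← pow_mul, mul_comm k n, pow_mul, hqn] at h4
    replace h5 := h4.trans (mul_le_mul_right h5 _)
    have h6 : ofReal s ^ n * (ofReal (s ^ n))⁻¹ ^ n *
        ((∫⁻ x in ball a (2 * s), g x ^ n) * (ofReal ((2 * s) ^ n) * om n) ^ (n - 1)) =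
        (2 ^ n * om n) ^ (n - 1) * ∫⁻ x in ball a (2 * s), g x ^ n := by
      have e1 : ofReal s ^ n = ofReal (s ^ n) := (ofReal_pow hp.le n).symm
      have e2 : ofReal ((2 * s) ^ n) = 2 ^ n * ofReal (s ^ n) := by
        rw [mul_pow, ofReal_mul pv, ofReal_pow zero_le_two]; simp
      have e3 : ofReal (s ^ n) ≠ 0 := by simpa using pow_pos hp n
      rw [e1, e2]
      generalize ofReal (s ^ n) = y at *
      have e4 : y * y⁻¹ ^ n * y ^ (n - 1) = 1 := by
        rw [mul_right_comm, mul_pow_sub_one (by omega), ← mul_pow, ENNReal.mul_inv_cancel e3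
          (by rw [← e1]; finiteness), one_pow]
      calc _ = (y * y⁻¹ ^ n * y ^ (n - 1)) * ((2 ^ n * om n) ^ (n - 1) *
            ∫⁻ x in ball a (2 * s), g x ^ n) := by rw [mul_right_comm (2 ^ n), mul_pow _ y]; ring
        _ = _ := by rw [e4, one_mul]
    rw [h6] at h5
    have h7 : (2⁻¹ : ENNReal) ^ k ≤ X * ∫⁻ x in ball a (2 * s), g x ^ n := by
      rw [← ENNReal.mul_le_mul_iff_right (pow_ne_zero n hk0) (pow_ne_top hkt)]
      refine h5.trans (le_of_eq ?_)
      rw [hX, ← mul_assoc, ← mul_assoc, ENNReal.mul_inv_cancel (pow_ne_zero n hk0)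
        (pow_ne_top hkt), one_mul]
    calc ofReal s = ofReal r * 2⁻¹ ^ k := by
          rw [hs, div_eq_mul_inv, ofReal_mul hr.le, ofReal_inv_of_pos pv,
            ofReal_pow zero_le_two, ENNReal.inv_pow]; simp
      _ ≤ ofReal r * (X * ∫⁻ x in ball a (2 * s), g x ^ n) := mul_le_mul_right h7 _
      _ = _ := by ring
  choose! k hk using h1
  obtain ⟨u, huS, huc, hud, hcov⟩ := vitali5 S (fun a => 2 * (r / 2 ^ k a)) (2 * r)
    (fun a _ => by positivity) (fun a _ => by
      gcongr; exact div_le_self hr.le (one_le_pow₀ (by norm_num)))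
  have := huc.to_subtype
  have hI : Icc T (T + L) ⊆ ⋃ b : u, closedBall (dist (b : En n) o) (10 * (r / 2 ^ k b)) := by
    intro t ht
    obtain ⟨a, ha, rfl⟩ := hS t ht
    obtain ⟨b, hb, hab⟩ := hcov a ha
    refine mem_iUnion.2 ⟨⟨b, hb⟩, ?_⟩
    have h2 : dist a b ≤ _ := hab (mem_closedBall_self pv)
    rw [mem_closedBall, dist_eq]
    exact (abs_dist_sub_le a b o).trans (h2.trans_eq (by ring))
  calc ofReal L = volume (Icc T (T + L)) := by rw [volume_Icc]; congr 1; ring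
    _ ≤ ∑' b : u, volume (closedBall (dist (b : En n) o) (10 * (r / 2 ^ k b))) :=
        (measure_mono hI).trans (measure_iUnion_le _)
    _ ≤ ∑' b : u, 20 * X * ofReal r * ∫⁻ x in closedBall (b : En n) (2 * (r / 2 ^ k b)), g x ^ n :=
        tsum_le_tsum fun b => by
          rw [Real.volume_closedBall, show (2 : ℝ) * (10 * (r / 2 ^ k b)) = 20 * (r / 2 ^ k b) by ring,
            ofReal_mul (by norm_num), ofReal_ofNat, mul_assoc 20, mul_assoc 20]
          exact mul_le_mul_right ((hk b (huS b.2)).trans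
            (mul_le_mul_right (lintegral_mono_set ball_subset_closedBall) _)) _
    _ = 20 * X * ofReal r * ∫⁻ x in ⋃ b : u, closedBall (b : En n) (2 * (r / 2 ^ k b)), g x ^ n := by
        rw [ENNReal.tsum_mul_left, lintegral_iUnion (fun b => measurableSet_closedBall)]
        exact fun b c hbc => hud b.2 c.2 (fun h => hbc (Subtype.ext h))
    _ ≤ _ := mul_le_mul_right (setLIntegral_le_lintegral _ _) _
theorem logu (hn : 2 ≤ n) : ∃ c : ENNReal, c ≠ ⊤ ∧ ∀ (m : ℕ) (x : En n) (r : ℝ), m ≠ 0 → 0 < r →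
    ∃ u : En n → ℝ, ContDiff ℝ 1 u ∧ (∀ p, dist p x ≤ r → u p = 1) ∧ (∀ p, 3 ^ m * r ≤ dist p x → u p = 0) ∧
      ∫⁻ p, ‖fderiv ℝ u p‖ₑ ^ n ≤ c * (m : ENNReal)⁻¹ := by
  let χ : ContDiffBump (0 : En n) := ⟨1, 2, one_pos, one_lt_two⟩
  have hχ : ContDiff ℝ 1 χ := χ.contDiff
  obtain ⟨M, hM⟩ := (χ.hasCompactSupport.fderiv ℝ).exists_bound_of_continuous (hχ.continuous_fderiv one_ne_zero)
  refine ⟨(ofReal M * 3) ^ n * om n, mul_ne_top (by finiteness) (om_top n), fun m x r hm hr => ?_⟩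
  have hn0 : n ≠ 0 := by omega
  have hm' : (0 : ℝ) < m := by positivity
  let s : ℕ → ℝ := fun k => 3 ^ k * r
  have hs : ∀ k, 0 < s k := fun k => by positivity
  let v : ℕ → En n → ℝ := fun k p => χ ((s k)⁻¹ • (p - x))
  have hn1 : ∀ k p, ‖(s k)⁻¹ • (p - x)‖ = dist p x / s k := fun k p => by
    rw [norm_smul, norm_inv, norm_of_nonneg (hs k).le, dist_eq_norm, inv_mul_eq_div]
  have hvc : ∀ k, ContDiff ℝ 1 (v k) := fun k => hχ.comp (by fun_prop)
  have hv1 : ∀ k p, dist p x ≤ s k → v k p = 1 := fun k p h => χ.one_of_mem_closedBall (by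
    rw [mem_closedBall_zero_iff, hn1]; exact (div_le_one (hs k)).2 h)
  have hv0 : ∀ k p, 2 * s k ≤ dist p x → v k p = 0 := fun k p h => χ.zero_of_le_dist (by
    rw [dist_zero_right, hn1]; exact (le_div_iff₀ (hs k)).2 h)
  have hd1 : ∀ k p, dist p x < s k → fderiv ℝ (v k) p = 0 := fun k p h => by
    have : v k =ᶠ[𝓝 p] fun _ => 1 := by
      filter_upwards [isOpen_ball.mem_nhds (show p ∈ ball x (s k) from h)] with q hq
      exact hv1 k q (le_of_lt hq)
    rw [this.fderiv_eq]; simp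
  have hd0 : ∀ k p, 2 * s k < dist p x → fderiv ℝ (v k) p = 0 := fun k p h => by
    have : v k =ᶠ[𝓝 p] fun _ => 0 := by
      filter_upwards [(isOpen_lt continuous_const (continuous_id.dist continuous_const)).mem_nhds
        (show p ∈ {q | 2 * s k < dist q x} from h)] with q hq
      exact hv0 k q (le_of_lt hq)
    rw [this.fderiv_eq]; simp
  have hdb : ∀ k p, ‖fderiv ℝ (v k) p‖ ≤ M * (s k)⁻¹ := fun k p => by
    have h1 : HasFDerivAt (fun p => (s k)⁻¹ • (p - x)) ((s k)⁻¹ • ContinuousLinearMap.id ℝ (En n)) p :=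
      ((hasFDerivAt_id (𝕜 := ℝ) p).sub_const x).const_smul (s k)⁻¹
    have h2 := ((hχ.differentiable one_ne_zero) ((s k)⁻¹ • (p - x))).hasFDerivAt.comp p h1
    rw [show fderiv ℝ (v k) p = _ from h2.fderiv]
    refine (ContinuousLinearMap.opNorm_comp_le _ _).trans (mul_le_mul (hM _) ?_ (norm_nonneg _) ((norm_nonneg _).trans (hM 0)))
    rw [norm_smul, norm_inv, norm_of_nonneg (hs k).le]
    exact mul_le_of_le_one_right (inv_nonneg.2 (hs k).le) ContinuousLinearMap.norm_id_le
  have hI : ∀ k, ∫⁻ p, ‖fderiv ℝ (v k) p‖ₑ ^ n ≤ (ofReal M * 3) ^ n * om n := fun k => by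
    calc _ ≤ ∫⁻ p, (ball x (3 * s k)).indicator (fun _ => (ofReal M * (ofReal (s k))⁻¹) ^ n) p :=
          lintegral_mono fun p => by
            by_cases hp : p ∈ ball x (3 * s k)
            · rw [indicator_of_mem hp, ← ofReal_norm_eq_enorm, ← ofReal_inv_of_pos (hs k), ← ofReal_mul ((norm_nonneg _).trans (hM 0))]
              gcongr; exact hdb k p
            · rw [hd0 k p (by rw [mem_ball, not_lt] at hp; linarith [hs k]), ← ofReal_norm_eq_enorm, norm_zero]; simp [hn0]
      _ = _ := by
        have h0 : ofReal (s k) ≠ 0 := by simp [hs k]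
        rw [lintegral_indicator measurableSet_ball, setLIntegral_const, vol_ball x (by linarith [hs k]),
          ofReal_pow (by linarith [hs k]), ofReal_mul (p := 3) (by norm_num), ← mul_assoc, ← mul_pow]
        congr 2
        rw [mul_assoc, mul_left_comm (_)⁻¹ (ofReal 3), ENNReal.inv_mul_cancel h0 ofReal_ne_top]; simp
  refine ⟨fun p => ∑ k ∈ Finset.range m, (m : ℝ)⁻¹ * v k p, ContDiff.sum fun k _ => contDiff_const.mul (hvc k), fun p hp => ?_, fun p hp => ?_, ?_⟩
  · have h := fun k => hv1 k p (hp.trans (le_mul_of_one_le_left hr.le (one_le_pow₀ (by norm_num))))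
    simp [h, hm]
  · refine sum_eq_zero fun k hk => ?_
    rw [hv0 k p, mul_zero]
    refine le_trans ?_ hp
    have : (3 : ℝ) ^ (k + 1) ≤ 3 ^ m := pow_le_pow_right₀ (by norm_num) (Finset.mem_range.1 hk)
    simp only [s]; rw [pow_succ] at this; nlinarith [pow_pos (show (0 : ℝ) < 3 by norm_num) k]
  · have hp : ∀ p, ‖fderiv ℝ (fun p => ∑ k ∈ Finset.range m, (m : ℝ)⁻¹ * v k p) p‖ₑ ^ n ≤
        ((m : ENNReal)⁻¹) ^ n * ∑ k ∈ Finset.range m, ‖fderiv ℝ (v k) p‖ₑ ^ n := fun p => by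
      have hdk := fun k => (hvc k).differentiable one_ne_zero p
      rw [fderiv_fun_sum fun k _ => (hdk k).const_mul _, sum_congr rfl fun k _ => fderiv_const_mul (hdk k) _,
        ← Finset.smul_sum, enorm_smul, mul_pow]
      refine mul_le_mul' (le_of_eq ?_) ?_
      · congr 1
        rw [enorm_eq_ofReal pv, ofReal_inv_of_pos hm', ofReal_natCast]
      · by_cases h : ∃ k ∈ Finset.range m, fderiv ℝ (v k) p ≠ 0
        · obtain ⟨k, hk, h⟩ := h
          rw [Finset.sum_eq_single_of_mem k hk]
          · exact Finset.single_le_sum (f := fun k => ‖fderiv ℝ (v k) p‖ₑ ^ n) (fun _ _ => zero_le) hk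
          intro j _ hj
          have h1 : s k ≤ dist p x := not_lt.1 fun h' => h (hd1 k p h')
          have h2 : dist p x ≤ 2 * s k := not_lt.1 fun h' => h (hd0 k p h')
          have h3 : ∀ a b, a < b → 2 * s a < s b := fun a b hab => by
            have : (3 : ℝ) ^ (a + 1) ≤ 3 ^ b := pow_le_pow_right₀ (by norm_num) hab
            simp only [s]; rw [pow_succ] at this; nlinarith [mul_pos (pow_pos (show (0 : ℝ) < 3 by norm_num) a) hr]
          rcases lt_or_gt_of_ne hj with h' | h'
          · exact hd0 j p ((h3 _ _ h').trans_le h1)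
          · exact hd1 j p (h2.trans_lt (h3 _ _ h'))
        · push Not at h
          rw [sum_eq_zero h, ← ofReal_norm_eq_enorm, norm_zero]; simp [hn0]
    have hm0 : (m : ENNReal) ≠ 0 := by exact_mod_cast hm
    calc _ ≤ ∫⁻ p, ((m : ENNReal)⁻¹) ^ n * ∑ k ∈ Finset.range m, ‖fderiv ℝ (v k) p‖ₑ ^ n := lintegral_mono hp
      _ = ((m : ENNReal)⁻¹) ^ n * ∑ k ∈ Finset.range m, ∫⁻ p, ‖fderiv ℝ (v k) p‖ₑ ^ n := by
        have hmm : ∀ k, Measurable fun p => ‖fderiv ℝ (v k) p‖ₑ ^ n := fun k =>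
          (((hvc k).continuous_fderiv one_ne_zero).enorm.measurable).pow_const n
        rw [lintegral_const_mul _ (Finset.measurable_sum _ fun k _ => hmm k), lintegral_finsetSum _ fun k _ => hmm k]
      _ ≤ ((m : ENNReal)⁻¹) ^ 2 * (m * ((ofReal M * 3) ^ n * om n)) := by
        refine mul_le_mul' (pow_le_pow_of_le_one zero_le (ENNReal.inv_le_one.2 (by exact_mod_cast one_le_iff_ne_zero.2 hm)) hn) ?_
        refine (sum_le_sum fun k _ => hI k).trans_eq ?_
        simp
      _ = _ := by
        rw [sq, mul_assoc, ← mul_assoc _ (m : ENNReal), ENNReal.inv_mul_cancel hm0 sm, one_mul, mul_comm]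
def Qp (K : ENNReal) (φ ψ : En n → En n) (G : En n → En n →L[ℝ] En n) : Prop :=
  Continuous φ ∧ WD ψ G ∧ (∀ x, φ (ψ x) = x) ∧ (∀ x, ψ (φ x) = x) ∧
    ∀ A, MeasurableSet A → ∫⁻ x in A, ‖G x‖ₑ ^ n ≤ K * volume (φ ⁻¹' A)
theorem Qp.cv {K : ENNReal} {φ ψ : En n → En n} {G : En n → En n →L[ℝ] En n} (h : Qp K φ ψ G)
    {w : En n → ENNReal} (hw : Measurable w) : ∫⁻ x, w (ψ x) * ‖G x‖ₑ ^ n ≤ K * ∫⁻ z, w z := by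
  obtain ⟨h1, h2, h3, h4, h5⟩ := h
  have hm : AEMeasurable (fun x => ‖G x‖ₑ ^ n) volume := h2.2.1.aestronglyMeasurable.enorm.pow_const n
  have hle : volume.withDensity (fun x => ‖G x‖ₑ ^ n) ≤ K • volume.map φ := Measure.le_intro fun A hA _ => by
    rw [withDensity_apply _ hA, Measure.smul_apply, Measure.map_apply h1.measurable hA]; exact h5 A hA
  have hwm : Measurable fun x => w (ψ x) := hw.comp h2.1.measurable
  calc _ = ∫⁻ x, w (ψ x) ∂(volume.withDensity fun x => ‖G x‖ₑ ^ n) := by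
        rw [lintegral_withDensity_eq_lintegral_mul₀ hm hwm.aemeasurable]
        exact lintegral_congr fun x => mul_comm _ _
    _ ≤ ∫⁻ x, w (ψ x) ∂(K • volume.map φ) := lintegral_mono' hle le_rfl
    _ = _ := by rw [lintegral_smul_measure, lintegral_map hwm h1.measurable]; simp [h4]
theorem Qs (hn : 2 ≤ n) {K : ENNReal} (hK : K ≠ ⊤) : ∃ C : ℝ, 0 < C ∧ ∀ φ ψ G, Qp (n := n) K φ ψ G → ∀ x y z,
    C * dist y x ≤ dist z x → 24 * dist (φ y) (φ x) ≤ dist (φ z) (φ x) := by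
  obtain ⟨c₀, hc₀, hu⟩ := logu hn
  set κ : ENNReal := (2 ^ n + 1)⁻¹ with hκd
  have hκ0 : κ ≠ 0 := ENNReal.inv_ne_zero.2 (by finiteness)
  have hκt : κ ≠ ⊤ := inv_ne_top.2 pv
  obtain ⟨C, hC, hcap⟩ := cap hn hκ0 hκt
  obtain ⟨m, hm⟩ := ENNReal.exists_nat_gt (r := 52 * C * K * c₀) (by finiteness)
  have hm0 : m ≠ 0 := by rintro rfl; simp at hm
  refine ⟨3 ^ m, by positivity, fun φ ψ G hq x y z h => ?_⟩
  by_contra! hlt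
  obtain ⟨h1, h2, h3, h4, h5⟩ := id hq
  set L := dist (φ y) (φ x) with hL
  have hL0 : 0 < L := by linarith [dist_nonneg (x := φ z) (y := φ x)]
  have hr0 : 0 < dist y x := dist_pos.2 fun e => by rw [hL, e, dist_self] at hL0; exact hL0.false
  have hz0 : 0 < dist z x := lt_of_lt_of_le pv h
  obtain ⟨u, huc, hu1, hu0, hui⟩ := hu m x _ hm0 hr0
  set f := fun q => u (ψ q) with hf
  set g := fun w => ‖fderiv ℝ u (ψ w)‖ₑ * ‖G w‖ₑ with hg
  have hdu : Measurable fun p => ‖fderiv ℝ u p‖ₑ := (huc.continuous_fderiv one_ne_zero).enorm.measurable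
  have hPI : PI f g := ⟨huc.continuous.comp h2.1, fun a r hr => Qa h2 huc a hr⟩
  have hgm : AEMeasurable g volume := (hdu.comp h2.1.measurable).aemeasurable.mul
    h2.2.1.aestronglyMeasurable.enorm
  have hgi : ∫⁻ w, g w ^ n ≤ K * (c₀ * (m : ENNReal)⁻¹) := by
    simp only [hg, mul_pow]
    exact (hq.cv (hdu.pow_const n)).trans (mul_le_mul_right hui _)
  have key : ∀ r T S, 0 < r → r ≤ 52 * L → (∀ t ∈ Icc T (T + L), ∃ a ∈ S, dist a (φ x) = t) →
      ¬ ∀ a ∈ S, κ * volume (ball a r) ≤ DD f a r := fun r T S hr hr' hS ha => by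
    have := hcap f g hPI hgm r L T (φ x) S hr hS ha
    refine absurd this (not_le.2 ?_)
    calc C * ofReal r * ∫⁻ w, g w ^ n ≤ C * ofReal (52 * L) * (K * (c₀ * (m : ENNReal)⁻¹)) := by
          gcongr
      _ = 52 * C * K * c₀ * ((m : ENNReal)⁻¹ * ofReal L) := by
          rw [ofReal_mul (by norm_num), ofReal_ofNat]; ring
      _ < m * ((m : ENNReal)⁻¹ * ofReal L) := by
          have : ofReal L ≠ 0 := by simpa using hL0
          refine ENNReal.mul_lt_mul_left (mul_ne_zero sm this) (mul_ne_top (by simpa using hm0) sm) hm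
      _ = _ := by rw [← mul_assoc, ENNReal.mul_inv_cancel (by exact_mod_cast hm0) sm, one_mul]
  have hSE : ∀ t ∈ Icc 0 (0 + L), ∃ a ∈ {q | dist q (φ x) ≤ L ∧ f q = 1}, dist a (φ x) = t := fun t ht => by
    have hc : Continuous fun s : ℝ => dist (φ (x + s • (y - x))) (φ x) := by fun_prop
    obtain ⟨s, hs, he⟩ := intermediate_value_Icc zero_le_one hc.continuousOn (show t ∈ _ by simpa using ht)
    refine ⟨_, ⟨he.trans_le (by simpa using ht.2), ?_⟩, he⟩
    simp only [hf, h4]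
    refine hu1 _ ?_
    rw [dist_eq_norm, add_sub_cancel_left, norm_smul, dist_eq_norm, norm_of_nonneg hs.1]
    exact mul_le_of_le_one_left (norm_nonneg _) hs.2
  have hSF : ∀ t ∈ Icc (24 * L) (24 * L + L), ∃ a ∈ {q | dist q (φ x) ≤ 25 * L ∧ f q = 0}, dist a (φ x) = t := fun t ht => by
    have hc : Continuous fun s : ℝ => dist (φ (x + (1 + s) • (z - x))) (φ x) := by fun_prop
    obtain ⟨R, hR⟩ := (isBounded_iff_subset_closedBall x).1 ((isCompact_closedBall (φ x) (25 * L)).image h2.1).isBounded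
    have hd : ∀ s : ℝ, 0 ≤ s → dist (x + (1 + s) • (z - x)) x = (1 + s) * dist z x := fun s hs => by
      rw [dist_eq_norm, add_sub_cancel_left, norm_smul, dist_eq_norm, norm_of_nonneg pv]
    have hs0 : 0 ≤ |R| / dist z x := by positivity
    obtain ⟨s, hs, he⟩ := intermediate_value_Icc hs0 hc.continuousOn (show t ∈ _ by
      refine ⟨by simpa using hlt.le.trans ht.1, ht.2.trans (not_lt.1 fun hh => ?_)⟩
      have h6 : dist (ψ _) x ≤ R := hR (mem_image_of_mem ψ (mem_closedBall.2 (hh.le.trans (by linarith))))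
      rw [h4, hd _ hs0, add_mul, div_mul_cancel₀ _ hz0.ne'] at h6
      linarith [le_abs_self R])
    refine ⟨_, ⟨he.trans_le (by linarith [ht.2]), ?_⟩, he⟩
    simp only [hf, h4]
    refine hu0 _ (h.trans ?_)
    rw [hd _ hs.1]; nlinarith [hs.1]
  have hE := key (52 * L) _ _ pv le_rfl hSE
  have hF := key (26 * L) _ _ pv (by linarith) hSF
  push Not at hE hF
  obtain ⟨a, ⟨ha1, ha2⟩, ha⟩ := hE
  obtain ⟨b, ⟨hb1, hb2⟩, hb⟩ := hF
  have ht := two_pt hPI.1 (show dist b a ≤ 26 * L from (dist_triangle_right _ _ (φ x)).trans (by linarith))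
  rw [ha2, hb2, show 2 * (26 * L) = 52 * L by ring] at ht
  refine absurd ht (not_le.2 ?_)
  calc _ < κ * volume (ball b (26 * L)) + κ * volume (ball a (52 * L)) := ENNReal.add_lt_add hb ha
    _ = κ * (2 ^ n + 1) * volume (ball b (26 * L)) := by
      rw [vol_ball b pv, vol_ball a pv, show (52 * L) ^ n = 2 ^ n * (26 * L) ^ n by rw [← mul_pow]; ring,
        ofReal_mul pv, ofReal_pow zero_le_two, ofReal_ofNat]; ring
    _ = _ := by rw [hκd, ENNReal.inv_mul_cancel pv (by finiteness)]; simp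
theorem Step (hn : 2 ≤ n) {K : ENNReal} (hK : K ≠ ⊤) : ∃ θ D : ENNReal, θ ≠ 0 ∧ θ ≤ 1 ∧ D ≠ ⊤ ∧ ∀ φ ψ G H,
    Qp (n := n) K φ ψ G → Qp K ψ φ H → ∀ y R, 0 < R → ∀ E, MeasurableSet E →
      volume (E ∩ ball y R) ≤ θ * volume (ball y R) →
      volume (φ ⁻¹' closedBall y (5 * R)) ≤ D * volume (φ ⁻¹' (ball y R \ E)) := by
  obtain ⟨C, hC, hQ⟩ := Qs hn hK
  obtain ⟨ε, hε, hεC, hε1⟩ : ∃ ε : ℝ, 0 < ε ∧ C * ε ≤ 1 ∧ ε ≤ 1 := ⟨min C⁻¹ 1, by positivity,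
    (mul_le_mul_of_nonneg_left (min_le_left _ _) hC.le).trans (mul_inv_cancel₀ hC.ne').le, min_le_right _ _⟩
  set e := ofReal ε
  have he : e ≠ 0 := by simpa [e] using hε
  have het : e ≠ ⊤ := ofReal_ne_top
  set c := ofReal C
  have hc : c ≠ 0 := by simpa [c] using hC
  have hct : c ≠ ⊤ := ofReal_ne_top
  have ho := om_pos n
  have hot := om_top n
  obtain ⟨A, hA⟩ : ∃ A : ENNReal, A = (e ^ n) ^ 2 * om n * (2 * 4 ^ (n + 1))⁻¹ / 2 := ⟨_, rfl⟩
  have h4 : (2 * 4 ^ (n + 1) : ENNReal) ≠ 0 := by positivity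
  have h4t : (2 * 4 ^ (n + 1) : ENNReal) ≠ ⊤ := by finiteness
  have hA0 : A ^ n ≠ 0 := by
    refine pow_ne_zero _ ?_; rw [hA]
    simp [he, ho, h4t, h4, mul_eq_top]
  have hAt : A ≠ ⊤ := by
    rw [hA]; exact div_ne_top (mul_ne_top (mul_ne_top (by finiteness) hot) (inv_ne_top.2 h4)) two_ne_zero
  obtain ⟨P, hP⟩ : ∃ P : ENNReal, P = (4 ^ n * om n) ^ (n - 1) := ⟨_, rfl⟩
  have hPt : P ≠ ⊤ := by rw [hP]; finiteness
  set Q := (K + 1) * c ^ n * om n * P with hQd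
  have hQt : Q ≠ ⊤ := by finiteness
  refine ⟨min 1 (A ^ n / Q), (A ^ n)⁻¹ * (K * P) * (c ^ n * om n), ?_, min_le_left _ _, ?_, ?_⟩
  · simp only [ne_eq, min_eq_iff, not_or]
    simp [hA0, hQt]
  · exact mul_ne_top (mul_ne_top (inv_ne_top.2 hA0) (by finiteness)) (by finiteness)
  intro φ ψ G H hq hq' y R hR E hE hθ
  have hn0 : n ≠ 0 := by omega
  obtain ⟨h1, h2, h3, hψφ, h5⟩ := id hq
  obtain ⟨d, hd, rfl⟩ : ∃ d : ℝ, 0 < d ∧ R = 4 * d := ⟨R / 4, by positivity, by ring⟩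
  set X := ofReal d
  have hX : X ≠ 0 := by simpa [X] using hd
  have hXt : X ≠ ⊤ := ofReal_ne_top
  obtain ⟨w, hw⟩ : ∃ w : En n, dist w y = d := ⟨y + d • single (⟨0, by omega⟩ : Fin n) (1 : ℝ), by
    simp [norm_smul, abs_of_pos hd]⟩
  set l := dist (ψ w) (ψ y) with hl
  set q := ofReal l
  obtain ⟨p, hp2, hqp⟩ : ∃ p, p = ofReal (l / 2) ∧ q = 2 * p := ⟨_, rfl, by
    rw [← ofReal_ofNat, ← ofReal_mul (by norm_num), mul_div_cancel₀ l two_ne_zero]⟩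
  have hV : volume (ball y (4 * d)) = 4 ^ n * X ^ n * om n := by
    rw [vol_ball y hR, mul_pow, ofReal_mul pv, ofReal_pow hd.le, ofReal_pow (by norm_num), ofReal_ofNat]
  have hV1 : volume (ball y (4 * d)) ^ (n - 1) = P * (X ^ (n - 1)) ^ n := by
    rw [hV, hP, mul_right_comm, mul_pow _ (X ^ n), ← pow_mul X, ← pow_mul X, mul_comm n]
  have hI : A * (q * X ^ (n - 1)) + A * (q * X ^ (n - 1)) ≤ ∫⁻ x in ball y (4 * d), ‖G x‖ₑ := by
    have hp := h2.pi.2 y (2 * d) pv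
    rw [show 2 * (2 * d) = 4 * d by ring] at hp
    have hb : ∀ z z', dist z z' = d → ∀ a ∈ ball z (ε * d), 24 * dist (ψ a) (ψ z) ≤ dist (ψ z') (ψ z) := fun z z' hz a ha =>
      hQ ψ φ H hq' z a z' (by
        rw [dist_comm z', hz]
        calc C * dist a z ≤ C * (ε * d) := by gcongr; exact (mem_ball.1 ha).le
          _ ≤ d := by rw [← mul_assoc]; exact mul_le_of_le_one_left hd.le hεC)
    have hlow : ∀ a ∈ ball y (ε * d), ∀ b ∈ ball w (ε * d), p ≤ ‖ψ a - ψ b‖ₑ := fun a ha b hb' => by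
      have k1 := hb y w (by rw [dist_comm]; exact hw) a ha
      have k2 := hb w y hw b hb'
      rw [dist_comm (ψ y)] at k2
      rw [← ofReal_norm_eq_enorm, ← dist_eq_norm, hp2]
      apply ofReal_le_ofReal
      have := dist_triangle4 (ψ w) (ψ b) (ψ a) (ψ y)
      rw [dist_comm (ψ w) (ψ b), dist_comm (ψ b) (ψ a)] at this
      linarith [hl, dist_nonneg (x := ψ w) (y := ψ y)]
    have hed : ε * d ≤ d := mul_le_of_le_one_left hd.le hε1
    have hs1 : ball y (ε * d) ⊆ ball y (2 * d) := ball_subset_ball (by linarith)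
    have hs2 : ball w (ε * d) ⊆ ball y (2 * d) := ball_subset_ball' (by linarith)
    have hvb : ∀ z, volume (ball z (ε * d)) = e ^ n * X ^ n * om n := fun z => by
      rw [vol_ball z pv, mul_pow, ofReal_mul pv, ofReal_pow hd.le, ofReal_pow hε.le]
    have h7 : p * (e ^ n * X ^ n * om n) * (e ^ n * X ^ n * om n) ≤ ∫⁻ a in ball y (2 * d), ∫⁻ b in ball y (2 * d), ‖ψ a - ψ b‖ₑ := by
      calc _ = ∫⁻ a in ball y (ε * d), ∫⁻ b in ball w (ε * d), p := by simp only [setLIntegral_const, hvb]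
        _ ≤ ∫⁻ a in ball y (ε * d), ∫⁻ b in ball w (ε * d), ‖ψ a - ψ b‖ₑ :=
          setLIntegral_mono' measurableSet_ball fun a ha => setLIntegral_mono' measurableSet_ball fun b hb => hlow a ha b hb
        _ ≤ _ := (lintegral_mono_set hs1).trans (lintegral_mono fun a => lintegral_mono_set hs2)
    have h8 := h7.trans hp
    obtain ⟨k, rfl⟩ : ∃ k, n = k + 1 := ⟨n - 1, by omega⟩
    simp only [Nat.add_sub_cancel] at hV1 hP ⊢
    set I := ∫⁻ x in ball y (4 * d), ‖G x‖ₑ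
    have h9 : X ^ (k + 2) * om (k + 1) * ((e ^ (k + 1)) ^ 2 * om (k + 1) * (q * X ^ k)) ≤
        X ^ (k + 2) * om (k + 1) * ((2 * 4 ^ (k + 1 + 1)) * I) := by
      calc _ = 2 * (p * (e ^ (k + 1) * X ^ (k + 1) * om (k + 1)) * (e ^ (k + 1) * X ^ (k + 1) * om (k + 1))) := by
            rw [hqp]; ring
        _ ≤ _ := mul_le_mul_right h8 2
        _ = _ := by
          rw [show (2 : ℝ) ^ (k + 1 + 1) * (2 * d) ^ (k + 1 + 1) = (4 * d) ^ (k + 2) by rw [← mul_pow]; ring,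
            ofReal_pow pv, ofReal_mul (by norm_num), ofReal_ofNat]; ring
    rw [ENNReal.mul_le_mul_iff_right pv (by finiteness)] at h9
    calc _ = (2 * 4 ^ (k + 1 + 1))⁻¹ * ((e ^ (k + 1)) ^ 2 * om (k + 1) * (q * X ^ k)) := by
          rw [← add_mul, hA, ENNReal.add_halves]; ring
      _ ≤ (2 * 4 ^ (k + 1 + 1))⁻¹ * ((2 * 4 ^ (k + 1 + 1)) * I) := mul_le_mul_right h9 _
      _ = I := by rw [← mul_assoc, ENNReal.inv_mul_cancel h4 h4t, one_mul]
  have hcb : volume (φ ⁻¹' closedBall y (5 * (4 * d))) ≤ c ^ n * q ^ n * om n := by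
    calc _ ≤ volume (closedBall (ψ y) (C * l)) := measure_mono fun z hz => by
          by_contra hh
          have := hQ φ ψ G hq (ψ y) (ψ w) z (not_le.1 hh).le
          rw [h3, h3, hw] at this
          linarith [show dist (φ z) y ≤ 5 * (4 * d) from hz]
      _ = _ := by
        rw [vol_cball _ pv, mul_pow, ofReal_mul pv, ofReal_pow hC.le, ofReal_pow dist_nonneg]
  have hGm : AEMeasurable (fun x => ‖G x‖ₑ) volume := h2.2.1.aestronglyMeasurable.enorm
  have hH : ∀ S, MeasurableSet S → (∫⁻ x in S, ‖G x‖ₑ) ^ n ≤ K * volume (φ ⁻¹' S) * volume S ^ (n - 1) := fun S hS => by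
    have := hold hn (μ := volume.restrict S) hGm.restrict
    rw [Measure.restrict_apply_univ] at this
    exact this.trans (mul_le_mul_left (h5 S hS) _)
  have hEb : MeasurableSet (E ∩ ball y (4 * d)) := hE.inter measurableSet_ball
  have h10 : ∫⁻ x in E ∩ ball y (4 * d), ‖G x‖ₑ ≤ A * (q * X ^ (n - 1)) := by
    refine (ENNReal.pow_le_pow_left_iff hn0).1 ((hH _ hEb).trans ?_)
    calc _ ≤ K * (c ^ n * q ^ n * om n) * (min 1 (A ^ n / Q) * volume (ball y (4 * d))) ^ (n - 1) := by
          gcongr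
          exact (measure_mono (preimage_mono (inter_subset_right.trans
            (ball_subset_closedBall.trans (closedBall_subset_closedBall (by linarith)))))).trans hcb
      _ ≤ (K + 1) * (c ^ n * q ^ n * om n) * (A ^ n / Q * (P * (X ^ (n - 1)) ^ n)) := by
          rw [mul_pow, hV1]
          gcongr
          · exact le_self_add
          · calc (min 1 (A ^ n / Q)) ^ (n - 1) ≤ min 1 (A ^ n / Q) := pow_le_of_le_one zero_le (min_le_left _ _) (by omega)
              _ ≤ _ := min_le_right _ _
      _ = A ^ n / Q * Q * (q * X ^ (n - 1)) ^ n := by rw [hQd, mul_pow]; ring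
      _ ≤ A ^ n * (q * X ^ (n - 1)) ^ n := mul_le_mul_left (by rw [mul_comm]; exact ENNReal.mul_div_le) _
      _ = _ := (mul_pow _ _ _).symm
  have h11 : A * (q * X ^ (n - 1)) ≤ ∫⁻ x in ball y (4 * d) \ E, ‖G x‖ₑ := by
    have h12 := hI.trans_eq (lintegral_inter_add_sdiff (fun x => ‖G x‖ₑ) (ball y (4 * d)) hE).symm
    rw [inter_comm] at h12
    exact ENNReal.le_of_add_le_add_left (mul_ne_top hAt (by finiteness)) (h12.trans (add_le_add_left h10 _))
  have h13 : A ^ n * q ^ n ≤ K * P * volume (φ ⁻¹' (ball y (4 * d) \ E)) := by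
    have h14 := (pow_le_pow_left₀ zero_le h11 n).trans (hH _ (measurableSet_ball.diff hE))
    have h15 := h14.trans (mul_le_mul_right (pow_le_pow_left₀ zero_le (measure_mono diff_subset) (n - 1)) _)
    rw [hV1] at h15
    refine (ENNReal.mul_le_mul_iff_left (c := (X ^ (n - 1)) ^ n) pv (by finiteness)).1 ?_
    calc _ = (A * (q * X ^ (n - 1))) ^ n := by ring
      _ ≤ _ := h15
      _ = _ := by ring
  calc _ ≤ c ^ n * q ^ n * om n := hcb
    _ = (A ^ n)⁻¹ * (A ^ n * q ^ n) * (c ^ n * om n) := by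
      rw [← mul_assoc (A ^ n)⁻¹, ENNReal.inv_mul_cancel hA0 (by finiteness)]; ring
    _ ≤ (A ^ n)⁻¹ * (K * P * volume (φ ⁻¹' (ball y (4 * d) \ E))) * (c ^ n * om n) := by gcongr
    _ = _ := by ring
section
variable {K : ENNReal} {φ ψ : En n → En n} {G H : En n → En n →L[ℝ] En n}
theorem Qp.img (h : Qp K φ ψ G) (A : Set (En n)) : φ ⁻¹' A = ψ '' A :=
  ((image_eq_preimage_of_inverse h.2.2.1 h.2.2.2.1) ▸ rfl)
theorem lusin (hn : 2 ≤ n) (hK : K ≠ ⊤) (h : Qp K φ ψ G) (h' : Qp K ψ φ H) {Z : Set (En n)} (hZ : MeasurableSet Z)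
    (h0 : volume Z = 0) : volume (φ ⁻¹' Z) = 0 := by
  obtain ⟨θ, D, hθ, -, -, hS⟩ := Step hn hK
  by_contra hP
  have hPm : MeasurableSet (φ ⁻¹' Z)ᶜ := (h.1.measurable hZ).compl
  have hd := Besicovitch.ae_tendsto_measure_inter_div_of_measurableSet (volume : Measure (En n)) hPm
  obtain ⟨x, hx, ht⟩ : ∃ x ∈ φ ⁻¹' Z, Tendsto (fun r => volume ((φ ⁻¹' Z)ᶜ ∩ closedBall x r) / volume (closedBall x r)) (𝓝[>] 0) (𝓝 ((φ ⁻¹' Z)ᶜ.indicator 1 x)) := by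
    by_contra! hh
    exact hP (measure_mono_null (fun x hx => hh x hx) (ae_iff.1 hd))
  rw [indicator_of_notMem (by simpa using hx)] at ht
  obtain ⟨r, hr, hr0⟩ := ((ht.eventually_lt_const (pos_iff_ne_zero.2 hθ)).and self_mem_nhdsWithin).exists
  replace hr0 : 0 < r := hr0
  have hv : volume ((φ ⁻¹' Z)ᶜ ∩ ball x r) ≤ θ * volume (ball x r) := by
    rw [vol_ball x hr0, ← vol_cball x hr0.le]
    refine (measure_mono (inter_subset_inter_right _ ball_subset_closedBall)).trans ?_
    exact (div_le_iff (measure_closedBall_pos _ _ hr0).ne' measure_closedBall_lt_top.ne).1 hr.le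
  have h1 := hS ψ φ H G h' h x r hr0 _ hPm hv
  have h2 : volume (ψ ⁻¹' (ball x r \ (φ ⁻¹' Z)ᶜ)) = 0 := measure_mono_null (fun z hz => by
    have := hz.2; simpa [h.2.2.1] using this) h0
  rw [h2, mul_zero, nonpos_iff_eq_zero] at h1
  refine (((isOpen_ball.preimage h'.1).measure_pos volume ⟨φ x, ?_⟩).ne' : volume (ψ ⁻¹' ball x (5 * r)) ≠ 0)
    (measure_mono_null (preimage_mono ball_subset_closedBall) h1)
  simp [h.2.2.2.1, hr0]
theorem Qp.cvm (hn : 2 ≤ n) (hK : K ≠ ⊤) (h : Qp K φ ψ G) (h' : Qp K ψ φ H) :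
    volume.map φ = volume.withDensity fun x => ofReal |(G x).det| := by
  obtain ⟨N, hN0, hNm, hN⟩ := area (by omega) h.2.1 (Function.LeftInverse.injective h.2.2.1)
  refine Measure.ext fun A hA => ?_
  rw [Measure.map_apply h.1.measurable hA, withDensity_apply _ hA,
    ← measure_diff_null (lusin hn hK h h' hNm hN0), ← preimage_diff, h.img, hN _ (hA.diff hNm) disjoint_sdiff_left,
    setLIntegral_congr (diff_null_ae_eq_self hN0)]
theorem IsQC.qp (hn : 2 ≤ n) {K : ℝ} (hK : 0 ≤ K) (h : IsQC n K ψ G) (hφ : Continuous φ) (h1 : ∀ x, φ (ψ x) = x)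
    (h2 : ∀ x, ψ (φ x) = x) : Qp (ofReal K) φ ψ G := by
  obtain ⟨-, hc, -, hm, hi, hw, hd⟩ := h
  have hW : WD ψ G := by
    refine ⟨hc, fun x => ⟨ball 0 (‖x‖ + 1), isOpen_ball.mem_nhds sm, ?_⟩, hw⟩
    refine Integrable.mono' (g := fun y => 1 + ‖G y‖ ^ n) (Integrable.add (integrableOn_const measure_ball_lt_top.ne) (hi (‖x‖ + 1))) hm.restrict (Eventually.of_forall fun y => ?_)
    rcases le_total ‖G y‖ 1 with h | h
    · exact h.trans (le_add_of_nonneg_right pv)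
    · exact (le_self_pow₀ h (by omega)).trans (le_add_of_nonneg_left zero_le_one)
  refine ⟨hφ, hW, h1, h2, fun A hA => ?_⟩
  obtain ⟨N, hN0, hNm, hN⟩ := area (by omega) hW (Function.LeftInverse.injective h1)
  rw [← setLIntegral_congr (diff_null_ae_eq_self (s := A) hN0)]
  calc _ ≤ ∫⁻ x in A \ N, ofReal K * ofReal |(G x).det| := lintegral_mono_ae (ae_restrict_of_ae (hd.mono fun x hx => by
        rw [← ofReal_norm_eq_enorm, ← ofReal_pow (norm_nonneg _), ← ofReal_mul hK]
        exact ofReal_le_ofReal (hx.trans (mul_le_mul_of_nonneg_left (le_abs_self _) hK))))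
    _ = ofReal K * volume (ψ '' (A \ N)) := by
      rw [lintegral_const_mul' _ _ ofReal_ne_top, hN _ (hA.diff hNm) disjoint_sdiff_left]
    _ ≤ _ := by
      gcongr
      rintro _ ⟨x, hx, rfl⟩
      simpa [h1] using hx.1
end
def St (θ D : ENNReal) (ν : Measure (En n)) : Prop := ∀ y R, 0 < R → ∀ E, MeasurableSet E →
  volume (E ∩ ball y R) ≤ θ * volume (ball y R) → ν (closedBall y (5 * R)) ≤ D * ν (ball y R \ E)
def EE (b : En n → ℝ) (c t : ℝ) : Set (En n) := {q | t < |b q - c|}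
theorem EE_open {b : En n → ℝ} (hb : Continuous b) (c t : ℝ) : IsOpen (EE b c t) :=
  isOpen_lt continuous_const (hb.sub continuous_const).abs
theorem osc1 {θ D : ENNReal} (hθ : θ ≠ 0) (hθ1 : θ ≤ 1) {ν : Measure (En n)} (hν : St θ D ν)
    {b : En n → ℝ} (hb : Continuous b) {l : ℝ} (hl : 0 ≤ l)
    (h : ∀ y r, 0 < r → ∃ c, volume (EE b c l ∩ ball y r) ≤ θ / 2 / 2 ^ n * volume (ball y r)) {R : ℝ} (hR : 0 < R)
    (x : En n) (s c t : ℝ) (hE : volume (EE b c (t + 2 * l) ∩ ball x s) ≤ θ / 2 * volume (ball x R)) :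
    (1 + D) * ν (EE b c (t + 2 * l) ∩ ball x s) ≤ D * ν (EE b c t ∩ ball x (s + R)) := by
  set E := EE b c (t + 2 * l) ∩ ball x s with hEd
  have hEo : IsOpen E := (EE_open hb c _).inter isOpen_ball
  set F := EE b c t ∩ ball x (s + R)
  have hF : IsOpen F := (EE_open hb c t).inter isOpen_ball
  have hEF : E ⊆ F := inter_subset_inter (fun q hq => lt_of_le_of_lt (by linarith) (show t + 2 * l < |b q - c| from hq)) (ball_subset_ball (by linarith))
  have hθt : θ ≠ ⊤ := ne_top_of_le_ne_top ENNReal.one_ne_top hθ1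
  have hr : ∀ y ∈ E, ∃ r : ℝ, 0 < r ∧ 2 * r ≤ R ∧ ν (closedBall y (5 * (2 * r))) ≤ D * ν (ball y (2 * r) ∩ (F \ E)) := by
    intro y hy
    have hex : ∃ j : ℕ, θ / 2 * volume (ball y (R / 2 ^ j)) < volume (E ∩ ball y (R / 2 ^ j)) := by
      obtain ⟨ρ, hρ, hs⟩ := Metric.isOpen_iff.1 hEo y hy
      obtain ⟨j, hj⟩ := exists_pow_lt_of_lt_one (show 0 < ρ / R by positivity) (show (1 / 2 : ℝ) < 1 by norm_num)
      have hj' : R / 2 ^ j ≤ ρ := by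
        rw [lt_div_iff₀ hR] at hj; rw [div_eq_mul_one_div, ← one_div_pow, mul_comm]; exact hj.le
      refine ⟨j, ?_⟩
      rw [inter_eq_self_of_subset_right ((ball_subset_ball hj').trans hs)]
      have h0 : volume (ball y (R / 2 ^ j)) ≠ 0 := (measure_ball_pos _ _ pv).ne'
      conv_rhs => rw [← one_mul (volume _)]
      exact ENNReal.mul_lt_mul_left h0 measure_ball_lt_top.ne ((ENNReal.half_lt_self hθ hθt).trans_le hθ1)
    classical
    have hj := find_spec hex
    have hj1 : Nat.find hex ≠ 0 := fun h0 => by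
      rw [h0, pow_zero, div_one] at hj
      rw [vol_ball y hR, ← vol_ball x hR] at hj
      exact absurd ((measure_mono inter_subset_left).trans hE) (not_le.2 hj)
    have hj2 := find_min hex (Nat.pred_lt hj1)
    obtain ⟨k, hk⟩ := Nat.exists_eq_succ_of_ne_zero hj1
    rw [hk, Nat.succ_eq_add_one, pow_succ] at hj
    rw [hk, Nat.pred_succ, not_lt] at hj2
    have hr : 0 < R / (2 ^ k * 2) := by positivity
    refine ⟨_, hr, ?_, ?_⟩
    · rw [← div_div, mul_div_cancel₀ _ two_ne_zero]; exact div_le_self hR.le (one_le_pow₀ one_le_two)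
    rw [show R / 2 ^ k = 2 * (R / (2 ^ k * 2)) by rw [← div_div, mul_div_cancel₀ _ two_ne_zero]] at hj2
    have hrR : 2 * (R / (2 ^ k * 2)) ≤ R := by
      rw [← div_div, mul_div_cancel₀ _ two_ne_zero]; exact div_le_self hR.le (one_le_pow₀ one_le_two)
    set r := R / (2 ^ k * 2)
    obtain ⟨c', hc'⟩ := h y (2 * r) pv
    have hv : θ / 2 / 2 ^ n * volume (ball y (2 * r)) = θ / 2 * volume (ball y r) := by
      rw [vol_ball y pv, vol_ball y hr, mul_pow, ofReal_mul pv, ofReal_pow zero_le_two,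
        ofReal_ofNat, ← mul_assoc, ← mul_assoc, ENNReal.div_mul_cancel pv (by finiteness), mul_assoc]
    obtain ⟨p, hp, hp'⟩ : ∃ p ∈ E ∩ ball y r, p ∉ EE b c' l := by
      by_contra! hh
      have hs : E ∩ ball y r ⊆ EE b c' l ∩ ball y (2 * r) := fun p hp => ⟨hh p hp, ball_subset_ball (by linarith) hp.2⟩
      exact absurd (hj.trans_le (measure_mono hs)) (not_lt.2 (hc'.trans_eq hv))
    have hp1 : t + 2 * l < |b p - c| := hp.1.1
    have hp2 : |b p - c'| ≤ l := not_lt.1 hp'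
    refine (hν y (2 * r) pv (E ∪ EE b c' l) (hEo.union (EE_open hb _ _)).measurableSet ?_).trans ?_
    · rw [union_inter_distrib_right]
      have h9 : θ / 2 / 2 ^ n ≤ θ / 2 := ENNReal.div_le_of_le_mul' (le_mul_of_one_le_left zero_le (one_le_pow₀ one_le_two))
      refine (measure_union_le _ _).trans ((add_le_add hj2 (hc'.trans (mul_le_mul_left h9 _))).trans_eq ?_)
      rw [← add_mul, ENNReal.add_halves]
    · gcongr
      rintro q ⟨hq1, hq2⟩
      rw [mem_union, not_or] at hq2
      refine ⟨hq1, ⟨?_, ?_⟩, hq2.1⟩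
      · have h3 : |b q - c'| ≤ l := not_lt.1 hq2.2
        change t < |b q - c|
        have h4 : |b p - c| ≤ |b p - c'| + |b q - c'| + |b q - c| := by
          calc _ = |(b p - c') - (b q - c') + (b q - c)| := by ring_nf
            _ ≤ _ := (abs_add_le _ _).trans (add_le_add_left (abs_sub _ _) _)
        linarith
      · have := hy.2; rw [mem_ball] at this hq1 ⊢
        linarith [dist_triangle q y x]
  choose! r hr0 hrR hrν using hr
  obtain ⟨u, huE, huc, hud, hcov⟩ := vitali5 E (fun y => 2 * r y) R (fun y hy => mul_pos two_pos (hr0 y hy)) hrR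
  have := huc.to_subtype
  have hm : MeasurableSet (F \ E) := hF.measurableSet.diff hEo.measurableSet
  have h1 : ν E ≤ D * ν (F \ E) := by
    calc ν E ≤ ∑' y : u, ν (closedBall (y : En n) (5 * (2 * r y))) := by
          refine (measure_mono fun a ha => ?_).trans (measure_iUnion_le _)
          obtain ⟨y, hy, hay⟩ := hcov a ha
          exact mem_iUnion.2 ⟨⟨y, hy⟩, hay (mem_closedBall_self (mul_pos two_pos (hr0 a ha)).le)⟩
      _ ≤ ∑' y : u, D * ν (closedBall (y : En n) (2 * r y) ∩ (F \ E)) := tsum_le_tsum fun y =>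
          (hrν y (huE y.2)).trans (mul_le_mul_right (measure_mono (inter_subset_inter_left _ ball_subset_closedBall)) _)
      _ = D * ν (⋃ y : u, closedBall (y : En n) (2 * r y) ∩ (F \ E)) := by
          rw [ENNReal.tsum_mul_left, measure_iUnion _ fun y => measurableSet_closedBall.inter hm]
          exact fun y z hyz => (hud y.2 z.2 fun h => hyz (Subtype.ext h)).mono inter_subset_left inter_subset_left
      _ ≤ _ := mul_le_mul_right (measure_mono (iUnion_subset fun y => inter_subset_right)) _
  calc _ = ν E + D * ν E := by ring
    _ ≤ D * ν (F \ E) + D * ν E := add_le_add_left h1 _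
    _ = D * ν F := by rw [← mul_add, measure_sdiff_add_inter F hEo.measurableSet |>.symm, inter_eq_self_of_subset_right hEF]
theorem osc2 (hn : n ≠ 0) {θ D M : ENNReal} (hθ : θ ≠ 0) (hθ1 : θ ≤ 1) (hD : D ≠ ⊤) (hM : M ≠ ⊤) :
    ∃ C : ENNReal, C ≠ ⊤ ∧ ∀ (ν : Measure (En n)) (b : En n → ℝ), St θ D ν → Continuous b →
      (∀ x r, 0 < r → ∃ c : ℝ, ∫⁻ y in ball x r, ‖b y - c‖ₑ ^ 2 ≤ M * ofReal (r ^ n)) →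
      ∀ x r, 0 < r → ∃ c : ℝ, ∫⁻ y in ball x r, ‖b y - c‖ₑ ^ 2 ∂ν ≤ C * ν (ball x (2 * r)) := by
  have hθt : θ ≠ ⊤ := ne_top_of_le_ne_top ENNReal.one_ne_top hθ1
  have ho := om_pos n
  have hot := om_top n
  set A := θ / 2 * om n with hA
  have hA0 : A ≠ 0 := mul_ne_zero (ENNReal.div_ne_zero.2 ⟨hθ, by simp⟩) ho
  have hAt : A ≠ ⊤ := mul_ne_top (div_ne_top hθt two_ne_zero) hot
  obtain ⟨l, hl⟩ := ENNReal.exists_nat_gt (r := M * 2 ^ n / A) (div_ne_top (by finiteness) hA0)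
  have hl0 : l ≠ 0 := by rintro rfl; simp at hl
  have hl1 : M * 2 ^ n ≤ l * A := (div_le_iff hA0 hAt).1 hl.le
  have hl0' : (l : ENNReal) ≠ 0 := by exact_mod_cast hl0
  have hl2 : (1 : ENNReal) ≤ l := by exact_mod_cast one_le_iff_ne_zero.2 hl0
  have hγ : D / (1 + D) < 1 := by
    rw [ENNReal.div_lt_iff sm (by simp [hD]), one_mul, add_comm]; exact ENNReal.lt_add_right hD one_ne_zero
  obtain ⟨g, hg0, hg1, hg2⟩ := ENNReal.lt_iff_exists_real_btwn.1 hγ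
  have hg3 : g < 1 := by simpa using hg2
  have hgp : 0 < g := ENNReal.ofReal_pos.1 (bot_le.trans_lt hg1)
  let a : ℕ → ℝ := fun m => 3 * l * m ^ n
  have ha0 : ∀ m, 0 ≤ a m := fun m => by positivity
  refine ⟨∑' m : ℕ, ofReal (a (m + 1) ^ 2 * g ^ m), Summable.tsum_ofReal_ne_top ?_, fun ν b hν hb h x r hr => ?_⟩
  · have h1 := (summable_nat_add_iff 1).2 (summable_pow_mul_geometric_of_norm_lt_one (2 * n) (r := g) (by rwa [norm_of_nonneg hg0]))
    refine (h1.mul_left ((3 * l) ^ 2 * g⁻¹)).congr fun m => ?_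
    simp only [a]; push_cast; field_simp; ring
  have hch : ∀ (N : ℕ) y r c, ∫⁻ q in ball y r, ‖b q - c‖ₑ ^ 2 ≤ M * ofReal (r ^ n) →
      (l * N : ENNReal) ^ 2 * volume (EE b c (l * N) ∩ ball y r) ≤ M * ofReal (r ^ n) := fun N y r c hc => by
    refine le_trans ?_ ((mul_meas_ge_le_lintegral ((hb.sub continuous_const).enorm.measurable.pow_const 2) ((l * N : ENNReal) ^ 2)).trans hc)
    rw [← Measure.restrict_apply (EE_open hb c _).measurableSet]
    gcongr
    intro q hq
    replace hq : (l * N : ℝ) < |b q - c| := hq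
    change _ ≤ ‖b q - c‖ₑ ^ 2
    gcongr
    rw [enorm_eq_ofReal_abs]
    exact le_trans (by simp [ofReal_mul]) (ofReal_le_ofReal hq.le)
  have hb1 : ∀ y r, 0 < r → ∃ c, volume (EE b c l ∩ ball y r) ≤ θ / 2 / 2 ^ n * volume (ball y r) := fun y r hr => by
    obtain ⟨c, hc⟩ := h y r hr
    refine ⟨c, ?_⟩
    have h1 := hch 1 y r c hc
    simp only [Nat.cast_one, mul_one] at h1
    set V := volume (EE b c l ∩ ball y r)
    have h2 : 2 ^ n * V ≤ A * ofReal (r ^ n) := by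
      refine (ENNReal.mul_le_mul_iff_right hl0' sm).1 ?_
      calc (l : ENNReal) * (2 ^ n * V) ≤ l * (l * (2 ^ n * V)) := le_mul_of_one_le_left zero_le hl2
        _ = 2 ^ n * (l ^ 2 * V) := by ring
        _ ≤ 2 ^ n * (M * ofReal (r ^ n)) := mul_le_mul_right h1 _
        _ = M * 2 ^ n * ofReal (r ^ n) := by ring
        _ ≤ l * A * ofReal (r ^ n) := mul_le_mul_left hl1 _
        _ = _ := by ring
    calc V ≤ A * ofReal (r ^ n) / 2 ^ n := by
          rw [ENNReal.le_div_iff_mul_le sm sm, mul_comm]; exact h2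
      _ = _ := by rw [vol_ball y hr, hA]; simp only [div_eq_mul_inv]; ring
  obtain ⟨c, hc⟩ := h x (2 * r) pv
  have hit : ∀ (R : ℝ), 0 < R → ∀ (t : ℝ) (j : ℕ) (s : ℝ), volume (EE b c t ∩ ball x (s + j * R)) ≤ θ / 2 * volume (ball x R) →
      ν (EE b c (t + 2 * j * l) ∩ ball x s) ≤ ofReal g ^ j * ν (ball x (s + j * R)) := fun R hR t j => by
    induction j with
    | zero => intro s _; simp only [Nat.cast_zero, zero_mul, add_zero, pow_zero, one_mul]; exact measure_mono inter_subset_right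
    | succ j ih =>
      intro s hs
      have e : s + (j + 1 : ℕ) * R = s + R + j * R := by push_cast; ring
      rw [e] at hs ⊢
      have hl' : (0 : ℝ) ≤ l := by positivity
      have h1 := osc1 hθ hθ1 hν hb hl' hb1 hR x s c (t + 2 * j * l) (le_trans (measure_mono (inter_subset_inter
        (fun q hq => lt_of_le_of_lt (by nlinarith [show (0 : ℝ) ≤ j * l by positivity]) (show t + 2 * j * l + 2 * l < |b q - c| from hq)) (ball_subset_ball (by nlinarith [show (0 : ℝ) ≤ j * R by positivity])))) hs)
      rw [show t + 2 * j * l + 2 * (l : ℝ) = t + 2 * (j + 1 : ℕ) * l by push_cast; ring] at h1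
      calc _ ≤ D / (1 + D) * ν (EE b c (t + 2 * j * l) ∩ ball x (s + R)) := by
            rw [div_eq_mul_inv, mul_right_comm D, ← div_eq_mul_inv, ENNReal.le_div_iff_mul_le sm (by simp [hD]), mul_comm]; exact h1
        _ ≤ ofReal g * (ofReal g ^ j * ν (ball x (s + R + j * R))) := mul_le_mul' hg1.le (ih _ hs)
        _ = _ := by ring
  have hlev : ∀ m : ℕ, ν (EE b c (a m) ∩ ball x r) ≤ ofReal g ^ m * ν (ball x (2 * r)) := fun m => by
    rcases Nat.eq_zero_or_pos m with rfl | hm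
    · rw [pow_zero, one_mul]; exact measure_mono (inter_subset_right.trans (ball_subset_ball (by linarith)))
    have hm' : (0 : ℝ) < m := by exact_mod_cast hm
    have hm1 : (1 : ℝ) ≤ m := by exact_mod_cast hm
    have e : r + m * (r / m) = 2 * r := by rw [mul_div_cancel₀ _ hm'.ne']; ring
    have h1 := hit (r / m) pv (l * (m ^ n : ℕ)) m r (by
      rw [e]
      have h1 := hch (m ^ n) x (2 * r) c hc
      set V := volume (EE b c (l * (m ^ n : ℕ)) ∩ ball x (2 * r))
      have h2 : m ^ n * V ≤ A * ofReal (r ^ n) := by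
        refine (ENNReal.mul_le_mul_iff_right hl0' sm).1 ?_
        calc (l : ENNReal) * (m ^ n * V) ≤ (l * m ^ n) * (l * (m ^ n * V)) := le_mul_of_one_le_left zero_le
              (one_le_mul hl2 (one_le_pow₀ (by exact_mod_cast hm)))
          _ = (l * (m ^ n : ℕ)) ^ 2 * V := by push_cast; ring
          _ ≤ M * ofReal ((2 * r) ^ n) := h1
          _ = M * 2 ^ n * ofReal (r ^ n) := by
            rw [mul_pow, ofReal_mul pv, ofReal_pow zero_le_two, ofReal_ofNat]; ring
          _ ≤ l * A * ofReal (r ^ n) := mul_le_mul_left hl1 _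
          _ = _ := by ring
      calc V ≤ A * ofReal (r ^ n) / m ^ n := by
            rw [ENNReal.le_div_iff_mul_le (Or.inl (by simp; omega)) (Or.inl sm), mul_comm]; exact h2
        _ = _ := by
          rw [vol_ball x pv, hA, div_pow, ENNReal.ofReal_div_of_pos pv, ofReal_pow hm'.le, ofReal_natCast]
          simp only [div_eq_mul_inv]; ring)
    rw [e] at h1
    refine (measure_mono (inter_subset_inter_left _ fun q hq => lt_of_le_of_lt ?_ (show a m < |b q - c| from hq))).trans h1
    have : (m : ℝ) ≤ m ^ n := le_self_pow₀ hm1 hn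
    simp only [a]; push_cast; nlinarith [show (0 : ℝ) ≤ l by positivity]
  refine ⟨c, ?_⟩
  have hp : ∀ y, ‖b y - c‖ₑ ^ 2 ≤ ∑' m : ℕ, (EE b c (a m)).indicator (fun _ => ofReal (a (m + 1) ^ 2)) y := fun y => by
    rcases (abs_nonneg (b y - c)).eq_or_lt with h0 | h0
    · rw [enorm_eq_ofReal_abs, ← h0]; simp
    have hex : ∃ m, |b y - c| ≤ a m := by
      obtain ⟨m, hm⟩ := exists_nat_ge |b y - c|
      refine ⟨m + 1, hm.trans ?_⟩
      have h1 : (m + 1 : ℝ) ≤ (m + 1) ^ n := le_self_pow₀ (by linarith [m.cast_nonneg (α := ℝ)]) hn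
      have h2 : (1 : ℝ) ≤ l := by exact_mod_cast one_le_iff_ne_zero.2 hl0
      simp only [a]; push_cast; nlinarith
    classical
    have hm := find_spec hex
    obtain ⟨k, hk⟩ := Nat.exists_eq_succ_of_ne_zero (fun h1 : Nat.find hex = 0 => by
      rw [h1] at hm; simp [a, hn] at hm; rw [hm] at h0; simp at h0)
    have hk' := find_min hex (m := k) (by omega)
    rw [hk] at hm
    refine le_trans ?_ (ENNReal.le_tsum k)
    rw [indicator_of_mem (show y ∈ EE b c (a k) from not_le.1 hk'), enorm_eq_ofReal_abs, ← ofReal_pow (abs_nonneg _)]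
    exact ofReal_le_ofReal (pow_le_pow_left₀ (abs_nonneg _) hm 2)
  calc _ ≤ ∫⁻ y in ball x r, ∑' m : ℕ, (EE b c (a m)).indicator (fun _ => ofReal (a (m + 1) ^ 2)) y ∂ν := lintegral_mono hp
    _ = ∑' m : ℕ, ofReal (a (m + 1) ^ 2) * ν (EE b c (a m) ∩ ball x r) := by
      have hm := fun m => (EE_open hb c (a m)).measurableSet
      rw [lintegral_tsum fun m => (measurable_const.indicator (hm m)).aemeasurable]
      congr 1; ext m
      rw [lintegral_indicator (hm m), setLIntegral_const, Measure.restrict_apply (hm m)]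
    _ ≤ ∑' m : ℕ, ofReal (a (m + 1) ^ 2 * g ^ m) * ν (ball x (2 * r)) := tsum_le_tsum fun m => by
      rw [ofReal_mul pv, ofReal_pow hg0, mul_assoc]; exact mul_le_mul_right (hlev m) _
    _ = _ := ENNReal.tsum_mul_right
theorem brei (hn : 2 ≤ n) {K M : ENNReal} (hK : K ≠ ⊤) (hM : M ≠ ⊤) : ∃ C : ENNReal, C ≠ ⊤ ∧ ∀ φ ψ G H,
    Qp (n := n) K φ ψ G → Qp K ψ φ H → ∀ b : En n → ℝ, Continuous b →
      (∀ x r, 0 < r → ∃ c : ℝ, ∫⁻ y in ball x r, ‖b y - c‖ₑ ^ 2 ≤ M * ofReal (r ^ n)) →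
      ∀ x r, 0 < r → ∃ c : ℝ, ∫⁻ y in ball x r, ‖b (φ y) - c‖ₑ ^ 2 ≤ C * ofReal (r ^ n) := by
  obtain ⟨θ, D, hθ, hθ1, hD, hS⟩ := Step hn hK
  obtain ⟨C, hC, hO⟩ := osc2 (n := n) (by omega) hθ hθ1 hD hM
  obtain ⟨L, hL, hQ⟩ := Qs hn hK
  have hot := om_top n
  refine ⟨C * (ofReal ((L * L) ^ n) * om n), by finiteness, fun φ ψ G H h h' b hb hB x r hr => ?_⟩
  have hm := h.1.measurable
  obtain ⟨w, hw⟩ : ∃ w : En n, dist w x = L * r :=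
    ⟨x + (L * r) • single (⟨0, by omega⟩ : Fin n) (1 : ℝ), by simp [norm_smul, abs_of_pos, hL, hr]⟩
  have hR : 0 < dist (φ w) (φ x) := dist_pos.2 fun e => by
    have := Function.LeftInverse.injective h.2.2.2.1 e
    rw [this, dist_self] at hw
    nlinarith [mul_pos hL hr]
  have hSt : St θ D (volume.map φ) := fun y R hR' E hE hv => by
    rw [Measure.map_apply hm measurableSet_closedBall, Measure.map_apply hm (measurableSet_ball.diff hE)]
    exact hS φ ψ G H h h' y R hR' E hE hv
  obtain ⟨c, hc⟩ := hO _ b hSt hb hB (φ x) _ hR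
  refine ⟨c, ?_⟩
  calc _ ≤ ∫⁻ y in φ ⁻¹' ball (φ x) (dist (φ w) (φ x)), ‖b (φ y) - c‖ₑ ^ 2 := lintegral_mono_set fun y hy => by
        have := hQ φ ψ G h x y w (by rw [hw]; exact mul_le_mul_of_nonneg_left (mem_ball.1 hy).le hL.le)
        change dist (φ y) (φ x) < _
        linarith
    _ = ∫⁻ y in ball (φ x) (dist (φ w) (φ x)), ‖b y - c‖ₑ ^ 2 ∂(volume.map φ) := by
        exact (setLIntegral_map (f := fun y => ‖b y - c‖ₑ ^ 2) measurableSet_ball ((hb.sub continuous_const).enorm.measurable.pow_const 2) hm).symm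
    _ ≤ _ := hc
    _ ≤ C * volume (closedBall x (L * L * r)) := by
        rw [Measure.map_apply hm measurableSet_ball]
        refine mul_le_mul_right (measure_mono fun z hz => ?_) _
        replace hz : dist (φ z) (φ x) < _ := hz
        by_contra hz'
        have := hQ φ ψ G h x w z (by rw [hw, ← mul_assoc]; exact (not_le.1 hz').le)
        linarith
    _ = _ := by
        rw [vol_cball x pv, mul_pow, ofReal_mul pv]; ring
theorem dual1 (hn : 2 ≤ n) {K : ENNReal} (hK : K ≠ ⊤) : ∃ C : ENNReal, C ≠ ⊤ ∧ ∀ φ ψ G H,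
    Qp (n := n) K φ ψ G → Qp K ψ φ H → ∀ t > 0, ∀ g : En n → Vn n, Integrable g → (∀ x, ‖g x‖ ≤ 1) →
      ∀ h : En n → ℝ, Integrable h → ∫⁻ x, Fs h x ≠ ⊤ → ‖∫ x, h x * bb t g (φ x)‖ₑ ≤ C * ∫⁻ x, Fs h x := by
  obtain ⟨M, hM, h15⟩ := H15 hn
  obtain ⟨C1, hC1, h1⟩ := brei hn hK hM
  obtain ⟨C2, hC2, h2⟩ := H14 (n := n) (by omega)
  refine ⟨C2 * (C1 + 1), by finiteness, fun φ ψ G H q q' t ht g hg hg1 h hh hF => ?_⟩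
  have hbc := (bb_cont ht hg).comp q.1
  refine eps_le (X := ∫⁻ x, ‖h x‖ₑ) hh.2.ne fun δ hδ => ?_
  let η : ℝ → ℝ := fun s => s - max (-δ) (min δ s)
  have ηc : Continuous η := by fun_prop
  have ηl0 : ∀ s u, s ≤ u → |η s - η u| ≤ |s - u| := fun s u hs => by
    have h1 : max (-δ) (min δ s) ≤ max (-δ) (min δ u) := by gcongr
    have h2 : max (-δ) (min δ u) ≤ max (-δ) (min δ s) + (u - s) := by
      rw [max_add, min_add]; exact max_le_max (by linarith) (min_le_min (by linarith) (by linarith))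
    rw [abs_of_nonpos (sub_nonpos.2 hs), abs_le]
    constructor <;> simp only [η] <;> linarith
  have ηl : ∀ s u, |η s - η u| ≤ |s - u| := fun s u => (le_total s u).elim (ηl0 s u) fun hs => by
    rw [abs_sub_comm, abs_sub_comm s]; exact ηl0 u s hs
  have ηb : ∀ s, |s - η s| ≤ δ := fun s => by
    simp only [η, sub_sub_cancel]
    exact abs_le.2 ⟨le_max_left _ _, max_le (by linarith) (min_le_left _ _)⟩
  have η0 : ∀ s, |s| ≤ δ → η s = 0 := fun s hs => by
    obtain ⟨a, b⟩ := abs_le.1 hs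
    simp [η, a, b]
  let β : En n → ℝ := fun x => η (bb t g (φ x))
  have βc : Continuous β := ηc.comp hbc
  have φh : Tendsto φ (cocompact (En n)) (cocompact (En n)) := by
    let e : En n ≃ₜ En n := ⟨⟨φ, ψ, q.2.2.2.1, q.2.2.1⟩, q.1, q.2.1.1⟩
    exact e.isClosedEmbedding.tendsto_cocompact
  have βs : HasCompactSupport β := by
    have := ((bb_zero (by omega) ht hg).comp φh).eventually (Metric.closedBall_mem_nhds 0 hδ)
    obtain ⟨S, hS, hS'⟩ := mem_cocompact.1 this
    exact HasCompactSupport.intro hS fun x hx => η0 _ (by have := hS' hx; simpa using this)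
  have βm : Bm (C1 + 1) β := fun x r hr => by
    obtain ⟨c, hc⟩ := h1 φ ψ G H q q' (bb t g) (bb_cont ht hg) (h15 t ht g hg hg1) x r hr
    refine ⟨η c, (lintegral_mono fun y => ?_).trans (hc.trans (mul_le_mul_left ?_ _))⟩
    · refine pow_le_pow_left' ?_ 2
      rw [enorm_eq_ofReal_abs, enorm_eq_ofReal_abs]
      exact ofReal_le_ofReal (ηl _ _)
    · calc C1 ≤ C1 + 1 := le_self_add
        _ ≤ _ := le_self_pow₀ le_add_self two_ne_zero
  have h3 := h2 (C1 + 1) h β sm (by finiteness) βm βc βs hh hF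
  obtain ⟨B, hB⟩ : ∃ B : ℝ, ∀ y, ‖bb t g y‖ ≤ B := ⟨_, fun y => bb_bd ht hg y⟩
  have i1 : Integrable fun x => h x * bb t g (φ x) := hh.mul_bdd (c := B) hbc.aestronglyMeasurable (ae_of_all _ fun x => hB _)
  have i2 : Integrable fun x => h x * (bb t g (φ x) - β x) := hh.mul_bdd (c := δ) (hbc.sub βc).aestronglyMeasurable (ae_of_all _ fun x => ηb _)
  have e : ∫ x, h x * bb t g (φ x) = (∫ x, h x * β x) + ∫ x, h x * (bb t g (φ x) - β x) := by
    rw [← sub_eq_iff_eq_add, ← integral_sub i1 i2]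
    congr 1; ext x; ring
  rw [e]
  refine (enorm_add_le _ _).trans (add_le_add h3 ((enorm_integral_le_lintegral_enorm _).trans ?_))
  rw [← lintegral_const_mul' _ _ (by finiteness)]
  refine lintegral_mono fun x => ?_
  rw [enorm_mul, mul_comm]
  refine mul_le_mul_left ?_ _
  rw [enorm_eq_ofReal_abs]
  exact ofReal_le_ofReal (ηb _)
theorem cvi (hn : 2 ≤ n) {K : ENNReal} (hK : K ≠ ⊤) {φ ψ : En n → En n} {G H : En n → En n →L[ℝ] En n} (q : Qp K φ ψ G) (q' : Qp K ψ φ H)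
    (hG : ∀ᵐ x, 0 ≤ (G x).det) (hGm : AEMeasurable fun x => (G x).det) (f : En n → ℝ) :
    (Integrable (fun x => f x * (G x).det) ↔ Integrable fun x => f (φ x)) ∧ ∫ x, f x * (G x).det = ∫ x, f (φ x) := by
  let e : En n ≃ₜ En n := ⟨⟨φ, ψ, q.2.2.2.1, q.2.2.1⟩, q.1, q.2.1.1⟩
  have he : MeasurableEmbedding φ := e.measurableEmbedding
  have hm : AEMeasurable (fun x => ofReal |(G x).det|) := hGm.abs.ennreal_ofReal
  have hl : ∀ᵐ x, ofReal |(G x).det| < ⊤ := ae_of_all _ fun x => ofReal_lt_top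
  have hc : (fun x => (ofReal |(G x).det|).toReal • f x) =ᵐ[volume] fun x => f x * (G x).det := by
    filter_upwards [hG] with x hx
    rw [ENNReal.toReal_ofReal (abs_nonneg _), abs_of_nonneg hx, smul_eq_mul, mul_comm]
  constructor
  · rw [← integrable_congr hc, ← integrable_withDensity_iff_integrable_smul₀' hm hl, ← q.cvm hn hK q', he.integrable_map_iff]
    rfl
  · rw [← integral_congr_ae hc, ← integral_withDensity_eq_integral_toReal_smul₀ hm hl, ← q.cvm hn hK q', he.integral_map]
theorem tr1 (hn : 2 ≤ n) {K : ENNReal} (hK : K ≠ ⊤) : ∃ C : ENNReal, C ≠ ⊤ ∧ ∀ φ ψ G H,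
    Qp (n := n) K φ ψ G → Qp K ψ φ H → (∀ᵐ x, 0 ≤ (G x).det) → (AEMeasurable fun x => (G x).det) →
      ∀ h : En n → ℝ, Integrable h → ∫⁻ x, Fs h x ≠ ⊤ → ∀ t > 0,
        ∫⁻ x, ‖Fp (fun x => h (ψ x) * (G x).det) (pt x t)‖ₑ ≤ C * ∫⁻ x, Fs h x := by
  obtain ⟨C, hC, hd⟩ := dual1 hn hK
  refine ⟨C, hC, fun φ ψ G H q q' hG hGm h hh hF t ht => ?_⟩
  have hcv := cvi hn hK q q' hG hGm
  have hT : Integrable fun x => h (ψ x) * (G x).det := (hcv fun x => h (ψ x)).1.2 (by simpa only [q.2.2.2.1] using hh)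
  set T : En n → ℝ := fun x => h (ψ x) * (G x).det with hTd
  have Fc := Ft_cont hT ht
  set F : En n → Vn n := fun x => Fp T (pt x t)
  have key : ∀ k : ℕ, ∫⁻ x in ball 0 (k : ℝ), ‖F x‖ₑ ≤ C * ∫⁻ x, Fs h x := fun k => by
    let g : En n → Vn n := (ball 0 (k : ℝ)).indicator fun x => (‖F x‖)⁻¹ • F x
    have hg1 : ∀ x, ‖g x‖ ≤ 1 := fun x => by
      refine (norm_indicator_le_norm_self _ _).trans ?_
      rw [norm_smul, norm_inv, norm_norm]
      exact inv_mul_le_one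
    have hFi : IntegrableOn F (ball 0 (k : ℝ)) := (Fc.continuousOn.integrableOn_compact (isCompact_closedBall 0 (k : ℝ))).mono_set ball_subset_closedBall
    have hgi : Integrable g := by
      refine IntegrableOn.integrable_indicator (Integrable.mono' (g := fun _ => (1 : ℝ)) (integrableOn_const measure_ball_lt_top.ne) ?_ (ae_of_all _ fun x => ?_)) measurableSet_ball
      · exact ((Fc.norm.measurable.inv).smul Fc.measurable).aestronglyMeasurable
      · rw [norm_smul, norm_inv, norm_norm]; exact inv_mul_le_one
    have e1 : ∫ x, ⟪g x, F x⟫_ℝ = ∫ x in ball 0 (k : ℝ), ‖F x‖ := by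
      rw [← integral_indicator measurableSet_ball]
      congr 1; ext x
      by_cases hx : x ∈ ball (0 : En n) k
      · simp only [g, indicator_of_mem hx]
        rw [real_inner_smul_left, real_inner_self_eq_norm_sq]
        rcases eq_or_ne ‖F x‖ 0 with h0 | h0
        · simp [h0]
        · field_simp
      · simp only [g, indicator_of_notMem hx, inner_zero_left]
    have e2 : ∫ x, T x * bb t g x = ∫ x, h x * bb t g (φ x) := by
      have := (hcv fun x => h (ψ x) * bb t g x).2
      simp only [q.2.2.2.1] at this
      rw [← this]
      congr 1; ext x; simp only [hTd]; ring
    have e3 := hd φ ψ G H q q' t ht g hgi hg1 h hh hF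
    rw [← e2, ← bb_dual ht hgi hT, e1, enorm_of_nonneg (integral_nonneg fun x => norm_nonneg _), ofReal_integral_norm_eq_lintegral_enorm hFi] at e3
    exact e3
  rw [← setLIntegral_univ, ← iUnion_ball_nat (0 : En n), setLIntegral_iUnion_of_directed _ (Monotone.directed_le fun i j hij => ball_subset_ball (by exact_mod_cast hij))]
  exact iSup_le key
theorem tr2 (hn : 2 ≤ n) {K : ENNReal} (hK : K ≠ ⊤) : ∃ C : ENNReal, C ≠ ⊤ ∧ ∀ φ ψ G H,
    Qp (n := n) K φ ψ G → Qp K ψ φ H → (∀ᵐ x, 0 ≤ (G x).det) → (AEMeasurable fun x => (G x).det) →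
      ∀ h : En n → ℝ, Integrable h → ∫⁻ x, ‖F0 h x‖ₑ ≠ ⊤ →
        ∫⁻ x, ‖F0 (fun x => h (ψ x) * (G x).det) x‖ₑ ≤ C * ∫⁻ x, ‖F0 h x‖ₑ := by
  obtain ⟨C, hC, h1⟩ := tr1 hn hK
  obtain ⟨C', hC', h10⟩ := H10 hn
  refine ⟨C * C', by finiteness, fun φ ψ G H q q' hG hGm h hh hF => ?_⟩
  have h2 := h10 h hh
  have hcv := cvi hn hK q q' hG hGm
  have hT : Integrable fun x => h (ψ x) * (G x).det := (hcv fun x => h (ψ x)).1.2 (by simpa only [q.2.2.2.1] using hh)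
  have h3 := h1 φ ψ G H q q' hG hGm h hh (ne_top_of_le_ne_top (by finiteness) h2)
  rw [mul_assoc]
  refine le_trans ?_ (mul_le_mul_right h2 C)
  set T : En n → ℝ := fun x => h (ψ x) * (G x).det with hTd
  calc _ = ∫⁻ x, liminf (fun k : ℕ => ‖Fp T (pt x (1 / ((k : ℝ) + 1)))‖ₑ) atTop := lintegral_congr_ae <| by
        filter_upwards [H9 hn hT] with x hx
        refine (Tendsto.liminf_eq (Tendsto.enorm (hx.comp (tendsto_nhdsWithin_iff.2 ⟨tendsto_one_div_add_atTop_nhds_zero_nat, Eventually.of_forall fun k => ?_⟩)))).symm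
        change (0 : ℝ) < _; positivity
    _ ≤ _ := lintegral_liminf_le fun k => (Ft_cont hT pv).enorm.measurable
    _ ≤ _ := liminf_le_of_frequently_le' (Frequently.of_forall fun k => h3 _ pv)
theorem Qp.mono {K K' : ENNReal} {φ ψ : En n → En n} {G : En n → En n →L[ℝ] En n} (q : Qp K φ ψ G) (h : K ≤ K') : Qp K' φ ψ G :=
  ⟨q.1, q.2.1, q.2.2.1, q.2.2.2.1, fun A hA => (q.2.2.2.2 A hA).trans (mul_le_mul_left h _)⟩
theorem F0_le (hh : MemH1 n h) : ∫⁻ x, ‖F0 h x‖ₑ ≤ ofReal ((1 + cP n) * H1Norm n h) := by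
  have hc := cP_pos n
  have i : ∀ j ∈ (Finset.univ : Finset (Fin n)), Integrable fun x => |rieszTransform n h j x| := fun j _ => (hh.2 j).abs
  have p : ∀ x, ‖F0 h x‖ ≤ (1 + cP n) * (|h x| + ∑ j, |rieszTransform n h j x|) := fun x => by
    have h1 : ‖(toLp 2 fun j => rieszTransform n h j x : En n)‖ ≤ ∑ j, |rieszTransform n h j x| := by
      rw [EuclideanSpace.norm_eq, ← Real.sqrt_sq (sum_nonneg fun j _ => abs_nonneg (rieszTransform n h j x))]
      refine Real.sqrt_le_sqrt ?_
      simpa using Finset.sum_sq_le_sq_sum_of_nonneg (s := Finset.univ) (f := fun j => |rieszTransform n h j x|) fun j _ => abs_nonneg _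
    have h2 := norm_pt_le (toLp 2 fun j => rieszTransform n h j x : En n) (cP n * h x)
    rw [abs_mul, abs_of_pos hc] at h2
    have h3 := norm_nonneg (toLp 2 fun j => rieszTransform n h j x : En n)
    change ‖pt _ _‖ ≤ _
    nlinarith [abs_nonneg (h x)]
  have e : (1 + cP n) * H1Norm n h = ∫ x, (1 + cP n) * (|h x| + ∑ j, |rieszTransform n h j x|) := by
    rw [integral_const_mul, integral_add hh.1.abs (integrable_finset_sum _ i), integral_finset_sum _ i]; rfl
  rw [e, ofReal_integral_eq_lintegral_ofReal (f := fun x => (1 + cP n) * (|h x| + ∑ j, |rieszTransform n h j x|)) ((hh.1.abs.add (integrable_finset_sum _ i)).const_mul _) (ae_of_all _ fun x => by positivity)]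
  refine lintegral_mono fun x => ?_
  rw [← ofReal_norm_eq_enorm]
  exact ofReal_le_ofReal (p x)
theorem le_F0 (hn : 2 ≤ n) (hh : Integrable h) {B : ℝ} (hB : 0 ≤ B) (h1 : ∫⁻ x, ‖F0 h x‖ₑ ≤ ofReal B) :
    MemH1 n h ∧ H1Norm n h ≤ (∫ x, |h x|) + n * B := by
  have p : ∀ j x, ‖rieszTransform n h j x‖ₑ ≤ ‖F0 h x‖ₑ := fun j x => by
    rw [← ofReal_norm_eq_enorm, ← ofReal_norm_eq_enorm]
    refine ofReal_le_ofReal (le_trans ?_ (fst_le_norm _))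
    exact PiLp.norm_apply_le (F0 h x).fst j
  have p' : ∀ j, ∫⁻ x, ‖rieszTransform n h j x‖ₑ ≤ ofReal B := fun j => (lintegral_mono (p j)).trans h1
  have hi : ∀ j, Integrable (rieszTransform n h j) := fun j => ⟨by
      have : Continuous fun z : Vn n => z.fst j := (by fun_prop : Continuous fun v : En n => v j).comp cont_fst
      exact this.comp_aestronglyMeasurable (F0_aesm hn hh), (p' j).trans_lt ofReal_lt_top⟩
  refine ⟨⟨hh, hi⟩, add_le_add_right ?_ _⟩
  calc _ ≤ ∑ j : Fin n, B := sum_le_sum fun j _ => by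
        rw [← ofReal_le_ofReal_iff hB]
        exact (ofReal_integral_norm_eq_lintegral_enorm (hi j)).trans_le (p' j)
    _ = _ := by simp
theorem fin16 (n : ℕ) (hn : 2 ≤ n) (K : ℝ) (hK : 1 ≤ K) : ∃ C : ℝ, 0 < C ∧ ∀ (φ ψ : En n → En n) (Dφ Dψ : En n → En n →L[ℝ] En n),
    IsQC n K φ Dφ → IsQC n (K ^ (n - 1)) ψ Dψ → (∀ x, φ (ψ x) = x) → (∀ x, ψ (φ x) = x) → ∀ h : En n → ℝ, MemH1 n h →
      MemH1 n (fun x => h (ψ x) * (Dψ x).det) ∧ H1Norm n (fun x => h (ψ x) * (Dψ x).det) ≤ C * H1Norm n h := by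
  have hK' : ofReal (K ^ (n - 1)) ≠ ⊤ := by finiteness
  obtain ⟨C, hC, hT⟩ := tr2 hn hK'
  have hc := cP_pos n
  refine ⟨1 + n * (C.toReal * (1 + cP n)), by positivity, fun φ ψ Dφ Dψ q1 q2 e1 e2 h hh => ?_⟩
  have q := q2.qp hn pv q1.2.1 e1 e2
  have q' := (q1.qp hn pv q2.2.1 e2 e1).mono (ofReal_le_ofReal (le_self_pow₀ (n := n - 1) hK (by omega)))
  have hG : ∀ᵐ x, 0 ≤ (Dψ x).det := by
    filter_upwards [q2.2.2.2.2.2.2] with x hx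
    exact nonneg_of_mul_nonneg_right ((pow_nonneg (norm_nonneg _) n).trans hx) pv
  have hGm : AEMeasurable fun x => (Dψ x).det :=
    (ContinuousLinearMap.continuous_det.comp_aestronglyMeasurable q2.2.2.2.1).aemeasurable
  have hcv := cvi hn hK' q q' hG hGm
  have iT : Integrable fun x => h (ψ x) * (Dψ x).det := (hcv fun x => h (ψ x)).1.2 (by simpa only [e2] using hh.1)
  have eT : ∫ x, |h (ψ x) * (Dψ x).det| = ∫ x, |h x| := by
    have := (hcv fun x => |h (ψ x)|).2
    simp only [e2] at this
    rw [← this]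
    refine integral_congr_ae ?_
    filter_upwards [hG] with x hx
    rw [abs_mul, abs_of_nonneg hx]
  have hN : ∫ x, |h x| ≤ H1Norm n h := le_add_of_nonneg_right (sum_nonneg fun j _ => integral_nonneg fun x => abs_nonneg _)
  have hN0 : 0 ≤ H1Norm n h := (integral_nonneg fun x => abs_nonneg _).trans hN
  have hF := F0_le hh
  have h1 := (hT φ ψ Dψ Dφ q q' hG hGm h hh.1 (ne_top_of_le_ne_top ofReal_ne_top hF)).trans (mul_le_mul_right hF C)
  rw [← ofReal_toReal hC, ← ofReal_mul toReal_nonneg] at h1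
  obtain ⟨m, hm⟩ := le_F0 hn iT pv h1
  refine ⟨m, hm.trans ?_⟩
  rw [eT]
  nlinarith
end
end
theorem stmt16 (n : ℕ) (hn : 2 ≤ n) (K : ℝ) (hK : 1 ≤ K) :
    ∃ C : ℝ, 0 < C ∧
      ∀ (φ ψ : EuclideanSpace ℝ (Fin n) → EuclideanSpace ℝ (Fin n))
        (Dφ Dψ : EuclideanSpace ℝ (Fin n) →
          EuclideanSpace ℝ (Fin n) →L[ℝ] EuclideanSpace ℝ (Fin n)),
        IsQC n K φ Dφ → IsQC n (K ^ (n - 1)) ψ Dψ →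
        (∀ x, φ (ψ x) = x) → (∀ x, ψ (φ x) = x) →
        ∀ h : EuclideanSpace ℝ (Fin n) → ℝ, MemH1 n h →
          MemH1 n (fun x => h (ψ x) *
            LinearMap.det ((Dψ x) : EuclideanSpace ℝ (Fin n) →ₗ[ℝ] EuclideanSpace ℝ (Fin n))) ∧
          H1Norm n (fun x => h (ψ x) *
            LinearMap.det ((Dψ x) : EuclideanSpace ℝ (Fin n) →ₗ[ℝ] EuclideanSpace ℝ (Fin n)))
            ≤ C * H1Norm n h :=
  fin16 n hn K hK
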